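/- Suppose condition (C1) holds, λ_2 ≥ λ_0 ≥ λ_1 > 0, and u_0 satisfies U_{λ_1}(·,0) ≤ u_0 ≤ U_{λ_2}(·,0) on ℝ^n and u_0 − U_{λ_0}(·,0) ∈ L¹(ℝ^n). Let u be the solution of the Cauchy problem u_t = Δ(u^m) in ℝ^n × (0,T) with initial value u_0 satisfying the Aronson–Bénilan inequality u_t ≤ u/((1−m)t), U_{λ_1} ≤ u ≤ U_{λ_2} on ℝ^n × (0,T), and the L¹-contraction ∫_{ℝ^n} |u(x,t) − U_{λ_0}(x,t)| dx ≤ ∫_{ℝ^n} |u_0(x) − U_{λ_0}(x,0)| dx for all 0 < t < T. Then the rescaled solution ũ(·,τ) converges to y ↦ f_{λ_0}(|y|) as τ → ∞ uniformly, together with its derivatives up to second order, on every compact subset of ℝ^n. Moreover, if β > β_1(m), then for all τ > 0 one has ‖ũ(·,τ) − f_{λ_0}(|·|)‖_{L¹(ℝ^n)} ≤ T^{nβ−α} e^{−(nβ−α)τ} ‖u_0 − U_{λ_0}(·,0)‖_{L¹(ℝ^n)}, where nβ − α = (1/(1−m))(β/β_1(m) − 1) > 0. -/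

import Mathlib

open Real Filter MeasureTheory Set Topology

noncomputable section

def Cstar (n : ℕ) (m : ℝ) : ℝ := 2 * m * ((n : ℝ) - 2 - n * m) / (1 - m)

def beta1 (n : ℕ) (m : ℝ) : ℝ := 1 / ((n : ℝ) - 2 - n * m)

def betaE (n : ℕ) (m : ℝ) : ℝ := m / ((n : ℝ) - 2 - n * m)

def beta2 (n : ℕ) (m : ℝ) : ℝ :=
  Real.sqrt (2 * (1 - m) / ((n : ℝ) - 2 - n * m)) +
    (((n : ℝ) + 2) * m - ((n : ℝ) - 2)) / (2 * ((n : ℝ) - 2 - n * m))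

def beta0 (n : ℕ) (m : ℝ) : ℝ := max (beta2 n m) (betaE n m)

def A0 (n : ℕ) (m β : ℝ) : ℝ :=
  (n : ℝ) - 2 - ((n : ℝ) + 2) * m + 2 * β * ((n : ℝ) - 2 - n * m)

def gamma1 (n : ℕ) (m β : ℝ) : ℝ :=
  (A0 n m β - Real.sqrt ((A0 n m β) ^ 2 - 8 * ((n : ℝ) - 2 - n * m) * (1 - m))) / (2 * (1 - m))

def gamma2 (n : ℕ) (m β : ℝ) : ℝ :=
  (A0 n m β + Real.sqrt ((A0 n m β) ^ 2 - 8 * ((n : ℝ) - 2 - n * m) * (1 - m))) / (2 * (1 - m))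

def Acoef1 (n : ℕ) (m β : ℝ) : ℝ := 1 / (1 - m) - β * gamma1 n m β

def Acoef2 (n : ℕ) (m β : ℝ) : ℝ := 1 / (1 - m) - β * gamma2 n m β

/-- Condition (C1). -/
def CondC1 (n : ℕ) (m β : ℝ) : Prop :=
  beta1 n m < β ∨
    (4 < n ∧ 0 < m ∧ m < ((n : ℝ) - 4) / ((n : ℝ) - 2) ∧ beta0 n m < β ∧ β ≤ beta1 n m)

/-- Condition (C2). -/
def CondC2 (n : ℕ) (m β : ℝ) : Prop :=
  beta0 n m < β ∧ β < beta1 n m ∧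
    (n ≤ 4 ∨ (4 < n ∧ ((n : ℝ) - 4) / ((n : ℝ) - 2) < m ∧ m < ((n : ℝ) - 2) / n))

/-- Condition (C3). -/
def CondC3 (n : ℕ) (m β : ℝ) : Prop :=
  β = beta1 n m ∧
    (n ≤ 4 ∨ (4 < n ∧ ((n : ℝ) - 4) / ((n : ℝ) - 2) < m ∧ m < ((n : ℝ) - 2) / n))

/-- A self-similar profile `f = f_lam`. -/
structure IsProfile (n : ℕ) (m β α lam : ℝ) (f : ℝ → ℝ) : Prop where
  pos : ∀ r, 0 ≤ r → 0 < f r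
  smooth : ContDiffOn ℝ 2 f (Set.Ici 0)
  ode : ∀ r, 0 < r →
    deriv (deriv (fun s => f s ^ m)) r + (((n : ℝ) - 1) / r) * deriv (fun s => f s ^ m) r +
      α * f r + β * r * deriv f r = 0
  init : f 0 = lam ^ (2 / (1 - m))
  init' : deriv f 0 = 0
  asymp : Tendsto (fun r => r ^ 2 * f r ^ (1 - m)) atTop (nhds (Cstar n m))

/-- The Laplacian of `f : ℝ^n → ℝ`. -/
def lap (n : ℕ) (f : EuclideanSpace ℝ (Fin n) → ℝ) (x : EuclideanSpace ℝ (Fin n)) : ℝ :=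
  ∑ i : Fin n,
    fderiv ℝ (fun y => fderiv ℝ f y (EuclideanSpace.single i (1 : ℝ))) x
      (EuclideanSpace.single i (1 : ℝ))

/-- The self-similar solution `U_lam(x,t) = (T-t)^α f_lam((T-t)^β |x|)`. -/
def Uself (n : ℕ) (β α T : ℝ) (f : ℝ → ℝ) (x : EuclideanSpace ℝ (Fin n)) (t : ℝ) : ℝ :=
  (T - t) ^ α * f ((T - t) ^ β * ‖x‖)

/-- A (positive smooth) solution of the Cauchy problem `u_t = Δ(u^m)` on `ℝ^n × (0,T)` with
initial value `u0` taken in `L¹_loc`. -/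
structure IsCauchySolution (n : ℕ) (m T : ℝ) (u0 : EuclideanSpace ℝ (Fin n) → ℝ)
    (u : EuclideanSpace ℝ (Fin n) → ℝ → ℝ) : Prop where
  pos : ∀ x, ∀ t ∈ Set.Ioo 0 T, 0 < u x t
  smooth : ContDiffOn ℝ (⊤ : ℕ∞) (fun p : EuclideanSpace ℝ (Fin n) × ℝ => u p.1 p.2)
    ((Set.univ : Set (EuclideanSpace ℝ (Fin n))) ×ˢ Set.Ioo 0 T)
  pde : ∀ x, ∀ t ∈ Set.Ioo 0 T, deriv (u x) t = lap n (fun y => u y t ^ m) x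
  init : ∀ K : Set (EuclideanSpace ℝ (Fin n)), IsCompact K →
    Tendsto (fun t => ∫ x in K, |u x t - u0 x|) (nhdsWithin 0 (Set.Ioi 0)) (nhds 0)

/-- The rescaled solution `ũ(y,τ)`. -/
def resc (n : ℕ) (β α T : ℝ) (u : EuclideanSpace ℝ (Fin n) → ℝ → ℝ)
    (y : EuclideanSpace ℝ (Fin n)) (τ : ℝ) : ℝ :=
  (T * Real.exp (-τ)) ^ (-α) * u (((T * Real.exp (-τ)) ^ (-β)) • y) (T * (1 - Real.exp (-τ)))

/-- The singular profile `𝒞(y) = (C_*/|y|²)^{1/(1-m)}`. -/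
def singC (n : ℕ) (m : ℝ) (y : EuclideanSpace ℝ (Fin n)) : ℝ :=
  (Cstar n m / ‖y‖ ^ 2) ^ (1 / (1 - m))

/-- The weight exponent `p₀`. -/
def pZero (n : ℕ) (m β : ℝ) : ℝ := ((1 - m) / 2) * ((n : ℝ) - 2 / (1 - m) - gamma1 n m β)

/-- The constant `a_*`. -/
def aStar (n : ℕ) (m β : ℝ) : ℝ :=
  2 * m * pZero n m β / (Cstar n m * (1 - m)) * (gamma1 n m β + 2 * m / (1 - m))

/-- `Φ(s) = (1+w(s))^{1/m} − 1 − w(s)/m`. -/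
def Phi (m : ℝ) (w : ℝ → ℝ) (s : ℝ) : ℝ := (1 + w s) ^ (1 / m) - 1 - w s / m

end

/-- Directional derivative of a scalar function. -/
noncomputable def dir {X : Type*} [NormedAddCommGroup X] [NormedSpace ℝ X] (v : X) (φ : X → ℝ) :
    X → ℝ := fun p => fderiv ℝ φ p v

section DirCalculus

variable {X : Type*} [NormedAddCommGroup X] [NormedSpace ℝ X]

theorem ContDiff.dir {k : WithTop ℕ∞} {φ : X → ℝ} (h : ContDiff ℝ (k + 1) φ) (v : X) :
    ContDiff ℝ k (dir v φ) :=
  (h.fderiv_right le_rfl).clm_apply contDiff_const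

theorem ContDiff.dir_infty {φ : X → ℝ} (h : ContDiff ℝ (⊤ : ℕ∞) φ) (v : X) :
    ContDiff ℝ (⊤ : ℕ∞) (_root_.dir v φ) :=
  (h.fderiv_right (by simp)).clm_apply contDiff_const

theorem dir_mul_apply {φ ψ : X → ℝ} {p : X} (hφ : DifferentiableAt ℝ φ p)
    (hψ : DifferentiableAt ℝ ψ p) (v : X) :
    dir v (fun x => φ x * ψ x) p = φ p * dir v ψ p + ψ p * dir v φ p := by
  simp only [dir]
  rw [fderiv_fun_mul hφ hψ]
  simp

theorem dir_comp_apply {φ : X → ℝ} {p : X} {G : ℝ → ℝ} {G' : ℝ} (hG : HasDerivAt G G' (φ p))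
    (hφ : DifferentiableAt ℝ φ p) (v : X) :
    dir v (fun x => G (φ x)) p = G' * dir v φ p := by
  simp only [dir]
  have h : HasFDerivAt (fun x => G (φ x)) (G' • fderiv ℝ φ p) p :=
    hG.comp_hasFDerivAt p hφ.hasFDerivAt
  rw [h.fderiv]
  simp

theorem dir_congr {φ ψ : X → ℝ} {p : X} (h : φ =ᶠ[𝓝 p] ψ) (v : X) : dir v φ =ᶠ[𝓝 p] dir v ψ := by
  filter_upwards [h.fderiv (𝕜 := ℝ)] with x hx
  simp [dir, hx]

end DirCalculus

theorem lap_eq_dir (n : ℕ) (f : EuclideanSpace ℝ (Fin n) → ℝ) (x : EuclideanSpace ℝ (Fin n)) :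
    lap n f x = ∑ i, dir (EuclideanSpace.single i (1 : ℝ))
      (dir (EuclideanSpace.single i (1 : ℝ)) f) x := rfl

theorem lap_congr {n : ℕ} {f g : EuclideanSpace ℝ (Fin n) → ℝ} {x : EuclideanSpace ℝ (Fin n)}
    (h : f =ᶠ[𝓝 x] g) : lap n f x = lap n g x := by
  simp only [lap_eq_dir]
  exact Finset.sum_congr rfl fun i _ => (dir_congr (dir_congr h _) _).self_of_nhds

theorem lap_comp {n : ℕ} {d : EuclideanSpace ℝ (Fin n) → ℝ} {x : EuclideanSpace ℝ (Fin n)}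
    (hd : ContDiffAt ℝ 2 d x) {G G1 : ℝ → ℝ} {G2 : ℝ}
    (hG : ∀ᶠ s in 𝓝 (d x), HasDerivAt G (G1 s) s) (hG1 : HasDerivAt G1 G2 (d x)) :
    lap n (fun y => G (d y)) x =
      G2 * (∑ i, (dir (EuclideanSpace.single i (1 : ℝ)) d x) ^ 2) + G1 (d x) * lap n d x := by
  simp only [lap_eq_dir]
  rw [Finset.mul_sum, Finset.mul_sum, ← Finset.sum_add_distrib]
  refine Finset.sum_congr rfl fun i _ => ?_
  have hd1 : ∀ᶠ y in 𝓝 x, DifferentiableAt ℝ d y :=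
    (hd.eventually (by simp)).mono fun y hy => hy.differentiableAt (by simp)
  have hev : dir (EuclideanSpace.single i (1 : ℝ)) (fun y => G (d y)) =ᶠ[𝓝 x]
      fun y => G1 (d y) * dir (EuclideanSpace.single i (1 : ℝ)) d y := by
    filter_upwards [hd.continuousAt.eventually hG, hd1] with y hy1 hy2
    exact dir_comp_apply hy1 hy2 _
  rw [(dir_congr hev _).self_of_nhds]
  have hdd : DifferentiableAt ℝ (dir (EuclideanSpace.single i (1 : ℝ)) d) x := by
    have : ContDiffAt ℝ 1 (fderiv ℝ d) x := hd.fderiv_right (by norm_num)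
    exact (this.differentiableAt (by simp)).clm_apply (differentiableAt_const _)
  have hx := hd1.self_of_nhds
  have hG1d : DifferentiableAt ℝ (fun y => G1 (d y)) x := hG1.differentiableAt.comp x hx
  rw [dir_mul_apply hG1d hdd, dir_comp_apply hG1 hx]
  ring

theorem dir_single_norm_sq {n : ℕ} (i : Fin n) (x : EuclideanSpace ℝ (Fin n)) :
    dir (EuclideanSpace.single i (1 : ℝ)) (fun y => ‖y‖ ^ 2) x = 2 * x i := by
  simp only [dir]
  rw [fderiv_norm_sq_apply]
  simp [EuclideanSpace.inner_single_right]

theorem dir_single_coord {n : ℕ} (i : Fin n) (x : EuclideanSpace ℝ (Fin n)) :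
    dir (EuclideanSpace.single i (1 : ℝ)) (fun y => y i) x = 1 := by
  have : (fun y : EuclideanSpace ℝ (Fin n) => y i) = EuclideanSpace.proj (𝕜 := ℝ) i := rfl
  simp only [dir]
  rw [this, ContinuousLinearMap.fderiv]
  simp

theorem lap_norm_sq {n : ℕ} (x : EuclideanSpace ℝ (Fin n)) :
    lap n (fun y => ‖y‖ ^ 2) x = 2 * n := by
  simp only [lap_eq_dir]
  have : ∀ i : Fin n, dir (EuclideanSpace.single i (1 : ℝ))
      (dir (EuclideanSpace.single i (1 : ℝ)) (fun y => ‖y‖ ^ 2)) x = 2 := by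
    intro i
    rw [funext (dir_single_norm_sq i),
      dir_mul_apply (differentiableAt_const _) (by fun_prop), dir_single_coord]
    simp [dir]
  simp [this, mul_comm]

/-- Laplacian of a function of `‖x‖²`. -/
theorem lap_comp_norm_sq {n : ℕ} {x : EuclideanSpace ℝ (Fin n)} {G G1 : ℝ → ℝ} {G2 : ℝ}
    (hG : ∀ᶠ s in 𝓝 (‖x‖ ^ 2), HasDerivAt G (G1 s) s) (hG1 : HasDerivAt G1 G2 (‖x‖ ^ 2)) :
    lap n (fun y => G (‖y‖ ^ 2)) x = 4 * ‖x‖ ^ 2 * G2 + 2 * n * G1 (‖x‖ ^ 2) := by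
  rw [lap_comp (d := fun y => ‖y‖ ^ 2) (contDiff_norm_sq ℝ).contDiffAt hG hG1, lap_norm_sq]
  simp only [dir_single_norm_sq, mul_pow, ← Finset.mul_sum]
  rw [EuclideanSpace.norm_sq_eq]
  simp only [Real.norm_eq_abs, sq_abs]
  ring

/-- Laplacian of a radial function away from the origin. -/
theorem lap_radial {n : ℕ} {x : EuclideanSpace ℝ (Fin n)} (hx : x ≠ 0) {h h1 : ℝ → ℝ} {h2 : ℝ}
    (hh : ∀ᶠ r in 𝓝 ‖x‖, HasDerivAt h (h1 r) r) (hh1 : HasDerivAt h1 h2 ‖x‖) :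
    lap n (fun y => h ‖y‖) x = h2 + ((n : ℝ) - 1) / ‖x‖ * h1 ‖x‖ := by
  have hr : 0 < ‖x‖ := norm_pos_iff.2 hx
  have hs : 0 < ‖x‖ ^ 2 := by positivity
  have hsq : √(‖x‖ ^ 2) = ‖x‖ := Real.sqrt_sq hr.le
  have h0 : (fun y : EuclideanSpace ℝ (Fin n) => h ‖y‖) = fun y => (fun s => h √s) (‖y‖ ^ 2) := by
    ext y; simp [Real.sqrt_sq]
  rw [h0, lap_comp_norm_sq (G := fun s => h √s) (G1 := fun s => h1 √s * (1 / (2 * √s)))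
    (G2 := h2 * (1 / (2 * ‖x‖)) * (1 / (2 * ‖x‖)) + h1 ‖x‖ *
      (-(2 * (1 / (2 * ‖x‖))) / (2 * ‖x‖) ^ 2))]
  · simp only [hsq]
    field_simp
    ring
  · have hc : Tendsto (fun s => √s) (𝓝 (‖x‖ ^ 2)) (𝓝 ‖x‖) := by
      have := Real.continuous_sqrt.tendsto (‖x‖ ^ 2)
      rwa [hsq] at this
    filter_upwards [hc.eventually hh, lt_mem_nhds hs] with s hs1 hs2
    exact hs1.comp s (Real.hasDerivAt_sqrt hs2.ne')
  · have e1 := Real.hasDerivAt_sqrt hs.ne'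
    have e2 : HasDerivAt (fun s => h1 √s) (h2 * (1 / (2 * √(‖x‖ ^ 2)))) (‖x‖ ^ 2) :=
      HasDerivAt.comp (‖x‖ ^ 2) (h₂ := h1) (by rw [hsq]; exact hh1) e1
    have e3 : HasDerivAt (fun s => 1 / (2 * √s))
        (-(2 * (1 / (2 * √(‖x‖ ^ 2)))) / (2 * √(‖x‖ ^ 2)) ^ 2) (‖x‖ ^ 2) := by
      have := (e1.const_mul 2).inv (by rw [hsq]; positivity)
      simp only [one_div] at this ⊢
      exact this
    have := e2.mul e3
    rw [hsq] at this
    exact this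

/-- A radial function with an even `C²` profile is `C²`. -/
theorem contDiff_radial {E : Type*} [NormedAddCommGroup E] [InnerProductSpace ℝ E]
    {h h1 h2 : ℝ → ℝ} (H1 : ∀ r, HasDerivAt h (h1 r) r) (H2 : ∀ r, HasDerivAt h1 (h2 r) r)
    (hc : Continuous h2) (h0 : h1 0 = 0) : ContDiff ℝ 2 (fun x : E => h ‖x‖) := by
  classical
  set q : ℝ → ℝ := fun r => if r = 0 then h2 0 else h1 r / r with hq
  have hq0 : q 0 = h2 0 := by simp [hq]
  have hqr : ∀ r, r ≠ 0 → q r = h1 r / r := fun r hr => by simp [hq, hr]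
  have hqc0 : Tendsto q (𝓝 0) (𝓝 (h2 0)) := by
    have h3 := (hasDerivAt_iff_tendsto_slope.1 (H2 0))
    have : Tendsto q (𝓝[≠] 0) (𝓝 (h2 0)) := by
      refine h3.congr' ?_
      filter_upwards [self_mem_nhdsWithin] with r hr
      rw [hqr r hr, slope_def_field, h0]; simp
    have h5 : ContinuousAt q 0 := by
      rw [continuousAt_iff_punctured_nhds, hq0]; exact this
    have h6 : Tendsto q (𝓝 0) (𝓝 (q 0)) := h5
    rwa [hq0] at h6
  have hqd : ∀ r, r ≠ 0 → HasDerivAt q ((h2 r - q r) / r) r := by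
    intro r hr
    have h4 : HasDerivAt (fun s => h1 s / s) ((h2 r * r - h1 r * 1) / r ^ 2) r :=
      (H2 r).div (hasDerivAt_id r) hr
    have h5 : q =ᶠ[𝓝 r] fun s => h1 s / s := by
      filter_upwards [isOpen_ne.mem_nhds hr] with s hs using hqr s hs
    refine (h4.congr_of_eventuallyEq h5).congr_deriv ?_
    rw [hqr r hr]; field_simp
  have hnorm : ∀ x : E, x ≠ 0 → HasFDerivAt (fun y : E => ‖y‖) (‖x‖⁻¹ • innerSL ℝ x) x := by
    intro x hx
    have hr : 0 < ‖x‖ := norm_pos_iff.2 hx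
    have h5 : HasFDerivAt (fun y : E => ‖y‖ ^ 2) (2 • innerSL ℝ x) x :=
      (hasStrictFDerivAt_norm_sq x).hasFDerivAt
    have h6 := h5.sqrt (by positivity)
    have h7 : (fun y : E => √(‖y‖ ^ 2)) = fun y => ‖y‖ := by ext y; simp
    rw [h7] at h6
    convert h6 using 1
    rw [Real.sqrt_sq hr.le]
    ext v
    simp
    field_simp
  let J : E →L[ℝ] E →L[ℝ] ℝ := innerSL ℝ
  have hJ : ∀ x y : E, J x y = inner ℝ x y := fun x y => rfl
  have hJn : ∀ x : E, ‖J x‖ = ‖x‖ := fun x => innerSL_apply_norm ℝ x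
  replace hnorm : ∀ x : E, x ≠ 0 → HasFDerivAt (fun y : E => ‖y‖) (‖x‖⁻¹ • J x) x := hnorm
  clear_value J
  set F1 : E → (E →L[ℝ] ℝ) := fun x => q ‖x‖ • J x with hF1
  have hF : ∀ x : E, HasFDerivAt (fun x : E => h ‖x‖) (F1 x) x := by
    intro x
    by_cases hx : x = 0
    · subst hx
      have h8 : F1 0 = 0 := by simp [hF1]
      rw [h8, hasFDerivAt_iff_isLittleO_nhds_zero]
      have h9 := hasDerivAt_iff_isLittleO_nhds_zero.1 (H1 0)
      rw [h0] at h9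
      have h10 : Tendsto (fun y : E => ‖y‖) (𝓝 0) (𝓝 0) := by
        have := continuous_norm.tendsto (0 : E)
        simpa using this
      have h11 := h9.comp_tendsto h10
      refine (h11.congr (fun y => ?_) (fun y => rfl)).of_norm_right
      simp
    · have := (H1 ‖x‖).comp_hasFDerivAt x (hnorm x hx)
      have h13 : F1 x = h1 ‖x‖ • ‖x‖⁻¹ • J x := by
        simp only [hF1]
        rw [hqr _ (norm_ne_zero_iff.2 hx), smul_smul, div_eq_mul_inv]
      rw [h13]
      exact this
  set V : E → E := fun x => q ‖x‖ • x with hV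
  set V' : E → (E →L[ℝ] E) := fun x => q ‖x‖ • ContinuousLinearMap.id ℝ E +
    ((h2 ‖x‖ - q ‖x‖) / ‖x‖ ^ 2) • (J x).smulRight x with hV'
  have hVV : ∀ x : E, HasFDerivAt V (V' x) x := by
    intro x
    by_cases hx : x = 0
    · subst hx
      have h8 : V' 0 = h2 0 • ContinuousLinearMap.id ℝ E := by
        ext v
        simp [hV', hq0]
      rw [h8, hasFDerivAt_iff_isLittleO_nhds_zero, Asymptotics.isLittleO_iff]
      intro c hc'
      have h10 : Tendsto (fun y : E => q ‖y‖) (𝓝 0) (𝓝 (h2 0)) := by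
        refine hqc0.comp ?_
        have := continuous_norm.tendsto (0 : E)
        simpa using this
      filter_upwards [(Metric.tendsto_nhds.1 h10) c hc'] with y hy
      have : V (0 + y) - V 0 - (h2 0 • ContinuousLinearMap.id ℝ E) y =
          (q ‖y‖ - h2 0) • y := by
        simp [hV, sub_smul]
      rw [this, norm_smul]
      rw [Real.dist_eq] at hy
      exact mul_le_mul_of_nonneg_right hy.le (norm_nonneg _)
    · have hr : ‖x‖ ≠ 0 := norm_ne_zero_iff.2 hx
      have h12 := ((hqd ‖x‖ hr).comp_hasFDerivAt x (hnorm x hx)).smul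
        (hasFDerivAt_id x)
      refine h12.congr_fderiv ?_
      ext v
      simp [hV', smul_smul]
      congr 1
      field_simp
  have hcq : Continuous q := by
    rw [continuous_iff_continuousAt]
    intro r
    by_cases hr : r = 0
    · subst hr; unfold ContinuousAt; rw [hq0]; exact hqc0
    · exact (hqd r hr).continuousAt
  have hV'c : Continuous V' := by
    have hsm : Continuous fun x : E => ((h2 ‖x‖ - q ‖x‖) / ‖x‖ ^ 2) • (J x).smulRight x := by
      rw [continuous_iff_continuousAt]
      intro x
      by_cases hx : x = 0
      · subst hx
        have : Tendsto (fun x : E => |h2 ‖x‖ - q ‖x‖|) (𝓝 0) (𝓝 0) := by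
          have hcont : Continuous fun x : E => |h2 ‖x‖ - q ‖x‖| :=
            ((hc.comp continuous_norm).sub (hcq.comp continuous_norm)).abs
          have := hcont.tendsto 0
          simpa [hq0] using this
        unfold ContinuousAt
        have hz : (fun x : E => ((h2 ‖x‖ - q ‖x‖) / ‖x‖ ^ 2) • (J x).smulRight x) 0 = 0 := by
          ext v; simp
        rw [hz, tendsto_zero_iff_norm_tendsto_zero]
        refine squeeze_zero (fun _ => norm_nonneg _) (fun y => ?_) this
        rw [norm_smul, ContinuousLinearMap.norm_smulRight_apply, hJn,
          Real.norm_eq_abs, abs_div, abs_of_nonneg (sq_nonneg ‖y‖)]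
        by_cases hy : ‖y‖ = 0
        · simp [hy]
        · apply le_of_eq; field_simp
      · have hr : ‖x‖ ^ 2 ≠ 0 := by have := norm_ne_zero_iff.2 hx; positivity
        have e1 : ContinuousAt (fun x : E => (h2 ‖x‖ - q ‖x‖) / ‖x‖ ^ 2) x :=
          (((hc.comp continuous_norm).sub (hcq.comp continuous_norm)).continuousAt).div
            (by fun_prop) hr
        have e2 : Continuous fun x : E => (J x).smulRight x := by fun_prop
        exact e1.smul e2.continuousAt
    exact ((hcq.comp continuous_norm).smul continuous_const).add hsm
  have hVC : ContDiff ℝ 1 V := by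
    rw [contDiff_one_iff_fderiv]
    refine ⟨fun x => (hVV x).differentiableAt, ?_⟩
    rw [show fderiv ℝ V = V' from funext fun x => (hVV x).fderiv]
    exact hV'c
  have hf1 : fderiv ℝ (fun x : E => h ‖x‖) = fun x => J (V x) := by
    funext x
    rw [(hF x).fderiv]
    exact (map_smul J (q ‖x‖) x).symm
  rw [show (2 : WithTop ℕ∞) = 1 + 1 by norm_num, contDiff_succ_iff_fderiv]
  refine ⟨fun x => (hF x).differentiableAt, by simp, ?_⟩
  rw [hf1]
  exact J.contDiff.comp hVC

/-- An even `C²` extension `h` of a profile, with its first two derivatives. -/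
structure EvenProfile (n : ℕ) (m β α : ℝ) (h h1 h2 : ℝ → ℝ) : Prop where
  pos : ∀ r, 0 < h r
  d1 : ∀ r, HasDerivAt h (h1 r) r
  d2 : ∀ r, HasDerivAt h1 (h2 r) r
  c2 : Continuous h2
  zero : h1 0 = 0
  ode : ∀ r, 0 < r → m * h r ^ (m - 1) * h2 r + m * (m - 1) * h r ^ (m - 2) * h1 r ^ 2 +
    ((n : ℝ) - 1) / r * (m * h r ^ (m - 1) * h1 r) + α * h r + β * r * h1 r = 0
  asymp : Tendsto (fun r => r ^ 2 * h r ^ (1 - m)) atTop (𝓝 (Cstar n m))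

theorem hasDerivAt_even_ext {f g : ℝ → ℝ} (hf : ContinuousOn f (Ici 0)) (hg : ContinuousOn g (Ici 0))
    (h : ∀ r, 0 < r → HasDerivAt f (g r) r) (h0 : g 0 = 0) (r : ℝ) :
    HasDerivAt (fun s => f |s|) (if 0 ≤ r then g r else - g (-r)) r := by
  have hfc : Continuous fun s => f |s| :=
    hf.comp_continuous continuous_abs fun s => abs_nonneg s
  have hgc : Continuous fun r => if 0 ≤ r then g r else - g (-r) := by
    have e : (fun r => if 0 ≤ r then g r else - g (-r)) =
        fun r => g (max r 0) - g (max (-r) 0) := by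
      ext r
      split_ifs with hr
      · rw [max_eq_left hr, max_eq_right (by linarith), h0, sub_zero]
      · push Not at hr
        rw [max_eq_right hr.le, max_eq_left (by linarith), h0, zero_sub]
    rw [e]
    exact (hg.comp_continuous (f := fun r => max r 0) (by fun_prop) fun s => mem_Ici.2 (le_max_right _ _)).sub
      (hg.comp_continuous (f := fun r => max (-r) 0) (by fun_prop) fun s => mem_Ici.2 (le_max_right _ _))
  have hne : ∀ y, y ≠ 0 → HasDerivAt (fun s => f |s|) (if 0 ≤ y then g y else - g (-y)) y := by
    intro y hy
    rcases lt_or_gt_of_ne hy with hy | hy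
    · rw [if_neg (not_le.2 hy)]
      have e1 : HasDerivAt (fun s => f (-s)) (-g (-y)) y := by
        exact ((h (-y) (by linarith)).comp y (hasDerivAt_neg y)).congr_deriv (by ring)
      refine e1.congr_of_eventuallyEq ?_
      filter_upwards [gt_mem_nhds hy] with s hs
      rw [abs_of_neg hs]
    · rw [if_pos hy.le]
      refine (h y hy).congr_of_eventuallyEq ?_
      filter_upwards [lt_mem_nhds hy] with s hs
      rw [abs_of_pos hs]
  by_cases hr : r = 0
  · subst hr
    exact hasDerivAt_of_hasDerivAt_of_ne (g := fun r => if 0 ≤ r then g r else - g (-r))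
      hne hfc.continuousAt hgc.continuousAt
  · exact hne r hr

theorem hasDerivAt_odd_ext {f g : ℝ → ℝ} (hf : ContinuousOn f (Ici 0)) (hg : ContinuousOn g (Ici 0))
    (h : ∀ r, 0 < r → HasDerivAt f (g r) r) (h0 : f 0 = 0) (r : ℝ) :
    HasDerivAt (fun r => if 0 ≤ r then f r else - f (-r)) (g |r|) r := by
  have hgc : Continuous fun s => g |s| :=
    hg.comp_continuous continuous_abs fun s => abs_nonneg s
  have hfc : Continuous fun r => if 0 ≤ r then f r else - f (-r) := by
    have e : (fun r => if 0 ≤ r then f r else - f (-r)) =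
        fun r => f (max r 0) - f (max (-r) 0) := by
      ext r
      split_ifs with hr
      · rw [max_eq_left hr, max_eq_right (by linarith), h0, sub_zero]
      · push Not at hr
        rw [max_eq_right hr.le, max_eq_left (by linarith), h0, zero_sub]
    rw [e]
    exact (hf.comp_continuous (f := fun r => max r 0) (by fun_prop) fun s => mem_Ici.2 (le_max_right _ _)).sub
      (hf.comp_continuous (f := fun r => max (-r) 0) (by fun_prop) fun s => mem_Ici.2 (le_max_right _ _))
  have hne : ∀ y, y ≠ 0 → HasDerivAt (fun r => if 0 ≤ r then f r else - f (-r)) (g |y|) y := by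
    intro y hy
    rcases lt_or_gt_of_ne hy with hy | hy
    · rw [abs_of_neg hy]
      have e1 : HasDerivAt (fun s => -f (-s)) (g (-y)) y := by
        exact ((h (-y) (by linarith)).comp y (hasDerivAt_neg y)).neg.congr_deriv (by ring)
      refine e1.congr_of_eventuallyEq ?_
      filter_upwards [gt_mem_nhds hy] with s hs
      rw [if_neg (not_le.2 hs)]
    · rw [abs_of_pos hy]
      refine (h y hy).congr_of_eventuallyEq ?_
      filter_upwards [lt_mem_nhds hy] with s hs
      rw [if_pos hs.le]
  by_cases hr : r = 0
  · subst hr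
    exact hasDerivAt_of_hasDerivAt_of_ne (g := fun r => g |r|)
      hne hfc.continuousAt hgc.continuousAt
  · exact hne r hr

theorem IsProfile.exists_even {n : ℕ} {m β α lam : ℝ} {f : ℝ → ℝ} (hn : 2 ≤ n) (hm0 : 0 < m)
    (hf : IsProfile n m β α lam f) : ∃ h1 h2, EvenProfile n m β α (fun r => f |r|) h1 h2 := by
  set g1 : ℝ → ℝ := derivWithin f (Ici 0) with hg1
  set g2 : ℝ → ℝ := derivWithin g1 (Ici 0) with hg2
  have hs : ContDiffOn ℝ (1 + 1) f (Ici 0) := by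
    have := hf.smooth
    rwa [show (2 : WithTop ℕ∞) = 1 + 1 by norm_num] at this
  have hs1 : ContDiffOn ℝ 1 g1 (Ici 0) :=
    ((contDiffOn_succ_iff_derivWithin (uniqueDiffOn_Ici 0)).1 hs).2.2
  have hs1' : ContDiffOn ℝ (0 + 1) g1 (Ici 0) := by simpa using hs1
  have hs2 : ContDiffOn ℝ 0 g2 (Ici 0) :=
    ((contDiffOn_succ_iff_derivWithin (uniqueDiffOn_Ici 0)).1 hs1').2.2
  have hfc := hs.continuousOn
  have hg1c := hs1.continuousOn
  have hg2c := hs2.continuousOn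
  have hd1 : ∀ r, 0 < r → HasDerivAt f (g1 r) r := fun r hr =>
    ((hs.differentiableOn (by simp)) r hr.le).hasDerivWithinAt.hasDerivAt (Ici_mem_nhds hr)
  have hd2 : ∀ r, 0 < r → HasDerivAt g1 (g2 r) r := fun r hr =>
    ((hs1.differentiableOn (by simp)) r hr.le).hasDerivWithinAt.hasDerivAt (Ici_mem_nhds hr)
  have hode : ∀ r, 0 < r → m * f r ^ (m - 1) * g2 r + m * (m - 1) * f r ^ (m - 2) * g1 r ^ 2 +
      ((n : ℝ) - 1) / r * (m * f r ^ (m - 1) * g1 r) + α * f r + β * r * g1 r = 0 := by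
    intro r hr
    have e1 : ∀ s, 0 < s → HasDerivAt (fun s => f s ^ m) (m * f s ^ (m - 1) * g1 s) s := by
      intro s hs
      convert (hd1 s hs).rpow_const (p := m) (Or.inl (hf.pos s hs.le).ne') using 1
      ring
    have e2 : deriv (fun s => f s ^ m) =ᶠ[𝓝 r] fun s => m * f s ^ (m - 1) * g1 s := by
      filter_upwards [lt_mem_nhds hr] with s hs using (e1 s hs).deriv
    have e3 : HasDerivAt (fun s => m * f s ^ (m - 1) * g1 s)
        (m * f r ^ (m - 1) * g2 r + m * (m - 1) * f r ^ (m - 2) * g1 r ^ 2) r := by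
      have := (((hd1 r hr).rpow_const (p := m - 1)
        (Or.inl (hf.pos r hr.le).ne')).const_mul m).mul (hd2 r hr)
      refine this.congr_deriv ?_
      rw [show m - 1 - 1 = m - 2 by ring]
      ring
    have := hf.ode r hr
    rw [e2.deriv_eq, e3.deriv, (e1 r hr).deriv, (hd1 r hr).deriv] at this
    exact this
  have hzero : g1 0 = 0 := by
    have hfc' : ∀ p : ℝ, ContinuousOn (fun r => f r ^ p) (Ici 0) := fun p =>
      hfc.rpow_const fun r hr => Or.inl (hf.pos r hr).ne'
    have hL : ContinuousOn (fun r => ((n : ℝ) - 1) * (m * f r ^ (m - 1) * g1 r)) (Ici 0) :=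
      continuousOn_const.mul ((continuousOn_const.mul (hfc' _)).mul hg1c)
    have hR : ContinuousOn (fun r => -(r * (m * f r ^ (m - 1) * g2 r +
        m * (m - 1) * f r ^ (m - 2) * g1 r ^ 2 + α * f r + β * r * g1 r))) (Ici 0) :=
      (continuousOn_id.mul (((((continuousOn_const.mul (hfc' _)).mul hg2c).add
        ((continuousOn_const.mul (hfc' _)).mul (hg1c.pow 2))).add
        (continuousOn_const.mul hfc)).add ((continuousOn_const.mul continuousOn_id).mul hg1c))).neg
    have hLt := (hL 0 self_mem_Ici).mono_left (nhdsWithin_mono 0 Ioi_subset_Ici_self)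
    have hRt := (hR 0 self_mem_Ici).mono_left (nhdsWithin_mono 0 Ioi_subset_Ici_self)
    have heq : (fun r => ((n : ℝ) - 1) * (m * f r ^ (m - 1) * g1 r)) =ᶠ[𝓝[>] 0]
        (fun r => -(r * (m * f r ^ (m - 1) * g2 r +
        m * (m - 1) * f r ^ (m - 2) * g1 r ^ 2 + α * f r + β * r * g1 r))) := by
      filter_upwards [self_mem_nhdsWithin] with r hr
      have hr' : 0 < r := hr
      have := hode r hr'
      field_simp at this
      linarith
    have := tendsto_nhds_unique (hLt.congr' heq) hRt
    simp only [zero_mul, neg_zero] at this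
    have hn1 : (0 : ℝ) < (n : ℝ) - 1 := by
      have : (2 : ℝ) ≤ n := by exact_mod_cast hn
      linarith
    have hp := rpow_pos_of_pos (hf.pos 0 le_rfl) (m - 1)
    rcases mul_eq_zero.1 this with h | h
    · linarith
    · rcases mul_eq_zero.1 h with h | h
      · have := mul_pos hm0 hp
        linarith
      · exact h
  refine ⟨fun r => if 0 ≤ r then g1 r else - g1 (-r), fun r => g2 |r|,
    fun r => hf.pos _ (abs_nonneg r), hasDerivAt_even_ext hfc hg1c hd1 hzero,
    hasDerivAt_odd_ext hg1c hg2c hd2 hzero,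
    hg2c.comp_continuous continuous_abs fun s => abs_nonneg s, by simp [hzero], ?_, ?_⟩
  · intro r hr
    have := hode r hr
    simpa [abs_of_pos hr, hr.le] using this
  · refine hf.asymp.congr' ?_
    filter_upwards [eventually_ge_atTop 0] with r hr
    rw [abs_of_nonneg hr]

namespace EvenProfile

variable {n : ℕ} {m β α : ℝ} {h h1 h2 : ℝ → ℝ}

theorem continuous (H : EvenProfile n m β α h h1 h2) : Continuous h :=
  continuous_iff_continuousAt.2 fun r => (H.d1 r).continuousAt

theorem continuous_deriv (H : EvenProfile n m β α h h1 h2) : Continuous h1 :=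
  continuous_iff_continuousAt.2 fun r => (H.d2 r).continuousAt

theorem contDiff_norm (H : EvenProfile n m β α h h1 h2) :
    ContDiff ℝ 2 (fun x : EuclideanSpace ℝ (Fin n) => h ‖x‖) :=
  contDiff_radial H.d1 H.d2 H.c2 H.zero

theorem bounds (H : EvenProfile n m β α h h1 h2) (hC : 0 < Cstar n m) :
    ∃ c C : ℝ, 0 < c ∧ ∀ r, 0 ≤ r → c ≤ (1 + r ^ 2) * h r ^ (1 - m) ∧
      (1 + r ^ 2) * h r ^ (1 - m) ≤ C := by
  have hcont : Continuous fun r => (1 + r ^ 2) * h r ^ (1 - m) :=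
    (by fun_prop : Continuous fun r : ℝ => 1 + r ^ 2).mul
      (H.continuous.rpow_const fun r => Or.inl (H.pos r).ne')
  have hpos : ∀ r, 0 < (1 + r ^ 2) * h r ^ (1 - m) := fun r =>
    mul_pos (by positivity) (rpow_pos_of_pos (H.pos r) _)
  have hinf : Tendsto (fun r => (1 + r ^ 2) * h r ^ (1 - m)) atTop (𝓝 (Cstar n m)) := by
    have e1 : Tendsto (fun r : ℝ => 1 + (r ^ 2)⁻¹) atTop (𝓝 (1 + 0)) :=
      tendsto_const_nhds.add (tendsto_inv_atTop_zero.comp (tendsto_pow_atTop (by norm_num)))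
    have := e1.mul H.asymp
    simp only [add_zero, one_mul] at this
    refine this.congr' ?_
    filter_upwards [eventually_gt_atTop 0] with r hr
    field_simp
    ring
  have hev := hinf.eventually (Icc_mem_nhds (show Cstar n m / 2 < Cstar n m by linarith)
    (show Cstar n m < Cstar n m + 1 by linarith))
  obtain ⟨R, hR⟩ := eventually_atTop.1 hev
  obtain ⟨a, -, ha⟩ := (isCompact_Icc (a := (0 : ℝ)) (b := max R 0)).exists_isMinOn
    ⟨0, by simp⟩ hcont.continuousOn
  obtain ⟨b, -, hb⟩ := (isCompact_Icc (a := (0 : ℝ)) (b := max R 0)).exists_isMaxOn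
    ⟨0, by simp⟩ hcont.continuousOn
  refine ⟨min ((1 + a ^ 2) * h a ^ (1 - m)) (Cstar n m / 2),
    max ((1 + b ^ 2) * h b ^ (1 - m)) (Cstar n m + 1), lt_min (hpos a) (by linarith), ?_⟩
  intro r hr
  by_cases hrR : R ≤ r
  · exact ⟨(min_le_right _ _).trans (hR r hrR).1, (hR r hrR).2.trans (le_max_right _ _)⟩
  · have hmem : r ∈ Icc 0 (max R 0) := ⟨hr, (le_of_not_ge hrR).trans (le_max_left _ _)⟩
    exact ⟨(min_le_left _ _).trans (ha hmem), (hb hmem : _ ≤ _).trans (le_max_left _ _)⟩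

theorem contDiff_uself (H : EvenProfile n m β α h h1 h2) {T t : ℝ} :
    ContDiff ℝ 2 (fun x => Uself n β α T h x t) := by
  have e : (fun x => Uself n β α T h x t) = fun x =>
      (T - t) ^ α * (fun r => h ((T - t) ^ β * r)) ‖x‖ := rfl
  rw [e]
  refine contDiff_const.mul (contDiff_radial (h := fun r => h ((T - t) ^ β * r)) (h1 := fun r => h1 ((T - t) ^ β * r) * (T - t) ^ β)
    (h2 := fun r => h2 ((T - t) ^ β * r) * (T - t) ^ β * (T - t) ^ β) ?_ ?_ ?_ ?_)
  · intro r
    exact ((H.d1 ((T - t) ^ β * r)).comp r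
      ((hasDerivAt_id r).const_mul ((T - t) ^ β))).congr_deriv (by ring)
  · intro r
    exact (((H.d2 ((T - t) ^ β * r)).comp r ((hasDerivAt_id r).const_mul
      ((T - t) ^ β))).mul_const ((T - t) ^ β)).congr_deriv (by ring)
  · exact ((H.c2.comp (by fun_prop)).mul continuous_const).mul continuous_const
  · simp [H.zero]

theorem uself_pos (H : EvenProfile n m β α h h1 h2) {T t : ℝ} (ht : t < T)
    (x : EuclideanSpace ℝ (Fin n)) : 0 < Uself n β α T h x t :=
  mul_pos (rpow_pos_of_pos (by linarith) _) (H.pos _)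

theorem hasDerivAt_uself (H : EvenProfile n m β α h h1 h2) {T t : ℝ} (ht : t < T)
    (x : EuclideanSpace ℝ (Fin n)) :
    HasDerivAt (fun t => Uself n β α T h x t) (-((T - t) ^ (α - 1) *
      (α * h ((T - t) ^ β * ‖x‖) + β * ((T - t) ^ β * ‖x‖) * h1 ((T - t) ^ β * ‖x‖)))) t := by
  have hs : 0 < T - t := by linarith
  have e0 : HasDerivAt (fun t => T - t) (-1) t := by
    simpa using (hasDerivAt_id t).const_sub T
  have e1 := e0.rpow_const (p := α) (Or.inl hs.ne')
  have e2 := (e0.rpow_const (p := β) (Or.inl hs.ne')).mul_const ‖x‖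
  have e3 := e1.mul ((H.d1 ((T - t) ^ β * ‖x‖)).comp t e2)
  refine e3.congr_deriv ?_
  simp only [Function.comp]
  rw [rpow_sub_one hs.ne', rpow_sub_one hs.ne']
  field_simp
  ring

theorem lap_uself_rpow (H : EvenProfile n m β α h h1 h2) {T t : ℝ} (ht : t < T)
    (hα : α * (1 - m) = 2 * β + 1) {x : EuclideanSpace ℝ (Fin n)} (hx : x ≠ 0) :
    lap n (fun y => Uself n β α T h y t ^ m) x = -((T - t) ^ (α - 1) *
      (α * h ((T - t) ^ β * ‖x‖) + β * ((T - t) ^ β * ‖x‖) * h1 ((T - t) ^ β * ‖x‖))) := by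
  have hs : 0 < T - t := by linarith
  have hr : 0 < ‖x‖ := norm_pos_iff.2 hx
  set a := (T - t) ^ α with ha
  set b := (T - t) ^ β with hb
  have ha0 : 0 < a := rpow_pos_of_pos hs _
  have hb0 : 0 < b := rpow_pos_of_pos hs _
  have e : (fun y => Uself n β α T h y t ^ m) = fun y : EuclideanSpace ℝ (Fin n) =>
      (fun r => a ^ m * h (b * r) ^ m) ‖y‖ := by
    ext y
    simp only [Uself]
    rw [mul_rpow ha0.le (H.pos _).le]
  have hb1 : ∀ r, HasDerivAt (fun r => h (b * r)) (h1 (b * r) * b) r := fun r => by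
    exact ((H.d1 (b * r)).comp r ((hasDerivAt_id r).const_mul b)).congr_deriv (by ring)
  have hb2 : ∀ r, HasDerivAt (fun r => h1 (b * r)) (h2 (b * r) * b) r := fun r => by
    exact ((H.d2 (b * r)).comp r ((hasDerivAt_id r).const_mul b)).congr_deriv (by ring)
  rw [e, lap_radial hx (h := fun r => a ^ m * h (b * r) ^ m) (h1 := fun r => a ^ m * (m * b * (h (b * r) ^ (m - 1) * h1 (b * r))))
    (h2 := a ^ m * (m * b * (h1 (b * ‖x‖) * b * (m - 1) * h (b * ‖x‖) ^ (m - 1 - 1) * h1 (b * ‖x‖) +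
      h (b * ‖x‖) ^ (m - 1) * (h2 (b * ‖x‖) * b))))]
  · have ho := H.ode (b * ‖x‖) (by positivity)
    have hab : (T - t) ^ (α - 1) = a ^ m * b ^ 2 := by
      rw [ha, hb, ← rpow_mul hs.le, ← rpow_natCast, ← rpow_mul hs.le, ← rpow_add hs]
      congr 1
      push_cast
      linarith
    rw [hab, show m - 1 - 1 = m - 2 by ring]
    have e5 : ((n : ℝ) - 1) / (b * ‖x‖) = ((n : ℝ) - 1) / ‖x‖ / b := by field_simp
    rw [e5] at ho
    generalize ((n : ℝ) - 1) / ‖x‖ = N at ho ⊢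
    have e6 : N / b * b = N := by field_simp
    generalize N / b = N' at *
    rw [← e6]
    linear_combination a ^ m * b ^ 2 * ho
  · refine Eventually.of_forall fun r => ?_
    refine (((hb1 r).rpow_const (p := m) (Or.inl (H.pos _).ne')).const_mul (a ^ m)).congr_deriv ?_
    ring
  · exact ((((hb1 ‖x‖).rpow_const (p := m - 1) (Or.inl (H.pos _).ne')).mul
      (hb2 ‖x‖)).const_mul (m * b)).const_mul (a ^ m)

end EvenProfile

theorem HasDerivAt.nonneg_of_left_le {Y : ℝ → ℝ} {Y' a : ℝ} (h : HasDerivAt Y Y' a)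
    (hl : ∀ᶠ r in 𝓝[<] a, Y r ≤ Y a) : 0 ≤ Y' := by
  have h1 := (hasDerivAt_iff_tendsto_slope.1 h).mono_left
    (nhdsWithin_mono a (s := Iio a) (fun r hr => (mem_Iio.1 hr).ne))
  refine ge_of_tendsto h1 ?_
  filter_upwards [hl, self_mem_nhdsWithin] with r hr hra
  rw [slope_def_field]
  have : r < a := hra
  exact div_nonneg_of_nonpos (by linarith) (by linarith)

theorem mul_sub_quadratic_neg {γ m D N β v : ℝ} (hm1 : m < 1) (hm0 : 0 < m) (hD : D = N - 2 - N * m)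
    (hN : 2 ≤ N) (hγ : 2 * (1 - m) * γ = N - 2 - (N + 2) * m + 2 * β * D) (hγ2 : 2 < γ)
    (hA : 2 * D < γ ^ 2 * (1 - m)) (hv0 : 0 < v) (hv1 : v ≤ 1) :
    -(N - 2) * (γ * v - 2) * (1 - m) - m * (γ * v - 2) ^ 2 - 2 * D * (1 - v) * (1 + β * (γ * v)) +
      γ * (1 - v) * (γ * v) * (1 - m) < 0 := by
  have e : -(N - 2) * (γ * v - 2) * (1 - m) - m * (γ * v - 2) ^ 2 -
      2 * D * (1 - v) * (1 + β * (γ * v)) + γ * (1 - v) * (γ * v) * (1 - m) =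
      v * ((1 - v) * (2 * D - γ ^ 2 * (1 - m)) +
        v * (-(γ - 2) * ((N - 2) * (1 - m) + m * (γ - 2)))) := by
    have hβ : 2 * β * D = 2 * (1 - m) * γ - (N - 2 - (N + 2) * m) := by linarith
    have : 2 * D * (1 - v) * (1 + β * (γ * v)) = (1 - v) * (2 * D + γ * v * (2 * β * D)) := by ring
    rw [this, hβ, hD]
    ring
  rw [e]
  refine mul_neg_of_pos_of_neg hv0 ?_
  have h1 : (1 - v) * (2 * D - γ ^ 2 * (1 - m)) ≤ 0 :=
    mul_nonpos_of_nonneg_of_nonpos (by linarith) (by linarith)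
  have h3 : 0 < (N - 2) * (1 - m) + m * (γ - 2) := by
    have := mul_pos hm0 (sub_pos.2 hγ2)
    have := mul_nonneg (sub_nonneg.2 hN) (sub_pos.2 hm1).le
    linarith
  have h2 : v * (-(γ - 2) * ((N - 2) * (1 - m) + m * (γ - 2))) < 0 := by
    have := mul_pos hv0 (mul_pos (sub_pos.2 hγ2) h3)
    linarith
  linarith

namespace EvenProfile

variable {n : ℕ} {m β α : ℝ} {h h1 h2 : ℝ → ℝ}

theorem hasDerivAt_sq_mul_rpow (H : EvenProfile n m β α h h1 h2) (r : ℝ) :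
    HasDerivAt (fun r => r ^ 2 * h r ^ (1 - m))
      (r ^ 2 * h r ^ (1 - m) * (2 + (1 - m) * (r * h1 r / h r)) / r) r := by
  have e := ((hasDerivAt_pow 2 r).mul ((H.d1 r).rpow_const (p := 1 - m) (Or.inl (H.pos r).ne')))
  refine e.congr_deriv ?_
  have hp := H.pos r
  rw [rpow_sub_one hp.ne']
  field_simp
  push_cast
  ring

theorem hasDerivAt_logDeriv (H : EvenProfile n m β α h h1 h2) (hm0 : 0 < m) {r : ℝ} (hr : 0 < r) :
    HasDerivAt (fun r => r * h1 r / h r)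
      ((-((n : ℝ) - 2) * (r * h1 r / h r) - m * (r * h1 r / h r) ^ 2 -
        r ^ 2 * h r ^ (1 - m) / m * (α + β * (r * h1 r / h r))) / r) r := by
  have hp := H.pos r
  refine (((hasDerivAt_id r).mul (H.d2 r)).div (H.d1 r) hp.ne').congr_deriv ?_
  have ho := H.ode r hr
  have e1 : h r ^ (m - 1) = (h r ^ (1 - m))⁻¹ := by rw [← rpow_neg hp.le]; ring_nf
  have e2 : h r ^ (m - 2) = (h r ^ (1 - m))⁻¹ / h r := by
    rw [← e1, show m - 2 = m - 1 - 1 by ring, rpow_sub_one hp.ne']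
  rw [e1, e2] at ho
  have hq := rpow_pos_of_pos hp (1 - m)
  generalize h r ^ (1 - m) = q at *
  generalize h r = w at *
  have ho' : m * h2 r * w * r + m * (m - 1) * h1 r ^ 2 * r + ((n : ℝ) - 1) * m * h1 r * w +
      (α * w + β * r * h1 r) * q * w * r = 0 := by
    field_simp at ho
    linear_combination ho
  simp only [id, Pi.mul_apply]
  field_simp
  linear_combination ho'

theorem barrier (H : EvenProfile n m β α h h1 h2) (hn : 2 ≤ n) (hm0 : 0 < m) (hm1 : m < 1)
    (hD : 0 < (n : ℝ) - 2 - n * m) (hα : α * (1 - m) = 2 * β + 1) {γ : ℝ}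
    (hγ : 2 * (1 - m) * γ = A0 n m β) (hγ2 : 2 < γ)
    (hA : 2 * ((n : ℝ) - 2 - n * m) < γ ^ 2 * (1 - m)) {r : ℝ} (hr : 0 ≤ r) :
    r ^ 2 * h r ^ (1 - m) < Cstar n m := by
  set D := (n : ℝ) - 2 - n * m with hDdef
  set G : ℝ → ℝ := fun r => r ^ 2 * h r ^ (1 - m) with hG
  set K : ℝ → ℝ := fun r => 2 + (1 - m) * (r * h1 r / h r) with hK
  set c := Cstar n m with hc
  have h1m : 0 < 1 - m := by linarith
  have hc' : c * (1 - m) = 2 * m * D := by rw [hc, Cstar, ← hDdef]; field_simp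
  have hcpos : 0 < c := by rw [hc, Cstar, ← hDdef]; positivity
  set Y : ℝ → ℝ := fun r => K r - γ * (1 - G r / c) with hY
  have hGc : Continuous G := (continuous_pow 2).mul
    (H.continuous.rpow_const fun r => Or.inl (H.pos r).ne')
  have hKc : Continuous K := continuous_const.add (continuous_const.mul
    ((continuous_id.mul H.continuous_deriv).div H.continuous fun r => (H.pos r).ne'))
  have hYc : Continuous Y := hKc.sub (continuous_const.mul (continuous_const.sub
    (hGc.div_const c)))
  have hGpos : ∀ r, 0 < r → 0 < G r := fun r hr =>
    mul_pos (by positivity) (rpow_pos_of_pos (H.pos r) _)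
  have hdG : ∀ r, 0 < r → HasDerivAt G (G r * K r / r) r := fun r _ =>
    H.hasDerivAt_sq_mul_rpow r
  by_contra hcon
  push Not at hcon
  set S : Set ℝ := {r | 0 ≤ r ∧ (0 ≤ Y r ∨ c ≤ G r)} with hS
  have hSne : S.Nonempty := ⟨r, hr, Or.inr hcon⟩
  have hSc : IsClosed S := by
    have : S = Ici 0 ∩ ({r | 0 ≤ Y r} ∪ {r | c ≤ G r}) := by ext; simp [hS]
    rw [this]
    exact isClosed_Ici.inter ((isClosed_le continuous_const hYc).union
      (isClosed_le continuous_const hGc))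
  have hSb : BddBelow S := ⟨0, fun r hr => hr.1⟩
  set r0 := sInf S with hr0
  have hr0S : r0 ∈ S := hSc.csInf_mem hSne hSb
  have hlt : ∀ r, 0 ≤ r → r < r0 → Y r < 0 ∧ G r < c := by
    intro s hs0 hs
    have : s ∉ S := notMem_of_lt_csInf hs hSb
    by_contra hcc
    refine this ⟨hs0, ?_⟩
    by_contra h3
    push Not at h3
    exact hcc h3
  have hr0pos : 0 < r0 := by
    refine lt_of_le_of_ne hr0S.1 fun h0 => ?_
    have hG0 : G 0 = 0 := by simp [hG]
    have hY0 : Y 0 = 2 - γ := by simp [hY, hK, hG0]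
    rcases hr0S.2 with h3 | h3
    · rw [← h0, hY0] at h3; linarith
    · rw [← h0, hG0] at h3; linarith
  have hGr0 : G r0 < c := by
    have hmono : MonotoneOn (fun r => (c - G r) * r ^ γ) (Icc (r0 / 2) r0) := by
      refine monotoneOn_of_hasDerivWithinAt_nonneg (f' := fun r => -(G r * K r / r) * r ^ γ +
        (c - G r) * (γ * r ^ (γ - 1))) (convex_Icc _ _) ?_ ?_ ?_
      · exact (continuousOn_const.sub hGc.continuousOn).mul
          (continuousOn_id.rpow_const fun s hs => Or.inl (by
            have := hs.1; simp only [id]; intro h0; rw [h0] at this; linarith))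
      · intro s hs
        rw [interior_Icc] at hs
        have hs0 : 0 < s := by linarith [hs.1]
        have e := ((hdG s hs0).const_sub c).mul
          (Real.hasDerivAt_rpow_const (x := s) (p := γ) (Or.inl hs0.ne'))
        exact e.hasDerivWithinAt
      · intro s hs
        rw [interior_Icc] at hs
        have hs0 : 0 < s := by linarith [hs.1]
        obtain ⟨hYs, hGs⟩ := hlt s hs0.le hs.2
        have hGs0 := hGpos s hs0
        have hpw := rpow_pos_of_pos hs0 γ
        have e3 : -(G s * K s / s) * s ^ γ + (c - G s) * (γ * s ^ (γ - 1)) =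
            s ^ γ / s * (γ * (c - G s) - G s * K s) := by
          rw [rpow_sub_one hs0.ne']; field_simp; ring
        rw [e3]
        refine mul_nonneg (by positivity) ?_
        have e4 : K s ≤ γ * (1 - G s / c) := by
          have : K s - γ * (1 - G s / c) < 0 := hYs
          linarith
        have e5 : G s * K s ≤ G s * (γ * (1 - G s / c)) := mul_le_mul_of_nonneg_left e4 hGs0.le
        have e6 : G s * (γ * (1 - G s / c)) = G s / c * (γ * (c - G s)) := by field_simp
        have e7 : G s / c * (γ * (c - G s)) ≤ 1 * (γ * (c - G s)) := by
          refine mul_le_mul_of_nonneg_right ((div_le_one hcpos).2 hGs.le) ?_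
          exact mul_nonneg (by linarith) (by linarith)
        linarith
    have h5 := hmono (left_mem_Icc.2 (by linarith)) (right_mem_Icc.2 (by linarith))
      (by linarith : r0 / 2 ≤ r0)
    have h6 : 0 < (c - G (r0 / 2)) * (r0 / 2) ^ γ :=
      mul_pos (by linarith [(hlt (r0 / 2) (by linarith) (by linarith)).2])
        (rpow_pos_of_pos (by linarith) _)
    have h7 : 0 < (c - G r0) * r0 ^ γ := lt_of_lt_of_le h6 h5
    have := pos_of_mul_pos_left h7 (rpow_pos_of_pos hr0pos γ).le
    linarith
  have hYr0 : 0 ≤ Y r0 := by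
    rcases hr0S.2 with h3 | h3
    · exact h3
    · linarith
  have hevY : ∀ᶠ s in 𝓝[<] r0, Y s ≤ 0 := by
    filter_upwards [self_mem_nhdsWithin, mem_nhdsWithin_of_mem_nhds (lt_mem_nhds hr0pos)]
      with s hs hs0
    exact (hlt s hs0.le hs).1.le
  have hY0 : Y r0 = 0 := le_antisymm
    (le_of_tendsto (hYc.continuousAt.mono_left nhdsWithin_le_nhds) hevY) hYr0
  have hdY := ((H.hasDerivAt_logDeriv hm0 hr0pos).const_mul (1 - m)).const_add 2 |>.sub
    ((((hdG r0 hr0pos).div_const c).const_sub 1).const_mul γ)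
  have hnn := HasDerivAt.nonneg_of_left_le (Y := Y) hdY (by simpa [hY0] using hevY)
  have hGp := hGpos r0 hr0pos
  set v := 1 - G r0 / c with hv
  have hv0 : 0 < v := by have := (div_lt_one hcpos).2 hGr0; linarith
  have hv1 : v ≤ 1 := by have := div_pos hGp hcpos; linarith
  have hKv : K r0 = γ * v := by
    have : K r0 - γ * v = 0 := hY0
    linarith
  have hGv : G r0 = c * (1 - v) := by rw [hv]; field_simp; ring
  have key := mul_sub_quadratic_neg (N := n) (β := β) hm1 hm0 hDdef
    (by exact_mod_cast hn) (by rw [hγ, A0, ← hDdef]) hγ2 hA hv0 hv1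
  have hE : r0 * h1 r0 / h r0 = (γ * v - 2) / (1 - m) := by
    have : 2 + (1 - m) * (r0 * h1 r0 / h r0) = γ * v := hKv
    rw [eq_div_iff h1m.ne']
    linarith
  have hGr : r0 ^ 2 * h r0 ^ (1 - m) = c * (1 - v) := hGv
  rw [hE, hGr, hKv, hGv] at hnn
  have hα' : α = (2 * β + 1) / (1 - m) := by rw [eq_div_iff h1m.ne']; exact hα
  have hcc : c = 2 * m * D / (1 - m) := by rw [eq_div_iff h1m.ne']; exact hc'
  have hid : (1 - m) * ((-((n : ℝ) - 2) * ((γ * v - 2) / (1 - m)) - m * ((γ * v - 2) / (1 - m)) ^ 2 -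
      c * (1 - v) / m * (α + β * ((γ * v - 2) / (1 - m)))) / r0) -
      γ * -(c * (1 - v) * (γ * v) / r0 / c) =
      (-(n - 2) * (γ * v - 2) * (1 - m) - m * (γ * v - 2) ^ 2 - 2 * D * (1 - v) * (1 + β * (γ * v)) +
      γ * (1 - v) * (γ * v) * (1 - m)) / ((1 - m) * r0) := by
    have e8 : γ * -(c * (1 - v) * (γ * v) / r0 / c) = -(γ * (1 - v) * (γ * v)) / r0 := by
      field_simp
    rw [e8, hα', hcc]
    field_simp
    ring
  rw [hid] at hnn
  have := div_neg_of_neg_of_pos key (mul_pos h1m hr0pos)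
  linarith

end EvenProfile

section CompactParam

variable {Y : Type*} [TopologicalSpace Y]

theorem continuous_slice {I : Set ℝ} {f : ℝ → Y → ℝ}
    (hf : ContinuousOn (Function.uncurry f) (I ×ˢ univ)) {t : ℝ} (ht : t ∈ I) :
    Continuous (f t) :=
  hf.comp_continuous (f := fun x => (t, x)) (by fun_prop) fun x => ⟨ht, mem_univ _⟩

theorem bound_of_zero_off {I : Set ℝ} {f : ℝ → Y → ℝ}
    (hf : ContinuousOn (Function.uncurry f) (I ×ˢ univ)) {J : Set ℝ} (hJ : IsCompact J)
    (hJI : J ⊆ I) {K : Set Y} (hK : IsCompact K) (h0 : ∀ t x, t ∈ I → x ∉ K → f t x = 0) :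
    ∃ C, 0 ≤ C ∧ ∀ t ∈ J, ∀ x, |f t x| ≤ K.indicator (fun _ => C) x := by
  obtain ⟨C, hC⟩ := (hJ.prod hK).exists_bound_of_continuousOn
    (hf.mono (prod_mono hJI (subset_univ K)))
  refine ⟨max C 0, le_max_right _ _, fun t ht x => ?_⟩
  by_cases hx : x ∈ K
  · rw [indicator_of_mem hx]
    exact (hC (t, x) ⟨ht, hx⟩).trans (le_max_left _ _)
  · rw [indicator_of_notMem hx, h0 t x (hJI ht) hx, abs_zero]

variable [MeasurableSpace Y] [OpensMeasurableSpace Y] {μ : Measure Y} [IsFiniteMeasureOnCompacts μ]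

theorem Continuous.integrable_of_zero_off [R1Space Y] {f : Y → ℝ} (hf : Continuous f) {K : Set Y}
    (hK : IsCompact K) (h0 : ∀ x, x ∉ K → f x = 0) : Integrable f μ :=
  hf.integrable_of_hasCompactSupport (HasCompactSupport.intro hK h0)

theorem integrable_indicator_const [T2Space Y] {K : Set Y} (hK : IsCompact K) (C : ℝ) :
    Integrable (K.indicator (fun _ => C)) μ :=
  (integrable_indicator_iff hK.measurableSet).2 (integrableOn_const hK.measure_lt_top.ne)

theorem hasDerivAt_integral_compact [T2Space Y] {I : Set ℝ} (hI : IsOpen I)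
    {f f' : ℝ → Y → ℝ}
    (hf : ContinuousOn (Function.uncurry f) (I ×ˢ univ))
    (hf' : ContinuousOn (Function.uncurry f') (I ×ˢ univ))
    (hd : ∀ t ∈ I, ∀ x, HasDerivAt (fun s => f s x) (f' t x) t) {K : Set Y} (hK : IsCompact K)
    (h0 : ∀ t x, t ∈ I → x ∉ K → f t x = 0) (h0' : ∀ t x, t ∈ I → x ∉ K → f' t x = 0)
    {t : ℝ} (ht : t ∈ I) : HasDerivAt (fun s => ∫ x, f s x ∂μ) (∫ x, f' t x ∂μ) t := by
  obtain ⟨δ, hδ, hδI⟩ := Metric.nhds_basis_closedBall.mem_iff.1 (hI.mem_nhds ht)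
  obtain ⟨C, -, hC⟩ := bound_of_zero_off hf' (isCompact_closedBall t δ) hδI hK h0'
  refine (hasDerivAt_integral_of_dominated_loc_of_deriv_le (Metric.closedBall_mem_nhds t hδ)
    (F := f) (bound := K.indicator (fun _ => C)) ?_ ?_ ?_ ?_ (integrable_indicator_const hK C) ?_).2
  · filter_upwards [hI.mem_nhds ht] with s hs
    exact ((continuous_slice hf hs).integrable_of_zero_off hK
      fun x hx => h0 s x hs hx).aestronglyMeasurable
  · exact (continuous_slice hf ht).integrable_of_zero_off hK fun x hx => h0 t x ht hx
  · exact ((continuous_slice hf' ht).integrable_of_zero_off hK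
      fun x hx => h0' t x ht hx).aestronglyMeasurable
  · exact Eventually.of_forall fun x s hs => hC s hs x
  · exact Eventually.of_forall fun x s hs => hd s (hδI hs) x

end CompactParam

section IntegrationByParts

variable {n : ℕ}

theorem continuous_dir {A : EuclideanSpace ℝ (Fin n) → ℝ} (hA : ContDiff ℝ 1 A)
    (v : EuclideanSpace ℝ (Fin n)) : Continuous (dir v A) :=
  (ContDiff.dir (k := 0) (by simpa using hA) v).continuous

theorem ContDiff.dir_one {A : EuclideanSpace ℝ (Fin n) → ℝ} (hA : ContDiff ℝ 2 A)
    (v : EuclideanSpace ℝ (Fin n)) : ContDiff ℝ 1 (_root_.dir v A) :=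
  ContDiff.dir (k := 1) (by rwa [show (1 : WithTop ℕ∞) + 1 = 2 by norm_num]) v

theorem continuous_lap {A : EuclideanSpace ℝ (Fin n) → ℝ} (hA : ContDiff ℝ 2 A) :
    Continuous (lap n A) := by
  have : lap n A = fun x => ∑ i, dir (EuclideanSpace.single i (1 : ℝ))
      (dir (EuclideanSpace.single i (1 : ℝ)) A) x := rfl
  rw [this]
  exact continuous_finsetSum _ fun i _ => continuous_dir (hA.dir_one _) _

theorem HasCompactSupport.dir {A : EuclideanSpace ℝ (Fin n) → ℝ} (hA : HasCompactSupport A)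
    (v : EuclideanSpace ℝ (Fin n)) : HasCompactSupport (_root_.dir v A) :=
  hA.fderiv_apply ℝ v

theorem HasCompactSupport.lap {A : EuclideanSpace ℝ (Fin n) → ℝ} (hA : HasCompactSupport A) :
    HasCompactSupport (_root_.lap n A) := by
  refine HasCompactSupport.intro hA.isCompact fun x hx => ?_
  have h := notMem_tsupport_iff_eventuallyEq.1 hx
  rw [lap_congr (g := fun _ => 0) h]
  have h0 : ∀ v : EuclideanSpace ℝ (Fin n),
      _root_.dir v (fun _ : EuclideanSpace ℝ (Fin n) => (0 : ℝ)) = fun _ => 0 := fun v => by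
    ext y; simp [_root_.dir]
  simp [lap_eq_dir, h0]

theorem integral_dir_mul {A B : EuclideanSpace ℝ (Fin n) → ℝ} (hA : ContDiff ℝ 1 A)
    (hB : ContDiff ℝ 1 B) (hBc : HasCompactSupport B) (v : EuclideanSpace ℝ (Fin n)) :
    ∫ x, A x * dir v B x = -∫ x, dir v A x * B x := by
  refine integral_mul_fderiv_eq_neg_fderiv_mul_of_integrable ?_ ?_ ?_
    (fun x _ => hA.differentiable (by simp) x) (fun x _ => hB.differentiable (by simp) x)
  · exact ((continuous_dir hA v).mul hB.continuous).integrable_of_hasCompactSupport hBc.mul_left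
  · exact (hA.continuous.mul (continuous_dir hB v)).integrable_of_hasCompactSupport
      (hBc.dir v).mul_left
  · exact (hA.continuous.mul hB.continuous).integrable_of_hasCompactSupport hBc.mul_left

theorem integral_lap_mul {A B : EuclideanSpace ℝ (Fin n) → ℝ} (hA : ContDiff ℝ 2 A)
    (hB : ContDiff ℝ 2 B) (hBc : HasCompactSupport B) :
    ∫ x, lap n A x * B x = ∫ x, A x * lap n B x := by
  have h21 : (1 : WithTop ℕ∞) ≤ 2 := by norm_num
  simp only [lap_eq_dir, Finset.sum_mul, Finset.mul_sum]
  rw [integral_finsetSum, integral_finsetSum]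
  · refine Finset.sum_congr rfl fun i _ => ?_
    have e1 := integral_dir_mul (hA.dir_one (EuclideanSpace.single i (1 : ℝ))) (hB.of_le h21) hBc
      (EuclideanSpace.single i (1 : ℝ))
    have e2 := integral_dir_mul (hA.of_le h21) (hB.dir_one (EuclideanSpace.single i (1 : ℝ)))
      (hBc.dir _) (EuclideanSpace.single i (1 : ℝ))
    linarith
  · intro i _
    exact (hA.continuous.mul (continuous_dir (hB.dir_one _) _)).integrable_of_hasCompactSupport
      ((hBc.dir _).dir _).mul_left
  · intro i _
    exact ((continuous_dir (hA.dir_one _) _).mul hB.continuous).integrable_of_hasCompactSupport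
      hBc.mul_left

end IntegrationByParts

section Kato

theorem tendsto_sqrt_sq_add (z : ℝ) : Tendsto (fun ε : ℝ => √(z ^ 2 + ε ^ 2)) (𝓝[>] 0) (𝓝 |z|) := by
  have : Continuous fun ε : ℝ => √(z ^ 2 + ε ^ 2) := by fun_prop
  have h := (this.tendsto 0).mono_left (nhdsWithin_le_nhds (s := Ioi 0))
  simpa [Real.sqrt_sq_eq_abs] using h

theorem tendsto_div_sqrt_sq_add (z : ℝ) :
    Tendsto (fun ε : ℝ => z / √(z ^ 2 + ε ^ 2)) (𝓝[>] 0) (𝓝 (z / |z|)) := by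
  by_cases hz : z = 0
  · simp [hz]
  · exact tendsto_const_nhds.div (tendsto_sqrt_sq_add z) (abs_ne_zero.2 hz)

theorem abs_div_sqrt_sq_add_le (z ε : ℝ) : |z / √(z ^ 2 + ε ^ 2)| ≤ 1 := by
  rw [abs_div, abs_of_nonneg (Real.sqrt_nonneg _)]
  refine div_le_one_of_le₀ (Real.abs_le_sqrt (by nlinarith)) (Real.sqrt_nonneg _)

theorem sqrt_sq_add_le (z : ℝ) {ε : ℝ} (hε : 0 ≤ ε) (hε1 : ε ≤ 1) : √(z ^ 2 + ε ^ 2) ≤ |z| + 1 := by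
  rw [Real.sqrt_le_left (by positivity)]
  nlinarith [sq_abs z, abs_nonneg z]

theorem hasDerivAt_sqrt_sq_add {ε : ℝ} (hε : 0 < ε) (z : ℝ) :
    HasDerivAt (fun z => √(z ^ 2 + ε ^ 2)) (z / √(z ^ 2 + ε ^ 2)) z := by
  have h : HasDerivAt (fun z => z ^ 2 + ε ^ 2) (2 * z) z := by
    simpa using (hasDerivAt_pow 2 z).add_const (ε ^ 2)
  refine (h.sqrt (by positivity)).congr_deriv ?_
  field_simp

theorem hasDerivAt_div_sqrt_sq_add {ε : ℝ} (hε : 0 < ε) (z : ℝ) :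
    HasDerivAt (fun z => z / √(z ^ 2 + ε ^ 2)) (ε ^ 2 / √(z ^ 2 + ε ^ 2) ^ 3) z := by
  have hp : 0 < √(z ^ 2 + ε ^ 2) := Real.sqrt_pos.2 (by positivity)
  refine ((hasDerivAt_id z).div (hasDerivAt_sqrt_sq_add hε z) hp.ne').congr_deriv ?_
  have hs : √(z ^ 2 + ε ^ 2) ^ 2 = z ^ 2 + ε ^ 2 := Real.sq_sqrt (by positivity)
  simp only [id]
  field_simp
  linear_combination hs

theorem eventually_small : ∀ᶠ ε : ℝ in 𝓝[>] 0, 0 < ε ∧ ε ≤ 1 :=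
  (eventually_mem_nhdsWithin).and (mem_nhdsWithin_of_mem_nhds (Iic_mem_nhds one_pos))

variable {n : ℕ}

theorem kato_inequality {d Φ : EuclideanSpace ℝ (Fin n) → ℝ} (hd : ContDiff ℝ 2 d)
    (hΦ : ContDiff ℝ 2 Φ) (hΦc : HasCompactSupport Φ) (hΦ0 : ∀ x, 0 ≤ Φ x) :
    ∫ x, d x / |d x| * lap n d x * Φ x ≤ ∫ x, |d x| * lap n Φ x := by
  have h1 : Tendsto (fun ε : ℝ => ∫ x, d x / √(d x ^ 2 + ε ^ 2) * lap n d x * Φ x) (𝓝[>] 0)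
      (𝓝 (∫ x, d x / |d x| * lap n d x * Φ x)) := by
    refine tendsto_integral_filter_of_dominated_convergence (fun x => |lap n d x * Φ x|) ?_ ?_ ?_ ?_
    · filter_upwards [eventually_small] with ε hε
      have hc : Continuous fun x => d x / √(d x ^ 2 + ε ^ 2) * lap n d x * Φ x := by
        refine ((hd.continuous.div ?_ fun x => ?_).mul (continuous_lap hd)).mul hΦ.continuous
        · have := hd.continuous
          fun_prop
        · have := hε.1
          positivity
      exact hc.aestronglyMeasurable
    · refine Eventually.of_forall fun ε => Eventually.of_forall fun x => ?_
      rw [mul_assoc, norm_mul]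
      exact mul_le_of_le_one_left (norm_nonneg _) (abs_div_sqrt_sq_add_le _ _)
    · exact (((continuous_lap hd).mul hΦ.continuous).integrable_of_hasCompactSupport
        hΦc.mul_left).abs
    · exact Eventually.of_forall fun x =>
        ((tendsto_div_sqrt_sq_add (d x)).mul_const _).mul_const _
  have h2 : Tendsto (fun ε : ℝ => ∫ x, √(d x ^ 2 + ε ^ 2) * lap n Φ x) (𝓝[>] 0)
      (𝓝 (∫ x, |d x| * lap n Φ x)) := by
    refine tendsto_integral_filter_of_dominated_convergence
      (fun x => |(|d x| + 1) * lap n Φ x|) ?_ ?_ ?_ ?_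
    · refine Eventually.of_forall fun ε => ?_
      have hc : Continuous fun x => √(d x ^ 2 + ε ^ 2) * lap n Φ x := by
        refine Continuous.mul ?_ (continuous_lap hΦ)
        have := hd.continuous
        fun_prop
      exact hc.aestronglyMeasurable
    · filter_upwards [eventually_small] with ε hε
      refine Eventually.of_forall fun x => ?_
      rw [norm_mul, abs_mul, Real.norm_eq_abs, Real.norm_eq_abs]
      refine mul_le_mul_of_nonneg_right ?_ (abs_nonneg _)
      rw [abs_of_nonneg (Real.sqrt_nonneg _)]
      exact (sqrt_sq_add_le _ hε.1.le hε.2).trans (le_abs_self _)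
    · have hc : Continuous fun x => (|d x| + 1) * lap n Φ x :=
        (hd.continuous.abs.add continuous_const).mul (continuous_lap hΦ)
      exact (hc.integrable_of_hasCompactSupport hΦc.lap.mul_left).abs
    · exact Eventually.of_forall fun x => (tendsto_sqrt_sq_add (d x)).mul_const _
  refine le_of_tendsto_of_tendsto h1 h2 ?_
  filter_upwards [eventually_small] with ε hε
  have hε0 := hε.1
  have hpos : ∀ x, 0 < √(d x ^ 2 + ε ^ 2) := fun x => Real.sqrt_pos.2 (by positivity)
  have hG : ContDiff ℝ 2 fun x => √(d x ^ 2 + ε ^ 2) :=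
    ((hd.pow 2).add contDiff_const).sqrt fun x => by positivity
  rw [← integral_lap_mul hG hΦ hΦc]
  refine integral_mono ?_ ?_ fun x => ?_
  · refine Continuous.integrable_of_hasCompactSupport ?_ hΦc.mul_left
    exact ((hd.continuous.div hG.continuous fun x => (hpos x).ne').mul
      (continuous_lap hd)).mul hΦ.continuous
  · exact ((continuous_lap hG).mul hΦ.continuous).integrable_of_hasCompactSupport hΦc.mul_left
  · refine mul_le_mul_of_nonneg_right ?_ (hΦ0 x)
    rw [lap_comp hd.contDiffAt (Eventually.of_forall (hasDerivAt_sqrt_sq_add hε0))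
      (hasDerivAt_div_sqrt_sq_add hε0 (d x))]
    have : 0 ≤ ε ^ 2 / √(d x ^ 2 + ε ^ 2) ^ 3 *
        ∑ i, dir (EuclideanSpace.single i (1 : ℝ)) d x ^ 2 := by positivity
    linarith

end Kato

/-- Kato's inequality in integrated form for `z_t = Δ d` with `sign z = sign d`. -/
theorem kato_evolution {n : ℕ} {I : Set ℝ} (hI : IsOpen I)
    {z zt d Φ Φt : ℝ → EuclideanSpace ℝ (Fin n) → ℝ}
    (hz : ContinuousOn (Function.uncurry z) (I ×ˢ univ))
    (hzt : ContinuousOn (Function.uncurry zt) (I ×ˢ univ))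
    (hdz : ∀ t ∈ I, ∀ x, HasDerivAt (fun s => z s x) (zt t x) t)
    (hd : ∀ t ∈ I, ContDiff ℝ 2 (d t))
    (hpde : ∀ t ∈ I, ∀ᵐ x, zt t x = lap n (d t) x)
    (hsign : ∀ t ∈ I, ∀ x, z t x / |z t x| = d t x / |d t x|)
    (hΦ : ContinuousOn (Function.uncurry Φ) (I ×ˢ univ))
    (hΦt : ContinuousOn (Function.uncurry Φt) (I ×ˢ univ))
    (hdΦ : ∀ t ∈ I, ∀ x, HasDerivAt (fun s => Φ s x) (Φt t x) t)
    (hΦ2 : ∀ t ∈ I, ContDiff ℝ 2 (Φ t)) (hΦ0 : ∀ t ∈ I, ∀ x, 0 ≤ Φ t x)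
    {K : Set (EuclideanSpace ℝ (Fin n))} (hK : IsCompact K)
    (hΦK : ∀ t x, t ∈ I → x ∉ K → Φ t x = 0) {e : ℝ → ℝ} (he : ContinuousOn e I)
    (hest : ∀ t ∈ I, ∫ x, (|z t x| * Φt t x + |d t x| * lap n (Φ t) x) ≤ e t)
    {t1 t2 : ℝ} (h12 : t1 ≤ t2) (ht : Icc t1 t2 ⊆ I) :
    ∫ x, |z t2 x| * Φ t2 x ≤ (∫ x, |z t1 x| * Φ t1 x) + ∫ t in t1..t2, e t := by
  have hΦtK : ∀ t x, t ∈ I → x ∉ K → Φt t x = 0 := by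
    intro t x htI hx
    refine (hdΦ t htI x).unique ((hasDerivAt_const t (0 : ℝ)).congr_of_eventuallyEq ?_)
    filter_upwards [hI.mem_nhds htI] with s hs using hΦK s x hs hx
  have hΦc : ∀ t ∈ I, HasCompactSupport (Φ t) := fun t ht =>
    HasCompactSupport.intro hK fun x hx => hΦK t x ht hx
  set J : ℝ → ℝ → EuclideanSpace ℝ (Fin n) → ℝ := fun ε t x => √(z t x ^ 2 + ε ^ 2) * Φ t x
  set J' : ℝ → ℝ → EuclideanSpace ℝ (Fin n) → ℝ := fun ε t x =>
    z t x / √(z t x ^ 2 + ε ^ 2) * zt t x * Φ t x + √(z t x ^ 2 + ε ^ 2) * Φt t x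
  set L : ℝ → EuclideanSpace ℝ (Fin n) → ℝ := fun t x =>
    z t x / |z t x| * zt t x * Φ t x + |z t x| * Φt t x
  have hsq : ∀ ε : ℝ, ContinuousOn (Function.uncurry fun t x => √(z t x ^ 2 + ε ^ 2))
      (I ×ˢ univ) := fun ε => ((hz.pow 2).add continuousOn_const).sqrt
  have hJ : ∀ ε : ℝ, ContinuousOn (Function.uncurry (J ε)) (I ×ˢ univ) := fun ε => (hsq ε).mul hΦ
  have hJ' : ∀ ε : ℝ, 0 < ε → ContinuousOn (Function.uncurry (J' ε)) (I ×ˢ univ) := fun ε hε =>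
    (((hz.div (hsq ε) fun p _ => (Real.sqrt_pos.2 (by positivity)).ne').mul hzt).mul hΦ).add
      ((hsq ε).mul hΦt)
  have hJK : ∀ ε t x, t ∈ I → x ∉ K → J ε t x = 0 := fun ε t x ht hx => by
    simp [J, hΦK t x ht hx]
  have hJK' : ∀ ε t x, t ∈ I → x ∉ K → J' ε t x = 0 := fun ε t x ht hx => by
    simp [J', hΦK t x ht hx, hΦtK t x ht hx]
  have hJd : ∀ ε, 0 < ε → ∀ t ∈ I, ∀ x, HasDerivAt (fun s => J ε s x) (J' ε t x) t := by
    intro ε hε t ht x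
    refine (((hasDerivAt_sqrt_sq_add hε (z t x)).comp t (hdz t ht x)).mul
      (hdΦ t ht x)).congr_deriv ?_
    rfl
  have hder : ∀ ε, 0 < ε → ∀ t ∈ I, HasDerivAt (fun s => ∫ x, J ε s x) (∫ x, J' ε t x) t :=
    fun ε hε t ht => hasDerivAt_integral_compact hI (hJ ε) (hJ' ε hε) (hJd ε hε) hK
      (hJK ε) (hJK' ε) ht
  have hcont : ∀ ε, 0 < ε → ContinuousOn (fun t => ∫ x, J' ε t x) I := fun ε hε =>
    continuousOn_integral_of_compact_support hK (hJ' ε hε) (hJK' ε)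
  have hu : uIcc t1 t2 ⊆ I := by rwa [uIcc_of_le h12]
  have hftc : ∀ ε, 0 < ε → ∫ t in t1..t2, ∫ x, J' ε t x =
      (∫ x, J ε t2 x) - ∫ x, J ε t1 x := fun ε hε =>
    intervalIntegral.integral_eq_sub_of_hasDerivAt (fun t ht => hder ε hε t (hu ht))
      ((hcont ε hε).mono hu).intervalIntegrable
  obtain ⟨C1, hC1, hb1⟩ := bound_of_zero_off (hzt.mul hΦ)
    (f := fun t x => zt t x * Φ t x) isCompact_Icc ht hK
    (fun t x ht hx => by simp [hΦK t x ht hx])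
  obtain ⟨C2, hC2, hb2⟩ := bound_of_zero_off
    (f := fun t x => (|z t x| + 1) * Φt t x) ((hz.abs.add (continuousOn_const (c := 1))).mul hΦt)
    isCompact_Icc ht hK
    (fun t x ht hx => by simp [hΦtK t x ht hx])
  have hbd : ∀ ε, 0 < ε → ε ≤ 1 → ∀ t ∈ Icc t1 t2, ∀ x,
      ‖J' ε t x‖ ≤ K.indicator (fun _ => C1 + C2) x := by
    intro ε hε hε1 t ht x
    have a1 : |zt t x * Φ t x| ≤ K.indicator (fun _ => C1) x := hb1 t ht x
    have a2 := hb2 t ht x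
    have a3 : |z t x / √(z t x ^ 2 + ε ^ 2) * zt t x * Φ t x| ≤ |zt t x * Φ t x| := by
      rw [mul_assoc, abs_mul]
      exact mul_le_of_le_one_left (abs_nonneg _) (abs_div_sqrt_sq_add_le _ _)
    have a4 : |√(z t x ^ 2 + ε ^ 2) * Φt t x| ≤ |(|z t x| + 1) * Φt t x| := by
      rw [abs_mul, abs_mul]
      refine mul_le_mul_of_nonneg_right ?_ (abs_nonneg _)
      rw [abs_of_nonneg (Real.sqrt_nonneg _)]
      exact (sqrt_sq_add_le _ hε.le hε1).trans (le_abs_self _)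
    have a5 : K.indicator (fun _ => C1 + C2) x =
        K.indicator (fun _ => C1) x + K.indicator (fun _ => C2) x := by
      by_cases hx : x ∈ K <;> simp [hx]
    rw [a5]
    exact (abs_add_le _ _).trans (add_le_add (a3.trans a1) (a4.trans a2))
  have hlimx : ∀ t x, Tendsto (fun ε => J' ε t x) (𝓝[>] 0) (𝓝 (L t x)) := fun t x =>
    (((tendsto_div_sqrt_sq_add (z t x)).mul_const _).mul_const _).add
      ((tendsto_sqrt_sq_add (z t x)).mul_const _)
  have hlim : ∀ t ∈ Icc t1 t2, Tendsto (fun ε => ∫ x, J' ε t x) (𝓝[>] 0) (𝓝 (∫ x, L t x)) := by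
    intro t htt
    refine tendsto_integral_filter_of_dominated_convergence _ ?_ ?_
      (integrable_indicator_const hK (C1 + C2)) (Eventually.of_forall fun x => hlimx t x)
    · filter_upwards [eventually_small] with ε hε
      exact (continuous_slice (hJ' ε hε.1) (ht htt)).aestronglyMeasurable
    · filter_upwards [eventually_small] with ε hε
      exact Eventually.of_forall fun x => hbd ε hε.1 hε.2 t htt x
  have hlim2 : ∀ t ∈ Icc t1 t2, Tendsto (fun ε => ∫ x, J ε t x) (𝓝[>] 0)
      (𝓝 (∫ x, |z t x| * Φ t x)) := by
    intro t htt
    have hzc := (continuous_slice hz (ht htt))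
    have hpc := (continuous_slice hΦ (ht htt))
    refine tendsto_integral_filter_of_dominated_convergence
      (fun x => |(|z t x| + 1) * Φ t x|) ?_ ?_ ?_ ?_
    · filter_upwards [eventually_small] with ε hε
      exact (continuous_slice (hJ ε) (ht htt)).aestronglyMeasurable
    · filter_upwards [eventually_small] with ε hε
      refine Eventually.of_forall fun x => ?_
      rw [norm_mul, abs_mul, Real.norm_eq_abs, Real.norm_eq_abs]
      refine mul_le_mul_of_nonneg_right ?_ (abs_nonneg _)
      rw [abs_of_nonneg (Real.sqrt_nonneg _)]
      exact (sqrt_sq_add_le _ hε.1.le hε.2).trans (le_abs_self _)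
    · exact (Continuous.integrable_of_zero_off ((hzc.abs.add continuous_const).mul hpc) hK
        fun x hx => by simp [hΦK t x (ht htt) hx]).abs
    · exact Eventually.of_forall fun x => (tendsto_sqrt_sq_add (z t x)).mul_const _
  set M := ∫ x, K.indicator (fun _ => C1 + C2) x
  have hMb : ∀ ε, 0 < ε → ε ≤ 1 → ∀ t ∈ Icc t1 t2, ‖∫ x, J' ε t x‖ ≤ M := by
    intro ε hε hε1 t htt
    refine norm_integral_le_of_norm_le (integrable_indicator_const hK _) ?_
    exact Eventually.of_forall fun x => hbd ε hε hε1 t htt x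
  have hle : ∀ t ∈ Icc t1 t2, ∫ x, L t x ≤ e t := by
    intro t htt
    have htI := ht htt
    refine le_trans ?_ (hest t htI)
    have i1 : Integrable fun x => |z t x| * Φt t x :=
      ((continuous_slice hz htI).abs.mul (continuous_slice hΦt htI)).integrable_of_zero_off hK
        fun x hx => by simp [hΦtK t x htI hx]
    have i2 : Integrable fun x => |d t x| * lap n (Φ t) x :=
      ((hd t htI).continuous.abs.mul (continuous_lap (hΦ2 t htI))).integrable_of_hasCompactSupport
        (hΦc t htI).lap.mul_left
    have i3 : Integrable fun x => z t x / |z t x| * zt t x * Φ t x := by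
      have hc := (continuous_slice hzt htI).mul (continuous_slice hΦ htI)
      refine (hc.integrable_of_zero_off (μ := volume) hK fun x hx => by
        simp [hΦK t x htI hx]).mono ?_ (Eventually.of_forall fun x => ?_)
      · have hm := ((continuous_slice hz htI).measurable.div
          (continuous_slice hz htI).abs.measurable).mul (continuous_slice hzt htI).measurable
        exact (hm.mul (continuous_slice hΦ htI).measurable).aestronglyMeasurable
      · rw [mul_assoc, norm_mul]
        refine mul_le_of_le_one_left (norm_nonneg _) ?_
        rw [norm_div, norm_abs_eq_norm]
        exact div_self_le_one _
    have hL : ∫ x, L t x = (∫ x, z t x / |z t x| * zt t x * Φ t x) + ∫ x, |z t x| * Φt t x :=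
      integral_add i3 i1
    rw [hL, integral_add i1 i2, add_comm]
    refine add_le_add le_rfl ?_
    refine le_trans (le_of_eq (integral_congr_ae ?_))
      (kato_inequality (hd t htI) (hΦ2 t htI) (hΦc t htI) (hΦ0 t htI))
    filter_upwards [hpde t htI] with x hx
    rw [hx, hsign t htI x]
  have hioc : uIoc t1 t2 ⊆ Icc t1 t2 := by
    rw [uIoc_of_le h12]; exact Ioc_subset_Icc_self
  have hmeas : ∀ ε, 0 < ε → AEStronglyMeasurable (fun t => ∫ x, J' ε t x)
      (volume.restrict (uIoc t1 t2)) := fun ε hε =>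
    (((hcont ε hε).mono (hioc.trans ht)).aestronglyMeasurable measurableSet_uIoc)
  have hlimt : Tendsto (fun ε => ∫ t in t1..t2, ∫ x, J' ε t x) (𝓝[>] 0)
      (𝓝 (∫ t in t1..t2, ∫ x, L t x)) := by
    refine intervalIntegral.tendsto_integral_filter_of_dominated_convergence (fun _ => M) ?_ ?_
      intervalIntegrable_const (Eventually.of_forall fun t htt => hlim t (hioc htt))
    · filter_upwards [eventually_small] with ε hε using hmeas ε hε.1
    · filter_upwards [eventually_small] with ε hε
      exact Eventually.of_forall fun t htt => hMb ε hε.1 hε.2 t (hioc htt)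
  have hfin : ∫ t in t1..t2, ∫ x, L t x =
      (∫ x, |z t2 x| * Φ t2 x) - ∫ x, |z t1 x| * Φ t1 x := by
    refine tendsto_nhds_unique hlimt (((hlim2 t2 (right_mem_Icc.2 h12)).sub
      (hlim2 t1 (left_mem_Icc.2 h12))).congr' ?_)
    filter_upwards [eventually_small] with ε hε
    exact (hftc ε hε.1).symm
  have hLint : IntervalIntegrable (fun t => ∫ x, L t x) volume t1 t2 := by
    rw [intervalIntegrable_iff]
    have hae : AEStronglyMeasurable (fun t => ∫ x, L t x) (volume.restrict (uIoc t1 t2)) := by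
      refine aestronglyMeasurable_of_tendsto_ae atTop
        (f := fun k : ℕ => fun t => ∫ x, J' (1 / ((k : ℝ) + 1)) t x)
        (fun k => hmeas _ (by positivity)) ?_
      filter_upwards [ae_restrict_mem measurableSet_uIoc] with t htt
      refine (hlim t (hioc htt)).comp ?_
      exact tendsto_nhdsWithin_iff.2 ⟨tendsto_one_div_add_atTop_nhds_zero_nat,
        Eventually.of_forall fun k => mem_Ioi.2 (by positivity)⟩
    refine Integrable.mono' (g := fun _ => M) (integrableOn_const (by simp)) hae ?_
    filter_upwards [ae_restrict_mem measurableSet_uIoc] with t htt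
    refine le_of_tendsto (hlim t (hioc htt)).norm ?_
    filter_upwards [eventually_small] with ε hε using hMb ε hε.1 hε.2 t (hioc htt)
  have := intervalIntegral.integral_mono_on h12 hLint (he.mono hu).intervalIntegrable hle
  linarith

theorem exponent_pos {n : ℕ} {m : ℝ} (hn : 3 ≤ n) (hm1 : m < ((n : ℝ) - 2) / n) :
    0 < (n : ℝ) - 2 - n * m := by
  have h0 : (0 : ℝ) < n := by exact_mod_cast (by omega : 0 < n)
  rw [lt_div_iff₀ h0] at hm1
  linarith

theorem lt_one_of_exponent {n : ℕ} {m : ℝ} (hn : 3 ≤ n) (hm1 : m < ((n : ℝ) - 2) / n) : m < 1 := by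
  have h0 : (0 : ℝ) < n := by exact_mod_cast (by omega : 0 < n)
  rw [lt_div_iff₀ h0] at hm1
  nlinarith

theorem Cstar_pos {n : ℕ} {m : ℝ} (hn : 3 ≤ n) (hm0 : 0 < m) (hm1 : m < ((n : ℝ) - 2) / n) :
    0 < Cstar n m := by
  have := exponent_pos hn hm1
  have := lt_one_of_exponent hn hm1
  unfold Cstar
  exact div_pos (by positivity) (by linarith)

/-- Under the second alternative in (C1) the barrier exponent lies in the admissible range. -/
theorem barrier_exponent {n : ℕ} {m β : ℝ} (hm1 : m < 1)
    (hm : m < ((n : ℝ) - 4) / ((n : ℝ) - 2)) (hn : 4 < n) (hD : 0 < (n : ℝ) - 2 - n * m)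
    (hβ : beta2 n m < β) :
    2 < A0 n m β / (2 * (1 - m)) ∧
      2 * ((n : ℝ) - 2 - n * m) < (A0 n m β / (2 * (1 - m))) ^ 2 * (1 - m) := by
  have hn' : (4 : ℝ) < n := by exact_mod_cast hn
  rw [lt_div_iff₀ (by linarith)] at hm
  have h1m : 0 < 1 - m := by linarith
  set D := (n : ℝ) - 2 - n * m with hDdef
  have e1 : √(2 * (1 - m) / D) < A0 n m β / (2 * D) := by
    have : A0 n m β / (2 * D) = β - (((n : ℝ) + 2) * m - ((n : ℝ) - 2)) / (2 * D) := by
      unfold A0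
      rw [← hDdef]
      field_simp
      ring
    rw [this]
    unfold beta2 at hβ
    rw [← hDdef] at hβ
    linarith
  have hA : 0 < A0 n m β := by
    have h := (Real.sqrt_nonneg _).trans_lt e1
    by_contra! h'
    exact absurd h (not_lt.2 (div_nonpos_of_nonpos_of_nonneg h' (by positivity)))
  have e2 := (Real.sqrt_lt' (div_pos hA (by positivity))).1 e1
  rw [div_pow, div_lt_div_iff₀ hD (by positivity)] at e2
  have e3 : 8 * D * (1 - m) < A0 n m β ^ 2 := by
    have : D * (8 * D * (1 - m)) < D * A0 n m β ^ 2 := by nlinarith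
    exact lt_of_mul_lt_mul_left this hD.le
  have e4 : 2 * (1 - m) < D := by rw [hDdef]; linarith
  refine ⟨?_, ?_⟩
  · rw [lt_div_iff₀ (by positivity)]
    nlinarith
  · rw [div_pow, div_mul_eq_mul_div, lt_div_iff₀ (by positivity)]
    nlinarith

set_option maxHeartbeats 400000 in
theorem exists_weight_parameters {N m β α c μ k C : ℝ} (hC : 0 < C) (hc : 0 < c) (hμ0 : 0 < μ)
    (hμC : m = μ * c) (hk0 : 0 < k) (hnk0 : 0 < N - 2 - k) (hβ0 : 0 < β)
    (hH0 : 0 < β * (N - k) - α + μ * (k * (N - 2 - k))) :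
    ∃ ε δ : ℝ, 0 < ε ∧ 0 < δ ∧
      ∀ X q A : ℝ, 0 ≤ X → 0 < q → q ≤ C → X * q ≤ c → m ≤ A * q →
        0 ≤ (N * β - α - δ) * (ε + X) - 2 * β * (k / 2) * X +
          A * (k / 2) * ((2 * N - 4 * (k / 2) - 4) * X + 2 * N * ε) / (ε + X) := by
  have hN0 : 0 < N := by linarith
  obtain ⟨H, hH⟩ : ∃ H, H = β * (N - k) - α + μ * (k * (N - 2 - k)) := ⟨_, rfl⟩
  rw [← hH] at hH0
  obtain ⟨P, hP⟩ : ∃ P, P = μ * (k * (N - 2 - k)) := ⟨_, rfl⟩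
  have hP0 : 0 < P := by rw [hP]; positivity
  obtain ⟨η, hη⟩ : ∃ η, η = H / (2 * P) := ⟨_, rfl⟩
  have hη0 : 0 < η := by rw [hη]; positivity
  refine ⟨η * c / C, H / 2, by positivity, half_pos hH0, ?_⟩
  intro X q A hX hq hqC hXq hA
  obtain ⟨ε, hε⟩ : ∃ ε, ε = η * c / C := ⟨_, rfl⟩
  have hε0 : 0 < ε := by rw [hε]; positivity
  obtain ⟨μ', hμ'⟩ : ∃ μ', μ' = μ / (1 + η) := ⟨_, rfl⟩
  have hμ'0 : 0 < μ' := by rw [hμ']; positivity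
  rw [← hε]
  have hAμ : μ' * (ε + X) ≤ A := by
    have e1 : ε * q ≤ η * c := by
      rw [hε, div_mul_eq_mul_div, div_le_iff₀ hC]
      exact mul_le_mul_of_nonneg_left hqC (by positivity)
    have e2 : (ε + X) * q ≤ (1 + η) * c := by linarith
    have e3 : μ' * (ε + X) * q ≤ m := by
      calc μ' * (ε + X) * q = μ' * ((ε + X) * q) := by ring
        _ ≤ μ' * ((1 + η) * c) := by gcongr
        _ = m := by rw [hμ', hμC]; field_simp
    exact le_of_mul_le_mul_right (e3.trans hA) hq
  have hlow : μ' * (k / 2) * ((2 * N - 4 * (k / 2) - 4) * X + 2 * N * ε) ≤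
      A * (k / 2) * ((2 * N - 4 * (k / 2) - 4) * X + 2 * N * ε) / (ε + X) := by
    rw [le_div_iff₀ (by positivity)]
    have : 0 ≤ (k / 2) * ((2 * N - 4 * (k / 2) - 4) * X + 2 * N * ε) := by
      have : 0 ≤ (2 * N - 4 * (k / 2) - 4 : ℝ) := by linarith
      positivity
    have h2 := mul_le_mul_of_nonneg_right hAμ this
    calc _ = μ' * (ε + X) * ((k / 2) * ((2 * N - 4 * (k / 2) - 4) * X + 2 * N * ε)) := by ring
      _ ≤ _ := h2
      _ = _ := by ring
  have hηP : P - H / 2 ≤ μ' * (k * (N - 2 - k)) := by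
    have : μ' * (k * (N - 2 - k)) = P / (1 + η) := by rw [hμ', hP]; ring
    rw [this, le_div_iff₀ (by positivity)]
    have h1 : P * η = H / 2 := by rw [hη]; field_simp
    have h2 : 0 ≤ H / 2 * η := mul_nonneg (half_pos hH0).le hη0.le
    linarith
  have hc1 : 0 ≤ N * β - α - H / 2 - β * k + μ' * (k * (N - 2 - k)) := by linarith
  have hc2 : 0 ≤ N * β - α - H / 2 + μ' * (k * N) := by
    have h1 : 0 ≤ μ' * (k * (k + 2)) := mul_nonneg hμ'0.le (mul_nonneg hk0.le (by linarith))
    linarith [mul_pos hβ0 hk0]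
  refine le_trans (add_nonneg (mul_nonneg hc1 hX) (mul_nonneg hc2 hε0.le)) ?_
  refine le_trans (le_of_eq ?_) (add_le_add_right hlow _)
  ring

/-- The algebra behind the space weight `(ε + ρ²)^(-κ)`. -/
theorem exists_weight_real {n : ℕ} {m β α : ℝ} (hn : 3 ≤ n) (hm0 : 0 < m)
    (hm1 : m < ((n : ℝ) - 2) / n) (hα : α = (2 * β + 1) / (1 - m)) (hC1 : CondC1 n m β)
    {C : ℝ} (hC : 0 < C) :
    ∃ κ ε δ : ℝ, 0 ≤ κ ∧ 2 * κ ≤ (n : ℝ) - 2 ∧ 0 < ε ∧ 0 < δ ∧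
      ∀ X q A : ℝ, 0 ≤ X → 0 < q → q ≤ C → (β ≤ beta1 n m → X * q ≤ Cstar n m) → m ≤ A * q →
        0 ≤ (n * β - α - δ) * (ε + X) - 2 * β * κ * X +
          A * κ * ((2 * n - 4 * κ - 4) * X + 2 * n * ε) / (ε + X) := by
  have hD := exponent_pos hn hm1
  have hm1' := lt_one_of_exponent hn hm1
  have h1m : 0 < 1 - m := by linarith
  have hn3 : (3 : ℝ) ≤ n := by exact_mod_cast hn
  have hCs := Cstar_pos hn hm0 hm1
  by_cases hβ : beta1 n m < β
  · refine ⟨0, 1, n * β - α, le_rfl, by linarith, one_pos, ?_, ?_⟩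
    · unfold beta1 at hβ
      rw [div_lt_iff₀ hD] at hβ
      have : n * β - α = (β * ((n : ℝ) - 2 - n * m) - 1) / (1 - m) := by
        rw [hα]; field_simp; ring
      rw [this]
      exact div_pos (by linarith) h1m
    · intro X q A _ _ _ _ _
      simp
  obtain h | ⟨hn4, -, hm, hb0, hb1⟩ := hC1
  · exact absurd h hβ
  have hb2 : beta2 n m < β := (le_max_left _ _).trans_lt hb0
  have hbe : betaE n m < β := (le_max_right _ _).trans_lt hb0
  have hβ0 : 0 < β := lt_trans (by unfold betaE; positivity) hbe
  obtain ⟨hγ2, hγA⟩ := barrier_exponent hm1' hm hn4 hD hb2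
  have hn' : (4 : ℝ) < n := by exact_mod_cast hn4
  rw [lt_div_iff₀ (by linarith)] at hm
  unfold beta1 at hb1
  rw [le_div_iff₀ hD] at hb1
  set γ := A0 n m β / (2 * (1 - m)) with hγ
  have hA0 : A0 n m β = 2 * (1 - m) * γ := by rw [hγ]; field_simp
  have hA0' : (n : ℝ) - 2 - ((n : ℝ) + 2) * m + 2 * β * ((n : ℝ) - 2 - n * m) = 2 * (1 - m) * γ := by
    rw [← hA0]; rfl
  set D := (n : ℝ) - 2 - n * m with hDdef
  set k := D / (1 - m) - γ with hk
  have hkD : k * (1 - m) = D - γ * (1 - m) := by rw [hk]; field_simp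
  have hk0 : 0 < k := by
    have : 0 < k * (1 - m) := by rw [hkD]; nlinarith
    exact pos_of_mul_pos_left this h1m.le
  have hnk : (n : ℝ) - 2 - k = 2 * m / (1 - m) + γ := by rw [hk, hDdef]; field_simp; ring
  have hnk0 : 0 < (n : ℝ) - 2 - k := by rw [hnk]; positivity
  set μ := (1 - m) / (2 * D) with hμ
  have hμ0 : 0 < μ := by positivity
  have hμC : m / Cstar n m = μ := by
    unfold Cstar
    rw [← hDdef, hμ]
    field_simp
  have hH0 : 0 < β * (n - k) - α + μ * (k * (n - 2 - k)) := by
    have : 2 * D * (β * (n - k) - α + μ * (k * (n - 2 - k))) = (1 - m) * γ ^ 2 - 2 * D := by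
      have e1 : (n : ℝ) - k = 2 / (1 - m) + γ := by rw [hk, hDdef]; field_simp; ring
      rw [hnk, e1, hμ, hα, hk]
      have e2 : (n : ℝ) - 2 - ((n : ℝ) + 2) * m = D - 2 * m := by rw [hDdef]; ring
      rw [e2] at hA0'
      have : 2 * β * D = 2 * (1 - m) * γ - D + 2 * m := by linarith
      have h3 : β = (2 * (1 - m) * γ - D + 2 * m) / (2 * D) := by
        rw [eq_div_iff (by positivity)]; linarith
      rw [h3]
      field_simp
      ring
    have h2 : 0 < 2 * D * (β * (n - k) - α + μ * (k * (n - 2 - k))) := by rw [this]; linarith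
    exact pos_of_mul_pos_right h2 (by positivity)
  obtain ⟨ε, δ, hε, hδ, h⟩ := exists_weight_parameters hC hCs hμ0
    (by rw [← hμC, div_mul_cancel₀ _ hCs.ne']) hk0 hnk0 hβ0 hH0
  refine ⟨k / 2, ε, δ, (half_pos hk0).le, by linarith, hε, hδ, fun X q A hX hq hqC hXq hA => ?_⟩
  exact h X q A hX hq hqC (hXq (by rw [beta1, le_div_iff₀ hD]; exact hb1)) hA

theorem exists_cutoff : ∃ (b b1 b2 : ℝ → ℝ) (B : ℝ), ContDiff ℝ 2 b ∧
    (∀ v, HasDerivAt b (b1 v) v) ∧ (∀ v, HasDerivAt b1 (b2 v) v) ∧ (∀ v, 0 ≤ b v ∧ b v ≤ 1) ∧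
    (∀ v, v ≤ 1 → b v = 1) ∧ (∀ v, 2 ≤ v → b v = 0) ∧ (∀ v, v < 1 ∨ 2 < v → b1 v = 0 ∧ b2 v = 0) ∧
    0 ≤ B ∧ ∀ v, |b1 v| ≤ B ∧ |b2 v| ≤ B := by
  set b : ℝ → ℝ := fun v => Real.smoothTransition (2 - v) with hb
  have hs : ContDiff ℝ 3 b := Real.smoothTransition.contDiff.comp (contDiff_const.sub contDiff_id)
  have hs1 : ContDiff ℝ 2 (deriv b) := (contDiff_succ_iff_deriv (n := 2)).1 hs |>.2.2
  have hs2 : ContDiff ℝ 1 (deriv (deriv b)) :=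
    (contDiff_succ_iff_deriv (n := 1)).1 (hs1.of_le (by norm_num)) |>.2.2
  have hone : ∀ v, v ≤ 1 → b v = 1 := fun v hv =>
    Real.smoothTransition.one_of_one_le (by linarith)
  have hzero : ∀ v, 2 ≤ v → b v = 0 := fun v hv =>
    Real.smoothTransition.zero_of_nonpos (by linarith)
  have hloc : ∀ v, v < 1 ∨ 2 < v → ∃ c, b =ᶠ[𝓝 v] fun _ => c := by
    rintro v (hv | hv)
    · exact ⟨1, by filter_upwards [Iio_mem_nhds hv] with w hw using hone w hw.le⟩
    · exact ⟨0, by filter_upwards [Ioi_mem_nhds hv] with w hw using hzero w hw.le⟩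
  have hoff : ∀ v, v < 1 ∨ 2 < v → deriv b v = 0 ∧ deriv (deriv b) v = 0 := by
    intro v hv
    obtain ⟨c, hc⟩ := hloc v hv
    refine ⟨by rw [hc.deriv_eq]; simp, ?_⟩
    have h2 : deriv b =ᶠ[𝓝 v] fun _ => 0 := by
      filter_upwards [hc.eventuallyEq_nhds] with w hw
      rw [hw.deriv_eq]; simp
    rw [h2.deriv_eq]; simp
  obtain ⟨B1, hB1⟩ := (isCompact_Icc (a := (1 : ℝ)) (b := 2)).exists_bound_of_continuousOn
    hs1.continuous.continuousOn
  obtain ⟨B2, hB2⟩ := (isCompact_Icc (a := (1 : ℝ)) (b := 2)).exists_bound_of_continuousOn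
    hs2.continuous.continuousOn
  refine ⟨b, deriv b, deriv (deriv b), max 0 (max B1 B2), hs.of_le (by norm_num),
    fun v => (hs.differentiable (by norm_num) v).hasDerivAt,
    fun v => (hs1.differentiable (by norm_num) v).hasDerivAt,
    fun v => ⟨Real.smoothTransition.nonneg _, Real.smoothTransition.le_one _⟩, hone, hzero, hoff,
    le_max_left _ _, fun v => ?_⟩
  by_cases hv : v < 1 ∨ 2 < v
  · simp [hoff v hv]
  · push Not at hv
    exact ⟨(hB1 v hv).trans ((le_max_left _ _).trans (le_max_right _ _)),
      (hB2 v hv).trans ((le_max_right _ _).trans (le_max_right _ _))⟩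

theorem cutoff_estimate {z d ψ κ n θ Q At s R b b1 b2 B C χ : ℝ} (hz : 0 ≤ z) (hd : 0 ≤ d)
    (hψ : 0 ≤ ψ) (hκ : 0 ≤ κ) (hn : 0 ≤ n) (hθ : 0 ≤ θ) (hQ : 0 < Q) (hθQ : θ * s ≤ Q)
    (hs : 0 ≤ s) (hR : 1 ≤ R) (hC : 0 ≤ C) (hdz : d ≤ C * (1 + s) * z) (hb : 0 ≤ b)
    (hB : 0 ≤ B) (hb1 : |b1| ≤ B) (hb2 : |b2| ≤ B) (hχ0 : 0 ≤ χ)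
    (hoff : s / R ^ 2 < 1 ∨ 2 < s / R ^ 2 → b1 = 0 ∧ b2 = 0)
    (hon : 1 ≤ s / R ^ 2 → s / R ^ 2 ≤ 2 → 1 ≤ χ)
    (hkey : z * At + d * (κ * θ / Q ^ 2 * (4 * (κ + 1) * θ * s - 2 * n * Q)) ≤ 0) :
    z * (b * (ψ * At)) + d * (4 * s * (b2 / R ^ 4 * ψ + 2 * (b1 / R ^ 2) * (-κ * θ / Q * ψ) +
        b * (κ * (κ + 1) * θ ^ 2 / Q ^ 2 * ψ)) +
        2 * n * (b1 / R ^ 2 * ψ + b * (-κ * θ / Q * ψ))) ≤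
      3 * C * B * (8 + 16 * κ + 2 * n) * (z * ψ * χ) := by
  have hR2 : 0 < R ^ 2 := by positivity
  have e1 : z * (b * (ψ * At)) + d * (4 * s * (b2 / R ^ 4 * ψ + 2 * (b1 / R ^ 2) * (-κ * θ / Q * ψ) +
        b * (κ * (κ + 1) * θ ^ 2 / Q ^ 2 * ψ)) +
        2 * n * (b1 / R ^ 2 * ψ + b * (-κ * θ / Q * ψ))) =
      b * ψ * (z * At + d * (κ * θ / Q ^ 2 * (4 * (κ + 1) * θ * s - 2 * n * Q))) +
      d * ψ * ((4 * (s / R ^ 2) * b2 - 8 * κ * (θ * s / Q) * b1 + 2 * n * b1) / R ^ 2) := by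
    field_simp
    ring
  rw [e1]
  have hneg := mul_nonpos_of_nonneg_of_nonpos (mul_nonneg hb hψ) hkey
  have hr : 0 ≤ 3 * C * B * (8 + 16 * κ + 2 * n) * (z * ψ * χ) := by positivity
  by_cases hv : s / R ^ 2 < 1 ∨ 2 < s / R ^ 2
  · obtain ⟨h1, h2⟩ := hoff hv
    rw [h1, h2]
    simp only [mul_zero, sub_zero, add_zero, zero_div]
    linarith
  push Not at hv
  have hχ := hon hv.1 hv.2
  have hw0 : 0 ≤ θ * s / Q := by positivity
  have hw1 : θ * s / Q ≤ 1 := (div_le_one hQ).2 hθQ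
  generalize θ * s / Q = w at hw0 hw1 ⊢
  have hsR : s = s / R ^ 2 * R ^ 2 := by field_simp
  generalize s / R ^ 2 = v at *
  have hb1' := abs_le.1 hb1
  have hb2' := abs_le.1 hb2
  have g1 : 4 * v * b2 ≤ 8 * B := by
    have h1 := mul_le_mul_of_nonneg_left hb2'.2 (zero_le_one.trans hv.1)
    have h2 := mul_le_mul_of_nonneg_right hv.2 hB
    linarith
  have g2 : -(8 * κ * w * b1) ≤ 8 * κ * B := by
    have h1 := mul_le_mul_of_nonneg_left hb1'.1 hw0
    have h2 := mul_le_mul_of_nonneg_right hw1 hB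
    have h3 := mul_le_mul_of_nonneg_left (show -(w * b1) ≤ B by linarith) hκ
    linarith
  have g3 : 2 * n * b1 ≤ 2 * n * B := mul_le_mul_of_nonneg_left hb1'.2 (by positivity)
  have g4 : 4 * v * b2 - 8 * κ * w * b1 + 2 * n * b1 ≤ B * (8 + 16 * κ + 2 * n) := by
    have : 0 ≤ κ * B := by positivity
    linarith
  have g5 : d ≤ 3 * C * R ^ 2 * z := by
    refine hdz.trans ?_
    have : 1 + s ≤ 3 * R ^ 2 := by
      have h1 : 1 ≤ R ^ 2 := one_le_pow₀ hR
      have h2 := mul_le_mul_of_nonneg_right hv.2 hR2.le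
      linarith
    calc C * (1 + s) * z ≤ C * (3 * R ^ 2) * z := by gcongr
      _ = _ := by ring
  calc _ ≤ d * ψ * ((4 * v * b2 - 8 * κ * w * b1 + 2 * n * b1) / R ^ 2) := by linarith
    _ ≤ d * ψ * (B * (8 + 16 * κ + 2 * n) / R ^ 2) := by gcongr
    _ ≤ 3 * C * R ^ 2 * z * ψ * (B * (8 + 16 * κ + 2 * n) / R ^ 2) := by gcongr
    _ = 3 * C * B * (8 + 16 * κ + 2 * n) * (z * ψ * 1) := by field_simp
    _ ≤ _ := by gcongr

theorem lap_cutoff_weight {n : ℕ} {b b1 b2 : ℝ → ℝ} (hb : ∀ v, HasDerivAt b (b1 v) v)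
    (hb1 : ∀ v, HasDerivAt b1 (b2 v) v) {A θ ε κ R : ℝ} (hθ : 0 < θ) (hε : 0 < ε) (hR : R ≠ 0)
    (x : EuclideanSpace ℝ (Fin n)) :
    lap n (fun y => b (‖y‖ ^ 2 / R ^ 2) * (A * (ε + θ * ‖y‖ ^ 2) ^ (-κ))) x =
      4 * ‖x‖ ^ 2 * (b2 (‖x‖ ^ 2 / R ^ 2) / R ^ 4 * (A * (ε + θ * ‖x‖ ^ 2) ^ (-κ)) +
        2 * (b1 (‖x‖ ^ 2 / R ^ 2) / R ^ 2) *
          (-κ * θ / (ε + θ * ‖x‖ ^ 2) * (A * (ε + θ * ‖x‖ ^ 2) ^ (-κ))) +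
        b (‖x‖ ^ 2 / R ^ 2) * (κ * (κ + 1) * θ ^ 2 / (ε + θ * ‖x‖ ^ 2) ^ 2 *
          (A * (ε + θ * ‖x‖ ^ 2) ^ (-κ)))) +
      2 * n * (b1 (‖x‖ ^ 2 / R ^ 2) / R ^ 2 * (A * (ε + θ * ‖x‖ ^ 2) ^ (-κ)) +
        b (‖x‖ ^ 2 / R ^ 2) * (-κ * θ / (ε + θ * ‖x‖ ^ 2) * (A * (ε + θ * ‖x‖ ^ 2) ^ (-κ)))) := by
  have hQ : 0 < ε + θ * ‖x‖ ^ 2 := by positivity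
  have hlin : ∀ s : ℝ, HasDerivAt (fun s => ε + θ * s) θ s := fun s => by
    simpa using ((hasDerivAt_id s).const_mul θ).const_add ε
  have hdiv : ∀ s : ℝ, HasDerivAt (fun s : ℝ => s / R ^ 2) (1 / R ^ 2) s := fun s =>
    (hasDerivAt_id s).div_const _
  have hQe : ∀ᶠ s : ℝ in 𝓝 (‖x‖ ^ 2), 0 < ε + θ * s :=
    (hlin _).continuousAt.eventually (lt_mem_nhds hQ)
  have hpow : ∀ (p s : ℝ), 0 < ε + θ * s →
      HasDerivAt (fun s => (ε + θ * s) ^ p) (θ * p * (ε + θ * s) ^ (p - 1)) s := fun p s hs =>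
    (hlin s).rpow_const (Or.inl hs.ne')
  have hbd : ∀ s, HasDerivAt (fun s => b (s / R ^ 2)) (b1 (s / R ^ 2) / R ^ 2) s := fun s =>
    ((hb (s / R ^ 2)).comp s (hdiv s)).congr_deriv (by ring)
  have hb1d : ∀ s, HasDerivAt (fun s => b1 (s / R ^ 2) / R ^ 2) (b2 (s / R ^ 2) / R ^ 4) s :=
    fun s => (((hb1 (s / R ^ 2)).comp s (hdiv s)).div_const (R ^ 2)).congr_deriv (by ring)
  rw [lap_comp_norm_sq (G := fun s => b (s / R ^ 2) * (A * (ε + θ * s) ^ (-κ)))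
    (G1 := fun s => b1 (s / R ^ 2) / R ^ 2 * (A * (ε + θ * s) ^ (-κ)) +
      b (s / R ^ 2) * (A * (θ * -κ * (ε + θ * s) ^ (-κ - 1))))
    (hQe.mono fun s hs => (hbd s).mul ((hpow (-κ) s hs).const_mul A))
    (((hb1d _).mul ((hpow (-κ) _ hQ).const_mul A)).add
      ((hbd _).mul (((hpow (-κ - 1) _ hQ).const_mul (θ * -κ)).const_mul A)))]
  simp only [rpow_sub_one hQ.ne']
  generalize (ε + θ * ‖x‖ ^ 2) ^ (-κ) = p
  field_simp
  ring

theorem weighted_contraction {n : ℕ} {T : ℝ} {z zt d : ℝ → EuclideanSpace ℝ (Fin n) → ℝ}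
    (hz : ContinuousOn (Function.uncurry z) (Ioo 0 T ×ˢ univ))
    (hzt : ContinuousOn (Function.uncurry zt) (Ioo 0 T ×ˢ univ))
    (hdz : ∀ t ∈ Ioo 0 T, ∀ x, HasDerivAt (fun s => z s x) (zt t x) t)
    (hd : ∀ t ∈ Ioo 0 T, ContDiff ℝ 2 (d t))
    (hpde : ∀ t ∈ Ioo 0 T, ∀ᵐ x, zt t x = lap n (d t) x)
    (hsign : ∀ t ∈ Ioo 0 T, ∀ x, z t x / |z t x| = d t x / |d t x|) {C : ℝ} (hC : 0 ≤ C)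
    (hdC : ∀ t ∈ Ioo 0 T, ∀ x, |d t x| ≤ C * (1 + ‖x‖ ^ 2) * |z t x|)
    {A A' θ θ' : ℝ → ℝ} {κ ε M : ℝ} (hκ : 0 ≤ κ) (hε : 0 < ε)
    (hA : ∀ t ∈ Ioo 0 T, HasDerivAt A (A' t) t) (hA' : ContinuousOn A' (Ioo 0 T))
    (hA0 : ∀ t ∈ Ioo 0 T, 0 < A t)
    (hθ : ∀ t ∈ Ioo 0 T, HasDerivAt θ (θ' t) t) (hθ' : ContinuousOn θ' (Ioo 0 T))
    (hθ0 : ∀ t ∈ Ioo 0 T, 0 < θ t)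
    (hkey : ∀ t ∈ Ioo 0 T, ∀ x, |z t x| * (A' t / A t - κ * θ' t * ‖x‖ ^ 2 / (ε + θ t * ‖x‖ ^ 2)) +
      |d t x| * (κ * θ t / (ε + θ t * ‖x‖ ^ 2) ^ 2 *
        (4 * (κ + 1) * θ t * ‖x‖ ^ 2 - 2 * n * (ε + θ t * ‖x‖ ^ 2))) ≤ 0)
    (hInt : ∀ t ∈ Ioo 0 T, Integrable fun x => |z t x| * (A t * (ε + θ t * ‖x‖ ^ 2) ^ (-κ)))
    (hM : ∀ t ∈ Ioo 0 T, ∫ x, |z t x| * (A t * (ε + θ t * ‖x‖ ^ 2) ^ (-κ)) ≤ M)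
    {t1 t2 : ℝ} (h1 : t1 ∈ Ioo 0 T) (h2 : t2 ∈ Ioo 0 T) (h12 : t1 ≤ t2) :
    ∫ x, |z t2 x| * (A t2 * (ε + θ t2 * ‖x‖ ^ 2) ^ (-κ)) ≤
      ∫ x, |z t1 x| * (A t1 * (ε + θ t1 * ‖x‖ ^ 2) ^ (-κ)) := by
  obtain ⟨b, b1, b2, B, hbs, hb1, hb2, hb01, hbone, hbzero, hboff, hB, hbB⟩ := exists_cutoff
  set I := Ioo 0 T with hI
  obtain ⟨χ, hχ⟩ : ∃ χ : ℝ → ℝ, χ = fun v => max 0 (3 - 2 * |v - 3 / 2|) := ⟨_, rfl⟩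
  have hχc : Continuous χ := by rw [hχ]; fun_prop
  have hχ0 : ∀ v, 0 ≤ χ v := fun v => by rw [hχ]; exact le_max_left _ _
  have hχ3 : ∀ v, χ v ≤ 3 := fun v => by
    rw [hχ]; exact max_le (by norm_num) (by linarith [abs_nonneg (v - 3 / 2)])
  have hχ1 : ∀ v, 1 ≤ v → v ≤ 2 → 1 ≤ χ v := fun v h1 h2 => by
    have : |v - 3 / 2| ≤ 1 / 2 := abs_le.2 ⟨by linarith, by linarith⟩
    rw [hχ]; exact le_max_of_le_right (by linarith)
  have hχz : χ 0 = 0 := by rw [hχ]; norm_num [abs_of_pos]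
  have hχb : ∀ v, 3 < v → χ v = 0 := fun v hv => by
    rw [hχ]; exact max_eq_left (by linarith [le_abs_self (v - 3 / 2)])
  set ψ : ℝ → EuclideanSpace ℝ (Fin n) → ℝ := fun t x => A t * (ε + θ t * ‖x‖ ^ 2) ^ (-κ) with hψ
  have hQ0 : ∀ t ∈ I, ∀ x : EuclideanSpace ℝ (Fin n), 0 < ε + θ t * ‖x‖ ^ 2 := fun t ht x => by
    have := hθ0 t ht; positivity
  have hψ0 : ∀ t ∈ I, ∀ x, 0 ≤ ψ t x := fun t ht x =>
    mul_nonneg (hA0 t ht).le (rpow_nonneg (hQ0 t ht x).le _)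
  have hAc : ContinuousOn A I := fun t ht => (hA t ht).continuousAt.continuousWithinAt
  have hθc : ContinuousOn θ I := fun t ht => (hθ t ht).continuousAt.continuousWithinAt
  have hfst : MapsTo Prod.fst (I ×ˢ (univ : Set (EuclideanSpace ℝ (Fin n)))) I := fun p hp => hp.1
  have lift : ∀ {g : ℝ → ℝ}, ContinuousOn g I →
      ContinuousOn (fun p : ℝ × EuclideanSpace ℝ (Fin n) => g p.1) (I ×ˢ univ) := fun hg =>
    hg.comp continuousOn_fst hfst
  have hQc : ContinuousOn (fun p : ℝ × EuclideanSpace ℝ (Fin n) => ε + θ p.1 * ‖p.2‖ ^ 2)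
      (I ×ˢ univ) := continuousOn_const.add ((lift hθc).mul (by fun_prop))
  have hpc : ContinuousOn (fun p : ℝ × EuclideanSpace ℝ (Fin n) => (ε + θ p.1 * ‖p.2‖ ^ 2) ^ (-κ))
      (I ×ˢ univ) := hQc.rpow_const fun p hp => Or.inl (hQ0 p.1 hp.1 p.2).ne'
  have hψc : ContinuousOn (Function.uncurry ψ) (I ×ˢ univ) := (lift hAc).mul hpc
  set At : ℝ → EuclideanSpace ℝ (Fin n) → ℝ := fun t x =>
    A' t / A t - κ * θ' t * ‖x‖ ^ 2 / (ε + θ t * ‖x‖ ^ 2) with hAt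
  have hAtc : ContinuousOn (Function.uncurry At) (I ×ˢ univ) :=
    ((lift hA').div (lift hAc) fun p hp => (hA0 p.1 hp.1).ne').sub
      (((continuousOn_const.mul (lift hθ')).mul (by fun_prop)).div hQc
        fun p hp => (hQ0 p.1 hp.1 p.2).ne')
  have hψt : ∀ t ∈ I, ∀ x, HasDerivAt (fun s => ψ s x) (ψ t x * At t x) t := by
    intro t ht x
    have hq := hQ0 t ht x
    have e := (((hθ t ht).mul_const (‖x‖ ^ 2)).const_add ε).rpow_const (p := -κ) (Or.inl hq.ne')
    refine ((hA t ht).mul e).congr_deriv ?_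
    have := (hA0 t ht).ne'
    simp only [hψ, hAt]
    rw [rpow_sub_one hq.ne']
    field_simp
    ring
  set C' := 3 * C * B * (8 + 16 * κ + 2 * n) with hC'
  have hC'0 : 0 ≤ C' := by positivity
  have hsc : ∀ (g : ℝ → ℝ), Continuous g → ∀ R : ℝ,
      Continuous fun x : EuclideanSpace ℝ (Fin n) => g (‖x‖ ^ 2 / R ^ 2) := fun g hg R => by
    fun_prop
  have hoff3 : ∀ R : ℝ, 1 ≤ R → ∀ x : EuclideanSpace ℝ (Fin n), x ∉ Metric.closedBall 0 (2 * R) →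
      3 < ‖x‖ ^ 2 / R ^ 2 := fun R hR x hx => by
    have hx' : 2 * R < ‖x‖ := by simpa using hx
    rw [lt_div_iff₀ (by positivity)]
    nlinarith
  have hstep : ∀ R : ℝ, 1 ≤ R → ∫ x, |z t2 x| * (b (‖x‖ ^ 2 / R ^ 2) * ψ t2 x) ≤
      (∫ x, |z t1 x| * (b (‖x‖ ^ 2 / R ^ 2) * ψ t1 x)) +
        ∫ t in t1..t2, ∫ x, C' * (|z t x| * ψ t x * χ (‖x‖ ^ 2 / R ^ 2)) := by
    intro R hR
    have hKc := isCompact_closedBall (0 : EuclideanSpace ℝ (Fin n)) (2 * R)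
    have hΦc : ContinuousOn (Function.uncurry fun t (x : EuclideanSpace ℝ (Fin n)) =>
        b (‖x‖ ^ 2 / R ^ 2) * ψ t x) (I ×ˢ univ) :=
      ((hsc b hbs.continuous R).comp continuous_snd).continuousOn.mul hψc
    have hΦtc : ContinuousOn (Function.uncurry fun t (x : EuclideanSpace ℝ (Fin n)) =>
        b (‖x‖ ^ 2 / R ^ 2) * (ψ t x * At t x)) (I ×ˢ univ) :=
      ((hsc b hbs.continuous R).comp continuous_snd).continuousOn.mul (hψc.mul hAtc)
    have hΦ2 : ∀ t ∈ I, ContDiff ℝ 2 fun x : EuclideanSpace ℝ (Fin n) =>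
        b (‖x‖ ^ 2 / R ^ 2) * ψ t x := by
      intro t ht
      refine (hbs.comp ((contDiff_norm_sq ℝ).div_const _)).mul (contDiff_const.mul ?_)
      exact (contDiff_const.add (contDiff_const.mul (contDiff_norm_sq ℝ))).rpow_const_of_ne
        fun x => (hQ0 t ht x).ne'
    have hΦK : ∀ t x, t ∈ I → x ∉ Metric.closedBall (0 : EuclideanSpace ℝ (Fin n)) (2 * R) →
        b (‖x‖ ^ 2 / R ^ 2) * ψ t x = 0 := fun t x _ hx => by
      rw [hbzero _ (by linarith [hoff3 R hR x hx]), zero_mul]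
    have hec : ContinuousOn (Function.uncurry fun t (x : EuclideanSpace ℝ (Fin n)) =>
        C' * (|z t x| * ψ t x * χ (‖x‖ ^ 2 / R ^ 2))) (I ×ˢ univ) :=
      continuousOn_const.mul ((hz.abs.mul hψc).mul
        ((hsc χ hχc R).comp continuous_snd).continuousOn)
    have heK : ∀ t x, t ∈ I → x ∉ Metric.closedBall (0 : EuclideanSpace ℝ (Fin n)) (2 * R) →
        C' * (|z t x| * ψ t x * χ (‖x‖ ^ 2 / R ^ 2)) = 0 := fun t x _ hx => by
      rw [hχb _ (hoff3 R hR x hx), mul_zero, mul_zero]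
    refine kato_evolution (zt := zt) (d := d)
      (Φt := fun t x => b (‖x‖ ^ 2 / R ^ 2) * (ψ t x * At t x)) isOpen_Ioo hz hzt hdz hd hpde
      hsign hΦc hΦtc (fun t ht x => (hψt t ht x).const_mul _) hΦ2
      (fun t ht x => mul_nonneg (hb01 _).1 (hψ0 t ht x)) hKc hΦK
      (continuousOn_integral_of_compact_support hKc hec heK) ?_ h12
      (fun t ht => ⟨h1.1.trans_le ht.1, ht.2.trans_lt h2.2⟩)
    intro t ht
    have hcs : HasCompactSupport fun x : EuclideanSpace ℝ (Fin n) =>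
        b (‖x‖ ^ 2 / R ^ 2) * ψ t x := HasCompactSupport.intro hKc fun x hx => hΦK t x ht hx
    refine integral_mono ?_ ?_ fun x => ?_
    · refine Integrable.add ?_ ?_
      · refine ((continuous_slice hz ht).abs.mul (continuous_slice hΦtc ht)).integrable_of_zero_off
          hKc fun x hx => ?_
        simp [hbzero _ (show 2 ≤ ‖x‖ ^ 2 / R ^ 2 by linarith [hoff3 R hR x hx])]
      · exact ((hd t ht).continuous.abs.mul
          (continuous_lap (hΦ2 t ht))).integrable_of_hasCompactSupport hcs.lap.mul_left
    · exact (continuous_slice hec ht).integrable_of_zero_off hKc fun x hx => heK t x ht hx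
    · beta_reduce
      rw [lap_cutoff_weight hb1 hb2 (hθ0 t ht) hε (by positivity)]
      exact cutoff_estimate (abs_nonneg _) (abs_nonneg _) (hψ0 t ht x) hκ n.cast_nonneg
        (hθ0 t ht).le (hQ0 t ht x) (by linarith) (by positivity) hR hC (hdC t ht x) (hb01 _).1 hB
        (hbB _).1 (hbB _).2 (hχ0 _) (hboff _) (hχ1 _) (hkey t ht x)
  have hsR : ∀ x : EuclideanSpace ℝ (Fin n), Tendsto (fun R : ℝ => ‖x‖ ^ 2 / R ^ 2) atTop (𝓝 0) :=
    fun x => tendsto_const_nhds.div_atTop (tendsto_pow_atTop two_ne_zero)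
  have hlim : ∀ t ∈ I, Tendsto (fun R : ℝ => ∫ x, |z t x| * (b (‖x‖ ^ 2 / R ^ 2) * ψ t x)) atTop
      (𝓝 (∫ x, |z t x| * ψ t x)) := by
    intro t ht
    refine tendsto_integral_filter_of_dominated_convergence (fun x => |z t x| * ψ t x) ?_ ?_
      (hInt t ht) (Eventually.of_forall fun x => ?_)
    · exact Eventually.of_forall fun R => ((continuous_slice hz ht).abs.mul
        ((hsc b hbs.continuous R).mul (continuous_slice hψc ht))).aestronglyMeasurable
    · refine Eventually.of_forall fun R => Eventually.of_forall fun x => ?_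
      have h0 := hψ0 t ht x
      have hb := hb01 (‖x‖ ^ 2 / R ^ 2)
      rw [Real.norm_of_nonneg (by have := hb.1; positivity)]
      exact mul_le_mul_of_nonneg_left (mul_le_of_le_one_left h0 hb.2) (abs_nonneg _)
    · have := (hbs.continuous.tendsto 0).comp (hsR x)
      rw [hbone 0 zero_le_one] at this
      simpa using (this.mul_const (ψ t x)).const_mul |z t x|
  have herr : Tendsto (fun R : ℝ => ∫ t in t1..t2, ∫ x, C' * (|z t x| * ψ t x * χ (‖x‖ ^ 2 / R ^ 2)))
      atTop (𝓝 (∫ t in t1..t2, (0 : ℝ))) := by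
    have hsub : uIoc t1 t2 ⊆ I := by
      rw [uIoc_of_le h12]
      exact fun t ht => ⟨h1.1.trans ht.1, ht.2.trans_lt h2.2⟩
    refine intervalIntegral.tendsto_integral_filter_of_dominated_convergence
      (fun _ => C' * (3 * M)) ?_ ?_ intervalIntegrable_const ?_
    · filter_upwards [eventually_ge_atTop 1] with R hR
      refine (ContinuousOn.mono (s := I) ?_ hsub).aestronglyMeasurable measurableSet_uIoc
      refine continuousOn_integral_of_compact_support
        (isCompact_closedBall (0 : EuclideanSpace ℝ (Fin n)) (2 * R)) ?_ fun t x _ hx => ?_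
      · exact continuousOn_const.mul ((hz.abs.mul hψc).mul
          ((hsc χ hχc R).comp continuous_snd).continuousOn)
      · rw [hχb _ (hoff3 R hR x hx), mul_zero, mul_zero]
    · refine Eventually.of_forall fun R => Eventually.of_forall fun t ht => ?_
      have htI := hsub ht
      refine (norm_integral_le_of_norm_le (((hInt t htI).const_mul 3).const_mul C')
        (Eventually.of_forall fun x => ?_)).trans ?_
      · have h0 := hψ0 t htI x
        have := hχ0 (‖x‖ ^ 2 / R ^ 2)
        rw [Real.norm_of_nonneg (by positivity)]
        refine mul_le_mul_of_nonneg_left ?_ hC'0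
        rw [mul_comm 3]
        exact mul_le_mul_of_nonneg_left (hχ3 _) (by positivity)
      · rw [integral_const_mul, integral_const_mul]
        exact mul_le_mul_of_nonneg_left (mul_le_mul_of_nonneg_left (hM t htI) (by norm_num)) hC'0
    · refine Eventually.of_forall fun t ht => ?_
      have htI := hsub ht
      have : (0 : ℝ) = ∫ x : EuclideanSpace ℝ (Fin n), (0 : ℝ) := by simp
      rw [this]
      refine tendsto_integral_filter_of_dominated_convergence
        (fun x => C' * (3 * (|z t x| * ψ t x))) ?_ ?_ (((hInt t htI).const_mul 3).const_mul C')
        (Eventually.of_forall fun x => ?_)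
      · exact Eventually.of_forall fun R => (continuous_const.mul
          (((continuous_slice hz htI).abs.mul (continuous_slice hψc htI)).mul
            (hsc χ hχc R))).aestronglyMeasurable
      · refine Eventually.of_forall fun R => Eventually.of_forall fun x => ?_
        have h0 := hψ0 t htI x
        have := hχ0 (‖x‖ ^ 2 / R ^ 2)
        rw [Real.norm_of_nonneg (by positivity)]
        refine mul_le_mul_of_nonneg_left ?_ hC'0
        rw [mul_comm 3]
        exact mul_le_mul_of_nonneg_left (hχ3 _) (by positivity)
      · have := (hχc.tendsto 0).comp (hsR x)
        rw [hχz] at this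
        simpa using (this.const_mul (|z t x| * ψ t x)).const_mul C'
  rw [intervalIntegral.integral_zero] at herr
  have hfin := le_of_tendsto_of_tendsto (hlim t2 h2) ((hlim t1 h1).add herr)
    (by filter_upwards [eventually_ge_atTop 1] with R hR using hstep R hR)
  simpa using hfin

theorem dir_sub_apply {X : Type*} [NormedAddCommGroup X] [NormedSpace ℝ X] {φ ψ : X → ℝ} {p : X}
    (hφ : DifferentiableAt ℝ φ p) (hψ : DifferentiableAt ℝ ψ p) (v : X) :
    dir v (fun x => φ x - ψ x) p = dir v φ p - dir v ψ p := by
  simp only [dir]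
  rw [fderiv_fun_sub hφ hψ]
  simp

theorem lap_sub {n : ℕ} {f g : EuclideanSpace ℝ (Fin n) → ℝ} (hf : ContDiff ℝ 2 f)
    (hg : ContDiff ℝ 2 g) (x : EuclideanSpace ℝ (Fin n)) :
    lap n (fun y => f y - g y) x = lap n f x - lap n g x := by
  simp only [lap_eq_dir]
  rw [← Finset.sum_sub_distrib]
  refine Finset.sum_congr rfl fun i _ => ?_
  have h1 : dir (EuclideanSpace.single i (1 : ℝ)) (fun y => f y - g y) =
      fun y => dir (EuclideanSpace.single i (1 : ℝ)) f y -
        dir (EuclideanSpace.single i (1 : ℝ)) g y := by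
    ext y
    exact dir_sub_apply (hf.differentiable (by norm_num) y) (hg.differentiable (by norm_num) y) _
  rw [h1]
  exact dir_sub_apply ((hf.dir_one _).differentiable (by norm_num) x)
    ((hg.dir_one _).differentiable (by norm_num) x) _

theorem rpow_sub_bounds {m a b : ℝ} (hm0 : 0 < m) (hm1 : m < 1) (ha : 0 < a) (hb : 0 < b) :
    (a - b) / |a - b| = (a ^ m - b ^ m) / |a ^ m - b ^ m| ∧
      (∀ q, a ^ (1 - m) ≤ q → b ^ (1 - m) ≤ q → m * |a - b| ≤ |a ^ m - b ^ m| * q) ∧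
      ∀ q, 0 ≤ q → q ≤ a ^ (1 - m) → q ≤ b ^ (1 - m) → |a ^ m - b ^ m| * q ≤ m * |a - b| := by
  wlog hab : a ≤ b generalizing a b
  · obtain ⟨h1, h2, h3⟩ := this hb ha (le_of_not_ge hab)
    rw [abs_sub_comm a b, abs_sub_comm (a ^ m)]
    refine ⟨?_, fun q ha hb => h2 q hb ha, fun q hq ha hb => h3 q hq hb ha⟩
    rw [← neg_sub b a, ← neg_sub (b ^ m), neg_div, neg_div, h1]
  rcases hab.eq_or_lt with rfl | hab
  · simp
  obtain ⟨c, hc, hce⟩ := exists_hasDerivAt_eq_slope (fun x => x ^ m) (fun x => m * x ^ (m - 1)) hab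
    (continuousOn_id.rpow_const fun x hx => Or.inl (ha.trans_le hx.1).ne')
    fun x hx => Real.hasDerivAt_rpow_const (Or.inl (ha.trans hx.1).ne')
  have hc0 : 0 < c := ha.trans hc.1
  have hba : 0 < b - a := sub_pos.2 hab
  rw [eq_div_iff hba.ne'] at hce
  have hlt : a ^ m < b ^ m := Real.rpow_lt_rpow ha.le hab hm0
  rw [abs_of_neg (sub_neg.2 hab), abs_of_neg (sub_neg.2 hlt), neg_sub, neg_sub, ← hce]
  have hcm : c ^ (m - 1) = (c ^ (1 - m))⁻¹ := by rw [← rpow_neg hc0.le]; ring_nf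
  have hcp : 0 < c ^ (1 - m) := rpow_pos_of_pos hc0 _
  have hac : a ^ (1 - m) ≤ c ^ (1 - m) := Real.rpow_le_rpow ha.le hc.1.le (by linarith)
  have hcb : c ^ (1 - m) ≤ b ^ (1 - m) := Real.rpow_le_rpow hc0.le hc.2.le (by linarith)
  refine ⟨?_, fun q _ hq => ?_, fun q _ hq _ => ?_⟩
  · rw [hce, ← neg_sub b a, ← neg_sub (b ^ m), neg_div, neg_div, div_self hba.ne',
      div_self (sub_pos.2 hlt).ne']
  · rw [hcm]
    have h1 : 1 ≤ (c ^ (1 - m))⁻¹ * q := by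
      rw [← div_eq_inv_mul, le_div_iff₀ hcp, one_mul]; exact hcb.trans hq
    have := mul_le_mul_of_nonneg_left h1 (mul_pos hm0 hba).le
    linarith
  · rw [hcm]
    have h1 : (c ^ (1 - m))⁻¹ * q ≤ 1 := by
      rw [← div_eq_inv_mul, div_le_iff₀ hcp, one_mul]; exact hq.trans hac
    have := mul_le_mul_of_nonneg_left h1 (mul_pos hm0 hba).le
    linarith

/-- A positive smooth solution of `u_t = Δ(u^m)` trapped between two self-similar solutions,
together with a reference profile `h`. -/
structure Sandwich (n : ℕ) (m β α T : ℝ) (h h1 h2 lo up : ℝ → ℝ)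
    (u : EuclideanSpace ℝ (Fin n) → ℝ → ℝ) : Prop where
  hn : 3 ≤ n
  hm0 : 0 < m
  hm1 : m < ((n : ℝ) - 2) / n
  hβ : 0 < β
  hα : α * (1 - m) = 2 * β + 1
  hT : 0 < T
  prof : EvenProfile n m β α h h1 h2
  profLo : ∃ l1 l2, EvenProfile n m β α lo l1 l2
  profUp : ∃ g1 g2, EvenProfile n m β α up g1 g2
  pos : ∀ x, ∀ t ∈ Ioo 0 T, 0 < u x t
  smooth : ContDiffOn ℝ (⊤ : ℕ∞) (fun p : EuclideanSpace ℝ (Fin n) × ℝ => u p.1 p.2)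
    (univ ×ˢ Ioo 0 T)
  pde : ∀ x, ∀ t ∈ Ioo 0 T, deriv (u x) t = lap n (fun y => u y t ^ m) x
  sand : ∀ x, ∀ t ∈ Ioo 0 T, Uself n β α T lo x t ≤ u x t ∧ u x t ≤ Uself n β α T up x t

namespace Sandwich

variable {n : ℕ} {m β α T : ℝ} {h h1 h2 lo up : ℝ → ℝ} {u : EuclideanSpace ℝ (Fin n) → ℝ → ℝ}

theorem lt_one (S : Sandwich n m β α T h h1 h2 lo up u) : m < 1 := lt_one_of_exponent S.hn S.hm1

theorem alpha_pos (S : Sandwich n m β α T h h1 h2 lo up u) : 0 < α := by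
  have := S.hα
  have := S.hβ
  have := S.lt_one
  have h3 : 0 < α * (1 - m) := by linarith
  exact pos_of_mul_pos_left h3 (by linarith)

theorem contDiffAt (S : Sandwich n m β α T h h1 h2 lo up u) (x : EuclideanSpace ℝ (Fin n)) {t : ℝ}
    (ht : t ∈ Ioo 0 T) :
    ContDiffAt ℝ (⊤ : ℕ∞) (fun p : EuclideanSpace ℝ (Fin n) × ℝ => u p.1 p.2) (x, t) :=
  S.smooth.contDiffAt ((isOpen_univ.prod isOpen_Ioo).mem_nhds ⟨mem_univ _, ht⟩)

theorem contDiff_slice (S : Sandwich n m β α T h h1 h2 lo up u) {t : ℝ} (ht : t ∈ Ioo 0 T) :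
    ContDiff ℝ (⊤ : ℕ∞) fun x => u x t :=
  contDiff_iff_contDiffAt.2 fun x =>
    (S.contDiffAt x ht).comp x (f := fun x => (x, t)) (contDiffAt_id.prodMk contDiffAt_const)

theorem hasDerivAt_time (S : Sandwich n m β α T h h1 h2 lo up u) (x : EuclideanSpace ℝ (Fin n))
    {t : ℝ} (ht : t ∈ Ioo 0 T) :
    HasDerivAt (u x) (fderiv ℝ (fun p : EuclideanSpace ℝ (Fin n) × ℝ => u p.1 p.2) (x, t) (0, 1)) t :=
  ((S.contDiffAt x ht).differentiableAt (by simp)).hasFDerivAt.comp_hasDerivAt t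
    (f := fun t => (x, t)) ((hasDerivAt_const t x).prodMk (hasDerivAt_id t))

theorem continuousOn_swap (S : Sandwich n m β α T h h1 h2 lo up u) :
    ContinuousOn (Function.uncurry fun t x => u x t) (Ioo 0 T ×ˢ univ) :=
  S.smooth.continuousOn.comp (f := Prod.swap) continuous_swap.continuousOn
    fun _ hp => ⟨hp.2, hp.1⟩

theorem continuousOn_deriv_swap (S : Sandwich n m β α T h h1 h2 lo up u) :
    ContinuousOn (Function.uncurry fun t x => deriv (u x) t) (Ioo 0 T ×ˢ univ) := by
  have h1 := (S.smooth.continuousOn_fderiv_of_isOpen (isOpen_univ.prod isOpen_Ioo)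
    (by simp)).clm_apply (continuousOn_const (c := ((0 : EuclideanSpace ℝ (Fin n)), (1 : ℝ))))
  refine (h1.comp (f := Prod.swap) continuous_swap.continuousOn
    fun p hp => ⟨hp.2, hp.1⟩).congr fun p hp => ?_
  exact (S.hasDerivAt_time p.2 hp.1).deriv

theorem _root_.continuousOn_uself {H H1 H2 : ℝ → ℝ} (E : EvenProfile n m β α H H1 H2) :
    ContinuousOn (Function.uncurry fun t x => Uself n β α T H x t) (Iio T ×ˢ univ) := by
  have hp : ∀ γ : ℝ, ContinuousOn (fun p : ℝ × EuclideanSpace ℝ (Fin n) => (T - p.1) ^ γ)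
      (Iio T ×ˢ univ) := fun γ => ContinuousOn.rpow_const (by fun_prop)
    fun p hp => Or.inl (sub_pos.2 hp.1).ne'
  exact (hp α).mul (E.continuous.comp_continuousOn ((hp β).mul (by fun_prop)))

theorem _root_.continuousOn_uself_deriv {H H1 H2 : ℝ → ℝ} (E : EvenProfile n m β α H H1 H2) :
    ContinuousOn (Function.uncurry fun t (x : EuclideanSpace ℝ (Fin n)) =>
      -((T - t) ^ (α - 1) * (α * H ((T - t) ^ β * ‖x‖) +
        β * ((T - t) ^ β * ‖x‖) * H1 ((T - t) ^ β * ‖x‖)))) (Iio T ×ˢ univ) := by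
  have hp : ∀ γ : ℝ, ContinuousOn (fun p : ℝ × EuclideanSpace ℝ (Fin n) => (T - p.1) ^ γ)
      (Iio T ×ˢ univ) := fun γ => ContinuousOn.rpow_const (by fun_prop)
    fun p hp => Or.inl (sub_pos.2 hp.1).ne'
  have hρ : ContinuousOn (fun p : ℝ × EuclideanSpace ℝ (Fin n) => (T - p.1) ^ β * ‖p.2‖)
      (Iio T ×ˢ univ) := (hp β).mul (by fun_prop)
  exact ((hp (α - 1)).mul ((continuousOn_const.mul (E.continuous.comp_continuousOn hρ)).add
    ((continuousOn_const.mul hρ).mul (E.continuous_deriv.comp_continuousOn hρ)))).neg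

end Sandwich

theorem uself_rpow {n : ℕ} {m β α T t : ℝ} {H H1 H2 : ℝ → ℝ} (E : EvenProfile n m β α H H1 H2)
    (hα : α * (1 - m) = 2 * β + 1) (ht : t < T) (x : EuclideanSpace ℝ (Fin n)) :
    Uself n β α T H x t ^ (1 - m) = (T - t) ^ (2 * β + 1) * H ((T - t) ^ β * ‖x‖) ^ (1 - m) := by
  have hs : 0 < T - t := by linarith
  rw [Uself, mul_rpow (rpow_nonneg hs.le _) (E.pos _).le, ← rpow_mul hs.le, hα]

namespace EvenProfile

theorem bounded {n : ℕ} {m β α : ℝ} {H H1 H2 : ℝ → ℝ} (E : EvenProfile n m β α H H1 H2)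
    (hC : 0 < Cstar n m) (hm1 : m < 1) : ∃ B, 0 ≤ B ∧ ∀ r, 0 ≤ r → H r ≤ B := by
  obtain ⟨c, C, hc, hb⟩ := E.bounds hC
  have h1m : 0 < 1 - m := by linarith
  have hCp : 0 < C := hc.trans_le ((hb 0 le_rfl).1.trans (hb 0 le_rfl).2)
  refine ⟨C ^ (1 - m)⁻¹, rpow_nonneg hCp.le _, fun r hr => ?_⟩
  have h1 : H r ^ (1 - m) ≤ C := by
    have h2 := (hb r hr).2
    have h3 : 0 ≤ H r ^ (1 - m) := rpow_nonneg (E.pos r).le _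
    have h4 := mul_nonneg (sq_nonneg r) h3
    linarith
  have h2 := Real.rpow_le_rpow (rpow_nonneg (E.pos r).le _) h1 (inv_nonneg.2 h1m.le)
  rwa [← rpow_mul (E.pos r).le, mul_inv_cancel₀ h1m.ne', rpow_one] at h2

theorem uself_le {n : ℕ} {m β α T : ℝ} {H H1 H2 : ℝ → ℝ} (E : EvenProfile n m β α H H1 H2)
    (hC : 0 < Cstar n m) (hm1 : m < 1) (hα : 0 ≤ α) (hT : 0 < T) :
    ∃ B, 0 ≤ B ∧ ∀ (x : EuclideanSpace ℝ (Fin n)), ∀ t, 0 ≤ t → t < T →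
      Uself n β α T H x t ≤ B := by
  obtain ⟨B, hB, hb⟩ := E.bounded hC hm1
  refine ⟨T ^ α * B, mul_nonneg (rpow_nonneg hT.le _) hB, fun x t h0 ht => ?_⟩
  exact mul_le_mul (rpow_le_rpow (by linarith) (by linarith) hα)
    (hb _ (mul_nonneg (rpow_nonneg (by linarith) _) (norm_nonneg _))) (E.pos _).le
    (rpow_nonneg hT.le _)

theorem uself_lower {n : ℕ} {m β α T T' : ℝ} {H H1 H2 : ℝ → ℝ} (E : EvenProfile n m β α H H1 H2)
    (hC : 0 < Cstar n m) (hα : α * (1 - m) = 2 * β + 1) (hβ : 0 < β) (hT : 0 < T)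
    (hT' : T' < T) :
    ∃ c, 0 < c ∧ ∀ (x : EuclideanSpace ℝ (Fin n)), ∀ t, 0 ≤ t → t < T' →
      c / (1 + ‖x‖ ^ 2) ≤ Uself n β α T H x t ^ (1 - m) := by
  obtain ⟨c, C, hc, hb⟩ := E.bounds hC
  have hT2 : 0 < T - T' := by linarith
  have hb0 : 0 < (T ^ β) ^ 2 := by positivity
  have ha0 : 0 < (T - T') ^ (2 * β + 1) := rpow_pos_of_pos hT2 _
  refine ⟨(T - T') ^ (2 * β + 1) * (c / (1 + (T ^ β) ^ 2)), by positivity, fun x t h0 ht => ?_⟩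
  rw [uself_rpow E hα (by linarith)]
  have hs : 0 < T - t := by linarith
  have h1 : (T - T') ^ (2 * β + 1) ≤ (T - t) ^ (2 * β + 1) :=
    rpow_le_rpow hT2.le (by linarith) (by linarith)
  have h2 : (T - t) ^ β ≤ T ^ β := rpow_le_rpow hs.le (by linarith) hβ.le
  have hρ : 0 ≤ (T - t) ^ β * ‖x‖ := mul_nonneg (rpow_nonneg hs.le _) (norm_nonneg _)
  obtain ⟨ρ, hρe⟩ : ∃ ρ, ρ = (T - t) ^ β * ‖x‖ := ⟨_, rfl⟩
  rw [← hρe] at hρ ⊢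
  have h3 : ρ ^ 2 ≤ (T ^ β) ^ 2 * ‖x‖ ^ 2 := by
    rw [hρe, ← mul_pow]
    exact pow_le_pow_left₀ (hρe ▸ hρ) (mul_le_mul_of_nonneg_right h2 (norm_nonneg _)) 2
  have h4 : c / (1 + (T ^ β) ^ 2) / (1 + ‖x‖ ^ 2) ≤ H ρ ^ (1 - m) := by
    rw [div_div, div_le_iff₀ (by positivity)]
    refine (hb ρ hρ).1.trans ?_
    rw [mul_comm]
    refine mul_le_mul_of_nonneg_left ?_ (rpow_nonneg (E.pos _).le _)
    have := sq_nonneg ‖x‖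
    nlinarith
  rw [mul_div_assoc]
  exact mul_le_mul h1 h4 (by positivity) (ha0.le.trans h1)

end EvenProfile

/-- Difference between `u` and the self-similar solution with profile `h`. -/
noncomputable def defect (n : ℕ) (β α T : ℝ) (h : ℝ → ℝ) (u : EuclideanSpace ℝ (Fin n) → ℝ → ℝ) (t : ℝ)
    (x : EuclideanSpace ℝ (Fin n)) : ℝ := u x t - Uself n β α T h x t

/-- Difference between `u ^ m` and the power of the self-similar solution with profile `h`. -/
noncomputable def defectPow (n : ℕ) (m β α T : ℝ) (h : ℝ → ℝ) (u : EuclideanSpace ℝ (Fin n) → ℝ → ℝ)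
    (t : ℝ) (x : EuclideanSpace ℝ (Fin n)) : ℝ := u x t ^ m - Uself n β α T h x t ^ m

namespace Sandwich

variable {n : ℕ} {m β α T : ℝ} {h h1 h2 lo up : ℝ → ℝ} {u : EuclideanSpace ℝ (Fin n) → ℝ → ℝ}

theorem cstar_pos (S : Sandwich n m β α T h h1 h2 lo up u) : 0 < Cstar n m :=
  Cstar_pos S.hn S.hm0 S.hm1

theorem contDiff_slice_two (S : Sandwich n m β α T h h1 h2 lo up u) {t : ℝ} (ht : t ∈ Ioo 0 T) :
    ContDiff ℝ 2 fun x => u x t :=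
  contDiff_infty.1 (S.contDiff_slice ht) 2

theorem contDiff_defectPow (S : Sandwich n m β α T h h1 h2 lo up u) {t : ℝ} (ht : t ∈ Ioo 0 T) :
    ContDiff ℝ 2 (defectPow n m β α T h u t) :=
  ((S.contDiff_slice_two ht).rpow_const_of_ne
    fun x => (S.pos x t ht).ne').sub
    (S.prof.contDiff_uself.rpow_const_of_ne fun x => (S.prof.uself_pos ht.2 x).ne')

theorem defectPow_bound (S : Sandwich n m β α T h h1 h2 lo up u) {T' : ℝ} (hT' : T' < T) :
    ∃ C, 0 ≤ C ∧ ∀ t ∈ Ioo 0 T', ∀ x, |defectPow n m β α T h u t x| ≤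
      C * (1 + ‖x‖ ^ 2) * |defect n β α T h u t x| := by
  obtain ⟨l1, l2, L⟩ := S.profLo
  obtain ⟨c, hc, hcl⟩ := L.uself_lower S.cstar_pos S.hα S.hβ S.hT hT'
  obtain ⟨c', hc', hcl'⟩ := S.prof.uself_lower S.cstar_pos S.hα S.hβ S.hT hT'
  have hm1 := S.lt_one
  have hm0 := S.hm0
  refine ⟨m / min c c', by positivity, fun t ht x => ?_⟩
  have htT : t ∈ Ioo 0 T := ⟨ht.1, ht.2.trans hT'⟩
  have hx : 0 < 1 + ‖x‖ ^ 2 := by positivity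
  have key := (rpow_sub_bounds S.hm0 hm1 (S.pos x t htT) (S.prof.uself_pos htT.2 x)).2.2
    (min c c' / (1 + ‖x‖ ^ 2)) (by positivity)
    (((div_le_div_of_nonneg_right (min_le_left c c') hx.le).trans (hcl x t ht.1.le ht.2)).trans
      (rpow_le_rpow (L.uself_pos htT.2 x).le (S.sand x t htT).1 (by linarith)))
    ((div_le_div_of_nonneg_right (min_le_right c c') hx.le).trans (hcl' x t ht.1.le ht.2))
  rw [← mul_div_assoc, div_le_iff₀ hx] at key
  rw [defect, defectPow, div_mul_eq_mul_div, div_mul_eq_mul_div, le_div_iff₀ (by positivity)]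
  linarith

theorem defect_bounded (S : Sandwich n m β α T h h1 h2 lo up u) :
    ∃ B, 0 ≤ B ∧ ∀ t ∈ Ioo 0 T, ∀ x, |defect n β α T h u t x| ≤ B := by
  obtain ⟨g1, g2, G⟩ := S.profUp
  obtain ⟨B, hB, hb⟩ := G.uself_le (T := T) S.cstar_pos S.lt_one S.alpha_pos.le S.hT
  obtain ⟨B', hB', hb'⟩ := S.prof.uself_le (T := T) S.cstar_pos S.lt_one S.alpha_pos.le S.hT
  refine ⟨B + B', by positivity, fun t ht x => ?_⟩
  have e1 := S.pos x t ht
  have e2 := S.prof.uself_pos ht.2 x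
  have e3 := (S.sand x t ht).2.trans (hb x t ht.1.le ht.2)
  have e4 := hb' x t ht.1.le ht.2
  rw [defect]
  exact abs_le.2 ⟨by linarith, by linarith⟩

theorem continuousOn_defect (S : Sandwich n m β α T h h1 h2 lo up u) :
    ContinuousOn (Function.uncurry (defect n β α T h u)) (Ioo 0 T ×ˢ univ) :=
  S.continuousOn_swap.sub ((continuousOn_uself S.prof).mono
    (prod_mono (fun _ ht => ht.2) (subset_univ _)))

theorem continuous_defect (S : Sandwich n m β α T h h1 h2 lo up u) {t : ℝ} (ht : t ∈ Ioo 0 T) :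
    Continuous (defect n β α T h u t) :=
  (S.contDiff_slice ht).continuous.sub S.prof.contDiff_uself.continuous

theorem contraction (S : Sandwich n m β α T h h1 h2 lo up u) {T' : ℝ} (hT' : T' < T)
    {A A' θ θ' : ℝ → ℝ} {κ ε M : ℝ} (hκ : 0 ≤ κ) (hε : 0 < ε)
    (hA : ∀ t ∈ Ioo 0 T', HasDerivAt A (A' t) t) (hA' : ContinuousOn A' (Ioo 0 T'))
    (hA0 : ∀ t ∈ Ioo 0 T', 0 < A t)
    (hθ : ∀ t ∈ Ioo 0 T', HasDerivAt θ (θ' t) t) (hθ' : ContinuousOn θ' (Ioo 0 T'))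
    (hθ0 : ∀ t ∈ Ioo 0 T', 0 < θ t)
    (hkey : ∀ t ∈ Ioo 0 T', ∀ x, |defect n β α T h u t x| *
      (A' t / A t - κ * θ' t * ‖x‖ ^ 2 / (ε + θ t * ‖x‖ ^ 2)) +
      |defectPow n m β α T h u t x| * (κ * θ t / (ε + θ t * ‖x‖ ^ 2) ^ 2 *
        (4 * (κ + 1) * θ t * ‖x‖ ^ 2 - 2 * n * (ε + θ t * ‖x‖ ^ 2))) ≤ 0)
    (hInt : ∀ t ∈ Ioo 0 T', Integrable fun x =>
      |defect n β α T h u t x| * (A t * (ε + θ t * ‖x‖ ^ 2) ^ (-κ)))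
    (hM : ∀ t ∈ Ioo 0 T',
      ∫ x, |defect n β α T h u t x| * (A t * (ε + θ t * ‖x‖ ^ 2) ^ (-κ)) ≤ M)
    {t1 t2 : ℝ} (ht1 : t1 ∈ Ioo 0 T') (ht2 : t2 ∈ Ioo 0 T') (h12 : t1 ≤ t2) :
    ∫ x, |defect n β α T h u t2 x| * (A t2 * (ε + θ t2 * ‖x‖ ^ 2) ^ (-κ)) ≤
      ∫ x, |defect n β α T h u t1 x| * (A t1 * (ε + θ t1 * ‖x‖ ^ 2) ^ (-κ)) := by
  have hI : ∀ t ∈ Ioo 0 T', t ∈ Ioo 0 T := fun t ht => ⟨ht.1, ht.2.trans hT'⟩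
  have hsub : Ioo 0 T' ×ˢ (univ : Set (EuclideanSpace ℝ (Fin n))) ⊆ Ioo 0 T ×ˢ univ :=
    prod_mono hI subset_rfl
  obtain ⟨C, hC, hdC⟩ := S.defectPow_bound hT'
  have : Nonempty (Fin n) := ⟨⟨0, by have := S.hn; omega⟩⟩
  have : Nontrivial (EuclideanSpace ℝ (Fin n)) := inferInstance
  refine weighted_contraction (z := defect n β α T h u)
    (zt := fun t x => deriv (u x) t - -((T - t) ^ (α - 1) * (α * h ((T - t) ^ β * ‖x‖) +
        β * ((T - t) ^ β * ‖x‖) * h1 ((T - t) ^ β * ‖x‖))))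
    (d := defectPow n m β α T h u) (S.continuousOn_defect.mono hsub)
    ((S.continuousOn_deriv_swap.mono hsub).sub ((continuousOn_uself_deriv S.prof).mono
      (prod_mono (fun t ht => (hI t ht).2) (subset_univ _)))) ?_ ?_ ?_ ?_ hC hdC hκ hε hA hA' hA0
    hθ hθ' hθ0 hkey hInt hM ht1 ht2 h12
  · intro t ht x
    exact (S.hasDerivAt_time x (hI t ht)).differentiableAt.hasDerivAt.sub
      (S.prof.hasDerivAt_uself (hI t ht).2 x)
  · exact fun t ht => S.contDiff_defectPow (hI t ht)
  · intro t ht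
    have h0 : ∀ᵐ x : EuclideanSpace ℝ (Fin n), x ≠ 0 := by
      simp [ae_iff]
    filter_upwards [h0] with x hx
    have e1 := S.pde x t (hI t ht)
    rw [e1, ← S.prof.lap_uself_rpow (hI t ht).2 S.hα hx]
    exact (lap_sub ((S.contDiff_slice_two (hI t ht)).rpow_const_of_ne
      fun x => (S.pos x t (hI t ht)).ne')
      (S.prof.contDiff_uself.rpow_const_of_ne fun x => (S.prof.uself_pos (hI t ht).2 x).ne') x).symm
  · intro t ht x
    exact (rpow_sub_bounds S.hm0 S.lt_one (S.pos x t (hI t ht))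
      (S.prof.uself_pos (hI t ht).2 x)).1

end Sandwich

theorem tendsto_integral_mul_weight {E ι : Type*} [NormedAddCommGroup E] [MeasureSpace E]
    [OpensMeasurableSpace E] {l : Filter ι} {g : ι → E → ℝ} {w : E → ℝ} {B : ℝ}
    (hg0 : ∀ᶠ i in l, ∀ x, 0 ≤ g i x) (hgB : ∀ᶠ i in l, ∀ x, g i x ≤ B)
    (hgm : ∀ᶠ i in l, AEStronglyMeasurable (g i) volume) (hw : Integrable w) (hw0 : ∀ x, 0 ≤ w x)
    (hw1 : ∀ x, w x ≤ 1) (hgi : ∀ᶠ i in l, ∀ R, IntegrableOn (g i) (Metric.closedBall 0 R))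
    (hg : ∀ R : ℝ, Tendsto (fun i => ∫ x in Metric.closedBall 0 R, g i x) l (𝓝 0)) :
    Tendsto (fun i => ∫ x, g i x * w x) l (𝓝 0) := by
  wlog hB : 0 ≤ B generalizing B
  · exact this (B := max B 0) (hgB.mono fun i h x => (h x).trans (le_max_left _ _)) (le_max_right _ _)
  rw [Metric.tendsto_nhds]
  intro η hη
  have htail : Tendsto (fun R : ℝ => ∫ x in (Metric.closedBall (0 : E) R)ᶜ, w x) atTop (𝓝 0) := by
    have h1 := ((aecover_closedBall (μ := volume) (x := (0 : E)) tendsto_id)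
      |>.integral_tendsto_of_countably_generated hw)
    have h2 := (tendsto_const_nhds (x := ∫ x, w x)).sub h1
    rw [sub_self] at h2
    refine h2.congr fun R => ?_
    have := integral_add_compl (Metric.isClosed_closedBall (x := (0 : E)) (ε := R)).measurableSet hw
    simp only [id]
    linarith
  have hR : ∀ᶠ R : ℝ in atTop, (∫ x in (Metric.closedBall (0 : E) R)ᶜ, w x) < η / (2 * (B + 1)) :=
    htail.eventually (gt_mem_nhds (by positivity))
  obtain ⟨R, hR⟩ := hR.exists
  have hRg := (hg R).eventually (gt_mem_nhds (half_pos hη))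
  filter_upwards [hg0, hgB, hgm, hgi, hRg] with i h0 h1 h2 h3 h4
  have hgw : Integrable fun x => g i x * w x := by
    refine hw.bdd_mul (c := B) h2 (Eventually.of_forall fun x => ?_)
    rw [Real.norm_eq_abs, abs_of_nonneg (h0 x)]; exact h1 x
  have hms := (Metric.isClosed_closedBall (x := (0 : E)) (ε := R)).measurableSet
  have hnn : 0 ≤ ∫ x, g i x * w x := integral_nonneg fun x => mul_nonneg (h0 x) (hw0 x)
  rw [Real.dist_eq, sub_zero, abs_of_nonneg hnn, ← integral_add_compl hms hgw]
  have e1 : ∫ x in Metric.closedBall 0 R, g i x * w x ≤ ∫ x in Metric.closedBall 0 R, g i x :=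
    setIntegral_mono hgw.integrableOn (h3 R) fun x => mul_le_of_le_one_right (h0 x) (hw1 x)
  have e2 : ∫ x in (Metric.closedBall 0 R)ᶜ, g i x * w x ≤
      B * ∫ x in (Metric.closedBall 0 R)ᶜ, w x := by
    rw [← integral_const_mul]
    exact setIntegral_mono hgw.integrableOn (hw.const_mul B).integrableOn
      fun x => mul_le_mul_of_nonneg_right (h1 x) (hw0 x)
  have e3 : B * ∫ x in (Metric.closedBall (0 : E) R)ᶜ, w x ≤ η / 2 := by
    refine (mul_le_mul_of_nonneg_left hR.le hB).trans ?_
    rw [← mul_div_assoc, div_le_div_iff₀ (by positivity) (by positivity)]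
    nlinarith
  linarith

theorem integrable_weight {n : ℕ} (hn : 1 ≤ n) {ε : ℝ} (hε : 0 < ε) :
    Integrable fun x : EuclideanSpace ℝ (Fin n) => (1 + ε * ‖x‖ ^ 2) ^ (-(n : ℝ)) := by
  have h1 : Integrable fun x : EuclideanSpace ℝ (Fin n) => (1 + ‖x‖ ^ 2) ^ (-(2 * n : ℝ) / 2) :=
    integrable_rpow_neg_one_add_norm_sq (by
      have : (1 : ℝ) ≤ n := by exact_mod_cast hn
      simp only [finrank_euclideanSpace, Fintype.card_fin]; linarith)
  have h2 := h1.comp_smul (R := √ε) (sqrt_pos.2 hε).ne'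
  refine h2.congr (Eventually.of_forall fun x => ?_)
  simp only [norm_smul, Real.norm_eq_abs, mul_pow, sq_abs, sq_sqrt hε.le]
  congr 1
  ring

/-- A `Sandwich` attaining, in `L¹_loc`, initial data at finite `L¹` distance from those of the
reference solution. -/
structure SandwichInit (n : ℕ) (m β α T : ℝ) (h h1 h2 lo up : ℝ → ℝ)
    (u : EuclideanSpace ℝ (Fin n) → ℝ → ℝ) (u0 : EuclideanSpace ℝ (Fin n) → ℝ) : Prop
    extends Sandwich n m β α T h h1 h2 lo up u where
  lower : ∀ x, Uself n β α T lo x 0 ≤ u0 x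
  upper : ∀ x, u0 x ≤ Uself n β α T up x 0
  integrable : Integrable fun x => u0 x - Uself n β α T h x 0
  init : ∀ K : Set (EuclideanSpace ℝ (Fin n)), IsCompact K →
    Tendsto (fun t => ∫ x in K, |u x t - u0 x|) (𝓝[>] 0) (𝓝 0)

namespace SandwichInit

variable {n : ℕ} {m β α T : ℝ} {h h1 h2 lo up : ℝ → ℝ} {u : EuclideanSpace ℝ (Fin n) → ℝ → ℝ}
  {u0 : EuclideanSpace ℝ (Fin n) → ℝ}

theorem locallyIntegrable (S : SandwichInit n m β α T h h1 h2 lo up u u0) :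
    LocallyIntegrable u0 := by
  have h1 : LocallyIntegrable fun x => Uself n β α T h x 0 :=
    S.prof.contDiff_uself.continuous.locallyIntegrable
  exact (S.integrable.locallyIntegrable.add h1).congr (Eventually.of_forall fun x => by simp)

theorem eventually_mem (S : SandwichInit n m β α T h h1 h2 lo up u u0) :
    ∀ᶠ t in 𝓝[>] (0 : ℝ), t ∈ Ioo 0 T := Ioo_mem_nhdsGT S.hT

theorem init_compact (S : SandwichInit n m β α T h h1 h2 lo up u u0)
    {K : Set (EuclideanSpace ℝ (Fin n))} (hK : IsCompact K) :
    Tendsto (fun t => ∫ x in K, |defect n β α T h u t x - (u0 x - Uself n β α T h x 0)|)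
      (𝓝[>] 0) (𝓝 0) := by
  obtain ⟨B, hB, hb⟩ := S.prof.uself_le (n := n) (T := T) S.cstar_pos S.lt_one S.alpha_pos.le S.hT
  have hU : Tendsto (fun t => ∫ x in K, |Uself n β α T h x t - Uself n β α T h x 0|)
      (𝓝[>] 0) (𝓝 (∫ x in K, (0 : ℝ))) := by
    refine tendsto_integral_filter_of_dominated_convergence (fun _ => B + B)
      (Eventually.of_forall fun t => ?_) ?_ (by
        rw [integrable_const_iff]
        right
        exact ⟨by simpa using hK.measure_lt_top⟩) (Eventually.of_forall fun x => ?_)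
    · exact ((S.prof.contDiff_uself.continuous.sub
        S.prof.contDiff_uself.continuous).abs).aestronglyMeasurable
    · filter_upwards [S.eventually_mem] with t ht
      refine Eventually.of_forall fun x => ?_
      have e1 := hb x t ht.1.le ht.2
      have e2 := hb x 0 le_rfl S.hT
      have e3 := S.prof.uself_pos ht.2 x
      have e4 := S.prof.uself_pos S.hT x
      rw [Real.norm_eq_abs, abs_abs]
      exact abs_le.2 ⟨by linarith, by linarith⟩
    · have h1 := (S.prof.hasDerivAt_uself S.hT x).continuousAt.tendsto
      have h2 := ((h1.mono_left nhdsWithin_le_nhds).sub_const (Uself n β α T h x 0)).abs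
        (G := ℝ) (l := 𝓝[>] (0 : ℝ))
      simpa using h2
  rw [integral_zero] at hU
  have hsum := (S.init K hK).add hU
  rw [add_zero] at hsum
  refine tendsto_of_tendsto_of_tendsto_of_le_of_le' tendsto_const_nhds hsum
    (Eventually.of_forall fun t => integral_nonneg fun x => abs_nonneg _) ?_
  filter_upwards [S.eventually_mem] with t ht
  have i0 : IntegrableOn u0 K := S.locallyIntegrable.integrableOn_isCompact hK
  have i1 : IntegrableOn (fun x => u x t) K :=
    (S.contDiff_slice ht).continuous.locallyIntegrable.integrableOn_isCompact hK
  have i2 : ∀ t, IntegrableOn (fun x => Uself n β α T h x t) K := fun t =>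
    S.prof.contDiff_uself.continuous.locallyIntegrable.integrableOn_isCompact hK
  have i3 : IntegrableOn (fun x => |u x t - u0 x|) K := (i1.sub i0).abs
  have i4 : IntegrableOn (fun x => |Uself n β α T h x t - Uself n β α T h x 0|) K :=
    ((i2 t).sub (i2 0)).abs
  rw [← integral_add i3 i4]
  refine integral_mono ((i1.sub (i2 t)).sub (i0.sub (i2 0))).abs (i3.add i4) fun x => ?_
  simp only [defect]
  calc |u x t - Uself n β α T h x t - (u0 x - Uself n β α T h x 0)| =
      |(u x t - u0 x) + -(Uself n β α T h x t - Uself n β α T h x 0)| := by congr 1; ring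
    _ ≤ _ := (abs_add_le _ _).trans_eq (by rw [abs_neg])

theorem init_bounded (S : SandwichInit n m β α T h h1 h2 lo up u u0) :
    ∃ B, 0 ≤ B ∧ ∀ x, |u0 x - Uself n β α T h x 0| ≤ B := by
  obtain ⟨g1, g2, G⟩ := S.profUp
  obtain ⟨l1, l2, L⟩ := S.profLo
  obtain ⟨B, hB, hb⟩ := G.uself_le (n := n) (T := T) S.cstar_pos S.lt_one S.alpha_pos.le S.hT
  obtain ⟨B', hB', hb'⟩ := S.prof.uself_le (n := n) (T := T) S.cstar_pos S.lt_one S.alpha_pos.le S.hT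
  refine ⟨B + B', by positivity, fun x => ?_⟩
  have e1 := (L.uself_pos S.hT x).trans_le (S.lower x)
  have e2 := S.prof.uself_pos S.hT x
  have e3 := (S.upper x).trans (hb x 0 le_rfl S.hT)
  have e4 := hb' x 0 le_rfl S.hT
  exact abs_le.2 ⟨by linarith, by linarith⟩

theorem eventually_weighted_le (S : SandwichInit n m β α T h h1 h2 lo up u u0) {ε : ℝ} (hε : 0 < ε)
    {Z : ℝ} (hZ : ∫ x, |u0 x - Uself n β α T h x 0| < Z) :
    ∀ᶠ t in 𝓝[>] (0 : ℝ), ∫ x, |defect n β α T h u t x| * (1 + ε * ‖x‖ ^ 2) ^ (-(n : ℝ)) ≤ Z := by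
  obtain ⟨B, hB, hb⟩ := S.init_bounded
  obtain ⟨B', hB', hb'⟩ := S.defect_bounded
  have hw := integrable_weight (by have := S.hn; omega : 1 ≤ n) hε
  have hw0 : ∀ x : EuclideanSpace ℝ (Fin n), 0 ≤ (1 + ε * ‖x‖ ^ 2) ^ (-(n : ℝ)) := fun x =>
    rpow_nonneg (by positivity) _
  have hw1 : ∀ x : EuclideanSpace ℝ (Fin n), (1 + ε * ‖x‖ ^ 2) ^ (-(n : ℝ)) ≤ 1 := fun x =>
    rpow_le_one_of_one_le_of_nonpos (by nlinarith [sq_nonneg ‖x‖]) (by simp)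
  have hlim := tendsto_integral_mul_weight (l := 𝓝[>] (0 : ℝ)) (B := B' + B)
    (g := fun t x => |defect n β α T h u t x - (u0 x - Uself n β α T h x 0)|)
    (Eventually.of_forall fun t x => abs_nonneg _)
    (S.eventually_mem.mono fun t ht x => (abs_sub _ _).trans (add_le_add (hb' t ht x) (hb x)))
    (S.eventually_mem.mono fun t ht => ((S.continuous_defect ht).aestronglyMeasurable.sub
      S.integrable.aestronglyMeasurable).norm) hw hw0 hw1
    (S.eventually_mem.mono fun t ht R => (((S.continuous_defect ht).locallyIntegrable.integrableOn_isCompact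
      (isCompact_closedBall _ _)).sub S.integrable.integrableOn).abs)
    fun R => S.init_compact (isCompact_closedBall _ _)
  filter_upwards [hlim.eventually (gt_mem_nhds (sub_pos.2 hZ)), S.eventually_mem] with t h1 ht
  have i1 : Integrable fun x => |defect n β α T h u t x - (u0 x - Uself n β α T h x 0)| *
      (1 + ε * ‖x‖ ^ 2) ^ (-(n : ℝ)) :=
    hw.bdd_mul (c := B' + B) ((S.continuous_defect ht).aestronglyMeasurable.sub
      S.integrable.aestronglyMeasurable).norm (Eventually.of_forall fun x => by
        rw [Real.norm_eq_abs, abs_abs]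
        exact (abs_sub _ _).trans (add_le_add (hb' t ht x) (hb x)))
  have i2 : Integrable fun x => |defect n β α T h u t x| * (1 + ε * ‖x‖ ^ 2) ^ (-(n : ℝ)) :=
    hw.bdd_mul (c := B') (S.continuous_defect ht).abs.aestronglyMeasurable
      (Eventually.of_forall fun x => by rw [Real.norm_eq_abs, abs_abs]; exact hb' t ht x)
  have h2 := integral_mono i2 (S.integrable.abs.add i1) fun x => by
    show _ ≤ |u0 x - Uself n β α T h x 0| + _
    have e1 := mul_le_mul_of_nonneg_right (abs_add_le (u0 x - Uself n β α T h x 0)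
      (defect n β α T h u t x - (u0 x - Uself n β α T h x 0))) (hw0 x)
    rw [add_sub_cancel, add_mul] at e1
    have e2 := mul_le_of_le_one_right (abs_nonneg (u0 x - Uself n β α T h x 0)) (hw1 x)
    linarith
  rw [integral_add' S.integrable.abs i1] at h2
  linarith

end SandwichInit

theorem weight_growth_bound {N X ε Z D C : ℝ} (hN : 0 ≤ N) (hX : 0 ≤ X) (hε : 0 < ε) (hε1 : ε ≤ 1)
    (hZ : 0 ≤ Z) (hC : 0 ≤ C) (hD0 : 0 ≤ D) (hD : D ≤ C * (1 + X) * Z) :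
    Z * -(4 * N * (N + 1) * C) + D * (N * ε / (1 + ε * X) ^ 2 *
      (4 * (N + 1) * ε * X - 2 * N * (1 + ε * X))) ≤ 0 := by
  have hQ : 0 < 1 + ε * X := by positivity
  have e1 : N * ε / (1 + ε * X) ^ 2 * (4 * (N + 1) * ε * X - 2 * N * (1 + ε * X)) ≤
      4 * N * (N + 1) * ε / (1 + ε * X) := by
    rw [div_mul_eq_mul_div, div_le_div_iff₀ (by positivity) hQ]
    have : 0 ≤ N * ε * ((4 * (N + 1) + 2 * N * (1 + ε * X)) * (1 + ε * X)) := by positivity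
    nlinarith
  have e2 := mul_le_mul_of_nonneg_left e1 hD0
  have e3 : 0 ≤ 4 * N * (N + 1) * ε / (1 + ε * X) := by positivity
  have e4 := mul_le_mul_of_nonneg_right hD e3
  have e5 : C * (1 + X) * Z * (4 * N * (N + 1) * ε / (1 + ε * X)) ≤ Z * (4 * N * (N + 1) * C) := by
    rw [← mul_div_assoc, div_le_iff₀ hQ]
    have e6 : ε * (1 + X) ≤ 1 + ε * X := by linarith
    have e7 := mul_le_mul_of_nonneg_left e6 (by positivity : 0 ≤ Z * (4 * N * (N + 1) * C))
    linarith
  linarith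

theorem weight_key {Z D s θ Y κ ε σ β N m q : ℝ} (hs : 0 < s) (hθ : 0 ≤ θ) (hY : 0 ≤ Y)
    (hε : 0 < ε) (hZ : 0 ≤ Z) (h0 : Z = 0 → D = 0)
    (hw : ∀ A, m ≤ A * q → 0 ≤ σ * (ε + θ * Y) - 2 * β * κ * (θ * Y) +
      A * κ * ((2 * N - 4 * κ - 4) * (θ * Y) + 2 * N * ε) / (ε + θ * Y))
    (hm : m * Z ≤ D * (s * θ * q)) :
    Z * (-(σ / s) - κ * (-(2 * β * θ / s)) * Y / (ε + θ * Y)) +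
      D * (κ * θ / (ε + θ * Y) ^ 2 * (4 * (κ + 1) * θ * Y - 2 * N * (ε + θ * Y))) ≤ 0 := by
  rcases hZ.eq_or_lt with hZ0 | hZ0
  · rw [h0 hZ0.symm, ← hZ0]; simp
  have hX : 0 ≤ θ * Y := mul_nonneg hθ hY
  have hQ : 0 < ε + θ * Y := by positivity
  have h1 := hw (D * s * θ / Z) (by
    rw [div_mul_eq_mul_div, le_div_iff₀ hZ0]; linarith)
  have h2 := mul_nonneg (by positivity : 0 ≤ Z / (s * (ε + θ * Y))) h1
  have h3 : Z * (-(σ / s) - κ * (-(2 * β * θ / s)) * Y / (ε + θ * Y)) +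
      D * (κ * θ / (ε + θ * Y) ^ 2 * (4 * (κ + 1) * θ * Y - 2 * N * (ε + θ * Y))) =
      -(Z / (s * (ε + θ * Y)) * (σ * (ε + θ * Y) - 2 * β * κ * (θ * Y) +
      D * s * θ / Z * κ * ((2 * N - 4 * κ - 4) * (θ * Y) + 2 * N * ε) / (ε + θ * Y))) := by
    field_simp
    ring
  rw [h3]
  linarith

theorem EvenProfile.sq_mul_rpow_le {n : ℕ} {m β α : ℝ} {h h1 h2 : ℝ → ℝ}
    (E : EvenProfile n m β α h h1 h2) (hn : 3 ≤ n) (hm0 : 0 < m) (hm1 : m < ((n : ℝ) - 2) / n)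
    (hα : α * (1 - m) = 2 * β + 1) (hC1 : CondC1 n m β) (hβ : β ≤ beta1 n m) {r : ℝ} (hr : 0 ≤ r) :
    r ^ 2 * h r ^ (1 - m) ≤ Cstar n m := by
  have hm1' := lt_one_of_exponent hn hm1
  have hD := exponent_pos hn hm1
  rcases hC1 with hc | ⟨hn4, -, hm4, hb, -⟩
  · exact absurd hc (not_lt.2 hβ)
  obtain ⟨e1, e2⟩ := barrier_exponent hm1' hm4 hn4 hD ((le_max_left _ _).trans_lt hb)
  refine (E.barrier (by omega) hm0 hm1' hD hα (γ := A0 n m β / (2 * (1 - m))) ?_ e1 e2 hr).le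
  rw [mul_div_cancel₀]
  have : 0 < 1 - m := by linarith
  positivity

namespace SandwichInit

variable {n : ℕ} {m β α T : ℝ} {h h1 h2 lo up : ℝ → ℝ} {u : EuclideanSpace ℝ (Fin n) → ℝ → ℝ}
  {u0 : EuclideanSpace ℝ (Fin n) → ℝ}

theorem weighted_le (S : SandwichInit n m β α T h h1 h2 lo up u u0) {t : ℝ} (ht : t ∈ Ioo 0 T) :
    ∃ C, ∀ ε, 0 < ε → ε ≤ 1 →
      ∫ x, |defect n β α T h u t x| * (1 + ε * ‖x‖ ^ 2) ^ (-(n : ℝ)) ≤ C := by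
  obtain ⟨T', htT', hT'⟩ := exists_between ht.2
  obtain ⟨C1, hC1, hd⟩ := S.defectPow_bound hT'
  obtain ⟨B, hB, hb⟩ := S.defect_bounded
  obtain ⟨C, hC⟩ : ∃ C, C = 4 * (n : ℝ) * (n + 1) * C1 := ⟨_, rfl⟩
  have hC0 : 0 ≤ C := by rw [hC]; positivity
  obtain ⟨Z, hZ⟩ : ∃ Z, Z = (∫ x, |u0 x - Uself n β α T h x 0|) + 1 := ⟨_, rfl⟩
  have hI : ∀ t ∈ Ioo 0 T', t ∈ Ioo 0 T := fun t ht => ⟨ht.1, ht.2.trans hT'⟩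
  refine ⟨exp (C * t) * Z, fun ε hε hε1 => ?_⟩
  have hw := integrable_weight (by have := S.hn; omega : 1 ≤ n) hε
  have hInt : ∀ t ∈ Ioo 0 T, Integrable fun x =>
      |defect n β α T h u t x| * (1 + ε * ‖x‖ ^ 2) ^ (-(n : ℝ)) := fun t ht =>
    hw.bdd_mul (c := B) (S.continuous_defect ht).abs.aestronglyMeasurable
      (Eventually.of_forall fun x => by rw [Real.norm_eq_abs, abs_abs]; exact hb t ht x)
  have e2 : ∀ᶠ t1 in 𝓝[>] (0 : ℝ), t1 ∈ Ioo 0 t := Ioo_mem_nhdsGT ht.1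
  obtain ⟨t1, h1, h2⟩ := ((S.eventually_weighted_le hε (Z := Z) (by linarith)).and e2).exists
  have key := S.contraction hT' (A := fun t => exp (-C * t)) (A' := fun t => exp (-C * t) * -C)
    (θ := fun _ => ε) (θ' := fun _ => 0) (κ := n) (ε := 1)
    (M := B * ∫ x : EuclideanSpace ℝ (Fin n), (1 + ε * ‖x‖ ^ 2) ^ (-(n : ℝ))) (by positivity) one_pos
    (fun t _ => by simpa using ((hasDerivAt_id t).const_mul (-C)).exp)
    (by fun_prop) (fun t _ => exp_pos _) (fun t _ => hasDerivAt_const t ε) continuousOn_const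
    (fun _ _ => hε) ?_ ?_ ?_ (t1 := t1) (t2 := t) ⟨h2.1, h2.2.trans htT'⟩ ⟨ht.1, htT'⟩ h2.2.le
  · simp only [mul_left_comm _ (exp _), integral_const_mul] at key
    have h3 : exp (-C * t1) ≤ 1 := exp_le_one_iff.2 (by nlinarith [h2.1])
    have h4 : 0 ≤ ∫ x, |defect n β α T h u t1 x| * (1 + ε * ‖x‖ ^ 2) ^ (-(n : ℝ)) :=
      integral_nonneg fun x => mul_nonneg (abs_nonneg _) (rpow_nonneg (by positivity) _)
    have h5 := key.trans ((mul_le_of_le_one_left h4 h3).trans h1)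
    have h6 := mul_le_mul_of_nonneg_left h5 (exp_pos (C * t)).le
    rwa [← mul_assoc, ← exp_add, show C * t + -C * t = 0 by ring, exp_zero, one_mul] at h6
  · intro t ht x
    have h3 := weight_growth_bound (N := n) (X := ‖x‖ ^ 2) (by positivity) (by positivity) hε hε1
      (abs_nonneg (defect n β α T h u t x)) hC1 (abs_nonneg _) (hd t ht x)
    rw [← hC] at h3
    rwa [mul_div_cancel_left₀ _ (exp_pos _).ne', mul_zero, zero_mul, zero_div, sub_zero]
  · intro t ht
    exact ((hInt t (hI t ht)).const_mul (exp (-C * t))).congr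
      (Eventually.of_forall fun x => by simp only []; ring)
  · intro t ht
    rw [← integral_const_mul]
    refine integral_mono_of_nonneg (Eventually.of_forall fun x => ?_) (hw.const_mul B)
      (Eventually.of_forall fun x => ?_)
    · exact mul_nonneg (abs_nonneg _) (mul_nonneg (exp_pos _).le (rpow_nonneg (by positivity) _))
    · have h3 : exp (-C * t) ≤ 1 := exp_le_one_iff.2 (by nlinarith [ht.1])
      have h4 : 0 ≤ (1 + ε * ‖x‖ ^ 2) ^ (-(n : ℝ)) := rpow_nonneg (by positivity) _
      exact mul_le_mul (hb t (hI t ht) x) (mul_le_of_le_one_left h4 h3)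
        (mul_nonneg (exp_pos _).le h4) hB

theorem integrable_defect (S : SandwichInit n m β α T h h1 h2 lo up u u0) {t : ℝ}
    (ht : t ∈ Ioo 0 T) : Integrable (defect n β α T h u t) := by
  obtain ⟨C, hC⟩ := S.weighted_le ht
  obtain ⟨B, hB, hb⟩ := S.defect_bounded
  have hcov : AECover (volume : Measure (EuclideanSpace ℝ (Fin n))) atTop
      fun R : ℝ => Metric.closedBall 0 R := aecover_closedBall tendsto_id
  refine hcov.integrable_of_integral_norm_bounded (2 ^ (n : ℝ) * C) (fun R =>
    (S.continuous_defect ht).locallyIntegrable.integrableOn_isCompact (isCompact_closedBall _ _)) ?_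
  filter_upwards [eventually_ge_atTop 1] with R hR
  have hR0 : 0 < R := by linarith
  have hε : 0 < (R ^ 2)⁻¹ := by positivity
  have h1 := hC (R ^ 2)⁻¹ hε (inv_le_one_of_one_le₀ (one_le_pow₀ hR))
  have hInt : Integrable fun x =>
      |defect n β α T h u t x| * (1 + (R ^ 2)⁻¹ * ‖x‖ ^ 2) ^ (-(n : ℝ)) :=
    (integrable_weight (by have := S.hn; omega : 1 ≤ n) hε).bdd_mul (c := B)
      (S.continuous_defect ht).abs.aestronglyMeasurable
      (Eventually.of_forall fun x => by rw [Real.norm_eq_abs, abs_abs]; exact hb t ht x)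
  have h2 : ∫ x in Metric.closedBall 0 R, ‖defect n β α T h u t x‖ ≤ ∫ x in Metric.closedBall 0 R,
      2 ^ (n : ℝ) * (|defect n β α T h u t x| * (1 + (R ^ 2)⁻¹ * ‖x‖ ^ 2) ^ (-(n : ℝ))) := by
    refine setIntegral_mono_on ((S.continuous_defect ht).norm.locallyIntegrable.integrableOn_isCompact
      (isCompact_closedBall _ _)) (hInt.const_mul _).integrableOn
      Metric.isClosed_closedBall.measurableSet fun x hx => ?_
    rw [mem_closedBall_zero_iff] at hx
    have h3 : 1 + (R ^ 2)⁻¹ * ‖x‖ ^ 2 ≤ 2 := by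
      have : (R ^ 2)⁻¹ * ‖x‖ ^ 2 ≤ 1 := by
        rw [← div_eq_inv_mul, div_le_one (by positivity)]
        exact pow_le_pow_left₀ (norm_nonneg _) hx 2
      linarith
    have h4 : 0 < 1 + (R ^ 2)⁻¹ * ‖x‖ ^ 2 := by positivity
    have h5 : (1 + (R ^ 2)⁻¹ * ‖x‖ ^ 2) ^ (n : ℝ) ≤ 2 ^ (n : ℝ) :=
      rpow_le_rpow h4.le h3 (by positivity)
    have h6 : 1 ≤ 2 ^ (n : ℝ) * (1 + (R ^ 2)⁻¹ * ‖x‖ ^ 2) ^ (-(n : ℝ)) := by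
      rw [rpow_neg h4.le, ← div_eq_mul_inv, le_div_iff₀ (rpow_pos_of_pos h4 _), one_mul]
      exact h5
    have h7 := mul_le_mul_of_nonneg_left h6 (abs_nonneg (defect n β α T h u t x))
    rw [Real.norm_eq_abs]
    linarith
  refine h2.trans ?_
  rw [integral_const_mul]
  refine mul_le_mul_of_nonneg_left (le_trans ?_ h1) (by positivity)
  exact setIntegral_le_integral hInt (Eventually.of_forall fun x =>
    mul_nonneg (abs_nonneg _) (rpow_nonneg (by positivity) _))

end SandwichInit

namespace SandwichInit

variable {n : ℕ} {m β α T : ℝ} {h h1 h2 lo up : ℝ → ℝ} {u : EuclideanSpace ℝ (Fin n) → ℝ → ℝ}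
  {u0 : EuclideanSpace ℝ (Fin n) → ℝ}

theorem defect_lower (S : SandwichInit n m β α T h h1 h2 lo up u u0) (hC1 : CondC1 n m β) :
    ∃ C, 0 < C ∧ ∀ t ∈ Ioo 0 T, ∀ x, ∃ q, 0 < q ∧ q ≤ C ∧
      (β ≤ beta1 n m → (T - t) ^ (2 * β) * ‖x‖ ^ 2 * q ≤ Cstar n m) ∧
      m * |defect n β α T h u t x| ≤
        |defectPow n m β α T h u t x| * ((T - t) * (T - t) ^ (2 * β) * q) := by
  obtain ⟨g1, g2, G⟩ := S.profUp
  obtain ⟨c, C, hc, hb⟩ := S.prof.bounds S.cstar_pos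
  obtain ⟨c', C', hc', hb'⟩ := G.bounds S.cstar_pos
  have hm1 := S.lt_one
  have hle : ∀ {H H1 H2 : ℝ → ℝ} (_ : EvenProfile n m β α H H1 H2) {C ρ : ℝ},
      (1 + ρ ^ 2) * H ρ ^ (1 - m) ≤ C → H ρ ^ (1 - m) ≤ C := fun E C ρ h => by
    have h3 := rpow_nonneg (E.pos ρ).le (1 - m)
    have h4 := mul_nonneg (sq_nonneg ρ) h3
    linarith
  refine ⟨max C C', lt_max_of_lt_left (hc.trans_le ((hb 0 le_rfl).1.trans (hb 0 le_rfl).2)),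
    fun t ht x => ?_⟩
  have hs : 0 < T - t := by linarith [ht.2]
  have hρ : 0 ≤ (T - t) ^ β * ‖x‖ := mul_nonneg (rpow_nonneg hs.le _) (norm_nonneg _)
  have hρ2 : (T - t) ^ (2 * β) * ‖x‖ ^ 2 = ((T - t) ^ β * ‖x‖) ^ 2 := by
    rw [mul_pow, mul_comm 2 β, rpow_mul hs.le, rpow_two]
  have hq := (rpow_sub_bounds S.hm0 hm1 (S.pos x t ht) (S.prof.uself_pos ht.2 x)).2.1
    ((T - t) ^ (2 * β + 1) * max (h ((T - t) ^ β * ‖x‖) ^ (1 - m)) (up ((T - t) ^ β * ‖x‖) ^ (1 - m)))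
    ((rpow_le_rpow (S.pos x t ht).le (S.sand x t ht).2 (by linarith)).trans (by
      rw [uself_rpow G S.hα ht.2]
      exact mul_le_mul_of_nonneg_left (le_max_right _ _) (rpow_nonneg hs.le _)))
    (by
      rw [uself_rpow S.prof S.hα ht.2]
      exact mul_le_mul_of_nonneg_left (le_max_left _ _) (rpow_nonneg hs.le _))
  rw [rpow_add_one hs.ne', mul_comm ((T - t) ^ (2 * β))] at hq
  refine ⟨_, lt_max_of_lt_left (rpow_pos_of_pos (S.prof.pos _) _),
    max_le_max (hle S.prof (hb _ hρ).2) (hle G (hb' _ hρ).2), fun hβ => ?_, hq⟩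
  rw [hρ2, mul_max_of_nonneg _ _ (sq_nonneg _)]
  exact max_le (S.prof.sq_mul_rpow_le S.hn S.hm0 S.hm1 S.hα hC1 hβ hρ)
    (G.sq_mul_rpow_le S.hn S.hm0 S.hm1 S.hα hC1 hβ hρ)

theorem weighted_decay (S : SandwichInit n m β α T h h1 h2 lo up u u0) (hC1 : CondC1 n m β)
    (hcontr : ∀ t ∈ Ioo 0 T, (∫ x, |defect n β α T h u t x|) ≤
      ∫ x, |u0 x - Uself n β α T h x 0|) :
    ∃ κ ε δ C : ℝ, 0 ≤ κ ∧ 0 < ε ∧ 0 < δ ∧ ∀ t ∈ Ico (T / 2) T, ∫ x, |defect n β α T h u t x| *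
      ((T - t) ^ (n * β - α - δ) * (ε + (T - t) ^ (2 * β) * ‖x‖ ^ 2) ^ (-κ)) ≤ C := by
  have hm1 := S.lt_one
  have hT := S.hT
  obtain ⟨C, hC, hlow⟩ := S.defect_lower hC1
  obtain ⟨κ, ε, δ, hκ, -, hε, hδ, hw⟩ := exists_weight_real S.hn S.hm0 S.hm1
    (by rw [eq_div_iff (by linarith), S.hα]) hC1 hC
  obtain ⟨σ, hσ⟩ : ∃ σ, σ = n * β - α - δ := ⟨_, rfl⟩
  obtain ⟨Z, hZ⟩ : ∃ Z, Z = ∫ x, |u0 x - Uself n β α T h x 0| := ⟨_, rfl⟩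
  rw [← hσ] at hw
  rw [← hZ] at hcontr
  have hwt : ∀ t ∈ Ioo 0 T, ∀ x : EuclideanSpace ℝ (Fin n),
      0 ≤ (T - t) ^ σ * (ε + (T - t) ^ (2 * β) * ‖x‖ ^ 2) ^ (-κ) ∧
      (T - t) ^ σ * (ε + (T - t) ^ (2 * β) * ‖x‖ ^ 2) ^ (-κ) ≤ (T - t) ^ σ * ε ^ (-κ) := by
    intro t ht x
    have hs : 0 < T - t := by linarith [ht.2]
    have h0 : 0 ≤ (T - t) ^ (2 * β) * ‖x‖ ^ 2 := mul_nonneg (rpow_nonneg hs.le _) (sq_nonneg _)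
    exact ⟨mul_nonneg (rpow_nonneg hs.le _) (rpow_nonneg (by linarith) _),
      mul_le_mul_of_nonneg_left (rpow_le_rpow_of_nonpos hε (by linarith) (by linarith))
        (rpow_nonneg hs.le _)⟩
  have hbd : ∀ t ∈ Ioo 0 T, ∫ x, |defect n β α T h u t x| *
      ((T - t) ^ σ * (ε + (T - t) ^ (2 * β) * ‖x‖ ^ 2) ^ (-κ)) ≤ (T - t) ^ σ * ε ^ (-κ) * Z := by
    intro t ht
    have hs : 0 < T - t := by linarith [ht.2]
    have h0 : 0 ≤ (T - t) ^ σ * ε ^ (-κ) := mul_nonneg (rpow_nonneg hs.le _) (rpow_nonneg hε.le _)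
    refine le_trans ?_ (mul_le_mul_of_nonneg_left (hcontr t ht) h0)
    rw [← integral_const_mul]
    refine integral_mono_of_nonneg (Eventually.of_forall fun x => mul_nonneg (abs_nonneg _)
      (hwt t ht x).1) ((S.integrable_defect ht).abs.const_mul _) (Eventually.of_forall fun x => ?_)
    simp only []
    rw [mul_comm]
    exact mul_le_mul_of_nonneg_right (hwt t ht x).2 (abs_nonneg _)
  refine ⟨κ, ε, δ, (T - T / 2) ^ σ * ε ^ (-κ) * Z, hκ, hε, hδ, fun t ht => ?_⟩
  rw [← hσ]
  obtain ⟨T', htT', hT'⟩ := exists_between ht.2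
  have hI : ∀ t ∈ Ioo 0 T', t ∈ Ioo 0 T := fun t ht => ⟨ht.1, ht.2.trans hT'⟩
  have hs : ∀ t ∈ Ioo 0 T', 0 < T - t := fun t ht => by linarith [ht.2]
  have hder : ∀ γ : ℝ, ∀ t ∈ Ioo 0 T', HasDerivAt (fun t => (T - t) ^ γ)
      (-(γ * ((T - t) ^ γ / (T - t)))) t := fun γ t ht => by
    refine (((hasDerivAt_id t).const_sub T).rpow_const (p := γ) (Or.inl (hs t ht).ne')).congr_deriv ?_
    rw [id, rpow_sub_one (hs t ht).ne']
    ring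
  have hcont : ∀ γ : ℝ, ContinuousOn (fun t => -(γ * ((T - t) ^ γ / (T - t)))) (Ioo 0 T') := fun γ =>
    ((continuousOn_const.mul (((continuousOn_const.sub continuousOn_id).rpow_const
      fun t ht => Or.inl (hs t ht).ne').div (continuousOn_const.sub continuousOn_id)
      fun t ht => (hs t ht).ne')).neg)
  have hM0 : ∀ t ∈ Ioo 0 T', (T - t) ^ σ ≤ T ^ σ + (T - T') ^ σ := fun t ht => by
    have p1 : 0 < T - T' := by linarith
    rcases le_total 0 σ with h0 | h0
    · have := rpow_le_rpow (hs t ht).le (by linarith [ht.1] : T - t ≤ T) h0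
      have := rpow_nonneg p1.le σ
      linarith
    · have := rpow_le_rpow_of_nonpos p1 (by linarith [ht.2] : T - T' ≤ T - t) h0
      have := rpow_nonneg hT.le σ
      linarith
  refine (S.contraction hT' (A := fun t => (T - t) ^ σ) (A' := fun t => -(σ * ((T - t) ^ σ / (T - t))))
    (θ := fun t => (T - t) ^ (2 * β)) (θ' := fun t => -(2 * β * ((T - t) ^ (2 * β) / (T - t))))
    (M := (T ^ σ + (T - T') ^ σ) * ε ^ (-κ) * Z)
    hκ hε (hder σ) (hcont σ) (fun t ht => rpow_pos_of_pos (hs t ht) _) (hder (2 * β)) (hcont (2 * β))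
    (fun t ht => rpow_pos_of_pos (hs t ht) _) ?_ ?_ ?_ (t1 := T / 2) (t2 := t)
    ⟨by linarith, by linarith [ht.1]⟩ ⟨by linarith [ht.1], htT'⟩ ht.1).trans
    (hbd (T / 2) ⟨by linarith, by linarith⟩)
  · intro t ht x
    obtain ⟨q, hq0, hqC, hqb, hqm⟩ := hlow t (hI t ht) x
    have hA0 := rpow_pos_of_pos (hs t ht) σ
    have hθ0 := rpow_pos_of_pos (hs t ht) (2 * β)
    have key := weight_key (Z := |defect n β α T h u t x|) (D := |defectPow n m β α T h u t x|)
      (N := n) (σ := σ) (β := β) (Y := ‖x‖ ^ 2) (hs t ht) hθ0.le (sq_nonneg _) hε (abs_nonneg _) ?_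
      (fun A hA => hw _ q A (mul_nonneg hθ0.le (sq_nonneg _)) hq0 hqC hqb hA) hqm
    · have e1 : -(σ * ((T - t) ^ σ / (T - t))) / (T - t) ^ σ = -(σ / (T - t)) := by
        have := (hs t ht).ne'
        field_simp
      rw [e1, ← mul_div_assoc (2 * β)]
      exact key
    · intro h0
      rw [abs_eq_zero, defect, sub_eq_zero] at h0
      rw [defectPow, h0, sub_self, abs_zero]
  · intro t ht
    refine ((S.integrable_defect (hI t ht)).abs.mul_const ((T - t) ^ σ * ε ^ (-κ))).mono'
      ((S.continuous_defect (hI t ht)).abs.mul (continuous_const.mul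
        (Continuous.rpow_const (by fun_prop) fun x => Or.inl ?_))).aestronglyMeasurable
      (Eventually.of_forall fun x => ?_)
    · have := rpow_pos_of_pos (hs t ht) (2 * β)
      positivity
    · rw [norm_of_nonneg (mul_nonneg (abs_nonneg _) (hwt t (hI t ht) x).1)]
      exact mul_le_mul_of_nonneg_left (hwt t (hI t ht) x).2 (abs_nonneg _)
  · intro t ht
    refine (hbd t (hI t ht)).trans ?_
    have hZ0 : 0 ≤ Z := by rw [hZ]; exact integral_nonneg fun x => abs_nonneg _
    exact mul_le_mul_of_nonneg_right (mul_le_mul_of_nonneg_right (hM0 t ht) (rpow_nonneg hε.le _)) hZ0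

theorem decay (S : SandwichInit n m β α T h h1 h2 lo up u u0) (hC1 : CondC1 n m β)
    (hcontr : ∀ t ∈ Ioo 0 T, (∫ x, |defect n β α T h u t x|) ≤
      ∫ x, |u0 x - Uself n β α T h x 0|) :
    ∃ δ : ℝ, 0 < δ ∧ ∀ R : ℝ, ∃ C : ℝ, 0 ≤ C ∧ ∀ s ∈ Ioc 0 (T / 2),
      ∫ y in Metric.closedBall (0 : EuclideanSpace ℝ (Fin n)) R,
        |s ^ (-α) * u (s ^ (-β) • y) (T - s) - h ‖y‖| ≤ C * s ^ δ := by
  obtain ⟨κ, ε, δ, C, hκ, hε, hδ, hd⟩ := S.weighted_decay hC1 hcontr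
  refine ⟨δ, hδ, fun R => ⟨(ε + R ^ 2) ^ κ * |C|, by positivity, fun s hs => ?_⟩⟩
  have hs0 : 0 < s := hs.1
  have hsT : s < T := by linarith [hs.2, S.hT]
  have ht : T - s ∈ Ioo 0 T := ⟨by linarith, by linarith⟩
  have key := hd (T - s) ⟨by linarith [hs.2], by linarith⟩
  rw [show T - (T - s) = s by ring] at key
  obtain ⟨F, hF⟩ : ∃ F : EuclideanSpace ℝ (Fin n) → ℝ, F = fun x => |defect n β α T h u (T - s) x| *
    (s ^ (n * β - α - δ) * (ε + s ^ (2 * β) * ‖x‖ ^ 2) ^ (-κ)) := ⟨_, rfl⟩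
  have hF0 : ∀ x, 0 ≤ F x := fun x => by
    rw [hF]
    have : 0 < ε + s ^ (2 * β) * ‖x‖ ^ 2 := by positivity
    positivity
  have hFi : Integrable F := by
    rw [hF]
    refine ((S.integrable_defect ht).abs.mul_const (s ^ (n * β - α - δ) * ε ^ (-κ))).mono'
      ((S.continuous_defect ht).abs.mul (continuous_const.mul
        (Continuous.rpow_const (by fun_prop) fun x => Or.inl ?_))).aestronglyMeasurable
      (Eventually.of_forall fun x => ?_)
    · positivity
    · have h0 : 0 ≤ s ^ (2 * β) * ‖x‖ ^ 2 := by positivity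
      rw [norm_of_nonneg (by positivity)]
      exact mul_le_mul_of_nonneg_left (mul_le_mul_of_nonneg_left
        (rpow_le_rpow_of_nonpos hε (by linarith) (by linarith)) (by positivity)) (abs_nonneg _)
  have hsβ : 0 < s ^ (-β) := rpow_pos_of_pos hs0 _
  have hcv := Measure.integral_comp_smul_of_nonneg (μ := (volume : Measure (EuclideanSpace ℝ (Fin n))))
    F (s ^ (-β)) (hR := hsβ.le)
  rw [finrank_euclideanSpace, Fintype.card_fin, smul_eq_mul] at hcv
  have hFs : Integrable fun y => F (s ^ (-β) • y) := hFi.comp_smul hsβ.ne'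
  have hFy : ∀ y, F (s ^ (-β) • y) = s ^ α * s ^ (n * β - α - δ) *
      (|s ^ (-α) * u (s ^ (-β) • y) (T - s) - h ‖y‖| * (ε + ‖y‖ ^ 2) ^ (-κ)) := by
    intro y
    have e1 : s ^ β * (s ^ (-β) * ‖y‖) = ‖y‖ := by
      rw [← mul_assoc, ← rpow_add hs0, add_neg_cancel, rpow_zero, one_mul]
    have e2 : s ^ (2 * β) * (s ^ (-β) * ‖y‖) ^ 2 = ‖y‖ ^ 2 := by
      rw [mul_comm 2 β, rpow_mul hs0.le, rpow_two, ← mul_pow, e1]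
    simp only [hF, defect, Uself, norm_smul, Real.norm_eq_abs, abs_of_pos hsβ]
    rw [show T - (T - s) = s by ring, e1, e2]
    have e3 : u (s ^ (-β) • y) (T - s) - s ^ α * h ‖y‖ =
        s ^ α * (s ^ (-α) * u (s ^ (-β) • y) (T - s) - h ‖y‖) := by
      rw [mul_sub, ← mul_assoc, ← rpow_add hs0, add_neg_cancel, rpow_zero, one_mul]
    rw [e3, abs_mul, abs_of_pos (rpow_pos_of_pos hs0 α)]
    ring
  have h1 : ∫ y in Metric.closedBall (0 : EuclideanSpace ℝ (Fin n)) R,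
      |s ^ (-α) * u (s ^ (-β) • y) (T - s) - h ‖y‖| ≤
      ∫ y in Metric.closedBall (0 : EuclideanSpace ℝ (Fin n)) R,
        (ε + R ^ 2) ^ κ * (s ^ α * s ^ (n * β - α - δ))⁻¹ * F (s ^ (-β) • y) := by
    refine integral_mono_of_nonneg (Eventually.of_forall fun y => abs_nonneg _)
      (hFs.const_mul _).integrableOn ?_
    filter_upwards [ae_restrict_mem Metric.isClosed_closedBall.measurableSet] with y hy
    rw [mem_closedBall_zero_iff] at hy
    have e0 : 0 < s ^ α * s ^ (n * β - α - δ) := by positivity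
    have e1 : 0 < ε + ‖y‖ ^ 2 := by positivity
    have e2 : 1 ≤ (ε + R ^ 2) ^ κ * (ε + ‖y‖ ^ 2) ^ (-κ) := by
      rw [rpow_neg e1.le, ← div_eq_mul_inv, le_div_iff₀ (rpow_pos_of_pos e1 _), one_mul]
      refine rpow_le_rpow e1.le ?_ hκ
      have := pow_le_pow_left₀ (norm_nonneg _) hy 2
      linarith
    rw [hFy, mul_assoc _ _⁻¹, ← mul_assoc _⁻¹, inv_mul_cancel₀ e0.ne', one_mul]
    have e3 := mul_le_mul_of_nonneg_left e2 (abs_nonneg (s ^ (-α) * u (s ^ (-β) • y) (T - s) - h ‖y‖))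
    linarith
  refine h1.trans ?_
  rw [integral_const_mul]
  have h2 : ∫ y in Metric.closedBall (0 : EuclideanSpace ℝ (Fin n)) R, F (s ^ (-β) • y) ≤
      s ^ (n * β) * |C| := by
    refine (setIntegral_le_integral hFs (Eventually.of_forall fun y => hF0 _)).trans ?_
    rw [hcv]
    have e4 : ((s ^ (-β)) ^ n)⁻¹ = s ^ (n * β) := by
      rw [rpow_neg hs0.le, inv_pow, inv_inv, ← rpow_natCast, ← rpow_mul hs0.le, mul_comm β]
    rw [e4]
    refine mul_le_mul_of_nonneg_left ?_ (by positivity)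
    rw [hF]
    exact key.trans (le_abs_self C)
  refine (mul_le_mul_of_nonneg_left h2 (by positivity)).trans_eq ?_
  rw [← rpow_add hs0, ← rpow_neg hs0.le]
  have e5 : s ^ (-(α + (n * β - α - δ))) * s ^ (n * β) = s ^ δ := by
    rw [← rpow_add hs0]
    congr 1
    ring
  rw [← e5]
  ring

end SandwichInit

/-- Space-time. -/
abbrev SpaceTime (n : ℕ) : Type := EuclideanSpace ℝ (Fin n) × ℝ

/-- Spatial coordinate directions in space-time. -/
noncomputable def ex {n : ℕ} (i : Fin n) : SpaceTime n := (EuclideanSpace.single i (1 : ℝ), 0)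

/-- The time direction in space-time. -/
noncomputable def et (n : ℕ) : SpaceTime n := (0, 1)

section MeanValue

theorem hasDerivAt_posPart_cube (x : ℝ) :
    HasDerivAt (fun t : ℝ => (max t 0) ^ 3) (3 * (max x 0) ^ 2) x := by
  rcases lt_trichotomy x 0 with hx | hx | hx
  · have h : (fun t : ℝ => (max t 0) ^ 3) =ᶠ[𝓝 x] fun _ => 0 := by
      filter_upwards [gt_mem_nhds hx] with t ht
      rw [max_eq_right ht.le]; norm_num
    rw [max_eq_right hx.le]
    simpa using (hasDerivAt_const x (0 : ℝ)).congr_of_eventuallyEq h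
  · subst hx
    rw [hasDerivAt_iff_isLittleO_nhds_zero]
    have h : (fun t : ℝ => t ^ 3) =o[𝓝 0] fun t => t := by
      simpa using Asymptotics.isLittleO_pow_pow (𝕜 := ℝ) (m := 1) (n := 3) (by norm_num)
    refine (Asymptotics.IsBigO.of_bound 1 (Eventually.of_forall fun t => ?_)).trans_isLittleO h
    simp only [zero_add, max_self]
    rcases le_total t 0 with ht | ht
    · rw [max_eq_right ht]; norm_num
    · rw [max_eq_left ht]; norm_num
  · have h : (fun t : ℝ => (max t 0) ^ 3) =ᶠ[𝓝 x] fun t => t ^ 3 := by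
      filter_upwards [lt_mem_nhds hx] with t ht
      rw [max_eq_left (le_of_lt ht)]
    rw [max_eq_left hx.le]
    simpa using (hasDerivAt_pow 3 x).congr_of_eventuallyEq h

theorem contDiff_posPart_cube : ContDiff ℝ 1 fun t : ℝ => (max t 0) ^ 3 := by
  rw [contDiff_one_iff_deriv]
  refine ⟨fun x => (hasDerivAt_posPart_cube x).differentiableAt, ?_⟩
  have : deriv (fun t : ℝ => (max t 0) ^ 3) = fun x => 3 * (max x 0) ^ 2 :=
    funext fun x => (hasDerivAt_posPart_cube x).deriv
  rw [this]
  fun_prop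

variable {n : ℕ}

/-- A compactly supported radial bump. -/
noncomputable def bump (ξ : EuclideanSpace ℝ (Fin n)) : ℝ := (max (1 - ‖ξ‖ ^ 2) 0) ^ 3

/-- The averaging kernel with `∇ bump = - ξ * kernel`. -/
noncomputable def kernel (ξ : EuclideanSpace ℝ (Fin n)) : ℝ := 6 * (max (1 - ‖ξ‖ ^ 2) 0) ^ 2

theorem kernel_nonneg (ξ : EuclideanSpace ℝ (Fin n)) : 0 ≤ kernel ξ := by unfold kernel; positivity

theorem kernel_le (ξ : EuclideanSpace ℝ (Fin n)) : kernel ξ ≤ 6 := by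
  unfold kernel
  have h0 : 0 ≤ max (1 - ‖ξ‖ ^ 2) 0 := le_max_right _ _
  have h1 : max (1 - ‖ξ‖ ^ 2) 0 ≤ 1 := max_le (by nlinarith [sq_nonneg ‖ξ‖]) zero_le_one
  nlinarith

theorem continuous_kernel : Continuous (kernel (n := n)) := by unfold kernel; fun_prop

theorem posPart_off {ξ : EuclideanSpace ℝ (Fin n)} (h : 1 ≤ ‖ξ‖) : max (1 - ‖ξ‖ ^ 2) 0 = 0 :=
  max_eq_right (by nlinarith)

theorem kernel_off {ξ : EuclideanSpace ℝ (Fin n)} (h : 1 ≤ ‖ξ‖) : kernel ξ = 0 := by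
  simp [kernel, posPart_off h]

theorem bump_off {ξ : EuclideanSpace ℝ (Fin n)} (h : 1 ≤ ‖ξ‖) : bump ξ = 0 := by
  simp [bump, posPart_off h]

theorem contDiff_bump : ContDiff ℝ 1 (bump (n := n)) := by
  have h : ContDiff ℝ 1 fun ξ : EuclideanSpace ℝ (Fin n) => 1 - ‖ξ‖ ^ 2 :=
    contDiff_const.sub (contDiff_norm_sq ℝ)
  exact contDiff_posPart_cube.comp h

theorem integral_kernel_pos : 0 < ∫ ξ : EuclideanSpace ℝ (Fin n), kernel ξ := by
  refine continuous_kernel.integral_pos_of_hasCompactSupport_nonneg_nonzero (x := 0) ?_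
    kernel_nonneg ?_
  · exact HasCompactSupport.intro (isCompact_closedBall 0 1) fun ξ hξ => kernel_off (by
      rw [mem_closedBall_zero_iff] at hξ; exact (not_le.1 hξ).le)
  · simp [kernel]

theorem dir_bump (i : Fin n) (ξ : EuclideanSpace ℝ (Fin n)) :
    dir (EuclideanSpace.single i (1 : ℝ)) bump ξ = -(ξ i * kernel ξ) := by
  have h := dir_comp_apply (φ := fun ξ : EuclideanSpace ℝ (Fin n) => ‖ξ‖ ^ 2) (p := ξ)
    (G := fun t => (max (1 - t) 0) ^ 3) (G' := -(3 * (max (1 - ‖ξ‖ ^ 2) 0) ^ 2))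
    (((hasDerivAt_posPart_cube (1 - ‖ξ‖ ^ 2)).comp (‖ξ‖ ^ 2)
      ((hasDerivAt_id (‖ξ‖ ^ 2)).const_sub 1)).congr_deriv (by ring))
    ((contDiff_norm_sq ℝ (n := 1)).differentiable (by simp) ξ) (EuclideanSpace.single i (1 : ℝ))
  have h' : bump (n := n) = fun ξ => (max (1 - ‖ξ‖ ^ 2) 0) ^ 3 := rfl
  rw [h', h, dir_single_norm_sq]
  unfold kernel
  ring

theorem isAddHaarMeasure_spaceTime : (volume : Measure (SpaceTime n)).IsAddHaarMeasure := by
  rw [Measure.volume_eq_prod]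
  infer_instance

theorem integral_dir_mul_spaceTime {A B : SpaceTime n → ℝ} (hA : ContDiff ℝ 1 A)
    (hB : ContDiff ℝ 1 B) (hBc : HasCompactSupport B) (v : SpaceTime n) :
    ∫ x, A x * dir v B x = -∫ x, dir v A x * B x := by
  have := isAddHaarMeasure_spaceTime (n := n)
  have hc : ∀ {F : SpaceTime n → ℝ}, ContDiff ℝ 1 F → Continuous (dir v F) := fun hF =>
    (ContDiff.dir (k := 0) (by simpa using hF) v).continuous
  refine integral_mul_fderiv_eq_neg_fderiv_mul_of_integrable ?_ ?_ ?_
    (fun x _ => hA.differentiable (by simp) x) (fun x _ => hB.differentiable (by simp) x)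
  · exact ((hc hA).mul hB.continuous).integrable_of_hasCompactSupport hBc.mul_left
  · exact (hA.continuous.mul (hc hB)).integrable_of_hasCompactSupport
      (hBc.fderiv_apply ℝ v).mul_left
  · exact (hA.continuous.mul hB.continuous).integrable_of_hasCompactSupport hBc.mul_left

/-- Spatial dilation of space-time. -/
noncomputable def dilate (n : ℕ) (r : ℝ) (p : SpaceTime n) : SpaceTime n := (r • p.1, p.2)

theorem contDiff_dilate (r : ℝ) {k : WithTop ℕ∞} : ContDiff ℝ k (dilate n r) :=
  (contDiff_fst.const_smul r).prodMk contDiff_snd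

theorem dir_dilate {A : SpaceTime n → ℝ} (hA : ContDiff ℝ 1 A) (r : ℝ) (p v : SpaceTime n) :
    dir v (fun q => A (dilate n r q)) p = fderiv ℝ A (dilate n r p) (r • v.1, v.2) := by
  have h1 : HasFDerivAt (dilate n r)
      ((r • ContinuousLinearMap.fst ℝ (EuclideanSpace ℝ (Fin n)) ℝ).prod
        (ContinuousLinearMap.snd ℝ (EuclideanSpace ℝ (Fin n)) ℝ)) p :=
    (hasFDerivAt_fst.const_smul r).prodMk hasFDerivAt_snd
  have h2 := ((hA.differentiable (by simp) (dilate n r p)).hasFDerivAt).comp p h1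
  unfold dir
  rw [show (fun q => A (dilate n r q)) = A ∘ dilate n r from rfl, h2.fderiv]
  simp

theorem dir_dilate_ex {A : SpaceTime n → ℝ} (hA : ContDiff ℝ 1 A) (r : ℝ) (p : SpaceTime n)
    (i : Fin n) : dir (ex i) (fun q => A (dilate n r q)) p = r * dir (ex i) A (dilate n r p) := by
  rw [dir_dilate hA, dir, ← smul_eq_mul, ← map_smul]
  simp [ex]

theorem dir_dilate_et {A : SpaceTime n → ℝ} (hA : ContDiff ℝ 1 A) (r : ℝ) (p : SpaceTime n) :
    dir (et n) (fun q => A (dilate n r q)) p = dir (et n) A (dilate n r p) := by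
  rw [dir_dilate hA, dir]
  simp [et]

theorem hasDerivAt_dilate {A : SpaceTime n → ℝ} (hA : ContDiff ℝ 1 A) (r : ℝ) (p : SpaceTime n) :
    HasDerivAt (fun r => A (dilate n r p)) (∑ i, p.1 i * dir (ex i) A (dilate n r p)) r := by
  have h1 : HasDerivAt (fun r => dilate n r p) (p.1, 0) r := by
    have h := ((hasDerivAt_id r).smul_const p.1).prodMk (hasDerivAt_const r p.2)
    rw [one_smul] at h
    exact h
  have h2 := ((hA.differentiable (by simp) (dilate n r p)).hasFDerivAt).comp_hasDerivAt r h1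
  refine h2.congr_deriv ?_
  have h3 : ((p.1, 0) : SpaceTime n) = ∑ i, p.1 i • ex i := by
    refine Prod.ext ?_ ?_
    · rw [Prod.fst_sum]
      simp only [ex, Prod.smul_fst]
      ext j
      simp [Finset.sum_apply, Pi.single_apply]
    · rw [Prod.snd_sum]
      simp [ex]
  rw [h3, map_sum]
  simp [dir]

end MeanValue

section MeanValue

variable {n : ℕ}

/-- The space-time test function `bump(ξ) χ(s)`. -/
noncomputable def bumpTime (χ : ℝ → ℝ) (p : SpaceTime n) : ℝ := bump p.1 * χ p.2

theorem contDiff_bumpTime {χ : ℝ → ℝ} (hχ : ContDiff ℝ 1 χ) : ContDiff ℝ 1 (bumpTime (n := n) χ) :=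
  (contDiff_bump.comp contDiff_fst).mul (hχ.comp contDiff_snd)

theorem dir_bumpTime {χ : ℝ → ℝ} (hχ : ContDiff ℝ 1 χ) (p v : SpaceTime n) :
    dir v (bumpTime χ) p = bump p.1 * (v.2 * deriv χ p.2) + χ p.2 * dir v.1 bump p.1 := by
  have h1 : HasFDerivAt (fun p : SpaceTime n => bump p.1)
      ((fderiv ℝ bump p.1).comp (ContinuousLinearMap.fst ℝ (EuclideanSpace ℝ (Fin n)) ℝ)) p :=
    (contDiff_bump.differentiable (by simp) p.1).hasFDerivAt.comp p hasFDerivAt_fst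
  have h2 : HasFDerivAt (fun p : SpaceTime n => χ p.2)
      (deriv χ p.2 • ContinuousLinearMap.snd ℝ (EuclideanSpace ℝ (Fin n)) ℝ) p :=
    (hχ.differentiable (by simp) p.2).hasDerivAt.comp_hasFDerivAt p hasFDerivAt_snd
  have h3 := dir_mul_apply h1.differentiableAt h2.differentiableAt v
  unfold bumpTime
  rw [h3, dir, dir, h1.fderiv, h2.fderiv]
  simp [dir, mul_comm]

theorem dir_bumpTime_ex {χ : ℝ → ℝ} (hχ : ContDiff ℝ 1 χ) (p : SpaceTime n) (i : Fin n) :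
    dir (ex i) (bumpTime χ) p = -(p.1 i * kernel p.1 * χ p.2) := by
  rw [dir_bumpTime hχ]
  simp only [ex, dir_bump]
  ring

theorem dir_bumpTime_et {χ : ℝ → ℝ} (hχ : ContDiff ℝ 1 χ) (p : SpaceTime n) :
    dir (et n) (bumpTime χ) p = bump p.1 * deriv χ p.2 := by
  rw [dir_bumpTime hχ]
  simp [et, dir]

/-- The parabolic cylinder. -/
def cyl (n : ℕ) (r δ : ℝ) : Set (SpaceTime n) :=
  Metric.closedBall 0 r ×ˢ Metric.closedBall 0 δ

theorem isCompact_cyl (r δ : ℝ) : IsCompact (cyl n r δ) :=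
  (isCompact_closedBall _ _).prod (isCompact_closedBall _ _)

theorem off_cyl {χ : ℝ → ℝ} {δ : ℝ} (h0 : ∀ s, s ∉ Metric.closedBall (0 : ℝ) δ → χ s = 0)
    {g : EuclideanSpace ℝ (Fin n) → ℝ} (hg : ∀ ξ, 1 ≤ ‖ξ‖ → g ξ = 0) (p : SpaceTime n)
    (hp : p ∉ cyl n 1 δ) : g p.1 * χ p.2 = 0 := by
  by_cases h1 : p.2 ∈ Metric.closedBall (0 : ℝ) δ
  · have h2 : p.1 ∉ Metric.closedBall (0 : EuclideanSpace ℝ (Fin n)) 1 := fun h => hp ⟨h, h1⟩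
    rw [mem_closedBall_zero_iff, not_le] at h2
    rw [hg _ h2.le, zero_mul]
  · rw [h0 _ h1, mul_zero]

/-- Weighted space-time averages. -/
noncomputable def bumpAverage (χ : ℝ → ℝ) (V : SpaceTime n → ℝ) (r : ℝ) : ℝ :=
  ∫ p : SpaceTime n, kernel p.1 * χ p.2 * V (dilate n r p)

theorem hasDerivAt_bumpAverage {V w : SpaceTime n → ℝ} (hV : ContDiff ℝ 2 V) (hw : ContDiff ℝ 1 w)
    {χ : ℝ → ℝ} (hχ : ContDiff ℝ 1 χ) {δ r0 r : ℝ}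
    (h0 : ∀ s, s ∉ Metric.closedBall (0 : ℝ) δ → χ s = 0)
    (hpde : ∀ p ∈ cyl n r0 δ, ∑ i, dir (ex i) (dir (ex i) V) p = dir (et n) w p)
    (hr : 0 ≤ r) (hr0 : r ≤ r0) :
    HasDerivAt (bumpAverage χ V) (-(r * ∫ p : SpaceTime n, w (dilate n r p) *
      (bump p.1 * deriv χ p.2))) r := by
  have hV1 : ∀ i, ContDiff ℝ 1 (dir (ex i) V) := fun i =>
    ContDiff.dir (k := 1) (by rwa [show (1 : WithTop ℕ∞) + 1 = 2 by norm_num]) _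
  have hV01 : ContDiff ℝ 1 V := hV.of_le (by norm_num)
  have hPc : HasCompactSupport (bumpTime (n := n) χ) :=
    HasCompactSupport.intro (isCompact_cyl 1 δ) (off_cyl h0 fun ξ => bump_off)
  have hχc := hχ.continuous
  have hkc := continuous_kernel (n := n)
  have hdc : Continuous fun q : ℝ × SpaceTime n => dilate n q.1 q.2 := by
    unfold dilate; fun_prop
  have key := hasDerivAt_integral_compact (μ := (volume : Measure (SpaceTime n))) isOpen_univ
    (f := fun r p => kernel p.1 * χ p.2 * V (dilate n r p))
    (f' := fun r p => kernel p.1 * χ p.2 * ∑ i, p.1 i * dir (ex i) V (dilate n r p))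
    (by
      refine Continuous.continuousOn ?_
      have h1 := hV.continuous.comp hdc
      simp only [Function.uncurry_def]
      exact (by fun_prop : Continuous fun q : ℝ × SpaceTime n =>
        kernel q.2.1 * χ q.2.2).mul h1)
    (by
      refine Continuous.continuousOn ?_
      simp only [Function.uncurry_def]
      refine (by fun_prop : Continuous fun q : ℝ × SpaceTime n =>
        kernel q.2.1 * χ q.2.2).mul (continuous_finsetSum _ fun i _ => ?_)
      exact (by fun_prop : Continuous fun q : ℝ × SpaceTime n => q.2.1 i).mul
        ((hV1 i).continuous.comp hdc))
    (fun t _ p => (hasDerivAt_dilate hV01 t p).const_mul _) (isCompact_cyl 1 δ)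
    (fun t p _ hp => by rw [off_cyl h0 (fun ξ => kernel_off) p hp, zero_mul])
    (fun t p _ hp => by rw [off_cyl h0 (fun ξ => kernel_off) p hp, zero_mul]) (mem_univ r)
  refine key.congr_deriv ?_
  have hP := contDiff_bumpTime (n := n) hχ
  have hdr : ContDiff ℝ 1 (dilate n r) := contDiff_dilate r
  have hPcont : Continuous (bumpTime (n := n) χ) := hP.continuous
  have e1 : ∀ i, ∫ p : SpaceTime n, kernel p.1 * χ p.2 * (p.1 i * dir (ex i) V (dilate n r p)) =
      ∫ p : SpaceTime n, r * dir (ex i) (dir (ex i) V) (dilate n r p) * bumpTime χ p := fun i => by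
    have h := integral_dir_mul_spaceTime ((hV1 i).comp hdr) hP hPc (ex i)
    have e2 : (fun p : SpaceTime n => kernel p.1 * χ p.2 * (p.1 i * dir (ex i) V (dilate n r p))) =
        fun p => -((dir (ex i) V ∘ dilate n r) p * dir (ex i) (bumpTime χ) p) := by
      funext p
      rw [dir_bumpTime_ex hχ]
      simp only [Function.comp]
      ring
    rw [e2, integral_neg, h, neg_neg]
    refine integral_congr_ae (Eventually.of_forall fun p => ?_)
    simp only [Function.comp_def]
    rw [dir_dilate_ex (hV1 i)]
  have hV2 : ∀ i, Continuous (dir (ex i) (dir (ex i) V)) := fun i =>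
    (ContDiff.dir (k := 0) (by simpa using hV1 i) _).continuous
  have e3 : ∫ p : SpaceTime n, kernel p.1 * χ p.2 * ∑ i, p.1 i * dir (ex i) V (dilate n r p) =
      ∑ i, ∫ p : SpaceTime n, kernel p.1 * χ p.2 * (p.1 i * dir (ex i) V (dilate n r p)) := by
    simp only [Finset.mul_sum]
    refine integral_finsetSum _ fun i _ => ?_
    refine Continuous.integrable_of_zero_off ?_ (isCompact_cyl 1 δ) fun p hp => by
      rw [off_cyl h0 (fun ξ => kernel_off) p hp, zero_mul]
    exact (by fun_prop : Continuous fun q : SpaceTime n => kernel q.1 * χ q.2).mul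
      ((by fun_prop : Continuous fun q : SpaceTime n => q.1 i).mul
        ((hV1 i).continuous.comp hdr.continuous))
  have e4 : ∑ i, ∫ p : SpaceTime n, r * dir (ex i) (dir (ex i) V) (dilate n r p) * bumpTime χ p =
      ∫ p : SpaceTime n, r * (dir (et n) w (dilate n r p) * bumpTime χ p) := by
    rw [← integral_finsetSum]
    · refine integral_congr_ae (Eventually.of_forall fun p => ?_)
      by_cases hp : p ∈ cyl n 1 δ
      · have hq : dilate n r p ∈ cyl n r0 δ := by
          refine ⟨?_, hp.2⟩
          have := mem_closedBall_zero_iff.1 hp.1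
          rw [dilate, mem_closedBall_zero_iff, norm_smul, Real.norm_eq_abs, abs_of_nonneg hr]
          nlinarith [norm_nonneg p.1]
        simp only
        rw [← hpde _ hq, ← Finset.sum_mul, ← Finset.mul_sum]
        ring
      · have : bumpTime χ p = 0 := off_cyl h0 (fun ξ => bump_off) p hp
        simp [this]
    · intro i _
      exact ((continuous_const.mul ((hV2 i).comp hdr.continuous)).mul
        hPcont).integrable_of_hasCompactSupport hPc.mul_left
  have e5 := integral_dir_mul_spaceTime (hw.comp hdr) hP hPc (et n)
  rw [e3, Finset.sum_congr rfl fun i _ => e1 i, e4, integral_const_mul, ← mul_neg]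
  congr 1
  simp only [dir_bumpTime_et hχ, Function.comp_def] at e5
  rw [e5, neg_neg]
  refine integral_congr_ae (Eventually.of_forall fun p => ?_)
  simp only
  rw [dir_dilate_et hw]

theorem bumpAverage_sub_le {V w : SpaceTime n → ℝ} (hV : ContDiff ℝ 2 V) (hw : ContDiff ℝ 1 w)
    {χ : ℝ → ℝ} (hχ : ContDiff ℝ 1 χ) {δ r0 c : ℝ} (hr0 : 0 ≤ r0)
    (h0 : ∀ s, s ∉ Metric.closedBall (0 : ℝ) δ → χ s = 0)
    (hpde : ∀ p ∈ cyl n r0 δ, ∑ i, dir (ex i) (dir (ex i) V) p = dir (et n) w p)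
    (hc : ∀ p ∈ cyl n r0 δ, |w p| ≤ c) :
    |bumpAverage χ V r0 - bumpAverage χ V 0| ≤
      r0 ^ 2 * (c * ∫ p : SpaceTime n, |bump p.1 * deriv χ p.2|) := by
  have h0' : ∀ s, s ∉ Metric.closedBall (0 : ℝ) δ → deriv χ s = 0 := fun s hs => by
    have : χ =ᶠ[𝓝 s] fun _ => 0 := by
      filter_upwards [Metric.isClosed_closedBall.isOpen_compl.mem_nhds hs] with t ht using h0 t ht
    rw [this.deriv_eq, deriv_const]
  have hcont : Continuous fun p : SpaceTime n => bump p.1 * deriv χ p.2 :=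
    (contDiff_bump.continuous.comp continuous_fst).mul
      ((hχ.continuous_deriv le_rfl).comp continuous_snd)
  have hInt : Integrable fun p : SpaceTime n => |bump p.1 * deriv χ p.2| :=
    (Continuous.integrable_of_zero_off hcont (isCompact_cyl 1 δ)
      (off_cyl h0' fun ξ => bump_off)).abs
  obtain ⟨D, hD⟩ : ∃ D, D = c * ∫ p : SpaceTime n, |bump p.1 * deriv χ p.2| := ⟨_, rfl⟩
  have hb : ∀ r ∈ Icc 0 r0, ‖-(r * ∫ p : SpaceTime n, w (dilate n r p) *
      (bump p.1 * deriv χ p.2))‖ ≤ r0 * D := fun r hr => by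
    rw [norm_neg, norm_mul, Real.norm_eq_abs, abs_of_nonneg hr.1]
    refine mul_le_mul hr.2 ?_ (norm_nonneg _) hr0
    rw [hD, ← integral_const_mul]
    refine norm_integral_le_of_norm_le (hInt.const_mul c) (Eventually.of_forall fun p => ?_)
    rw [norm_mul, Real.norm_eq_abs, Real.norm_eq_abs]
    by_cases hp : p ∈ cyl n 1 δ
    · have hq : dilate n r p ∈ cyl n r0 δ := by
        refine ⟨?_, hp.2⟩
        have := mem_closedBall_zero_iff.1 hp.1
        have h1 := hr.1
        have h2 := hr.2
        rw [dilate, mem_closedBall_zero_iff, norm_smul, Real.norm_eq_abs, abs_of_nonneg hr.1]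
        nlinarith [norm_nonneg p.1]
      exact mul_le_mul_of_nonneg_right (hc _ hq) (abs_nonneg _)
    · rw [off_cyl h0' (fun ξ => bump_off) p hp]
      simp
  have := Convex.norm_image_sub_le_of_norm_hasDerivWithin_le (f := bumpAverage χ V)
    (fun r hr => (hasDerivAt_bumpAverage hV hw hχ h0 hpde hr.1 hr.2).hasDerivWithinAt) hb
    (convex_Icc 0 r0) (left_mem_Icc.2 hr0) (right_mem_Icc.2 hr0)
  rw [Real.norm_eq_abs, Real.norm_eq_abs, sub_zero, abs_of_nonneg hr0] at this
  rw [← hD]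
  linarith

end MeanValue

section PointwiseControl

variable {n : ℕ}

theorem bumpAverage_zero (χ : ℝ → ℝ) (V : SpaceTime n → ℝ) :
    bumpAverage χ V 0 = (∫ ξ : EuclideanSpace ℝ (Fin n), kernel ξ) * ∫ s, χ s * V (0, s) := by
  rw [bumpAverage, ← integral_prod_mul, ← Measure.volume_eq_prod]
  refine integral_congr_ae (Eventually.of_forall fun p => ?_)
  simp [dilate, mul_assoc]

theorem bumpAverage_sub_const_le {V : SpaceTime n → ℝ} (hV : Continuous V) {χ : ℝ → ℝ}
    (hχ : Continuous χ) (hχ0 : ∀ s, 0 ≤ χ s) (hχ1 : ∫ s, χ s = 1) {δ r G κ : ℝ}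
    (h0 : ∀ s, s ∉ Metric.closedBall (0 : ℝ) δ → χ s = 0)
    (hκ : ∀ s ∈ Metric.closedBall (0 : ℝ) δ,
      ∫ ξ in Metric.closedBall (0 : EuclideanSpace ℝ (Fin n)) 1, |V (r • ξ, s) - G| ≤ κ) :
    |bumpAverage χ V r - (∫ ξ : EuclideanSpace ℝ (Fin n), kernel ξ) * G| ≤ 6 * κ := by
  have hkc := continuous_kernel (n := n)
  have hχi : Integrable χ := hχ.integrable_of_zero_off (isCompact_closedBall 0 δ) h0
  have hki : Integrable (kernel (n := n)) := hkc.integrable_of_zero_off (isCompact_closedBall 0 1)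
    fun ξ hξ => kernel_off (by rw [mem_closedBall_zero_iff] at hξ; exact (not_le.1 hξ).le)
  have hVd : Continuous fun p : SpaceTime n => V (dilate n r p) :=
    hV.comp (contDiff_dilate (k := 0) r).continuous
  have hkχ : Continuous fun p : SpaceTime n => kernel p.1 * χ p.2 := by fun_prop
  have e1 : (∫ ξ : EuclideanSpace ℝ (Fin n), kernel ξ) * G =
      ∫ p : SpaceTime n, kernel p.1 * χ p.2 * G := by
    rw [integral_mul_const, Measure.volume_eq_prod, integral_prod_mul, hχ1, mul_one]
  have i1 : Integrable fun p : SpaceTime n => kernel p.1 * χ p.2 * V (dilate n r p) :=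
    (hkχ.mul hVd).integrable_of_zero_off (isCompact_cyl 1 δ) fun p hp =>
      mul_eq_zero_of_left (off_cyl h0 (fun ξ => kernel_off) p hp) _
  have i2 : Integrable fun p : SpaceTime n => kernel p.1 * χ p.2 * G :=
    (hkχ.mul continuous_const).integrable_of_zero_off (isCompact_cyl 1 δ) fun p hp =>
      mul_eq_zero_of_left (off_cyl h0 (fun ξ => kernel_off) p hp) _
  have i3 : Integrable fun p : SpaceTime n => kernel p.1 * χ p.2 * |V (dilate n r p) - G| :=
    (hkχ.mul (hVd.sub continuous_const).abs).integrable_of_zero_off (isCompact_cyl 1 δ)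
      fun p hp => mul_eq_zero_of_left (off_cyl h0 (fun ξ => kernel_off) p hp) _
  rw [e1, bumpAverage, ← integral_sub i1 i2]
  calc |∫ p : SpaceTime n, (kernel p.1 * χ p.2 * V (dilate n r p) - kernel p.1 * χ p.2 * G)|
      ≤ ∫ p : SpaceTime n, kernel p.1 * χ p.2 * |V (dilate n r p) - G| := by
        rw [← Real.norm_eq_abs]
        refine norm_integral_le_of_norm_le i3 (Eventually.of_forall fun p => ?_)
        rw [← mul_sub, norm_mul, Real.norm_eq_abs, Real.norm_eq_abs,
          abs_of_nonneg (mul_nonneg (kernel_nonneg _) (hχ0 _))]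
    _ = ∫ s, ∫ ξ, kernel ξ * χ s * |V (r • ξ, s) - G| := by
        rw [Measure.volume_eq_prod] at i3 ⊢
        exact integral_prod_symm _ i3
    _ ≤ ∫ s, χ s * (6 * κ) := by
        refine integral_mono_of_nonneg (Eventually.of_forall fun s => integral_nonneg fun ξ => ?_)
          (hχi.mul_const _) (Eventually.of_forall fun s => ?_)
        · exact mul_nonneg (mul_nonneg (kernel_nonneg _) (hχ0 _)) (abs_nonneg _)
        · simp only
          by_cases hs : s ∈ Metric.closedBall (0 : ℝ) δ
          · have e2 : ∫ ξ : EuclideanSpace ℝ (Fin n), kernel ξ * χ s * |V (r • ξ, s) - G| =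
                χ s * ∫ ξ : EuclideanSpace ℝ (Fin n), kernel ξ * |V (r • ξ, s) - G| := by
              rw [← integral_const_mul]
              exact integral_congr_ae (Eventually.of_forall fun ξ => by simp only; ring)
            have hc : Continuous fun ξ : EuclideanSpace ℝ (Fin n) => |V (r • ξ, s) - G| :=
              ((hV.comp (by fun_prop : Continuous fun ξ : EuclideanSpace ℝ (Fin n) =>
                (r • ξ, s))).sub continuous_const).abs
            rw [e2]
            refine mul_le_mul_of_nonneg_left ?_ (hχ0 s)
            have e3 : ∫ ξ : EuclideanSpace ℝ (Fin n), kernel ξ * |V (r • ξ, s) - G| =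
                ∫ ξ in Metric.closedBall (0 : EuclideanSpace ℝ (Fin n)) 1,
                  kernel ξ * |V (r • ξ, s) - G| := by
              refine (setIntegral_eq_integral_of_forall_compl_eq_zero fun ξ hξ => ?_).symm
              rw [mem_closedBall_zero_iff, not_le] at hξ
              rw [kernel_off hξ.le, zero_mul]
            rw [e3]
            refine le_trans ?_ (mul_le_mul_of_nonneg_left (hκ s hs) (by norm_num))
            rw [← integral_const_mul]
            refine integral_mono_of_nonneg (Eventually.of_forall fun ξ =>
              mul_nonneg (kernel_nonneg _) (abs_nonneg _)) ?_ (Eventually.of_forall fun ξ =>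
              mul_le_mul_of_nonneg_right (kernel_le ξ) (abs_nonneg _))
            exact (continuous_const.mul hc).continuousOn.integrableOn_compact
              (isCompact_closedBall _ _)
          · simp [h0 s hs]
    _ = 6 * κ := by rw [integral_mul_const, hχ1, one_mul]

theorem time_average_close {V w : SpaceTime n → ℝ} (hV : ContDiff ℝ 2 V) (hw : ContDiff ℝ 1 w)
    {χ : ℝ → ℝ} (hχ : ContDiff ℝ 1 χ) (hχ0 : ∀ s, 0 ≤ χ s) (hχ1 : ∫ s, χ s = 1)
    {δ r c G κ : ℝ} (hr : 0 ≤ r)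
    (h0 : ∀ s, s ∉ Metric.closedBall (0 : ℝ) δ → χ s = 0)
    (hpde : ∀ p ∈ cyl n r δ, ∑ i, dir (ex i) (dir (ex i) V) p = dir (et n) w p)
    (hc : ∀ p ∈ cyl n r δ, |w p| ≤ c)
    (hκ : ∀ s ∈ Metric.closedBall (0 : ℝ) δ,
      ∫ ξ in Metric.closedBall (0 : EuclideanSpace ℝ (Fin n)) 1, |V (r • ξ, s) - G| ≤ κ) :
    |(∫ s, χ s * V (0, s)) - G| ≤
      (r ^ 2 * (c * ∫ p : SpaceTime n, |bump p.1 * deriv χ p.2|) + 6 * κ) /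
        ∫ ξ : EuclideanSpace ℝ (Fin n), kernel ξ := by
  have h1 := bumpAverage_sub_le hV hw hχ hr h0 hpde hc
  have h2 := bumpAverage_sub_const_le hV.continuous hχ.continuous hχ0 hχ1 h0 hκ
  have h3 := integral_kernel_pos (n := n)
  rw [bumpAverage_zero] at h1
  rw [le_div_iff₀ h3]
  rw [← abs_of_pos h3, ← abs_mul]
  have h4 := abs_le.1 h1
  have h5 := abs_le.1 h2
  refine abs_le.2 ⟨?_, ?_⟩ <;> nlinarith

theorem exists_time_bump {a δ : ℝ} (hδ : 0 < δ) : ∃ χ : ℝ → ℝ, ContDiff ℝ 1 χ ∧ (∀ s, 0 ≤ χ s) ∧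
    ∫ s, χ s = 1 ∧ ∀ s, s ∉ Ioo (a - δ) (a + δ) → χ s = 0 := by
  let b : ContDiffBump a := ⟨δ / 2, δ, by positivity, by linarith⟩
  refine ⟨b.normed volume, b.contDiff_normed, b.nonneg_normed, b.integral_normed, fun s hs => ?_⟩
  have := b.support_normed_eq (μ := volume)
  rw [Real.ball_eq_Ioo] at this
  exact Function.notMem_support.1 (by rw [this]; exact hs)

end PointwiseControl

section PointwiseControl

/-- A smooth positive function solving the equation, with two-sided bounds and a one-sided bound
on its logarithmic time derivative, on a cylinder. -/
structure LocalSol (n : ℕ) (m c0 c1 K ρ : ℝ) (w : SpaceTime n → ℝ) : Prop where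
  smooth : ContDiff ℝ (⊤ : ℕ∞) w
  pos : ∀ p, 0 < w p
  lower : ∀ p ∈ cyl n ρ ρ, c0 ≤ w p
  upper : ∀ p ∈ cyl n ρ ρ, w p ≤ c1
  pde : ∀ p ∈ cyl n ρ ρ,
    dir (et n) w p = ∑ i, dir (ex i) (dir (ex i) fun q => w q ^ m) p
  growth : ∀ p ∈ cyl n ρ ρ, dir (et n) w p ≤ K * w p

variable {n : ℕ} {m c0 c1 K ρ : ℝ} {w : SpaceTime n → ℝ}

theorem cyl_mono {r δ r' δ' : ℝ} (hr : r ≤ r') (hδ : δ ≤ δ') : cyl n r δ ⊆ cyl n r' δ' :=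
  prod_mono (Metric.closedBall_subset_closedBall hr) (Metric.closedBall_subset_closedBall hδ)

theorem LocalSol.exp_growth (S : LocalSol n m c0 c1 K ρ w) (hρ : 0 ≤ ρ) {s t : ℝ}
    (hs : -ρ ≤ s) (hst : s ≤ t) (ht : t ≤ ρ) : w (0, t) ≤ exp (K * (t - s)) * w (0, s) := by
  have hd : ∀ t : ℝ, HasDerivAt (fun t => w (0, t)) (dir (et n) w (0, t)) t := fun t =>
    ((S.smooth.differentiable (by simp) (0, t)).hasFDerivAt).comp_hasDerivAt t
      (f := fun t => ((0 : EuclideanSpace ℝ (Fin n)), t))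
      ((hasDerivAt_const t _).prodMk (hasDerivAt_id t))
  have hg : ∀ t : ℝ, HasDerivAt (fun t => exp (-(K * t)) * w (0, t))
      (exp (-(K * t)) * (dir (et n) w (0, t) - K * w (0, t))) t := fun t =>
    ((((hasDerivAt_id t).const_mul K).neg.exp).mul (hd t)).congr_deriv (by simp; ring)
  have hanti : AntitoneOn (fun t => exp (-(K * t)) * w (0, t)) (Icc (-ρ) ρ) := by
    refine antitoneOn_of_deriv_nonpos (convex_Icc _ _)
      (fun t _ => (hg t).continuousAt.continuousWithinAt)
      (fun t _ => (hg t).differentiableAt.differentiableWithinAt) fun t ht => ?_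
    rw [interior_Icc] at ht
    rw [(hg t).deriv]
    refine mul_nonpos_of_nonneg_of_nonpos (exp_pos _).le ?_
    have hmem : ((0 : EuclideanSpace ℝ (Fin n)), t) ∈ cyl n ρ ρ :=
      ⟨Metric.mem_closedBall_self hρ, mem_closedBall_zero_iff.2 (abs_le.2 ⟨ht.1.le, ht.2.le⟩)⟩
    linarith [S.growth _ hmem]
  have h := hanti ⟨hs, hst.trans ht⟩ ⟨hs.trans hst, ht⟩ hst
  simp only at h
  have h2 := mul_le_mul_of_nonneg_left h (exp_pos (K * t)).le
  rw [← mul_assoc, ← mul_assoc, ← exp_add, ← exp_add, add_neg_cancel, exp_zero, one_mul] at h2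
  rwa [mul_sub, sub_eq_add_neg]

theorem rpow_exp_growth {a b x : ℝ} (hm0 : 0 < m) (hm1 : m < 1) (ha : 0 < a) (hb : 0 < b)
    (hx : 0 ≤ x) (h : a ≤ exp x * b) : a ^ m ≤ exp x * b ^ m := by
  have h1 := rpow_le_rpow ha.le h hm0.le
  rw [mul_rpow (exp_pos x).le hb.le] at h1
  refine h1.trans (mul_le_mul_of_nonneg_right ?_ (rpow_nonneg hb.le m))
  rw [← exp_mul]
  exact exp_le_exp.2 (by nlinarith)

theorem LocalSol.contDiff_rpow (S : LocalSol n m c0 c1 K ρ w) (q : ℝ) :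
    ContDiff ℝ (⊤ : ℕ∞) fun p => w p ^ q :=
  S.smooth.rpow_const_of_ne fun p => (S.pos p).ne'

theorem integral_bump_mul {χ g : ℝ → ℝ} (hχ : Continuous χ) (hg : Continuous g) {a δ : ℝ}
    (h0 : ∀ s, s ∉ Ioo (a - δ) (a + δ) → χ s = 0) : Integrable fun s => χ s * g s :=
  (hχ.mul hg).integrable_of_zero_off (isCompact_Icc (a := a - δ) (b := a + δ))
    fun s hs => mul_eq_zero_of_left (h0 s fun h => hs (Ioo_subset_Icc_self h)) _

set_option maxHeartbeats 400000 in
theorem exists_pointwise_close (n : ℕ) (hm0 : 0 < m) (hm1 : m < 1) (hc0 : 0 < c0) (hc01 : c0 ≤ c1)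
    (hK : 0 ≤ K) {η : ℝ} (hη : 0 < η) : ∃ κ > 0, ∀ ρ > 0, ∃ r ∈ Ioc 0 ρ, ∃ δ ∈ Ioc 0 ρ,
    ∀ (w : SpaceTime n → ℝ) (F0 : ℝ), LocalSol n m c0 c1 K ρ w → c0 ≤ F0 → F0 ≤ c1 →
      (∀ s ∈ Metric.closedBall (0 : ℝ) δ,
        ∫ ξ in Metric.closedBall (0 : EuclideanSpace ℝ (Fin n)) 1, |w (r • ξ, s) - F0| ≤ κ) →
      |w 0 - F0| ≤ η := by
  have hc := integral_kernel_pos (n := n)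
  obtain ⟨c, hcd⟩ : ∃ c, c = ∫ ξ : EuclideanSpace ℝ (Fin n), kernel ξ := ⟨_, rfl⟩
  rw [← hcd] at hc
  have hc1 : 0 < c1 := hc0.trans_le hc01
  have hQ0 : 0 < c0 ^ (1 - m) := rpow_pos_of_pos hc0 _
  have hQ1 : 0 < c1 ^ (1 - m) := rpow_pos_of_pos hc1 _
  have hM : 0 < c1 ^ m := rpow_pos_of_pos hc1 _
  obtain ⟨η', hη'd⟩ : ∃ η', η' = m * η / c1 ^ (1 - m) := ⟨_, rfl⟩
  have hη' : 0 < η' := by rw [hη'd]; positivity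
  refine ⟨η' * c * c0 ^ (1 - m) / (48 * m), by positivity, fun ρ hρ => ?_⟩
  have hcont : Tendsto (fun δ : ℝ => exp (K * δ)) (𝓝[>] 0) (𝓝 1) := by
    have : Continuous fun δ : ℝ => exp (K * δ) := by fun_prop
    have := this.tendsto 0
    rw [mul_zero, exp_zero] at this
    exact this.mono_left nhdsWithin_le_nhds
  have hE1 : (1 : ℝ) < 1 + min 1 (η' / (4 * c1 ^ m)) := by
    have : 0 < min 1 (η' / (4 * c1 ^ m)) := by positivity
    linarith
  obtain ⟨δ, hEδ, hδ⟩ := ((hcont.eventually (gt_mem_nhds hE1)).and (Ioc_mem_nhdsGT hρ)).exists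
  obtain ⟨χ, hχ, hχ0, hχ1, hχs⟩ := exists_time_bump (a := -(δ / 2)) (half_pos hδ.1)
  obtain ⟨χ', hχ', hχ0', hχ1', hχs'⟩ := exists_time_bump (a := δ / 2) (half_pos hδ.1)
  obtain ⟨D, hD⟩ : ∃ D, D = c1 * ∫ p : SpaceTime n, |bump p.1 * deriv χ p.2| := ⟨_, rfl⟩
  obtain ⟨D', hD'⟩ : ∃ D, D = c1 * ∫ p : SpaceTime n, |bump p.1 * deriv χ' p.2| := ⟨_, rfl⟩
  have hD0 : 0 ≤ D := by rw [hD]; exact mul_nonneg hc1.le (integral_nonneg fun _ => abs_nonneg _)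
  have hD0' : 0 ≤ D' := by rw [hD']; exact mul_nonneg hc1.le (integral_nonneg fun _ => abs_nonneg _)
  obtain ⟨r, hrd⟩ : ∃ r, r = min (min ρ 1) (η' * c / (8 * (D + D' + 1))) := ⟨_, rfl⟩
  have hr0 : 0 < r := by rw [hrd]; positivity
  have hr1 : r ≤ ρ := by rw [hrd]; exact (min_le_left _ _).trans (min_le_left _ _)
  have hr2 : r ≤ 1 := by rw [hrd]; exact (min_le_left _ _).trans (min_le_right _ _)
  have hr3 : r * (8 * (D + D' + 1)) ≤ η' * c := by
    rw [← le_div_iff₀ (by positivity), hrd]; exact min_le_right _ _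
  refine ⟨r, ⟨hr0, hr1⟩, δ, hδ, fun w F0 S hF0 hF1 hInt => ?_⟩
  have hF00 : 0 < F0 := hc0.trans_le hF0
  have hmem : ∀ {ξ : EuclideanSpace ℝ (Fin n)} {s : ℝ}, ‖ξ‖ ≤ r → s ∈ Metric.closedBall (0 : ℝ) δ →
      (ξ, s) ∈ cyl n ρ ρ := fun h1 h2 => cyl_mono hr1 hδ.2 ⟨mem_closedBall_zero_iff.2 h1, h2⟩
  have hV : ContDiff ℝ 2 fun p => w p ^ m := contDiff_infty.1 (S.contDiff_rpow m) 2
  have hw : ContDiff ℝ 1 w := contDiff_infty.1 S.smooth 1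
  have hInt' : ∀ s ∈ Metric.closedBall (0 : ℝ) δ,
      ∫ ξ in Metric.closedBall (0 : EuclideanSpace ℝ (Fin n)) 1, |w (r • ξ, s) ^ m - F0 ^ m| ≤
        η' * c / 48 := fun s hs => by
    have hcw : Continuous fun ξ : EuclideanSpace ℝ (Fin n) => |w (r • ξ, s) - F0| :=
      ((hw.continuous.comp (by fun_prop : Continuous fun ξ : EuclideanSpace ℝ (Fin n) =>
        (r • ξ, s))).sub continuous_const).abs
    have hi : IntegrableOn (fun ξ : EuclideanSpace ℝ (Fin n) =>
        m / c0 ^ (1 - m) * |w (r • ξ, s) - F0|) (Metric.closedBall 0 1) :=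
      (continuous_const.mul hcw).continuousOn.integrableOn_compact (isCompact_closedBall _ _)
    have h1 : ∫ ξ in Metric.closedBall (0 : EuclideanSpace ℝ (Fin n)) 1,
        |w (r • ξ, s) ^ m - F0 ^ m| ≤ ∫ ξ in Metric.closedBall (0 : EuclideanSpace ℝ (Fin n)) 1,
          m / c0 ^ (1 - m) * |w (r • ξ, s) - F0| := by
      refine integral_mono_of_nonneg (Eventually.of_forall fun _ => abs_nonneg _) hi ?_
      filter_upwards [ae_restrict_mem Metric.isClosed_closedBall.measurableSet] with ξ hξ
      rw [mem_closedBall_zero_iff] at hξ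
      have hq : (r • ξ, s) ∈ cyl n ρ ρ := by
        refine hmem ?_ hs
        rw [norm_smul, Real.norm_eq_abs, abs_of_pos hr0]
        nlinarith
      have := (rpow_sub_bounds hm0 hm1 (S.pos (r • ξ, s)) hF00).2.2 _ hQ0.le
        (rpow_le_rpow hc0.le (S.lower _ hq) (by linarith))
        (rpow_le_rpow hc0.le hF0 (by linarith))
      rw [div_mul_eq_mul_div, le_div_iff₀ hQ0]
      exact this
    refine h1.trans ?_
    rw [integral_const_mul]
    refine (mul_le_mul_of_nonneg_left (hInt s hs) (by positivity)).trans_eq ?_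
    field_simp
  have hpde : ∀ p ∈ cyl n r δ, ∑ i, dir (ex i) (dir (ex i) fun p => w p ^ m) p =
      dir (et n) w p := fun p hp => (S.pde p (cyl_mono hr1 hδ.2 hp)).symm
  have hbd : ∀ p ∈ cyl n r δ, |w p| ≤ c1 := fun p hp => by
    rw [abs_of_pos (S.pos p)]
    exact S.upper p (cyl_mono hr1 hδ.2 hp)
  have hsub : ∀ s, s ∉ Metric.closedBall (0 : ℝ) δ → χ s = 0 := fun s hs => hχs s fun h => hs (by
    rw [mem_closedBall_zero_iff, Real.norm_eq_abs, abs_le]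
    have h1 := h.1
    have h2 := h.2
    exact ⟨by linarith, by linarith [hδ.1]⟩)
  have hsub' : ∀ s, s ∉ Metric.closedBall (0 : ℝ) δ → χ' s = 0 := fun s hs => hχs' s fun h => hs (by
    rw [mem_closedBall_zero_iff, Real.norm_eq_abs, abs_le]
    have h1 := h.1
    have h2 := h.2
    exact ⟨by linarith [hδ.1], by linarith⟩)
  have a1 := time_average_close hV hw hχ hχ0 hχ1 hr0.le hsub hpde hbd hInt'
  have a2 := time_average_close hV hw hχ' hχ0' hχ1' hr0.le hsub' hpde hbd hInt'
  rw [← hD, ← hcd] at a1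
  rw [← hD', ← hcd] at a2
  have hrr : r ^ 2 ≤ r := by nlinarith
  have b1 : (r ^ 2 * D + 6 * (η' * c / 48)) / c ≤ η' / 4 := by
    rw [div_le_iff₀ hc]
    nlinarith [mul_le_mul_of_nonneg_right hrr hD0, mul_nonneg hr0.le hD0']
  have b2 : (r ^ 2 * D' + 6 * (η' * c / 48)) / c ≤ η' / 4 := by
    rw [div_le_iff₀ hc]
    nlinarith [mul_le_mul_of_nonneg_right hrr hD0', mul_nonneg hr0.le hD0]
  have a1' := abs_le.1 (a1.trans b1)
  have a2' := abs_le.1 (a2.trans b2)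
  have hg : Continuous fun s : ℝ => w (0, s) ^ m :=
    hV.continuous.comp (by fun_prop : Continuous fun s : ℝ => ((0 : EuclideanSpace ℝ (Fin n)), s))
  have hKδ : 0 ≤ K * δ := mul_nonneg hK hδ.1.le
  have u1 : w 0 ^ m ≤ exp (K * δ) * ∫ s, χ s * w (0, s) ^ m := by
    have e1 : w 0 ^ m = ∫ s, χ s * w 0 ^ m := by rw [integral_mul_const, hχ1, one_mul]
    rw [e1, ← integral_const_mul]
    refine integral_mono (integral_bump_mul hχ.continuous continuous_const hχs)
      ((integral_bump_mul hχ.continuous hg hχs).const_mul _) fun s => ?_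
    by_cases hs : s ∈ Ioo (-(δ / 2) - δ / 2) (-(δ / 2) + δ / 2)
    · have hs1 := hs.1
      have hs2 := hs.2
      have h1 := S.exp_growth hρ.le (s := s) (t := 0) (by linarith [hδ.2]) (by linarith) hρ.le
      have h2 : exp (K * (0 - s)) ≤ exp (K * δ) :=
        exp_le_exp.2 (mul_le_mul_of_nonneg_left (by linarith) hK)
      have h3 := rpow_exp_growth hm0 hm1 (S.pos 0) (S.pos (0, s)) hKδ
        (h1.trans (mul_le_mul_of_nonneg_right h2 (S.pos _).le))
      have h4 := mul_le_mul_of_nonneg_left h3 (hχ0 s)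
      simp only
      linarith
    · simp [hχs s hs]
  have u2 : ∫ s, χ' s * w (0, s) ^ m ≤ exp (K * δ) * w 0 ^ m := by
    have e1 : exp (K * δ) * w 0 ^ m = ∫ s, χ' s * (exp (K * δ) * w 0 ^ m) := by
      rw [integral_mul_const, hχ1', one_mul]
    rw [e1]
    refine integral_mono (integral_bump_mul hχ'.continuous hg hχs')
      (integral_bump_mul hχ'.continuous continuous_const hχs') fun s => ?_
    by_cases hs : s ∈ Ioo (δ / 2 - δ / 2) (δ / 2 + δ / 2)
    · have hs1 := hs.1
      have hs2 := hs.2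
      have h1 := S.exp_growth hρ.le (s := 0) (t := s) (by linarith) (by linarith)
        (by linarith [hδ.2])
      have h2 : exp (K * (s - 0)) ≤ exp (K * δ) :=
        exp_le_exp.2 (mul_le_mul_of_nonneg_left (by linarith) hK)
      have h3 := rpow_exp_growth hm0 hm1 (S.pos (0, s)) (S.pos 0) hKδ
        (h1.trans (mul_le_mul_of_nonneg_right h2 (S.pos _).le))
      exact mul_le_mul_of_nonneg_left h3 (hχ0' s)
    · simp [hχs' s hs]
  have hz : (0 : SpaceTime n) ∈ cyl n ρ ρ := hmem (by simpa using hr0.le)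
    (Metric.mem_closedBall_self hδ.1.le)
  have hG1 : F0 ^ m ≤ c1 ^ m := rpow_le_rpow hF00.le hF1 hm0.le
  have hG2 : w 0 ^ m ≤ c1 ^ m := rpow_le_rpow (S.pos 0).le (S.upper _ hz) hm0.le
  have hG0 : 0 < F0 ^ m := rpow_pos_of_pos hF00 m
  have hE0 : 1 ≤ exp (K * δ) := one_le_exp hKδ
  have hE2 : exp (K * δ) ≤ 2 := by linarith [min_le_left 1 (η' / (4 * c1 ^ m))]
  have hE3 : (exp (K * δ) - 1) * c1 ^ m ≤ η' / 4 := by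
    have : exp (K * δ) - 1 ≤ η' / (4 * c1 ^ m) := by
      linarith [min_le_right 1 (η' / (4 * c1 ^ m))]
    refine (mul_le_mul_of_nonneg_right this hM.le).trans_eq ?_
    field_simp
  have hfin : |w 0 ^ m - F0 ^ m| ≤ η' := by
    have t1 := mul_le_mul_of_nonneg_left hG1 (sub_nonneg.2 hE0)
    have t2 := mul_le_mul_of_nonneg_left hG2 (sub_nonneg.2 hE0)
    have t3 := mul_le_mul_of_nonneg_left a1'.2 (exp_pos (K * δ)).le
    have t4 := mul_le_mul_of_nonneg_right hE2 hη'.le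
    exact abs_le.2 ⟨by linarith, by linarith⟩
  have := (rpow_sub_bounds hm0 hm1 (S.pos 0) hF00).2.1 (c1 ^ (1 - m))
    (rpow_le_rpow (S.pos 0).le (S.upper _ hz) (by linarith)) (rpow_le_rpow hF00.le hF1 (by linarith))
  have h5 := mul_le_mul_of_nonneg_right hfin hQ1.le
  have h6 : η' * c1 ^ (1 - m) = m * η := by rw [hη'd]; field_simp
  rw [h6] at h5
  exact le_of_mul_le_mul_left (this.trans h5) hm0

end PointwiseControl

section DirCalculus

variable {X : Type*} [NormedAddCommGroup X] [NormedSpace ℝ X]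

theorem ContDiff.differentiable_infty {φ : X → ℝ} (h : ContDiff ℝ (⊤ : ℕ∞) φ) :
    Differentiable ℝ φ := h.differentiable (by simp)

theorem dir_dir_apply {φ : X → ℝ} (h : ContDiff ℝ (⊤ : ℕ∞) φ) (v w p : X) :
    dir v (dir w φ) p = fderiv ℝ (fderiv ℝ φ) p v w := by
  have h1 : DifferentiableAt ℝ (fderiv ℝ φ) p :=
    (h.fderiv_right (m := (⊤ : ℕ∞)) (by simp)).differentiable (by simp) p
  have h2 := h1.hasFDerivAt.clm_apply (hasFDerivAt_const w p)
  rw [show dir v (dir w φ) p = fderiv ℝ (fun y => fderiv ℝ φ y w) p v from rfl, h2.fderiv]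
  simp

theorem dir_comm {φ : X → ℝ} (h : ContDiff ℝ (⊤ : ℕ∞) φ) (v w : X) :
    dir v (dir w φ) = dir w (dir v φ) := by
  funext p
  rw [dir_dir_apply h, dir_dir_apply h]
  exact ((contDiff_infty.1 h 2).contDiffAt.isSymmSndFDerivAt (by simp)) v w

theorem dir_mul {φ ψ : X → ℝ} (hφ : ContDiff ℝ (⊤ : ℕ∞) φ) (hψ : ContDiff ℝ (⊤ : ℕ∞) ψ) (v : X) :
    dir v (fun x => φ x * ψ x) = fun p => φ p * dir v ψ p + ψ p * dir v φ p :=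
  funext fun p => dir_mul_apply (hφ.differentiable_infty p) (hψ.differentiable_infty p) v

theorem dir_add {φ ψ : X → ℝ} (hφ : ContDiff ℝ (⊤ : ℕ∞) φ) (hψ : ContDiff ℝ (⊤ : ℕ∞) ψ) (v : X) :
    dir v (fun x => φ x + ψ x) = fun p => dir v φ p + dir v ψ p := by
  funext p
  simp only [dir]
  rw [fderiv_fun_add (hφ.differentiable_infty p) (hψ.differentiable_infty p)]
  rfl

theorem dir_sum {ι : Type*} {s : Finset ι} {φ : ι → X → ℝ}
    (hφ : ∀ k ∈ s, ContDiff ℝ (⊤ : ℕ∞) (φ k)) (v : X) :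
    dir v (fun x => ∑ k ∈ s, φ k x) = fun p => ∑ k ∈ s, dir v (φ k) p := by
  funext p
  simp only [dir]
  rw [fderiv_fun_sum fun k hk => (hφ k hk).differentiable_infty p]
  simp

theorem dir_const_mul {φ : X → ℝ} (hφ : ContDiff ℝ (⊤ : ℕ∞) φ) (c : ℝ) (v : X) :
    dir v (fun x => c * φ x) = fun p => c * dir v φ p := by
  funext p
  simp only [dir]
  rw [fderiv_const_mul (hφ.differentiable_infty p)]
  rfl

theorem dir_sub_const (φ : X → ℝ) (c : ℝ) (v : X) : dir v (fun x => φ x - c) = dir v φ := by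
  funext p
  simp only [dir, fderiv_sub_const]

theorem dir_const_add (φ : X → ℝ) (c : ℝ) (v : X) : dir v (fun x => c + φ x) = dir v φ := by
  funext p
  simp only [dir, fderiv_const_add]

theorem dir_sq {φ : X → ℝ} (hφ : ContDiff ℝ (⊤ : ℕ∞) φ) (v : X) :
    dir v (fun x => φ x ^ 2) = fun p => 2 * φ p * dir v φ p := by
  have h := dir_mul hφ hφ v
  simp only [sq]
  rw [h]
  funext p
  ring

theorem hasDerivAt_line {φ : X → ℝ} (hφ : ContDiff ℝ (⊤ : ℕ∞) φ) (p v : X) (t : ℝ) :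
    HasDerivAt (fun t : ℝ => φ (p + t • v)) (dir v φ (p + t • v)) t := by
  have h1 : HasDerivAt (fun t : ℝ => p + t • v) v t := by
    simpa using ((hasDerivAt_id t).smul_const v).const_add p
  exact (hφ.differentiable_infty (p + t • v)).hasFDerivAt.comp_hasDerivAt t h1

theorem dir_nonneg_of_left_max {φ : X → ℝ} (hφ : ContDiff ℝ (⊤ : ℕ∞) φ) {p v : X}
    (h : ∀ᶠ t : ℝ in 𝓝[<] 0, φ (p + t • v) ≤ φ p) : 0 ≤ dir v φ p := by
  have hd := hasDerivAt_line hφ p v 0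
  rw [hasDerivAt_iff_tendsto_slope] at hd
  have h2 := hd.mono_left (nhdsWithin_mono (0 : ℝ) (show Iio (0 : ℝ) ⊆ {0}ᶜ from
    fun t ht => ne_of_lt ht))
  rw [zero_smul, add_zero] at h2
  refine ge_of_tendsto h2 ?_
  filter_upwards [h, self_mem_nhdsWithin] with t ht ht0
  rw [slope_def_field, zero_smul, add_zero, sub_zero]
  exact div_nonneg_of_nonpos (by linarith) (le_of_lt ht0)

theorem deriv2_nonpos_of_max {f f' : ℝ → ℝ} {f'' : ℝ} (hf : ∀ t, HasDerivAt f (f' t) t)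
    (hf' : HasDerivAt f' f'' 0) (h : IsLocalMax f 0) : f'' ≤ 0 := by
  by_contra! hpos
  have e1 : deriv f = f' := funext fun t => (hf t).deriv
  have h0 : deriv f 0 = 0 := h.deriv_eq_zero
  have hmin : IsLocalMin f 0 := isLocalMin_of_deriv_deriv_pos (by rw [e1, hf'.deriv]; exact hpos) h0
    (hf 0).continuousAt
  have hc : f =ᶠ[𝓝 0] fun _ => f 0 := by
    filter_upwards [h, hmin] with t h1 h2 using le_antisymm h1 h2
  have hc1 : f' =ᶠ[𝓝 0] fun _ => 0 := by
    have := hc.deriv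
    rw [e1] at this
    filter_upwards [this] with t ht
    rw [ht, deriv_const]
  have := hc1.deriv_eq
  rw [hf'.deriv, deriv_const] at this
  linarith

theorem dir_dir_nonpos_of_max {φ : X → ℝ} (hφ : ContDiff ℝ (⊤ : ℕ∞) φ) {p v : X}
    (h : IsLocalMax (fun t : ℝ => φ (p + t • v)) 0) : dir v (dir v φ) p ≤ 0 := by
  have h2 := hasDerivAt_line (hφ.dir_infty v) p v 0
  rw [zero_smul, add_zero] at h2
  exact deriv2_nonpos_of_max (hasDerivAt_line hφ p v) h2 h

theorem dir_eq_zero_of_line_max {φ : X → ℝ} (hφ : ContDiff ℝ (⊤ : ℕ∞) φ) {p v : X}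
    (h : IsLocalMax (fun t : ℝ => φ (p + t • v)) 0) : dir v φ p = 0 := by
  have h2 := hasDerivAt_line hφ p v 0
  rw [zero_smul, add_zero] at h2
  rw [← h2.deriv]
  exact h.deriv_eq_zero

end DirCalculus

section HeatOperator

variable {n : ℕ}

/-- Spatial Laplacian on space-time. -/
noncomputable def slap (φ : SpaceTime n → ℝ) (p : SpaceTime n) : ℝ :=
  ∑ i, dir (ex i) (dir (ex i) φ) p

/-- The linear parabolic operator `∂ₛ - a Δ`. -/
noncomputable def heatOp (a φ : SpaceTime n → ℝ) (p : SpaceTime n) : ℝ :=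
  dir (et n) φ p - a p * slap φ p

variable {a φ ψ : SpaceTime n → ℝ}

theorem contDiff_slap (hφ : ContDiff ℝ (⊤ : ℕ∞) φ) : ContDiff ℝ (⊤ : ℕ∞) (slap φ) :=
  ContDiff.sum fun i _ => (hφ.dir_infty (ex i)).dir_infty (ex i)

theorem slap_mul (hφ : ContDiff ℝ (⊤ : ℕ∞) φ) (hψ : ContDiff ℝ (⊤ : ℕ∞) ψ) (p : SpaceTime n) :
    slap (fun x => φ x * ψ x) p = φ p * slap ψ p + ψ p * slap φ p +
      2 * ∑ i, dir (ex i) φ p * dir (ex i) ψ p := by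
  simp only [slap]
  rw [Finset.mul_sum, Finset.mul_sum, Finset.mul_sum, ← Finset.sum_add_distrib,
    ← Finset.sum_add_distrib]
  refine Finset.sum_congr rfl fun i _ => ?_
  rw [dir_mul hφ hψ, dir_add (hφ.mul (hψ.dir_infty _)) (hψ.mul (hφ.dir_infty _)),
    dir_mul hφ (hψ.dir_infty _), dir_mul hψ (hφ.dir_infty _)]
  ring

theorem heatOp_mul (a : SpaceTime n → ℝ) (hφ : ContDiff ℝ (⊤ : ℕ∞) φ)
    (hψ : ContDiff ℝ (⊤ : ℕ∞) ψ) (p : SpaceTime n) :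
    heatOp a (fun x => φ x * ψ x) p = φ p * heatOp a ψ p + ψ p * heatOp a φ p -
      2 * a p * ∑ i, dir (ex i) φ p * dir (ex i) ψ p := by
  simp only [heatOp]
  rw [slap_mul hφ hψ, dir_mul hφ hψ]
  ring

theorem heatOp_sq (a : SpaceTime n → ℝ) (hφ : ContDiff ℝ (⊤ : ℕ∞) φ) (p : SpaceTime n) :
    heatOp a (fun x => φ x ^ 2) p = 2 * φ p * heatOp a φ p -
      2 * a p * ∑ i, dir (ex i) φ p ^ 2 := by
  simp only [sq]
  rw [heatOp_mul a hφ hφ]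
  ring

theorem heatOp_sum (a : SpaceTime n → ℝ) {ι : Type*} {s : Finset ι} {φ : ι → SpaceTime n → ℝ}
    (hφ : ∀ k ∈ s, ContDiff ℝ (⊤ : ℕ∞) (φ k)) (p : SpaceTime n) :
    heatOp a (fun x => ∑ k ∈ s, φ k x) p = ∑ k ∈ s, heatOp a (φ k) p := by
  simp only [heatOp, slap]
  rw [Finset.sum_sub_distrib, ← Finset.mul_sum, Finset.sum_comm, dir_sum hφ]
  congr 2
  refine Finset.sum_congr rfl fun i _ => ?_
  rw [dir_sum hφ, dir_sum fun k hk => (hφ k hk).dir_infty _]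

theorem heatOp_sub_const (a φ : SpaceTime n → ℝ) (c : ℝ) :
    heatOp a (fun x => φ x - c) = heatOp a φ := by
  funext p
  simp only [heatOp, slap, dir_sub_const]

theorem heatOp_const_add (a φ : SpaceTime n → ℝ) (c : ℝ) :
    heatOp a (fun x => c + φ x) = heatOp a φ := by
  funext p
  simp only [heatOp, slap, dir_const_add]

/-- Commutator of the heat operator with a spatial derivative. -/
theorem heatOp_dir (ha : ContDiff ℝ (⊤ : ℕ∞) a) (hφ : ContDiff ℝ (⊤ : ℕ∞) φ) (j : Fin n)
    (p : SpaceTime n) : heatOp a (dir (ex j) φ) p =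
      dir (ex j) (heatOp a φ) p + dir (ex j) a p * slap φ p := by
  have e1 : slap (dir (ex j) φ) = dir (ex j) (slap φ) := by
    have : slap φ = fun x => ∑ i, dir (ex i) (dir (ex i) φ) x := rfl
    rw [this, dir_sum fun i _ => (hφ.dir_infty _).dir_infty _]
    funext q
    refine Finset.sum_congr rfl fun i _ => ?_
    rw [dir_comm hφ (ex i) (ex j), dir_comm (hφ.dir_infty (ex i)) (ex i) (ex j)]
  have e2 : heatOp a φ = fun x => dir (et n) φ x + (-1) * (a x * slap φ x) := by
    funext q; simp only [heatOp]; ring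
  rw [e2, dir_add (hφ.dir_infty _) (contDiff_const.mul (ha.mul (contDiff_slap hφ))),
    dir_const_mul (ha.mul (contDiff_slap hφ)), dir_mul ha (contDiff_slap hφ), heatOp, e1,
    dir_comm hφ (et n) (ex j)]
  ring

end HeatOperator

section Bernstein

variable {n : ℕ} {ι : Type*} [Fintype ι]

/-- Sum of the squares of a finite family of functions. -/
noncomputable def sqSum (g : ι → SpaceTime n → ℝ) (p : SpaceTime n) : ℝ := ∑ k, g k p ^ 2

/-- The family of all spatial first derivatives of a family of functions. -/
noncomputable def gradFam (g : ι → SpaceTime n → ℝ) (k : ι × Fin n) : SpaceTime n → ℝ :=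
  dir (ex k.2) (g k.1)

/-- The backward cylinder with vertex at the origin. -/
def backCyl (n : ℕ) (ρ : ℝ) : Set (SpaceTime n) :=
  Metric.closedBall 0 ρ ×ˢ Icc (-ρ) 0

variable {g : ι → SpaceTime n → ℝ}

theorem sqSum_nonneg (g : ι → SpaceTime n → ℝ) (p : SpaceTime n) : 0 ≤ sqSum g p :=
  Finset.sum_nonneg fun _ _ => sq_nonneg _

theorem abs_le_sqrt_sqSum (g : ι → SpaceTime n → ℝ) (k : ι) (p : SpaceTime n) :
    |g k p| ≤ √(sqSum g p) :=
  Real.abs_le_sqrt (Finset.single_le_sum (f := fun k => g k p ^ 2) (fun _ _ => sq_nonneg _)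
    (Finset.mem_univ k))

theorem contDiff_sqSum (hg : ∀ k, ContDiff ℝ (⊤ : ℕ∞) (g k)) : ContDiff ℝ (⊤ : ℕ∞) (sqSum g) :=
  ContDiff.sum fun k _ => (hg k).pow 2

theorem contDiff_gradFam (hg : ∀ k, ContDiff ℝ (⊤ : ℕ∞) (g k)) (k : ι × Fin n) :
    ContDiff ℝ (⊤ : ℕ∞) (gradFam g k) := (hg k.1).dir_infty _

theorem dir_sqSum (hg : ∀ k, ContDiff ℝ (⊤ : ℕ∞) (g k)) (v p : SpaceTime n) :
    dir v (sqSum g) p = 2 * ∑ k, g k p * dir v (g k) p := by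
  have : sqSum g = fun x => ∑ k, g k x ^ 2 := rfl
  rw [this, dir_sum fun k _ => (hg k).pow 2, Finset.mul_sum]
  refine Finset.sum_congr rfl fun k _ => ?_
  rw [dir_sq (hg k)]
  ring

theorem sum_dir_sqSum_sq_le (hg : ∀ k, ContDiff ℝ (⊤ : ℕ∞) (g k)) (p : SpaceTime n) :
    ∑ i, dir (ex i) (sqSum g) p ^ 2 ≤ 4 * (sqSum g p * sqSum (gradFam g) p) := by
  have e : sqSum (gradFam g) p = ∑ i, ∑ k, dir (ex i) (g k) p ^ 2 := by
    rw [sqSum, Fintype.sum_prod_type, Finset.sum_comm]; rfl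
  rw [e, Finset.mul_sum, Finset.mul_sum]
  refine Finset.sum_le_sum fun i _ => ?_
  rw [dir_sqSum hg, mul_pow]
  have := Finset.sum_mul_sq_le_sq_mul_sq Finset.univ (fun k => g k p)
    (fun k => dir (ex i) (g k) p)
  rw [sqSum]
  linarith

theorem heatOp_sqSum (a : SpaceTime n → ℝ) (hg : ∀ k, ContDiff ℝ (⊤ : ℕ∞) (g k))
    (p : SpaceTime n) : heatOp a (sqSum g) p =
      2 * ∑ k, g k p * heatOp a (g k) p - 2 * a p * sqSum (gradFam g) p := by
  have e : sqSum (gradFam g) p = ∑ k, ∑ i, dir (ex i) (g k) p ^ 2 := by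
    rw [sqSum, Fintype.sum_prod_type]; rfl
  have : sqSum g = fun x => ∑ k, g k x ^ 2 := rfl
  rw [e, this, heatOp_sum a fun k _ => (hg k).pow 2, Finset.mul_sum, Finset.mul_sum,
    ← Finset.sum_sub_distrib]
  refine Finset.sum_congr rfl fun k _ => ?_
  rw [heatOp_sq a (hg k)]
  ring

/-- The heat operator of `η² W` at a spatially critical point of `η² W`. -/
theorem heatOp_cutoff_of_critical (a : SpaceTime n → ℝ) {η W : SpaceTime n → ℝ}
    (hη : ContDiff ℝ (⊤ : ℕ∞) η) (hW : ContDiff ℝ (⊤ : ℕ∞) W) {p : SpaceTime n} (hp : 0 < η p)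
    (hcrit : ∀ i, dir (ex i) (fun q => η q ^ 2 * W q) p = 0) :
    heatOp a (fun q => η q ^ 2 * W q) p = η p ^ 2 * heatOp a W p +
      W p * (2 * η p * heatOp a η p + 6 * a p * ∑ i, dir (ex i) η p ^ 2) := by
  have h1 : ∀ i, η p * dir (ex i) W p = -(2 * W p * dir (ex i) η p) := by
    intro i
    have h := hcrit i
    rw [dir_mul (hη.pow 2) hW, dir_sq hη] at h
    have h' : η p * (η p * dir (ex i) W p + 2 * W p * dir (ex i) η p) = 0 := by
      rw [← h]; ring
    have := (mul_eq_zero.1 h').resolve_left hp.ne'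
    linarith
  have h2 : ∑ i, dir (ex i) (fun q => η q ^ 2) p * dir (ex i) W p =
      -4 * W p * ∑ i, dir (ex i) η p ^ 2 := by
    rw [Finset.mul_sum]
    refine Finset.sum_congr rfl fun i _ => ?_
    rw [dir_sq hη]
    have : 2 * η p * dir (ex i) η p * dir (ex i) W p =
      2 * dir (ex i) η p * (η p * dir (ex i) W p) := by ring
    rw [this, h1]
    ring
  rw [heatOp_mul a (hη.pow 2) hW, h2, heatOp_sq a hη]
  ring

set_option maxHeartbeats 800000 in
theorem bernstein_scalar {a0 a1 A B K μ J N C0 η1 : ℝ} (ha0 : 0 < a0) (hB : 0 ≤ B)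
    (hK : 0 < K) (hμ : 0 ≤ μ) (hJ : 0 ≤ J) (hN : 0 ≤ N) (hC0 : 0 ≤ C0) (hη1 : 0 ≤ η1)
    (s1 : 16 * J ^ 2 * A ^ 2 * K ≤ a0 ^ 2) (s2 : 8 * N * μ * A ≤ a0) :
    ∃ M, 0 ≤ M ∧ ∀ η p h E a : ℝ, 0 < η → η ≤ η1 → 0 ≤ p → 0 ≤ h → K ≤ E → E ≤ 2 * K →
      a0 ≤ a → a ≤ a1 →
      0 ≤ η ^ 2 * (E * (2 * J * p * (A * p * h + B * (1 + h + p ^ 2)) - 2 * a * h ^ 2) +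
        p ^ 2 * (2 * N * μ * (A * p ^ 2 + B * (1 + p)) - 2 * a * p ^ 2) +
        a / 2 * (E * h ^ 2 + p ^ 4)) + p ^ 2 * E * C0 →
      η * p ≤ M := by
  obtain ⟨C1, hC1⟩ : ∃ C1, C1 = 8 * J ^ 2 * B ^ 2 * K / a0 + 4 * J * B * K + 2 * N * μ * B :=
    ⟨_, rfl⟩
  have hC1n : 0 ≤ C1 := by rw [hC1]; positivity
  obtain ⟨C3, hC3⟩ : ∃ C3, C3 = C1 * (η1 ^ 3 + η1 ^ 2 + η1) + 2 * K * C0 := ⟨_, rfl⟩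
  have hC3n : 0 ≤ C3 := by rw [hC3]; positivity
  refine ⟨1 + 4 * C3 / a0, by positivity, ?_⟩
  intro η p h E a hη hηle hp hh hE1 hE2 ha1 ha2 hmain
  have hE : 0 < E := hK.trans_le hE1
  have t1 : 2 * J * A * p ^ 2 * h ≤ a0 / 4 * h ^ 2 + 4 * J ^ 2 * A ^ 2 / a0 * p ^ 4 := by
    have e : a0 / 4 * h ^ 2 + 4 * J ^ 2 * A ^ 2 / a0 * p ^ 4 - 2 * J * A * p ^ 2 * h =
      (a0 * h - 4 * J * A * p ^ 2) ^ 2 / (4 * a0) := by field_simp; ring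
    have : 0 ≤ (a0 * h - 4 * J * A * p ^ 2) ^ 2 / (4 * a0) := by positivity
    linarith
  have t2 : 2 * J * B * p * h ≤ a0 / 4 * h ^ 2 + 4 * J ^ 2 * B ^ 2 / a0 * p ^ 2 := by
    have e : a0 / 4 * h ^ 2 + 4 * J ^ 2 * B ^ 2 / a0 * p ^ 2 - 2 * J * B * p * h =
      (a0 * h - 4 * J * B * p) ^ 2 / (4 * a0) := by field_simp; ring
    have : 0 ≤ (a0 * h - 4 * J * B * p) ^ 2 / (4 * a0) := by positivity
    linarith
  have t3 : E * (4 * J ^ 2 * A ^ 2 / a0) ≤ a0 / 2 := by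
    have : E * (4 * J ^ 2 * A ^ 2 / a0) ≤ 2 * K * (4 * J ^ 2 * A ^ 2 / a0) :=
      mul_le_mul_of_nonneg_right hE2 (by positivity)
    refine this.trans ?_
    rw [mul_div_assoc', div_le_iff₀ ha0]
    linarith
  have t4 : E * (4 * J ^ 2 * B ^ 2 / a0) ≤ 8 * J ^ 2 * B ^ 2 * K / a0 := by
    have : E * (4 * J ^ 2 * B ^ 2 / a0) ≤ 2 * K * (4 * J ^ 2 * B ^ 2 / a0) :=
      mul_le_mul_of_nonneg_right hE2 (by positivity)
    refine this.trans (le_of_eq ?_)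
    ring
  have t5 : E * (2 * J * B * (p + p ^ 3)) ≤ 4 * J * B * K * (p + p ^ 3) := by
    have : E * (2 * J * B * (p + p ^ 3)) ≤ 2 * K * (2 * J * B * (p + p ^ 3)) :=
      mul_le_mul_of_nonneg_right hE2 (by positivity)
    linarith
  have hbr : E * (2 * J * p * (A * p * h + B * (1 + h + p ^ 2)) - 2 * a * h ^ 2) +
        p ^ 2 * (2 * N * μ * (A * p ^ 2 + B * (1 + p)) - 2 * a * p ^ 2) +
        a / 2 * (E * h ^ 2 + p ^ 4) ≤ C1 * (p + p ^ 2 + p ^ 3) - 3 / 4 * a0 * p ^ 4 := by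
    have q1 := mul_le_mul_of_nonneg_left t1 hE.le
    have q2 := mul_le_mul_of_nonneg_left t2 hE.le
    have q3 := mul_le_mul_of_nonneg_right t3 (by positivity : 0 ≤ p ^ 4)
    have q4 := mul_le_mul_of_nonneg_right t4 (by positivity : 0 ≤ p ^ 2)
    have q5 := mul_le_mul_of_nonneg_right s2 (by positivity : 0 ≤ p ^ 4)
    have q6 := mul_le_mul_of_nonneg_right ha1 (by positivity : 0 ≤ p ^ 4)
    have q7 := mul_le_mul_of_nonneg_right ha1 (by positivity : 0 ≤ E * h ^ 2)
    have q8 : 0 ≤ 8 * J ^ 2 * B ^ 2 * K / a0 * (p + p ^ 3) := by positivity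
    have q9 : 0 ≤ 4 * J * B * K * p ^ 2 := by positivity
    have q10 : 0 ≤ 2 * N * μ * B * p := by positivity
    rw [hC1]
    have q11 : 0 ≤ a0 * (E * h ^ 2) := by positivity
    linarith
  have hx : 3 / 4 * a0 * (η * p) ^ 4 ≤ C3 * (η * p + (η * p) ^ 2 + (η * p) ^ 3) := by
    have r1 : 0 ≤ η ^ 2 * (C1 * (p + p ^ 2 + p ^ 3) - 3 / 4 * a0 * p ^ 4) + p ^ 2 * (2 * K) * C0 := by
      have := mul_le_mul_of_nonneg_left hbr (by positivity : 0 ≤ η ^ 2)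
      have := mul_le_mul_of_nonneg_left hE2 (by positivity : 0 ≤ p ^ 2 * C0)
      linarith
    have r2 := mul_nonneg (by positivity : 0 ≤ η ^ 2) r1
    have e1 : η ^ 3 ≤ η1 ^ 3 := by gcongr
    have e2 : η ^ 2 ≤ η1 ^ 2 := by gcongr
    have c1 := mul_le_mul_of_nonneg_left e1 (by positivity : 0 ≤ C1 * (η * p))
    have c2 := mul_le_mul_of_nonneg_left e2 (by positivity : 0 ≤ C1 * (η * p) ^ 2)
    have c3 := mul_le_mul_of_nonneg_left hηle (by positivity : 0 ≤ C1 * (η * p) ^ 3)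
    have d1 : 0 ≤ (C1 * (η1 ^ 2 + η1) + 2 * K * C0) * (η * p) := by positivity
    have d2 : 0 ≤ (C1 * (η1 ^ 3 + η1)) * (η * p) ^ 2 := by positivity
    have d3 : 0 ≤ (C1 * (η1 ^ 3 + η1 ^ 2) + 2 * K * C0) * (η * p) ^ 3 := by positivity
    rw [hC3]
    linarith
  by_contra! hM
  obtain ⟨x, hxd⟩ : ∃ x, x = η * p := ⟨_, rfl⟩
  rw [← hxd] at hx hM
  have hx1 : 1 < x := by
    have : 0 ≤ 4 * C3 / a0 := by positivity
    linarith
  have hx2 : 4 * C3 < x * a0 := by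
    rw [← div_lt_iff₀ ha0]; linarith
  have u1 : x ≤ x ^ 3 := le_self_pow₀ hx1.le (by norm_num)
  have u2 : x ^ 2 ≤ x ^ 3 := pow_le_pow_right₀ hx1.le (by norm_num)
  have u3 := mul_le_mul_of_nonneg_left u1 hC3n
  have u4 := mul_le_mul_of_nonneg_left u2 hC3n
  have u5 := mul_lt_mul_of_pos_right hx2 (by positivity : 0 < x ^ 3)
  linarith

end Bernstein

section GradientBound

variable {n : ℕ} {ι : Type*} [Fintype ι]

/-- A cutoff vanishing on the parabolic boundary of `backCyl n ρ`. -/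
noncomputable def paraCut (n : ℕ) (ρ : ℝ) (p : SpaceTime n) : ℝ := (ρ ^ 2 - ‖p.1‖ ^ 2) * (p.2 + ρ)

theorem contDiff_paraCut (n : ℕ) (ρ : ℝ) : ContDiff ℝ (⊤ : ℕ∞) (paraCut n ρ) :=
  (contDiff_const.sub (contDiff_fst.norm_sq ℝ)).mul (contDiff_snd.add contDiff_const)

theorem isCompact_backCyl (n : ℕ) (ρ : ℝ) : IsCompact (backCyl n ρ) :=
  (isCompact_closedBall _ _).prod isCompact_Icc

theorem paraCut_bounds {ρ : ℝ} (hρ : 0 < ρ) {p : SpaceTime n} (hp : p ∈ backCyl n ρ) :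
    0 ≤ paraCut n ρ p ∧ paraCut n ρ p ≤ ρ ^ 2 * ρ := by
  obtain ⟨h1, h2, h3⟩ := hp
  rw [mem_closedBall_zero_iff] at h1
  have h4 : ‖p.1‖ ^ 2 ≤ ρ ^ 2 := by gcongr
  have h5 : 0 ≤ ‖p.1‖ ^ 2 := by positivity
  refine ⟨mul_nonneg (by linarith) (by linarith), ?_⟩
  exact mul_le_mul (by linarith) (by linarith) (by linarith) (by positivity)

theorem paraCut_half {ρ : ℝ} (hρ : 0 < ρ) {p : SpaceTime n} (hp : p ∈ backCyl n (ρ / 2)) :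
    3 / 4 * ρ ^ 2 * (ρ / 2) ≤ paraCut n ρ p := by
  obtain ⟨h1, h2, h3⟩ := hp
  rw [mem_closedBall_zero_iff] at h1
  have h4 : ‖p.1‖ ^ 2 ≤ (ρ / 2) ^ 2 := by gcongr
  exact mul_le_mul (by linarith) (by linarith) (by positivity) (by nlinarith)

theorem backCyl_mono {ρ ρ' : ℝ} (h : ρ ≤ ρ') : backCyl n ρ ⊆ backCyl n ρ' :=
  prod_mono (Metric.closedBall_subset_closedBall h) (Icc_subset_Icc_left (by linarith))

theorem mem_backCyl_of_paraCut_pos {ρ : ℝ} {p : SpaceTime n} (hp : p ∈ backCyl n ρ)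
    (h : 0 < paraCut n ρ p) : ‖p.1‖ < ρ ∧ -ρ < p.2 := by
  obtain ⟨h1, h2, h3⟩ := hp
  rw [mem_closedBall_zero_iff] at h1
  constructor
  · refine lt_of_le_of_ne h1 fun e => ?_
    rw [paraCut, e] at h; simp at h
  · refine lt_of_le_of_ne h2 fun e => ?_
    rw [paraCut, ← e] at h; simp at h

/-- First and second order conditions at a maximum of a smooth function over `backCyl n ρ` off the
parabolic boundary. -/
theorem critical_of_isMaxOn {ρ : ℝ} {F a : SpaceTime n → ℝ} (hF : ContDiff ℝ (⊤ : ℕ∞) F)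
    {p : SpaceTime n} (hp : p ∈ backCyl n ρ) (h1 : ‖p.1‖ < ρ) (h2 : -ρ < p.2)
    (hmax : IsMaxOn F (backCyl n ρ) p) (ha : 0 ≤ a p) :
    (∀ i, dir (ex i) F p = 0) ∧ 0 ≤ heatOp a F p := by
  obtain ⟨-, -, h3⟩ := hp
  have hl : ∀ i, IsLocalMax (fun t : ℝ => F (p + t • ex i)) 0 := by
    intro i
    have hc : Continuous fun t : ℝ => ‖(p + t • (ex i : SpaceTime n)).1‖ := by fun_prop
    have hev : ∀ᶠ t : ℝ in 𝓝 0, ‖(p + t • (ex i : SpaceTime n)).1‖ < ρ := by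
      refine hc.continuousAt.eventually_lt continuousAt_const ?_
      simpa using h1
    filter_upwards [hev] with t ht
    have hmem : p + t • ex i ∈ backCyl n ρ := by
      refine ⟨mem_closedBall_zero_iff.2 ht.le, ?_⟩
      have : (p + t • (ex i : SpaceTime n)).2 = p.2 := by simp [ex]
      rw [this]
      exact ⟨h2.le, h3⟩
    simpa using hmax hmem
  have ht : 0 ≤ dir (et n) F p := by
    refine dir_nonneg_of_left_max hF ?_
    have hev : ∀ᶠ t : ℝ in 𝓝[<] 0, -ρ - p.2 < t := by
      refine nhdsWithin_le_nhds (lt_mem_nhds (by linarith))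
    filter_upwards [hev, self_mem_nhdsWithin] with t ht ht0
    have ht0' : t < 0 := ht0
    refine hmax ⟨?_, ?_⟩
    · have : (p + t • et n).1 = p.1 := by simp [et]
      rw [this]
      exact mem_closedBall_zero_iff.2 h1.le
    · have : (p + t • et n).2 = p.2 + t := by simp [et]
      rw [this]
      exact ⟨by linarith, by linarith⟩
  refine ⟨fun i => dir_eq_zero_of_line_max hF (hl i), ?_⟩
  have hs : slap F p ≤ 0 := Finset.sum_nonpos fun i _ => dir_dir_nonpos_of_max hF (hl i)
  have := mul_nonneg ha (neg_nonneg.2 hs)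
  rw [heatOp]
  linarith

theorem abs_sum_le_card_mul {κ : Type*} [Fintype κ] (φ : κ → ℝ) {c : ℝ} (h : ∀ k, |φ k| ≤ c) :
    |∑ k, φ k| ≤ Fintype.card κ * c := by
  have := Finset.sum_le_card_nsmul Finset.univ (fun k => |φ k|) c fun k _ => h k
  rw [nsmul_eq_mul, Finset.card_univ] at this
  exact (Finset.abs_sum_le_sum_abs _ _).trans this

/-- The Bernstein inequality at a maximum of `η² P E`. -/
theorem bernstein_at_max {a η : SpaceTime n → ℝ} {f : ι → SpaceTime n → ℝ} {d : ι → ℝ}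
    {A B K μ C0 : ℝ} (hη : ContDiff ℝ (⊤ : ℕ∞) η) (hf : ∀ k, ContDiff ℝ (⊤ : ℕ∞) (f k))
    {p : SpaceTime n} (ha : 0 ≤ a p) (hηp : 0 < η p) (hK : 0 < K)
    (hμ : ∀ k, |f k p - d k| ≤ μ)
    (hE : sqSum (fun k q => f k q - d k) p ≤ K / 64)
    (h1 : ∀ k, |heatOp a (f k) p| ≤ A * sqSum (gradFam f) p + B * (1 + √(sqSum (gradFam f) p)))
    (h2 : ∀ k, |heatOp a (gradFam f k) p| ≤
      A * √(sqSum (gradFam f) p) * √(sqSum (gradFam (gradFam f)) p) +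
        B * (1 + √(sqSum (gradFam (gradFam f)) p) + sqSum (gradFam f) p))
    (hC0 : 2 * η p * heatOp a η p + 6 * a p * ∑ i, dir (ex i) η p ^ 2 ≤ C0)
    (hcrit : ∀ i, dir (ex i) (fun q => η q ^ 2 *
      (sqSum (gradFam f) q * (K + sqSum (fun k q => f k q - d k) q))) p = 0)
    (hheat : 0 ≤ heatOp a (fun q => η q ^ 2 *
      (sqSum (gradFam f) q * (K + sqSum (fun k q => f k q - d k) q))) p) :
    0 ≤ η p ^ 2 * ((K + sqSum (fun k q => f k q - d k) p) *
        (2 * (Fintype.card ι * n) * √(sqSum (gradFam f) p) *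
          (A * √(sqSum (gradFam f) p) * √(sqSum (gradFam (gradFam f)) p) +
            B * (1 + √(sqSum (gradFam (gradFam f)) p) + √(sqSum (gradFam f) p) ^ 2)) -
          2 * a p * √(sqSum (gradFam (gradFam f)) p) ^ 2) +
        √(sqSum (gradFam f) p) ^ 2 * (2 * Fintype.card ι * μ *
          (A * √(sqSum (gradFam f) p) ^ 2 + B * (1 + √(sqSum (gradFam f) p))) -
          2 * a p * √(sqSum (gradFam f) p) ^ 2) +
        a p / 2 * ((K + sqSum (fun k q => f k q - d k) p) *
          √(sqSum (gradFam (gradFam f)) p) ^ 2 + √(sqSum (gradFam f) p) ^ 4)) +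
      √(sqSum (gradFam f) p) ^ 2 * (K + sqSum (fun k q => f k q - d k) p) * C0 := by
  obtain ⟨e, he⟩ : ∃ e : ι → SpaceTime n → ℝ, e = fun k q => f k q - d k := ⟨_, rfl⟩
  have hes : ∀ k, ContDiff ℝ (⊤ : ℕ∞) (e k) := by
    intro k; rw [he]; exact (hf k).sub contDiff_const
  have hge : gradFam e = gradFam f := by
    funext k
    simp only [gradFam, he, dir_sub_const]
  have hLe : ∀ k, heatOp a (e k) = heatOp a (f k) := by
    intro k; rw [he]; exact heatOp_sub_const a (f k) (d k)
  rw [← he] at hE hcrit hheat ⊢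
  have hμ' : ∀ k, |e k p| ≤ μ := by rw [he]; exact hμ
  have hg := contDiff_gradFam hf
  have hPs := contDiff_sqSum hg
  have hGs := contDiff_sqSum hes
  rw [heatOp_cutoff_of_critical a hη (hPs.mul (contDiff_const.add hGs)) hηp hcrit,
    heatOp_mul a hPs (contDiff_const.add hGs), heatOp_const_add, heatOp_sqSum a hg,
    heatOp_sqSum a hes, hge] at hheat
  obtain ⟨X, hX⟩ : ∃ X, X = ∑ i, dir (ex i) (sqSum (gradFam f)) p *
    dir (ex i) (fun x => K + sqSum e x) p := ⟨_, rfl⟩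
  rw [← hX] at hheat
  have hXsq : X ^ 2 ≤ 4 * (sqSum (gradFam f) p * sqSum (gradFam (gradFam f)) p) *
      (4 * (sqSum e p * sqSum (gradFam f) p)) := by
    rw [hX]
    refine (Finset.sum_mul_sq_le_sq_mul_sq _ _ _).trans ?_
    refine mul_le_mul (sum_dir_sqSum_sq_le hg p) ?_ (Finset.sum_nonneg fun _ _ => sq_nonneg _) ?_
    · simp only [dir_const_add]
      rw [← hge]
      exact sum_dir_sqSum_sq_le hes p
    · have := sqSum_nonneg (gradFam f) p
      have := sqSum_nonneg (gradFam (gradFam f)) p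
      positivity
  have hS1 : |∑ k, gradFam f k p * heatOp a (gradFam f k) p| ≤
      (Fintype.card ι * n) * (√(sqSum (gradFam f) p) *
        (A * √(sqSum (gradFam f) p) * √(sqSum (gradFam (gradFam f)) p) +
        B * (1 + √(sqSum (gradFam (gradFam f)) p) + sqSum (gradFam f) p))) := by
    have := abs_sum_le_card_mul (fun k => gradFam f k p * heatOp a (gradFam f k) p) fun k => by
      rw [abs_mul]
      exact mul_le_mul (abs_le_sqrt_sqSum _ k p) (h2 k) (abs_nonneg _) (Real.sqrt_nonneg _)
    rwa [Fintype.card_prod, Fintype.card_fin, Nat.cast_mul] at this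
  have hS2 : |∑ k, e k p * heatOp a (e k) p| ≤ Fintype.card ι * (μ *
      (A * sqSum (gradFam f) p + B * (1 + √(sqSum (gradFam f) p)))) := by
    refine abs_sum_le_card_mul (fun k => e k p * heatOp a (e k) p) fun k => ?_
    rw [abs_mul, hLe]
    exact mul_le_mul (hμ' k) (h1 k) (abs_nonneg _) ((abs_nonneg _).trans (hμ' k))
  obtain ⟨S1, hS1d⟩ : ∃ S, S = ∑ k, gradFam f k p * heatOp a (gradFam f k) p := ⟨_, rfl⟩
  obtain ⟨S2, hS2d⟩ : ∃ S, S = ∑ k, e k p * heatOp a (e k) p := ⟨_, rfl⟩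
  rw [← hS1d] at hS1 hheat
  rw [← hS2d] at hS2 hheat
  have hP0 := sqSum_nonneg (gradFam f) p
  have hH0 := sqSum_nonneg (gradFam (gradFam f)) p
  have hG0 := sqSum_nonneg e p
  obtain ⟨P, hP⟩ : ∃ P, P = √(sqSum (gradFam f) p) := ⟨_, rfl⟩
  obtain ⟨H, hH⟩ : ∃ H, H = √(sqSum (gradFam (gradFam f)) p) := ⟨_, rfl⟩
  have hP2 : sqSum (gradFam f) p = P ^ 2 := by rw [hP, Real.sq_sqrt hP0]
  have hH2 : sqSum (gradFam (gradFam f)) p = H ^ 2 := by rw [hH, Real.sq_sqrt hH0]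
  have hPn : 0 ≤ P := by rw [hP]; positivity
  have hHn : 0 ≤ H := by rw [hH]; positivity
  rw [← hP] at hS1 hS2 ⊢
  rw [← hH] at hS1 ⊢
  rw [hP2, hH2] at hXsq hheat
  rw [hP2] at hS1 hS2
  obtain ⟨G, hG⟩ : ∃ G, G = sqSum e p := ⟨_, rfl⟩
  rw [← hG] at hheat hXsq hG0 hE ⊢
  obtain ⟨Y, hY⟩ : ∃ Y, Y = 2 * η p * heatOp a η p + 6 * a p * ∑ i, dir (ex i) η p ^ 2 :=
    ⟨_, rfl⟩
  rw [← hY] at hC0 hheat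
  obtain ⟨z, hz⟩ : ∃ z, z = η p := ⟨_, rfl⟩
  obtain ⟨b, hb⟩ : ∃ b, b = a p := ⟨_, rfl⟩
  rw [← hz, ← hb] at hheat ⊢
  rw [← hb] at ha
  have hXabs : |X| ≤ 1 / 4 * ((K + G) * H ^ 2 + P ^ 4) := by
    refine abs_le_of_sq_le_sq (hXsq.trans ?_) (by positivity)
    have q1 : 4 * (P ^ 2 * H ^ 2) * (4 * (G * P ^ 2)) ≤ 1 / 4 * ((K + G) * H ^ 2 * P ^ 4) := by
      have : 64 * G ≤ K + G := by linarith
      have := mul_le_mul_of_nonneg_right this (by positivity : 0 ≤ H ^ 2 * P ^ 4)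
      linarith
    have q2 := sq_nonneg ((K + G) * H ^ 2 - P ^ 4)
    have e2 : (1 / 4 * ((K + G) * H ^ 2 + P ^ 4)) ^ 2 =
      1 / 16 * ((K + G) * H ^ 2 - P ^ 4) ^ 2 + 1 / 4 * ((K + G) * H ^ 2 * P ^ 4) := by ring
    rw [e2]
    linarith
  have l1 := mul_le_mul_of_nonneg_left (le_of_abs_le hS1) (by positivity : 0 ≤ z ^ 2 * (K + G))
  have l2 := mul_le_mul_of_nonneg_left (le_of_abs_le hS2) (by positivity : 0 ≤ z ^ 2 * P ^ 2)
  have l3 := mul_le_mul_of_nonneg_left (neg_le_of_abs_le hXabs) (by positivity : 0 ≤ z ^ 2 * b)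
  have l4 := mul_le_mul_of_nonneg_left hC0 (by positivity : 0 ≤ P ^ 2 * (K + G))
  refine hheat.trans ?_
  linarith

end GradientBound

/-- Interior gradient bound of Bernstein type for a system with quadratic right-hand sides and
small oscillation. -/
theorem exists_gradient_bound (n : ℕ) (ι : Type*) [Fintype ι] {a0 a1 A B K μ ρ : ℝ} (ha0 : 0 < a0)
    (hA : 0 ≤ A) (hB : 0 ≤ B) (hK : 0 < K) (hμ : 0 ≤ μ) (hρ : 0 < ρ)
    (s1 : 16 * (Fintype.card ι * n : ℝ) ^ 2 * A ^ 2 * K ≤ a0 ^ 2)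
    (s2 : 8 * (Fintype.card ι : ℝ) * μ * A ≤ a0) :
    ∃ C, 0 ≤ C ∧ ∀ (a : SpaceTime n → ℝ) (f : ι → SpaceTime n → ℝ) (d : ι → ℝ),
      (∀ k, ContDiff ℝ (⊤ : ℕ∞) (f k)) →
      (∀ p ∈ backCyl n ρ, a0 ≤ a p ∧ a p ≤ a1) →
      (∀ p ∈ backCyl n ρ, ∀ k, |f k p - d k| ≤ μ) →
      (∀ p ∈ backCyl n ρ, sqSum (fun k q => f k q - d k) p ≤ K / 64) →
      (∀ p ∈ backCyl n ρ, ∀ k, |heatOp a (f k) p| ≤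
        A * sqSum (gradFam f) p + B * (1 + √(sqSum (gradFam f) p))) →
      (∀ p ∈ backCyl n ρ, ∀ k, |heatOp a (gradFam f k) p| ≤
        A * √(sqSum (gradFam f) p) * √(sqSum (gradFam (gradFam f)) p) +
          B * (1 + √(sqSum (gradFam (gradFam f)) p) + sqSum (gradFam f) p)) →
      ∀ p ∈ backCyl n (ρ / 2), sqSum (gradFam f) p ≤ C := by
  obtain ⟨η, hη⟩ : ∃ η, η = paraCut n ρ := ⟨_, rfl⟩
  have hηs : ContDiff ℝ (⊤ : ℕ∞) η := by rw [hη]; exact contDiff_paraCut n ρ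
  obtain ⟨c1, hc1⟩ := (isCompact_backCyl n ρ).exists_bound_of_continuousOn
    (hηs.dir_infty (et n)).continuous.continuousOn
  obtain ⟨c2, hc2⟩ := (isCompact_backCyl n ρ).exists_bound_of_continuousOn
    (contDiff_slap hηs).continuous.continuousOn
  obtain ⟨c3, hc3⟩ := (isCompact_backCyl n ρ).exists_bound_of_continuousOn
    (f := fun p => ∑ i, dir (ex i) η p ^ 2)
    (continuous_finsetSum _ fun i _ => (hηs.dir_infty (ex i)).continuous.pow 2).continuousOn
  obtain ⟨C0, hC0⟩ : ∃ C0, C0 = 2 * (ρ ^ 2 * ρ) * (|c1| + |a1| * |c2|) + 6 * |a1| * |c3| := ⟨_, rfl⟩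
  have hC0n : 0 ≤ C0 := by rw [hC0]; positivity
  obtain ⟨M, hM0, hM⟩ := bernstein_scalar (a1 := a1) (η1 := ρ ^ 2 * ρ)
    (J := Fintype.card ι * n) (N := Fintype.card ι) ha0 hB hK hμ (by positivity) (by positivity)
    hC0n (by positivity) s1 s2
  refine ⟨2 * M ^ 2 / (3 / 4 * ρ ^ 2 * (ρ / 2)) ^ 2, by positivity, ?_⟩
  intro a f d hf ha hfμ hfK h1 h2 p hp
  have hg := contDiff_gradFam hf
  have hes : ∀ k, ContDiff ℝ (⊤ : ℕ∞) fun q => f k q - d k := fun k => (hf k).sub contDiff_const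
  obtain ⟨F, hF⟩ : ∃ F, F = fun q => η q ^ 2 *
    (sqSum (gradFam f) q * (K + sqSum (fun k q => f k q - d k) q)) := ⟨_, rfl⟩
  have hFs : ContDiff ℝ (⊤ : ℕ∞) F := by
    rw [hF]
    exact (hηs.pow 2).mul ((contDiff_sqSum hg).mul (contDiff_const.add (contDiff_sqSum hes)))
  have hne : (backCyl n ρ).Nonempty := ⟨p, backCyl_mono (by linarith) hp⟩
  obtain ⟨q, hq, hmax⟩ := (isCompact_backCyl n ρ).exists_isMaxOn hne hFs.continuous.continuousOn
  have hFq : F q ≤ 2 * K * M ^ 2 := by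
    have hb := paraCut_bounds hρ hq
    rw [← hη] at hb
    rcases hb.1.eq_or_lt with h0 | h0
    · rw [hF]
      simp only [← h0]
      have : 0 ≤ 2 * K * M ^ 2 := by positivity
      simpa using this
    · have hin := mem_backCyl_of_paraCut_pos hq (by rw [← hη]; exact h0)
      obtain ⟨ha1, ha2⟩ := ha q hq
      have hapos : 0 < a q := ha0.trans_le ha1
      obtain ⟨hcrit, hheat⟩ := critical_of_isMaxOn (a := a) hFs hq hin.1 hin.2 hmax hapos.le
      have haabs : a q ≤ |a1| := ha2.trans (le_abs_self _)
      have hbd : 2 * η q * heatOp a η q + 6 * a q * ∑ i, dir (ex i) η q ^ 2 ≤ C0 := by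
        have e1 : heatOp a η q ≤ |c1| + |a1| * |c2| := by
          have h3 := (le_abs_self _).trans ((hc1 q hq).trans (le_abs_self c1))
          have h4 : |slap η q| ≤ |c2| := (hc2 q hq).trans (le_abs_self c2)
          have h5 : -(a q * slap η q) ≤ |a1| * |c2| := by
            have := neg_le_of_abs_le h4
            have h6 : a q * |c2| ≤ |a1| * |c2| := mul_le_mul_of_nonneg_right haabs (abs_nonneg _)
            have h7 := mul_le_mul_of_nonneg_left this hapos.le
            linarith
          rw [heatOp]
          linarith
        have e2 : ∑ i, dir (ex i) η q ^ 2 ≤ |c3| :=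
          (le_abs_self _).trans ((hc3 q hq).trans (le_abs_self c3))
        have e3 : 2 * η q * heatOp a η q ≤ 2 * (ρ ^ 2 * ρ) * (|c1| + |a1| * |c2|) :=
          (mul_le_mul_of_nonneg_left e1 (by linarith)).trans
            (mul_le_mul_of_nonneg_right (by linarith [hb.2]) (by positivity))
        have e4 : 6 * a q * ∑ i, dir (ex i) η q ^ 2 ≤ 6 * |a1| * |c3| :=
          mul_le_mul (by linarith) e2 (Finset.sum_nonneg fun _ _ => sq_nonneg _) (by positivity)
        rw [hC0]
        linarith
      rw [hF] at hcrit hheat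
      have hkey := bernstein_at_max hηs hf hapos.le h0 hK (hfμ q hq) (hfK q hq) (h1 q hq) (h2 q hq)
        hbd hcrit hheat
      have hG0 := sqSum_nonneg (fun k q => f k q - d k) q
      have hGK := hfK q hq
      have := hM (η q) (√(sqSum (gradFam f) q)) (√(sqSum (gradFam (gradFam f)) q))
        (K + sqSum (fun k q => f k q - d k) q) (a q) h0 hb.2 (Real.sqrt_nonneg _)
        (Real.sqrt_nonneg _) (by linarith) (by linarith) ha1 ha2 hkey
      have hsq : (η q * √(sqSum (gradFam f) q)) ^ 2 ≤ M ^ 2 := by gcongr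
      rw [mul_pow, Real.sq_sqrt (sqSum_nonneg _ _)] at hsq
      have hEq : K + sqSum (fun k q => f k q - d k) q ≤ 2 * K := by linarith
      have hP := sqSum_nonneg (gradFam f) q
      have h8 : F q = (η q ^ 2 * sqSum (gradFam f) q) *
        (K + sqSum (fun k q => f k q - d k) q) := by rw [hF]; ring
      rw [h8, mul_comm (2 * K)]
      exact mul_le_mul hsq hEq (by linarith) (by positivity)
  have hFp : F p ≤ 2 * K * M ^ 2 := (hmax (backCyl_mono (by linarith) hp)).trans hFq
  have hhalf := paraCut_half hρ hp
  rw [← hη] at hhalf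
  have hP := sqSum_nonneg (gradFam f) p
  have hG0 := sqSum_nonneg (fun k q => f k q - d k) p
  rw [le_div_iff₀ (by positivity)]
  have h9 : sqSum (gradFam f) p * (3 / 4 * ρ ^ 2 * (ρ / 2)) ^ 2 ≤ sqSum (gradFam f) p * η p ^ 2 := by
    gcongr
  have h10 : K * (sqSum (gradFam f) p * η p ^ 2) ≤ F p := by
    have : F p = (K + sqSum (fun k q => f k q - d k) p) * (sqSum (gradFam f) p * η p ^ 2) := by
      rw [hF]; ring
    rw [this]
    exact mul_le_mul_of_nonneg_right (by linarith) (by positivity)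
  have h11 : K * (sqSum (gradFam f) p * η p ^ 2) ≤ K * (2 * M ^ 2) := by linarith
  exact h9.trans (le_of_mul_le_mul_left h11 hK)

section JetBound

variable {n : ℕ}

/-- Bounds for a smooth function and its spatial gradient at a point. -/
structure JetBound (p : SpaceTime n) (φ : SpaceTime n → ℝ) (x y : ℝ) : Prop where
  smooth : ContDiff ℝ (⊤ : ℕ∞) φ
  zero : |φ p| ≤ x
  one : ∀ l, |dir (ex l) φ p| ≤ y

variable {p : SpaceTime n} {φ ψ : SpaceTime n → ℝ} {x y x' y' : ℝ}

theorem JetBound.nonneg (h : JetBound p φ x y) : 0 ≤ x := (abs_nonneg _).trans h.zero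

theorem JetBound.add (h : JetBound p φ x y) (h' : JetBound p ψ x' y') :
    JetBound p (fun q => φ q + ψ q) (x + x') (y + y') where
  smooth := h.smooth.add h'.smooth
  zero := (abs_add_le _ _).trans (add_le_add h.zero h'.zero)
  one l := by
    rw [dir_add h.smooth h'.smooth]
    exact (abs_add_le _ _).trans (add_le_add (h.one l) (h'.one l))

theorem JetBound.mul (h : JetBound p φ x y) (h' : JetBound p ψ x' y') :
    JetBound p (fun q => φ q * ψ q) (x * x') (x * y' + x' * y) where
  smooth := h.smooth.mul h'.smooth
  zero := by
    rw [abs_mul]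
    exact mul_le_mul h.zero h'.zero (abs_nonneg _) h.nonneg
  one l := by
    rw [dir_mul h.smooth h'.smooth]
    refine (abs_add_le _ _).trans ?_
    rw [abs_mul, abs_mul]
    exact add_le_add (mul_le_mul h.zero (h'.one l) (abs_nonneg _) h.nonneg)
      (mul_le_mul h'.zero (h.one l) (abs_nonneg _) h'.nonneg)

theorem JetBound.const_mul (h : JetBound p φ x y) (c : ℝ) :
    JetBound p (fun q => c * φ q) (|c| * x) (|c| * y) where
  smooth := contDiff_const.mul h.smooth
  zero := by
    rw [abs_mul]
    exact mul_le_mul_of_nonneg_left h.zero (abs_nonneg _)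
  one l := by
    rw [dir_const_mul h.smooth, abs_mul]
    exact mul_le_mul_of_nonneg_left (h.one l) (abs_nonneg _)

theorem JetBound.sum {φ : Fin n → SpaceTime n → ℝ} (h : ∀ i, JetBound p (φ i) x y) :
    JetBound p (fun q => ∑ i, φ i q) (n * x) (n * y) where
  smooth := ContDiff.sum fun i _ => (h i).smooth
  zero := by simpa using abs_sum_le_card_mul (fun i => φ i p) fun i => (h i).zero
  one l := by
    rw [dir_sum fun i _ => (h i).smooth]
    simpa using abs_sum_le_card_mul (fun i => dir (ex l) (φ i) p) fun i => (h i).one l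

end JetBound

section Reaction

variable {n : ℕ} {c : ℝ} {b : SpaceTime n → ℝ} {O : Set (SpaceTime n)}

/-- Right-hand side of the equation for the first derivatives of a solution of
`∂ₛ b - b Δ b = c |∇ b|²`. -/
noncomputable def reac1 (c : ℝ) (b : SpaceTime n → ℝ) (k : Fin n) (p : SpaceTime n) : ℝ :=
  2 * c * ∑ i, dir (ex i) b p * dir (ex k) (dir (ex i) b) p + dir (ex k) b p * slap b p

/-- Right-hand side of the equation for the second derivatives. -/
noncomputable def reac2 (c : ℝ) (b : SpaceTime n → ℝ) (j k : Fin n) (p : SpaceTime n) : ℝ :=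
  2 * c * ∑ i, (dir (ex i) b p * dir (ex j) (dir (ex k) (dir (ex i) b)) p +
      dir (ex k) (dir (ex i) b) p * dir (ex j) (dir (ex i) b) p) +
    (dir (ex k) b p * ∑ i, dir (ex j) (dir (ex i) (dir (ex i) b)) p +
      slap b p * dir (ex j) (dir (ex k) b) p) +
    dir (ex j) b p * slap (dir (ex k) b) p

theorem contDiff_reac1_sum (hb : ContDiff ℝ (⊤ : ℕ∞) b) (k i : Fin n) :
    ContDiff ℝ (⊤ : ℕ∞) fun p => dir (ex i) b p * dir (ex k) (dir (ex i) b) p :=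
  (hb.dir_infty _).mul ((hb.dir_infty _).dir_infty _)

theorem dir_reac1 (hb : ContDiff ℝ (⊤ : ℕ∞) b) (j k : Fin n) (p : SpaceTime n) :
    dir (ex j) (reac1 c b k) p =
    2 * c * ∑ i, (dir (ex i) b p * dir (ex j) (dir (ex k) (dir (ex i) b)) p +
      dir (ex k) (dir (ex i) b) p * dir (ex j) (dir (ex i) b) p) +
    (dir (ex k) b p * ∑ i, dir (ex j) (dir (ex i) (dir (ex i) b)) p +
      slap b p * dir (ex j) (dir (ex k) b) p) := by
  have hs := fun i (_ : i ∈ Finset.univ) => contDiff_reac1_sum hb k i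
  have e : dir (ex j) (slap b) p = ∑ i, dir (ex j) (dir (ex i) (dir (ex i) b)) p := by
    have : slap b = fun x => ∑ i, dir (ex i) (dir (ex i) b) x := rfl
    rw [this, dir_sum fun i _ => (hb.dir_infty _).dir_infty _]
  have e2 : reac1 c b k = fun p => 2 * c * (∑ i, dir (ex i) b p * dir (ex k) (dir (ex i) b) p) +
    dir (ex k) b p * slap b p := rfl
  rw [e2, dir_add (contDiff_const.mul (ContDiff.sum hs)) ((hb.dir_infty _).mul (contDiff_slap hb)),
    dir_const_mul (ContDiff.sum hs), dir_sum hs, dir_mul (hb.dir_infty _) (contDiff_slap hb)]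
  simp only []
  rw [e]
  congr 2
  refine Finset.sum_congr rfl fun i _ => ?_
  rw [dir_mul (hb.dir_infty _) ((hb.dir_infty _).dir_infty _)]

theorem dir_congr_of_isOpen {φ ψ : SpaceTime n → ℝ} (hO : IsOpen O) (h : ∀ p ∈ O, φ p = ψ p)
    {p : SpaceTime n} (hp : p ∈ O) (v : SpaceTime n) : dir v φ p = dir v ψ p := by
  have : φ =ᶠ[𝓝 p] ψ := by
    filter_upwards [hO.mem_nhds hp] with q hq using h q hq
  rw [dir, dir, this.fderiv_eq]

theorem heatOp_first (hb : ContDiff ℝ (⊤ : ℕ∞) b) (hO : IsOpen O)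
    (heq : ∀ p ∈ O, heatOp b b p = c * ∑ i, dir (ex i) b p ^ 2) (k : Fin n) :
    ∀ p ∈ O, heatOp b (dir (ex k) b) p = reac1 c b k p := by
  intro p hp
  have hs := fun i (_ : i ∈ Finset.univ) => (hb.dir_infty (ex i : SpaceTime n)).pow 2
  rw [heatOp_dir hb hb, dir_congr_of_isOpen hO heq hp, dir_const_mul (ContDiff.sum hs),
    dir_sum hs, reac1, mul_comm 2 c, mul_assoc c 2, Finset.mul_sum (a := (2 : ℝ))]
  simp only []
  congr 2
  refine Finset.sum_congr rfl fun i _ => ?_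
  rw [dir_sq (hb.dir_infty _)]
  ring

theorem heatOp_second (hb : ContDiff ℝ (⊤ : ℕ∞) b) (hO : IsOpen O)
    (heq : ∀ p ∈ O, heatOp b b p = c * ∑ i, dir (ex i) b p ^ 2) (j k : Fin n) :
    ∀ p ∈ O, heatOp b (dir (ex j) (dir (ex k) b)) p = reac2 c b j k p := by
  intro p hp
  rw [heatOp_dir hb (hb.dir_infty _), dir_congr_of_isOpen hO (heatOp_first hb hO heq k) hp,
    dir_reac1 hb, reac2]

theorem heatOp_third (hb : ContDiff ℝ (⊤ : ℕ∞) b) (hO : IsOpen O)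
    (heq : ∀ p ∈ O, heatOp b b p = c * ∑ i, dir (ex i) b p ^ 2) (l j k : Fin n) :
    ∀ p ∈ O, heatOp b (dir (ex l) (dir (ex j) (dir (ex k) b))) p =
      dir (ex l) (reac2 c b j k) p + dir (ex l) b p * slap (dir (ex j) (dir (ex k) b)) p := by
  intro p hp
  rw [heatOp_dir hb ((hb.dir_infty _).dir_infty _),
    dir_congr_of_isOpen hO (heatOp_second hb hO heq j k) hp]

theorem abs_slap_le {φ : SpaceTime n → ℝ} {p : SpaceTime n} {x : ℝ}
    (h : ∀ i, |dir (ex i) (dir (ex i) φ) p| ≤ x) : |slap φ p| ≤ n * x := by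
  have := abs_sum_le_card_mul (fun i => dir (ex i) (dir (ex i) φ) p) h
  rwa [Fintype.card_fin] at this

variable {p : SpaceTime n} {m1 m2 m3 m4 : ℝ}

theorem jetBound_reac1 (hb : ContDiff ℝ (⊤ : ℕ∞) b) (h1 : ∀ i, |dir (ex i) b p| ≤ m1)
    (h2 : ∀ i j, |dir (ex i) (dir (ex j) b) p| ≤ m2)
    (h3 : ∀ i j k, |dir (ex i) (dir (ex j) (dir (ex k) b)) p| ≤ m3) (k : Fin n) :
    JetBound p (reac1 c b k) (|2 * c| * (n * (m1 * m2)) + m1 * (n * m2))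
      (|2 * c| * (n * (m1 * m3 + m2 * m2)) + (m1 * (n * m3) + n * m2 * m2)) := by
  have j1 : ∀ i, JetBound p (dir (ex i) b) m1 m2 := fun i => ⟨hb.dir_infty _, h1 i, fun l => h2 l i⟩
  have j2 : ∀ i j, JetBound p (dir (ex i) (dir (ex j) b)) m2 m3 :=
    fun i j => ⟨(hb.dir_infty _).dir_infty _, h2 i j, fun l => h3 l i j⟩
  exact ((JetBound.sum fun i => (j1 i).mul (j2 k i)).const_mul (2 * c)).add
    ((j1 k).mul (JetBound.sum fun i => j2 i i))

theorem jetBound_reac2 (hb : ContDiff ℝ (⊤ : ℕ∞) b) (h1 : ∀ i, |dir (ex i) b p| ≤ m1)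
    (h2 : ∀ i j, |dir (ex i) (dir (ex j) b) p| ≤ m2)
    (h3 : ∀ i j k, |dir (ex i) (dir (ex j) (dir (ex k) b)) p| ≤ m3)
    (h4 : ∀ i j k l, |dir (ex i) (dir (ex j) (dir (ex k) (dir (ex l) b))) p| ≤ m4) (j k : Fin n) :
    JetBound p (reac2 c b j k)
      (|2 * c| * (n * (m1 * m3 + m2 * m2)) + (m1 * (n * m3) + n * m2 * m2) + m1 * (n * m3))
      (|2 * c| * (n * ((m1 * m4 + m3 * m2) + (m2 * m3 + m2 * m3))) +
        ((m1 * (n * m4) + n * m3 * m2) + (n * m2 * m3 + m2 * (n * m3))) +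
        (m1 * (n * m4) + n * m3 * m2)) := by
  have j1 : ∀ i, JetBound p (dir (ex i) b) m1 m2 := fun i => ⟨hb.dir_infty _, h1 i, fun l => h2 l i⟩
  have j2 : ∀ i j, JetBound p (dir (ex i) (dir (ex j) b)) m2 m3 :=
    fun i j => ⟨(hb.dir_infty _).dir_infty _, h2 i j, fun l => h3 l i j⟩
  have j3 : ∀ i j k, JetBound p (dir (ex i) (dir (ex j) (dir (ex k) b))) m3 m4 :=
    fun i j k => ⟨((hb.dir_infty _).dir_infty _).dir_infty _, h3 i j k, fun l => h4 l i j k⟩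
  exact (((JetBound.sum fun i => ((j1 i).mul (j3 j k i)).add
    ((j2 k i).mul (j2 j i))).const_mul (2 * c)).add
    (((j1 k).mul (JetBound.sum fun i => j3 j i i)).add ((JetBound.sum fun i => j2 i i).mul (j2 j k)))).add
    ((j1 j).mul (JetBound.sum fun i => j3 i i k))

end Reaction

section ThirdDerivatives

variable {n : ℕ} {c : ℝ} {b : SpaceTime n → ℝ} {O : Set (SpaceTime n)}

theorem exists_first_derivative_bound (n : ℕ) (c : ℝ) {a0 : ℝ} (a1 : ℝ) (ha0 : 0 < a0) :
    ∃ μ, 0 < μ ∧ ∀ ρ, 0 < ρ → ∃ C, 0 ≤ C ∧ ∀ (b : SpaceTime n → ℝ) (d : ℝ) (O : Set (SpaceTime n)),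
      ContDiff ℝ (⊤ : ℕ∞) b → IsOpen O → backCyl n ρ ⊆ O →
      (∀ p ∈ O, heatOp b b p = c * ∑ i, dir (ex i) b p ^ 2) →
      (∀ p ∈ backCyl n ρ, a0 ≤ b p ∧ b p ≤ a1) → (∀ p ∈ backCyl n ρ, |b p - d| ≤ μ) →
      ∀ p ∈ backCyl n (ρ / 2), sqSum (gradFam fun _ : Unit => b) p ≤ C := by
  obtain ⟨A, hA⟩ : ∃ A, A = 2 * |c| * n + n + |c| + 1 := ⟨_, rfl⟩
  have hA0 : 0 < A := by rw [hA]; positivity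
  obtain ⟨μ, hμ⟩ : ∃ μ, μ = a0 / (8 * A * (4 * n + 1)) := ⟨_, rfl⟩
  have hμ0 : 0 < μ := by rw [hμ]; positivity
  have hμA : 8 * A * (4 * n + 1) * μ = a0 := by rw [hμ]; field_simp
  refine ⟨μ, hμ0, fun ρ hρ => ?_⟩
  have s1 : 16 * ((Fintype.card Unit : ℝ) * n) ^ 2 * A ^ 2 * (64 * μ ^ 2) ≤ a0 ^ 2 := by
    have e : 16 * ((Fintype.card Unit : ℝ) * n) ^ 2 * A ^ 2 * (64 * μ ^ 2) =
      (32 * A * n * μ) ^ 2 := by rw [Fintype.card_unit]; push_cast; ring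
    rw [e]
    have : 0 ≤ 8 * A * μ := by positivity
    refine pow_le_pow_left₀ (by positivity) ?_ 2
    linarith
  have s2 : 8 * (Fintype.card Unit : ℝ) * μ * A ≤ a0 := by
    have : 0 ≤ 8 * A * (4 * n) * μ := by positivity
    rw [Fintype.card_unit]
    push_cast
    linarith
  obtain ⟨C, hC, H⟩ := exists_gradient_bound n Unit (a1 := a1) (B := 0) ha0 hA0.le le_rfl
    (K := 64 * μ ^ 2) (by positivity) hμ0.le hρ s1 s2
  refine ⟨C, hC, fun b d O hb hO hsub heq hbb hbd => ?_⟩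
  have hcn : 0 ≤ |c| * n := by positivity
  refine H b (fun _ => b) (fun _ => d) (fun _ => hb) hbb (fun p hp _ => hbd p hp) ?_ ?_ ?_
  · intro p hp
    have : (b p - d) ^ 2 ≤ μ ^ 2 := sq_le_sq' (neg_le_of_abs_le (hbd p hp)) (le_of_abs_le (hbd p hp))
    simpa [sqSum] using this
  · intro p hp k
    have e : sqSum (gradFam fun _ : Unit => b) p = ∑ i, dir (ex i) b p ^ 2 := by
      rw [sqSum, Fintype.sum_prod_type]
      simp [gradFam]
    have h0 := sqSum_nonneg (gradFam fun _ : Unit => b) p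
    rw [heq p (hsub hp), ← e, abs_mul, abs_of_nonneg h0, zero_mul, add_zero]
    exact mul_le_mul_of_nonneg_right (by rw [hA]; have : (0 : ℝ) ≤ n := by positivity
                                         linarith) h0
  · rintro p hp ⟨-, k⟩
    have hz := (jetBound_reac1 (c := c) (p := p) hb
      (fun i => abs_le_sqrt_sqSum (gradFam fun _ : Unit => b) ((), i) p)
      (fun i j => abs_le_sqrt_sqSum (gradFam (gradFam fun _ : Unit => b)) (((), j), i) p)
      (fun i j k => abs_le_sqrt_sqSum (gradFam (gradFam (gradFam fun _ : Unit => b)))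
        ((((), k), j), i) p) k).zero
    rw [show gradFam (fun _ : Unit => b) ((), k) = dir (ex k) b from rfl,
      heatOp_first hb hO heq k p (hsub hp), zero_mul, add_zero]
    refine hz.trans ?_
    rw [abs_mul, abs_two, hA]
    have : 0 ≤ (|c| + 1) * (√(sqSum (gradFam fun _ : Unit => b) p) *
      √(sqSum (gradFam (gradFam fun _ : Unit => b)) p)) := by positivity
    linarith

theorem exists_second_derivative_bound (n : ℕ) (c : ℝ) {a0 : ℝ} (a1 : ℝ) (ha0 : 0 < a0) {ρ M : ℝ}
    (hρ : 0 < ρ) (hM : 0 ≤ M) : ∃ C, 0 ≤ C ∧ ∀ (b : SpaceTime n → ℝ) (O : Set (SpaceTime n)),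
      ContDiff ℝ (⊤ : ℕ∞) b → IsOpen O → backCyl n ρ ⊆ O →
      (∀ p ∈ O, heatOp b b p = c * ∑ i, dir (ex i) b p ^ 2) →
      (∀ p ∈ backCyl n ρ, a0 ≤ b p ∧ b p ≤ a1) →
      (∀ p ∈ backCyl n ρ, sqSum (gradFam fun _ : Unit => b) p ≤ M ^ 2) →
      ∀ p ∈ backCyl n (ρ / 2), sqSum (gradFam (gradFam fun _ : Unit => b)) p ≤ C := by
  obtain ⟨C, hC, H⟩ := exists_gradient_bound n (Unit × Fin n) (a1 := a1) (A := 0)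
    (B := (2 * |c| * n + 2 * n) * (M + 1)) (K := 64 * M ^ 2 + 1) (μ := M) ha0 le_rfl (by positivity)
    (by positivity) hM hρ (by simp; positivity) (by simpa using ha0.le)
  refine ⟨C, hC, fun b O hb hO hsub heq hbb hb1 => ?_⟩
  have hd1 : ∀ p ∈ backCyl n ρ, ∀ i, |dir (ex i) b p| ≤ M := fun p hp i =>
    (abs_le_sqrt_sqSum (gradFam fun _ : Unit => b) ((), i) p).trans
      (Real.sqrt_le_iff.2 ⟨hM, hb1 p hp⟩)
  refine H b (gradFam fun _ : Unit => b) (fun _ => 0) (contDiff_gradFam fun _ => hb) hbb ?_ ?_ ?_ ?_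
  · rintro p hp ⟨-, i⟩
    rw [sub_zero]
    exact hd1 p hp i
  · intro p hp
    simp only [sub_zero]
    have := hb1 p hp
    change sqSum (gradFam fun _ : Unit => b) p ≤ _
    linarith
  · rintro p hp ⟨-, k⟩
    have hz := (jetBound_reac1 (c := c) (p := p) hb (hd1 p hp)
      (fun i j => abs_le_sqrt_sqSum (gradFam (gradFam fun _ : Unit => b)) (((), j), i) p)
      (fun i j k => abs_le_sqrt_sqSum (gradFam (gradFam (gradFam fun _ : Unit => b)))
        ((((), k), j), i) p) k).zero
    rw [show gradFam (fun _ : Unit => b) ((), k) = dir (ex k) b from rfl,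
      heatOp_first hb hO heq k p (hsub hp), zero_mul, zero_add]
    refine hz.trans ?_
    rw [abs_mul, abs_two]
    obtain ⟨x, hx⟩ : ∃ x, x = √(sqSum (gradFam (gradFam fun _ : Unit => b)) p) := ⟨_, rfl⟩
    rw [← hx]
    have hx0 : 0 ≤ x := by rw [hx]; positivity
    have t1 : 0 ≤ |c| * n * x := by positivity
    have t2 : 0 ≤ n * x := by positivity
    have t3 : 0 ≤ |c| * n * M := by positivity
    have t4 : 0 ≤ n * M := by positivity
    have t5 : 0 ≤ |c| * n := by positivity
    have t6 : (0 : ℝ) ≤ n := by positivity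
    have t7 : 0 ≤ n * M * x := by positivity
    linarith
  · rintro p hp ⟨⟨-, k⟩, j⟩
    have hz := (jetBound_reac2 (c := c) (p := p) hb (hd1 p hp)
      (fun i j => abs_le_sqrt_sqSum (gradFam (gradFam fun _ : Unit => b)) (((), j), i) p)
      (fun i j k => abs_le_sqrt_sqSum (gradFam (gradFam (gradFam fun _ : Unit => b)))
        ((((), k), j), i) p)
      (fun i j k l => abs_le_sqrt_sqSum (gradFam (gradFam (gradFam (gradFam fun _ : Unit => b))))
        (((((), l), k), j), i) p) j k).zero
    rw [show gradFam (gradFam fun _ : Unit => b) (((), k), j) = dir (ex j) (dir (ex k) b) from rfl,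
      heatOp_second hb hO heq j k p (hsub hp), zero_mul, zero_mul, zero_add]
    refine hz.trans ?_
    rw [abs_mul, abs_two]
    obtain ⟨x, hx⟩ : ∃ x, x = √(sqSum (gradFam (gradFam fun _ : Unit => b)) p) := ⟨_, rfl⟩
    have hx2 : sqSum (gradFam (gradFam fun _ : Unit => b)) p = x ^ 2 := by
      rw [hx, Real.sq_sqrt (sqSum_nonneg _ _)]
    rw [← hx, hx2]
    obtain ⟨y, hy⟩ : ∃ y, y = √(sqSum (gradFam (gradFam (gradFam fun _ : Unit => b))) p) :=
      ⟨_, rfl⟩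
    rw [← hy]
    have hx0 : 0 ≤ x := by rw [hx]; positivity
    have hy0 : 0 ≤ y := by rw [hy]; positivity
    have t1 : 0 ≤ |c| * n * y := by positivity
    have t2 : 0 ≤ n * y := by positivity
    have t3 : 0 ≤ |c| * n * M := by positivity
    have t4 : 0 ≤ n * M := by positivity
    have t5 : 0 ≤ |c| * n := by positivity
    have t6 : (0 : ℝ) ≤ n := by positivity
    have t7 : 0 ≤ n * M * x ^ 2 := by positivity
    have t8 : 0 ≤ |c| * n * M * x ^ 2 := by positivity
    have t9 : 0 ≤ n * x ^ 2 := by positivity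
    linarith

theorem exists_third_derivative_bound (n : ℕ) (c : ℝ) {a0 : ℝ} (a1 : ℝ) (ha0 : 0 < a0) {ρ M M' : ℝ}
    (hρ : 0 < ρ) (hM : 0 ≤ M) (hM' : 0 ≤ M') :
    ∃ C, 0 ≤ C ∧ ∀ (b : SpaceTime n → ℝ) (O : Set (SpaceTime n)),
      ContDiff ℝ (⊤ : ℕ∞) b → IsOpen O → backCyl n ρ ⊆ O →
      (∀ p ∈ O, heatOp b b p = c * ∑ i, dir (ex i) b p ^ 2) →
      (∀ p ∈ backCyl n ρ, a0 ≤ b p ∧ b p ≤ a1) →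
      (∀ p ∈ backCyl n ρ, sqSum (gradFam fun _ : Unit => b) p ≤ M ^ 2) →
      (∀ p ∈ backCyl n ρ, sqSum (gradFam (gradFam fun _ : Unit => b)) p ≤ M' ^ 2) →
      ∀ p ∈ backCyl n (ρ / 2), sqSum (gradFam (gradFam (gradFam fun _ : Unit => b))) p ≤ C := by
  obtain ⟨C, hC, H⟩ := exists_gradient_bound n ((Unit × Fin n) × Fin n) (a1 := a1) (A := 0)
    (B := (6 * |c| * n + 4 * n) * (M + M' + M' ^ 2)) (K := 64 * M' ^ 2 + 1) (μ := M') ha0 le_rfl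
    (by positivity) (by positivity) hM' hρ (by simp; positivity) (by simpa using ha0.le)
  refine ⟨C, hC, fun b O hb hO hsub heq hbb hb1 hb2 => ?_⟩
  have hd1 : ∀ p ∈ backCyl n ρ, ∀ i, |dir (ex i) b p| ≤ M := fun p hp i =>
    (abs_le_sqrt_sqSum (gradFam fun _ : Unit => b) ((), i) p).trans
      (Real.sqrt_le_iff.2 ⟨hM, hb1 p hp⟩)
  have hd2 : ∀ p ∈ backCyl n ρ, ∀ i j, |dir (ex i) (dir (ex j) b) p| ≤ M' := fun p hp i j =>
    (abs_le_sqrt_sqSum (gradFam (gradFam fun _ : Unit => b)) (((), j), i) p).trans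
      (Real.sqrt_le_iff.2 ⟨hM', hb2 p hp⟩)
  refine H b (gradFam (gradFam fun _ : Unit => b)) (fun _ => 0)
    (contDiff_gradFam (contDiff_gradFam fun _ => hb)) hbb ?_ ?_ ?_ ?_
  · rintro p hp ⟨⟨-, j⟩, i⟩
    rw [sub_zero]
    exact hd2 p hp i j
  · intro p hp
    simp only [sub_zero]
    have := hb2 p hp
    change sqSum (gradFam (gradFam fun _ : Unit => b)) p ≤ _
    linarith
  · rintro p hp ⟨⟨-, k⟩, j⟩
    have hz := (jetBound_reac2 (c := c) (p := p) hb (hd1 p hp) (hd2 p hp)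
      (fun i j k => abs_le_sqrt_sqSum (gradFam (gradFam (gradFam fun _ : Unit => b)))
        ((((), k), j), i) p)
      (fun i j k l => abs_le_sqrt_sqSum (gradFam (gradFam (gradFam (gradFam fun _ : Unit => b))))
        (((((), l), k), j), i) p) j k).zero
    rw [show gradFam (gradFam fun _ : Unit => b) (((), k), j) = dir (ex j) (dir (ex k) b) from rfl,
      heatOp_second hb hO heq j k p (hsub hp), zero_mul, zero_add]
    refine hz.trans ?_
    rw [abs_mul, abs_two]
    obtain ⟨y, hy⟩ : ∃ y, y = √(sqSum (gradFam (gradFam (gradFam fun _ : Unit => b))) p) :=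
      ⟨_, rfl⟩
    rw [← hy]
    have hy0 : 0 ≤ y := by rw [hy]; positivity
    have t1 : 0 ≤ |c| * n * M * y := by positivity
    have t2 : 0 ≤ n * M * y := by positivity
    have t3 : 0 ≤ (6 * |c| * n + 4 * n) * (M' + M' ^ 2) * y := by positivity
    have t4 : 0 ≤ |c| * n * M' ^ 2 := by positivity
    have t5 : 0 ≤ n * M' ^ 2 := by positivity
    have t6 : 0 ≤ (6 * |c| * n + 4 * n) * (M + M') := by positivity
    linarith
  · rintro p hp ⟨⟨⟨-, k⟩, j⟩, l⟩
    obtain ⟨y, hy⟩ : ∃ y, y = √(sqSum (gradFam (gradFam (gradFam fun _ : Unit => b))) p) :=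
      ⟨_, rfl⟩
    obtain ⟨z, hz⟩ : ∃ z,
      z = √(sqSum (gradFam (gradFam (gradFam (gradFam fun _ : Unit => b)))) p) := ⟨_, rfl⟩
    have hd4 : ∀ i j k l, |dir (ex i) (dir (ex j) (dir (ex k) (dir (ex l) b))) p| ≤ z := by
      intro i j k l
      rw [hz]
      exact abs_le_sqrt_sqSum (gradFam (gradFam (gradFam (gradFam fun _ : Unit => b))))
        (((((), l), k), j), i) p
    have hd3 : ∀ i j k, |dir (ex i) (dir (ex j) (dir (ex k) b)) p| ≤ y := by
      intro i j k
      rw [hy]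
      exact abs_le_sqrt_sqSum (gradFam (gradFam (gradFam fun _ : Unit => b))) ((((), k), j), i) p
    have hone := (jetBound_reac2 (c := c) (p := p) hb (hd1 p hp) (hd2 p hp) hd3 hd4 j k).one l
    have hy2 : sqSum (gradFam (gradFam (gradFam fun _ : Unit => b))) p = y ^ 2 := by
      rw [hy, Real.sq_sqrt (sqSum_nonneg _ _)]
    have hprod : |dir (ex l) b p * slap (dir (ex j) (dir (ex k) b)) p| ≤ M * (n * z) := by
      rw [abs_mul]
      exact mul_le_mul (hd1 p hp l) (abs_slap_le fun i => hd4 i i j k) (abs_nonneg _) hM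
    rw [show gradFam (gradFam (gradFam fun _ : Unit => b)) ((((), k), j), l) =
      dir (ex l) (dir (ex j) (dir (ex k) b)) from rfl,
      heatOp_third hb hO heq l j k p (hsub hp), ← hy, ← hz, hy2, zero_mul, zero_mul, zero_add]
    refine (abs_add_le _ _).trans ((add_le_add hone hprod).trans ?_)
    rw [abs_mul, abs_two]
    have hy0 : 0 ≤ y := by rw [hy]; positivity
    have hz0 : 0 ≤ z := by rw [hz]; positivity
    have hyy : y ≤ 1 + y ^ 2 := by nlinarith [sq_nonneg (y - 1)]
    have t0 := mul_le_mul_of_nonneg_left hyy (by positivity : 0 ≤ (6 * |c| * n + 4 * n) * M')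
    have t1 : 0 ≤ |c| * n * M * z := by positivity
    have t2 : 0 ≤ n * M * z := by positivity
    have t3 : 0 ≤ (6 * |c| * n + 4 * n) * (M' + M' ^ 2) * z := by positivity
    have t4 : 0 ≤ (6 * |c| * n + 4 * n) * (M + M' ^ 2) * (1 + y ^ 2) := by positivity
    have t5 : 0 ≤ |c| * n * M' * y := by positivity
    have t6 : 0 ≤ n * M' * y := by positivity
    linarith

/-- Uniform interior bounds for the derivatives up to third order of solutions of
`∂ₛ b - b Δ b = c |∇ b|²` with small oscillation. -/
theorem exists_derivative_bounds (n : ℕ) (c : ℝ) {a0 : ℝ} (a1 : ℝ) (ha0 : 0 < a0) :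
    ∃ μ, 0 < μ ∧ ∀ ρ, 0 < ρ → ∃ C, 0 ≤ C ∧ ∀ (b : SpaceTime n → ℝ) (d : ℝ) (O : Set (SpaceTime n)),
      ContDiff ℝ (⊤ : ℕ∞) b → IsOpen O → backCyl n ρ ⊆ O →
      (∀ p ∈ O, heatOp b b p = c * ∑ i, dir (ex i) b p ^ 2) →
      (∀ p ∈ backCyl n ρ, a0 ≤ b p ∧ b p ≤ a1) → (∀ p ∈ backCyl n ρ, |b p - d| ≤ μ) →
      ∀ p ∈ backCyl n (ρ / 8), (∀ i, |dir (ex i) b p| ≤ C) ∧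
        (∀ i j, |dir (ex i) (dir (ex j) b) p| ≤ C) ∧
        ∀ i j k, |dir (ex i) (dir (ex j) (dir (ex k) b)) p| ≤ C := by
  obtain ⟨μ, hμ, H⟩ := exists_first_derivative_bound n c a1 ha0
  refine ⟨μ, hμ, fun ρ hρ => ?_⟩
  obtain ⟨C1, h1, H1⟩ := H ρ hρ
  obtain ⟨C2, h2, H2⟩ := exists_second_derivative_bound n c a1 ha0 (ρ := ρ / 2) (M := √C1)
    (by linarith) (Real.sqrt_nonneg _)
  obtain ⟨C3, h3, H3⟩ := exists_third_derivative_bound n c a1 ha0 (ρ := ρ / 4) (M := √C1)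
    (M' := √C2) (by linarith) (Real.sqrt_nonneg _) (Real.sqrt_nonneg _)
  refine ⟨√C1 + √C2 + √C3, by positivity, fun b d O hb hO hsub heq hbb hbd p hp => ?_⟩
  have i1 : ∀ q ∈ backCyl n (ρ / 2), sqSum (gradFam fun _ : Unit => b) q ≤ C1 :=
    H1 b d O hb hO hsub heq hbb hbd
  have s2 : backCyl n (ρ / 2) ⊆ backCyl n ρ := backCyl_mono (by linarith)
  have s4 : backCyl n (ρ / 4) ⊆ backCyl n (ρ / 2) := backCyl_mono (by linarith)
  have s8 : backCyl n (ρ / 8) ⊆ backCyl n (ρ / 4) := backCyl_mono (by linarith)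
  have i2 : ∀ q ∈ backCyl n (ρ / 4), sqSum (gradFam (gradFam fun _ : Unit => b)) q ≤ C2 := by
    have := H2 b O hb hO (s2.trans hsub) heq (fun q hq => hbb q (s2 hq)) fun q hq => by
      rw [Real.sq_sqrt h1]; exact i1 q hq
    rwa [show ρ / 2 / 2 = ρ / 4 by ring] at this
  have i3 : sqSum (gradFam (gradFam (gradFam fun _ : Unit => b))) p ≤ C3 := by
    refine H3 b O hb hO (s4.trans (s2.trans hsub)) heq (fun q hq => hbb q (s2 (s4 hq)))
      (fun q hq => by rw [Real.sq_sqrt h1]; exact i1 q (s4 hq))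
      (fun q hq => by rw [Real.sq_sqrt h2]; exact i2 q hq) p ?_
    rwa [show ρ / 4 / 2 = ρ / 8 by ring]
  have n1 := Real.sqrt_nonneg C1
  have n2 := Real.sqrt_nonneg C2
  have n3 := Real.sqrt_nonneg C3
  refine ⟨fun i => ?_, fun i j => ?_, fun i j k => ?_⟩
  · have := (abs_le_sqrt_sqSum (gradFam fun _ : Unit => b) ((), i) p).trans
      (Real.sqrt_le_sqrt (i1 p (s4 (s8 hp))))
    exact this.trans (by linarith)
  · have := (abs_le_sqrt_sqSum (gradFam (gradFam fun _ : Unit => b)) (((), j), i) p).trans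
      (Real.sqrt_le_sqrt (i2 p (s8 hp)))
    exact this.trans (by linarith)
  · have := (abs_le_sqrt_sqSum (gradFam (gradFam (gradFam fun _ : Unit => b))) ((((), k), j), i)
      p).trans (Real.sqrt_le_sqrt i3)
    exact this.trans (by linarith)

end ThirdDerivatives

section Pressure

variable {X : Type*} [NormedAddCommGroup X] [NormedSpace ℝ X]

theorem dir_rpow {w : X → ℝ} (hw : ContDiff ℝ (⊤ : ℕ∞) w) (hpos : ∀ p, 0 < w p) (s : ℝ) (v : X) :
    dir v (fun q => w q ^ s) = fun p => s * w p ^ (s - 1) * dir v w p := by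
  funext p
  exact dir_comp_apply (G := fun x => x ^ s) (hasDerivAt_rpow_const (Or.inl (hpos p).ne'))
    (hw.differentiable_infty p) v

theorem dir_dir_rpow {w : X → ℝ} (hw : ContDiff ℝ (⊤ : ℕ∞) w) (hpos : ∀ p, 0 < w p) (s : ℝ)
    (v : X) (p : X) :
    dir v (dir v fun q => w q ^ s) p =
      s * (s - 1) * w p ^ (s - 2) * dir v w p ^ 2 + s * w p ^ (s - 1) * dir v (dir v w) p := by
  have hr : ∀ q : ℝ, ContDiff ℝ (⊤ : ℕ∞) fun p => w p ^ q := fun q =>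
    hw.rpow_const_of_ne fun p => (hpos p).ne'
  rw [dir_rpow hw hpos s v, dir_mul (contDiff_const.mul (hr (s - 1))) (hw.dir_infty v) v,
    dir_const_mul (hr (s - 1)) s v, dir_rpow hw hpos (s - 1) v]
  simp only []
  rw [show s - 1 - 1 = s - 2 by ring]
  ring

variable {n : ℕ}

/-- The pressure of a solution solves a quasilinear equation with itself as diffusivity. -/
theorem heatOp_pressure {m : ℝ} (hm : m ≠ 1) {w : SpaceTime n → ℝ}
    (hw : ContDiff ℝ (⊤ : ℕ∞) w) (hpos : ∀ p, 0 < w p) {p : SpaceTime n}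
    (hpde : dir (et n) w p = ∑ i, dir (ex i) (dir (ex i) fun q => w q ^ m) p) :
    heatOp (fun q => m * w q ^ (m - 1)) (fun q => m * w q ^ (m - 1)) p =
      1 / (m - 1) * ∑ i, dir (ex i) (fun q => m * w q ^ (m - 1)) p ^ 2 := by
  have hr : ∀ q : ℝ, ContDiff ℝ (⊤ : ℕ∞) fun p => w p ^ q := fun q =>
    hw.rpow_const_of_ne fun p => (hpos p).ne'
  have hdir : ∀ v, dir v (fun q => m * w q ^ (m - 1)) =
      fun q => m * dir v (fun q => w q ^ (m - 1)) q := fun v => dir_const_mul (hr _) m v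
  have hm' : m - 1 ≠ 0 := sub_ne_zero.2 hm
  have hp := hpos p
  have e2 : w p ^ (m - 2) = w p ^ (m - 1) / w p := by
    rw [show m - 2 = m - 1 - 1 by ring, rpow_sub_one hp.ne']
  have e3 : w p ^ (m - 1 - 2) = w p ^ (m - 1) / w p / w p := by
    rw [show m - 1 - 2 = m - 2 - 1 by ring, rpow_sub_one hp.ne', e2]
  have e4 : w p ^ (m - 1 - 1) = w p ^ (m - 1) / w p := rpow_sub_one hp.ne' _
  simp only [dir_dir_rpow hw hpos] at hpde
  simp only [heatOp, slap, hdir, dir_const_mul ((hr (m - 1)).dir_infty _), dir_dir_rpow hw hpos]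
  simp only [dir_rpow hw hpos, hpde]
  rw [e2, e3, e4]
  simp only [Finset.mul_sum, ← Finset.sum_sub_distrib]
  refine Finset.sum_congr rfl fun i _ => ?_
  field_simp
  ring

end Pressure

section Blowup

variable {n : ℕ}

theorem dir_dilate_apply {φ : EuclideanSpace ℝ (Fin n) → ℝ} (k : ℝ) (x v : EuclideanSpace ℝ (Fin n))
    (hφ : DifferentiableAt ℝ φ (k • x)) :
    dir v (fun y => φ (k • y)) x = k * dir v φ (k • x) := by
  have h : HasFDerivAt (fun y => φ (k • y)) ((fderiv ℝ φ (k • x)).comp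
      (k • ContinuousLinearMap.id ℝ (EuclideanSpace ℝ (Fin n)))) x :=
    hφ.hasFDerivAt.comp x ((hasFDerivAt_id x).const_smul k)
  simp [dir, h.fderiv]

theorem lap_dilate {φ : EuclideanSpace ℝ (Fin n) → ℝ} (hφ : ContDiff ℝ 2 φ) (k c : ℝ)
    (x : EuclideanSpace ℝ (Fin n)) :
    lap n (fun y => c * φ (k • y)) x = c * k ^ 2 * lap n φ (k • x) := by
  have hd : ∀ v, ContDiff ℝ 1 (dir v φ) := fun v => ContDiff.dir (k := 1) (by norm_num; exact hφ) v
  have hk : ∀ ψ : EuclideanSpace ℝ (Fin n) → ℝ, ContDiff ℝ 1 ψ → ∀ y,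
      DifferentiableAt ℝ (fun y => ψ (k • y)) y := fun ψ hψ y =>
    ((hψ.comp (contDiff_const_smul k)).differentiable (by simp)) y
  have key : ∀ c' (ψ : EuclideanSpace ℝ (Fin n) → ℝ), ContDiff ℝ 1 ψ → ∀ v,
      dir v (fun y => c' * ψ (k • y)) = fun y => c' * k * dir v ψ (k • y) := by
    intro c' ψ hψ v
    funext y
    rw [dir_comp_apply (G := fun x => c' * x) (φ := fun y => ψ (k • y)) (G' := c')
      (((hasDerivAt_id _).const_mul c').congr_deriv (by simp)) (hk ψ hψ y),
      dir_dilate_apply k y v (hψ.differentiable (by simp) _)]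
    ring
  simp only [lap_eq_dir]
  rw [Finset.mul_sum]
  refine Finset.sum_congr rfl fun i _ => ?_
  rw [key c φ (hφ.of_le (by norm_num)), key _ _ (hd _)]
  ring

theorem dir_ex_slice {g : SpaceTime n → ℝ} (i : Fin n) (y : EuclideanSpace ℝ (Fin n)) (s : ℝ)
    (hg : DifferentiableAt ℝ g (y, s)) :
    dir (ex i) g (y, s) = dir (EuclideanSpace.single i (1 : ℝ)) (fun y => g (y, s)) y := by
  have h : HasFDerivAt (fun y => g (y, s)) ((fderiv ℝ g (y, s)).comp
      (ContinuousLinearMap.inl ℝ _ ℝ)) y :=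
    hg.hasFDerivAt.comp y (f := fun y => (y, s)) ((hasFDerivAt_id y).prodMk (hasFDerivAt_const s y))
  simp [dir, h.fderiv, ex]

theorem slap_eq_lap {g : SpaceTime n → ℝ} (hg : ContDiff ℝ (⊤ : ℕ∞) g)
    (y : EuclideanSpace ℝ (Fin n)) (s : ℝ) :
    slap g (y, s) = lap n (fun y => g (y, s)) y := by
  simp only [slap, lap_eq_dir]
  refine Finset.sum_congr rfl fun i _ => ?_
  rw [dir_ex_slice i y s ((hg.dir_infty _).differentiable_infty _)]
  congr 1
  funext z
  exact dir_ex_slice i z s (hg.differentiable_infty _)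

theorem hasDerivAt_slice {g : SpaceTime n → ℝ} (hg : ContDiff ℝ (⊤ : ℕ∞) g)
    (y : EuclideanSpace ℝ (Fin n)) (s : ℝ) :
    HasDerivAt (fun s => g (y, s)) (dir (et n) g (y, s)) s :=
  ((hg.differentiable_infty (y, s)).hasFDerivAt).comp_hasDerivAt s (f := fun s => (y, s))
    ((hasDerivAt_const s y).prodMk (hasDerivAt_id s))

/-- The rescaled solution centred at the extinction time, with time variable normalised by the
remaining life time `θ`. -/
noncomputable def blowup (β α T : ℝ) (u : EuclideanSpace ℝ (Fin n) → ℝ → ℝ) (θ : ℝ) :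
    SpaceTime n → ℝ :=
  fun p => θ ^ (-α) * u (θ ^ (-β) • p.1) (T - θ * (1 - p.2))

theorem blowup_time_mem {T θ s : ℝ} (hθ : θ ∈ Ioc 0 (T / 4)) (hs : |s| < 1) :
    T - θ * (1 - s) ∈ Ioo (T / 2) T := by
  obtain ⟨h1, h2⟩ := abs_lt.1 hs
  have a := mul_pos hθ.1 (show 0 < 1 - s by linarith)
  have b := mul_lt_mul_of_pos_left (show 1 - s < 2 by linarith) hθ.1
  exact ⟨by linarith [hθ.2], by linarith⟩

variable {m β α T : ℝ} {h h1 h2 lo up : ℝ → ℝ} {u : EuclideanSpace ℝ (Fin n) → ℝ → ℝ} {θ : ℝ}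

theorem Sandwich.blowup_mem (S : Sandwich n m β α T h h1 h2 lo up u) (hθ : θ ∈ Ioc 0 (T / 4)) {s : ℝ}
    (hs : |s| < 1) : T - θ * (1 - s) ∈ Ioo 0 T :=
  ⟨by linarith [(blowup_time_mem hθ hs).1, S.hT], (blowup_time_mem hθ hs).2⟩

theorem Sandwich.blowup_pos (S : Sandwich n m β α T h h1 h2 lo up u) (hθ : θ ∈ Ioc 0 (T / 4))
    {p : SpaceTime n} (hp : |p.2| < 1) : 0 < blowup β α T u θ p :=
  mul_pos (rpow_pos_of_pos hθ.1 _) (S.pos _ _ (S.blowup_mem hθ hp))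

theorem Sandwich.contDiffAt_blowup (S : Sandwich n m β α T h h1 h2 lo up u)
    (hθ : θ ∈ Ioc 0 (T / 4)) {p : SpaceTime n} (hp : |p.2| < 1) :
    ContDiffAt ℝ (⊤ : ℕ∞) (blowup β α T u θ) p :=
  contDiffAt_const.mul ((S.contDiffAt (θ ^ (-β) • p.1) (S.blowup_mem hθ hp)).comp p
    (f := fun p : SpaceTime n => (θ ^ (-β) • p.1, T - θ * (1 - p.2)))
    (ContDiff.contDiffAt (by fun_prop)))

/-- The blow-up agrees for times in `[-1/2,1/2]` with a globally smooth positive function. -/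
theorem Sandwich.exists_smooth_blowup (S : Sandwich n m β α T h h1 h2 lo up u)
    (hθ : θ ∈ Ioc 0 (T / 4)) : ∃ W : SpaceTime n → ℝ, ContDiff ℝ (⊤ : ℕ∞) W ∧ (∀ p, 0 < W p) ∧
      ∀ p, |p.2| ≤ 1 / 2 → W p = blowup β α T u θ p := by
  obtain ⟨χ, hχ⟩ : ∃ χ : ContDiffBump (0 : ℝ), χ.rIn = 1 / 2 ∧ χ.rOut = 3 / 4 :=
    ⟨⟨1 / 2, 3 / 4, by norm_num, by norm_num⟩, rfl, rfl⟩
  have hχs : ContDiff ℝ (⊤ : ℕ∞) fun p : SpaceTime n => χ p.2 := χ.contDiff.comp contDiff_snd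
  have hoff : ∀ s : ℝ, 3 / 4 ≤ |s| → χ s = 0 := fun s hs => χ.zero_of_le_dist (by
    rw [hχ.2, dist_zero_right, Real.norm_eq_abs]; exact hs)
  refine ⟨fun p => χ p.2 * blowup β α T u θ p + (1 - χ p.2), ?_, fun p => ?_, fun p hp => ?_⟩
  · rw [contDiff_iff_contDiffAt]
    intro p
    rcases lt_or_ge |p.2| 1 with hp | hp
    · exact (hχs.contDiffAt.mul (S.contDiffAt_blowup hθ hp)).add
        (contDiffAt_const.sub hχs.contDiffAt)
    · have hev : ∀ᶠ q : SpaceTime n in 𝓝 p, 3 / 4 < |q.2| :=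
        (continuous_snd.abs.continuousAt).eventually_const_lt (by linarith)
      refine (contDiffAt_const (c := (1 : ℝ))).congr_of_eventuallyEq ?_
      filter_upwards [hev] with q hq
      simp [hoff q.2 hq.le]
  · have h0 := χ.nonneg (x := p.2)
    have h1 := χ.le_one (x := p.2)
    rcases lt_or_ge |p.2| 1 with hp | hp
    · rcases h0.eq_or_lt with h | h
      · simp [← h]
      · have := mul_pos h (S.blowup_pos hθ hp)
        simp only
        linarith
    · simp [hoff p.2 (by linarith)]
  · have : χ p.2 = 1 := χ.one_of_mem_closedBall (by
      rw [hχ.1, mem_closedBall_zero_iff, Real.norm_eq_abs]; exact hp)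
    simp [this]

end Blowup

section BlowupEquation

variable {n : ℕ} {m β α T : ℝ} {h h1 h2 lo up : ℝ → ℝ} {u : EuclideanSpace ℝ (Fin n) → ℝ → ℝ}
  {θ : ℝ} {W : SpaceTime n → ℝ}

theorem Sandwich.dir_et_blowup (S : Sandwich n m β α T h h1 h2 lo up u) (hθ : θ ∈ Ioc 0 (T / 4))
    (hW : ContDiff ℝ (⊤ : ℕ∞) W) (heq : ∀ p, |p.2| ≤ 1 / 2 → W p = blowup β α T u θ p)
    {p : SpaceTime n} (hp : |p.2| < 1 / 2) :
    dir (et n) W p =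
      θ ^ (-α) * (deriv (u (θ ^ (-β) • p.1)) (T - θ * (1 - p.2)) * θ) := by
  obtain ⟨y, s⟩ := p
  simp only at hp ⊢
  have ht := S.blowup_mem hθ (hp.trans (by norm_num))
  have h1 := hasDerivAt_slice hW y s
  have h2 : HasDerivAt (fun s : ℝ => T - θ * (1 - s)) θ s :=
    ((((hasDerivAt_id s).const_sub 1).const_mul θ).const_sub T).congr_deriv (by ring)
  have h3 := ((S.hasDerivAt_time (θ ^ (-β) • y) ht).differentiableAt.hasDerivAt.comp s
    (h := fun s : ℝ => T - θ * (1 - s)) h2).const_mul (θ ^ (-α))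
  refine h1.unique (h3.congr_of_eventuallyEq ?_)
  filter_upwards [(continuous_abs.continuousAt).eventually_lt_const hp] with r hr
  exact heq (y, r) hr.le

theorem Sandwich.blowup_pde (S : Sandwich n m β α T h h1 h2 lo up u) (hθ : θ ∈ Ioc 0 (T / 4))
    (hW : ContDiff ℝ (⊤ : ℕ∞) W) (hpos : ∀ p, 0 < W p)
    (heq : ∀ p, |p.2| ≤ 1 / 2 → W p = blowup β α T u θ p)
    {p : SpaceTime n} (hp : |p.2| < 1 / 2) :
    dir (et n) W p = ∑ i, dir (ex i) (dir (ex i) fun q => W q ^ m) p := by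
  rw [S.dir_et_blowup hθ hW heq hp]
  obtain ⟨y, s⟩ := p
  simp only at hp ⊢
  have ht := S.blowup_mem hθ (hp.trans (by norm_num))
  have hWm : ContDiff ℝ (⊤ : ℕ∞) fun q => W q ^ m := hW.rpow_const_of_ne fun p => (hpos p).ne'
  have hum : ContDiff ℝ 2 fun x => u x (T - θ * (1 - s)) ^ m :=
    (contDiff_infty.1 (S.contDiff_slice ht) 2).rpow_const_of_ne fun x => (S.pos x _ ht).ne'
  have e := slap_eq_lap hWm y s
  rw [slap] at e
  have e2 : (fun y => W (y, s) ^ m) = fun y =>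
      (θ ^ (-α)) ^ m * (fun x => u x (T - θ * (1 - s)) ^ m) (θ ^ (-β) • y) := by
    funext z
    rw [heq (z, s) hp.le, blowup, mul_rpow (rpow_pos_of_pos hθ.1 _).le (S.pos _ _ ht).le]
  rw [e, e2, lap_dilate hum, S.pde _ _ ht]
  have e3 : θ ^ (-α) * θ = (θ ^ (-α)) ^ m * (θ ^ (-β)) ^ 2 := by
    rw [← rpow_mul hθ.1.le, ← rpow_natCast, ← rpow_mul hθ.1.le, ← rpow_add_one hθ.1.ne',
      ← rpow_add hθ.1]
    congr 1
    push_cast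
    linarith [S.hα]
  rw [← e3]
  ring

theorem Sandwich.blowup_growth (S : Sandwich n m β α T h h1 h2 lo up u)
    (hAB : ∀ x, ∀ t ∈ Ioo 0 T, deriv (u x) t ≤ u x t / ((1 - m) * t)) (hθ : θ ∈ Ioc 0 (T / 4))
    (hW : ContDiff ℝ (⊤ : ℕ∞) W) (heq : ∀ p, |p.2| ≤ 1 / 2 → W p = blowup β α T u θ p)
    {p : SpaceTime n} (hp : |p.2| < 1 / 2) :
    dir (et n) W p ≤ 1 / (1 - m) * W p := by
  rw [S.dir_et_blowup hθ hW heq hp, heq p hp.le, blowup]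
  have hs : |p.2| < 1 := hp.trans (by norm_num)
  have ht := S.blowup_mem hθ hs
  have htT := (blowup_time_mem hθ hs).1
  obtain ⟨t, e⟩ : ∃ t, t = T - θ * (1 - p.2) := ⟨_, rfl⟩
  rw [← e] at ht htT ⊢
  have hθt : θ ≤ t := by linarith [hθ.2, S.hT]
  have hm : 0 < 1 - m := sub_pos.2 S.lt_one
  have hu := S.pos (θ ^ (-β) • p.1) t ht
  have key : deriv (u (θ ^ (-β) • p.1)) t * θ ≤ 1 / (1 - m) * u (θ ^ (-β) • p.1) t := by
    have ht0 := ht.1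
    refine (mul_le_mul_of_nonneg_right (hAB _ t ht) hθ.1.le).trans ?_
    rw [div_mul_eq_mul_div, div_mul_eq_mul_div, one_mul, div_le_div_iff₀ (by positivity) hm]
    have := mul_le_mul_of_nonneg_left hθt (mul_pos hu hm).le
    linarith
  have := mul_le_mul_of_nonneg_left key (rpow_pos_of_pos hθ.1 (-α)).le
  linarith

/-- The self-similar solution in blow-up variables. -/
noncomputable def model (n : ℕ) (β α : ℝ) (h : ℝ → ℝ) (p : SpaceTime n) : ℝ :=
  (1 - p.2) ^ α * h ((1 - p.2) ^ β * ‖p.1‖)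

theorem EvenProfile.continuousOn_model (H : EvenProfile n m β α h h1 h2) :
    ContinuousOn (model n β α h) {p | p.2 < 1} := by
  have hp : ∀ γ : ℝ, ContinuousOn (fun p : SpaceTime n => (1 - p.2) ^ γ) {p | p.2 < 1} := fun γ =>
    ContinuousOn.rpow_const (by fun_prop) fun p hp => Or.inl (sub_pos.2 hp).ne'
  exact (hp α).mul (H.continuous.comp_continuousOn ((hp β).mul (by fun_prop)))

theorem EvenProfile.model_pos (H : EvenProfile n m β α h h1 h2) {p : SpaceTime n} (hp : p.2 < 1) :
    0 < model n β α h p :=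
  mul_pos (rpow_pos_of_pos (sub_pos.2 hp) _) (H.pos _)

/-- The self-similar solution is invariant under the blow-up scaling. -/
theorem blowup_uself {T θ : ℝ} (hθ : 0 < θ) (H : ℝ → ℝ) {p : SpaceTime n} (hp : p.2 < 1) :
    blowup β α T (fun x t => Uself n β α T H x t) θ p = model n β α H p := by
  have h1 : 0 < 1 - p.2 := sub_pos.2 hp
  simp only [blowup, Uself, model]
  rw [show T - (T - θ * (1 - p.2)) = θ * (1 - p.2) by ring, mul_rpow hθ.le h1.le,
    mul_rpow hθ.le h1.le, norm_smul, Real.norm_eq_abs, abs_of_pos (rpow_pos_of_pos hθ _),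
    rpow_neg hθ.le, rpow_neg hθ.le]
  have := (rpow_pos_of_pos hθ α).ne'
  have := (rpow_pos_of_pos hθ β).ne'
  rw [show θ ^ β * (1 - p.2) ^ β * ((θ ^ β)⁻¹ * ‖p.1‖) = (1 - p.2) ^ β * ‖p.1‖ by field_simp]
  field_simp

theorem Sandwich.blowup_bounds (S : Sandwich n m β α T h h1 h2 lo up u) (R : ℝ) :
    ∃ c0 c1, 0 < c0 ∧ c0 ≤ c1 ∧ ∀ p ∈ cyl n R (1 / 2),
      (c0 ≤ model n β α h p ∧ model n β α h p ≤ c1) ∧ ∀ θ ∈ Ioc 0 (T / 4),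
      c0 ≤ blowup β α T u θ p ∧ blowup β α T u θ p ≤ c1 := by
  obtain ⟨l1, l2, hlo⟩ := S.profLo
  obtain ⟨g1, g2, hup⟩ := S.profUp
  have hsub : cyl n R (1 / 2) ⊆ {p | p.2 < 1} := fun p hp => by
    have := (abs_le.1 ((Real.norm_eq_abs _).symm.le.trans (mem_closedBall_zero_iff.1 hp.2))).2
    simp only [mem_ofPred_eq]
    linarith
  have low : ∀ H H1 H2, EvenProfile n m β α H H1 H2 → ∃ c, 0 < c ∧ ∀ p ∈ cyl n R (1 / 2),
      c ≤ model n β α H p := by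
    intro H H1 H2 E
    rcases (cyl n R (1 / 2)).eq_empty_or_nonempty with he | he
    · exact ⟨1, one_pos, fun p hp => absurd hp (he ▸ notMem_empty p)⟩
    · obtain ⟨p, hp, hmin⟩ := (isCompact_cyl _ _).exists_isMinOn he (E.continuousOn_model.mono hsub)
      exact ⟨_, E.model_pos (hsub hp), fun q hq => hmin hq⟩
  have upp : ∀ H H1 H2, EvenProfile n m β α H H1 H2 → ∃ c, ∀ p ∈ cyl n R (1 / 2),
      model n β α H p ≤ c := by
    intro H H1 H2 E
    obtain ⟨c, hc⟩ := (isCompact_cyl _ _).bddAbove_image (E.continuousOn_model.mono hsub)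
    exact ⟨c, fun p hp => hc ⟨p, hp, rfl⟩⟩
  obtain ⟨a, ha, hA⟩ := low _ _ _ hlo
  obtain ⟨b, hb, hB⟩ := low _ _ _ S.prof
  obtain ⟨c, hc⟩ := upp _ _ _ hup
  obtain ⟨d, hd⟩ := upp _ _ _ S.prof
  refine ⟨min a b, max (min a b) (max c d), lt_min ha hb, le_max_left _ _, fun p hp =>
    ⟨⟨(min_le_right _ _).trans (hB p hp), (hd p hp).trans ((le_max_right c d).trans
      (le_max_right _ _))⟩, fun θ hθ => ?_⟩⟩
  have hp1 := hsub hp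
  have hs : |p.2| < 1 := lt_of_le_of_lt
    ((Real.norm_eq_abs _).symm.le.trans (mem_closedBall_zero_iff.1 hp.2)) (by norm_num)
  obtain ⟨s1, s2⟩ := S.sand (θ ^ (-β) • p.1) _ (S.blowup_mem hθ hs)
  have hθα := (rpow_pos_of_pos hθ.1 (-α)).le
  have e1 := mul_le_mul_of_nonneg_left s1 hθα
  have e2 := mul_le_mul_of_nonneg_left s2 hθα
  have f1 := blowup_uself (n := n) (β := β) (α := α) (T := T) hθ.1 lo hp1
  have f2 := blowup_uself (n := n) (β := β) (α := α) (T := T) hθ.1 up hp1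
  rw [blowup] at f1 f2
  rw [f1] at e1
  rw [f2] at e2
  exact ⟨((min_le_left _ _).trans (hA p hp)).trans e1,
    e2.trans ((hc p hp).trans ((le_max_left c d).trans (le_max_right _ _)))⟩

end BlowupEquation

section BlowupAverages

variable {n : ℕ}

theorem integral_unitBall_affine_le {g : EuclideanSpace ℝ (Fin n) → ℝ} (hg : Continuous g)
    (hg0 : ∀ x, 0 ≤ g x) {z : EuclideanSpace ℝ (Fin n)} {μ R : ℝ} (hμ : 0 < μ) (hz : ‖z‖ + μ ≤ R) :
    ∫ ξ in Metric.closedBall 0 1, g (z + μ • ξ) ≤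
      (μ ^ n)⁻¹ * ∫ x in Metric.closedBall 0 R, g x := by
  obtain ⟨G, hG⟩ : ∃ G, G = indicator (Metric.closedBall (0 : EuclideanSpace ℝ (Fin n)) R) g :=
    ⟨_, rfl⟩
  have hGi : Integrable G := by
    rw [hG, integrable_indicator_iff Metric.isClosed_closedBall.measurableSet]
    exact hg.continuousOn.integrableOn_compact (isCompact_closedBall _ _)
  have hG0 : ∀ x, 0 ≤ G x := fun x => by rw [hG]; exact indicator_nonneg (fun x _ => hg0 x) x
  have hi : Integrable fun ξ => G (z + μ • ξ) :=
    (hGi.comp_add_left z).comp_smul hμ.ne'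
  have e1 : ∫ ξ in Metric.closedBall 0 1, g (z + μ • ξ) =
      ∫ ξ in Metric.closedBall 0 1, G (z + μ • ξ) := by
    refine setIntegral_congr_fun Metric.isClosed_closedBall.measurableSet fun ξ hξ => ?_
    have : z + μ • ξ ∈ Metric.closedBall (0 : EuclideanSpace ℝ (Fin n)) R := by
      rw [mem_closedBall_zero_iff] at hξ ⊢
      refine (norm_add_le _ _).trans ?_
      rw [norm_smul, Real.norm_eq_abs, abs_of_pos hμ]
      have := mul_le_mul_of_nonneg_left hξ hμ.le
      linarith
    simp only [hG, indicator_of_mem this]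
  have e2 : ∫ ξ, G (z + μ • ξ) = (μ ^ n)⁻¹ * ∫ x, G x := by
    have := Measure.integral_comp_smul_of_nonneg volume (fun x => G (z + x)) μ (hR := hμ.le)
    rw [this, integral_add_left_eq_self G z]
    simp
  have e3 : ∫ x, G x = ∫ x in Metric.closedBall 0 R, g x := by
    rw [hG, integral_indicator Metric.isClosed_closedBall.measurableSet]
  rw [e1, ← e3, ← e2]
  exact setIntegral_le_integral hi (Eventually.of_forall fun ξ => hG0 _)

variable {m β α T : ℝ} {h h1 h2 lo up : ℝ → ℝ} {u : EuclideanSpace ℝ (Fin n) → ℝ → ℝ} {θ : ℝ}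
  {u0 : EuclideanSpace ℝ (Fin n) → ℝ}

theorem blowup_sub_model (hθ : 0 < θ) {p : SpaceTime n} (hp : p.2 < 1) :
    blowup β α T u θ p - model n β α h p = (1 - p.2) ^ α *
      ((θ * (1 - p.2)) ^ (-α) * u ((θ * (1 - p.2)) ^ (-β) • ((1 - p.2) ^ β • p.1))
        (T - θ * (1 - p.2)) - h ‖(1 - p.2) ^ β • p.1‖) := by
  have hq : 0 < 1 - p.2 := sub_pos.2 hp
  have hc : ∀ γ : ℝ, (1 - p.2) ^ γ * (θ * (1 - p.2)) ^ (-γ) = θ ^ (-γ) := fun γ => by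
    rw [mul_rpow hθ.le hq.le, mul_left_comm, ← rpow_add hq, add_neg_cancel, rpow_zero, mul_one]
  rw [smul_smul, mul_comm (_ ^ (-β)), hc β, norm_smul, Real.norm_eq_abs,
    abs_of_pos (rpow_pos_of_pos hq β), mul_sub, ← mul_assoc, hc α]
  rfl

theorem SandwichInit.blowup_average (S : SandwichInit n m β α T h h1 h2 lo up u u0)
    (hC1 : CondC1 n m β)
    (hcontr : ∀ t ∈ Ioo 0 T, (∫ x, |defect n β α T h u t x|) ≤
      ∫ x, |u0 x - Uself n β α T h x 0|) (R : ℝ) {r : ℝ} (hr : r ∈ Ioc 0 1) {κ : ℝ} (hκ : 0 < κ) :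
    ∃ θ0 ∈ Ioc 0 (T / 4), ∀ θ ∈ Ioc 0 θ0, ∀ y s, ‖y‖ ≤ R → |s| ≤ 1 / 2 →
      ∫ ξ in Metric.closedBall (0 : EuclideanSpace ℝ (Fin n)) 1,
        |blowup β α T u θ (y + r • ξ, s) - model n β α h (y + r • ξ, s)| ≤ κ := by
  obtain ⟨δ, hδ, hd⟩ := S.decay hC1 hcontr
  obtain ⟨C, hC, hd⟩ := hd (2 ^ β * (R + 1))
  obtain ⟨M, hM⟩ : ∃ M : ℝ, M = 2 ^ α * (((1 / 2) ^ β * r) ^ n)⁻¹ * C * 2 ^ δ := ⟨_, rfl⟩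
  have hT := S.hT
  have hα := S.alpha_pos
  have hr0 := hr.1
  have hlim : Tendsto (fun θ : ℝ => M * θ ^ δ) (𝓝 0) (𝓝 0) := by
    have := ((continuous_rpow_const hδ.le).tendsto 0).const_mul M
    rwa [zero_rpow hδ.ne', mul_zero] at this
  obtain ⟨ε, hε, hεκ⟩ := Metric.eventually_nhds_iff.1 (hlim.eventually_lt_const hκ)
  refine ⟨min (ε / 2) (T / 4), ⟨by positivity, min_le_right _ _⟩, fun θ hθ y s hy hs => ?_⟩
  have hθ0 := hθ.1
  have hθε : θ ≤ ε / 2 := hθ.2.trans (min_le_left _ _)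
  have hθT : θ ≤ T / 4 := hθ.2.trans (min_le_right _ _)
  obtain ⟨hs1, hs2⟩ := abs_le.1 hs
  have hMκ : M * θ ^ δ < κ := hεκ (by
    rw [dist_zero_right, Real.norm_eq_abs, abs_of_pos hθ0]; linarith)
  obtain ⟨q, hq⟩ : ∃ q, q = 1 - s := ⟨_, rfl⟩
  have hq1 : 1 / 2 ≤ q := by linarith
  have hq2 : q ≤ 2 := by linarith
  have hq0 : 0 < q := by linarith
  have hσ0 : 0 < θ * q := by positivity
  have hσ2 : θ * q ≤ θ * 2 := mul_le_mul_of_nonneg_left hq2 hθ0.le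
  have ht : T - θ * q ∈ Ioo 0 T := ⟨by linarith, by linarith⟩
  obtain ⟨g, hg⟩ : ∃ g : EuclideanSpace ℝ (Fin n) → ℝ, g = fun z =>
    |(θ * q) ^ (-α) * u ((θ * q) ^ (-β) • z) (T - θ * q) - h ‖z‖| := ⟨_, rfl⟩
  have hgc : Continuous g := by
    have h1 := (S.contDiff_slice ht).continuous
    have h2 := S.prof.continuous
    rw [hg]
    fun_prop
  have hqβ : 0 < q ^ β := by positivity
  have e : ∀ ξ : EuclideanSpace ℝ (Fin n),
      |blowup β α T u θ (y + r • ξ, s) - model n β α h (y + r • ξ, s)| =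
      q ^ α * g (q ^ β • y + (q ^ β * r) • ξ) := fun ξ => by
    rw [blowup_sub_model hθ0 (by simp only; linarith), abs_mul, ← hq, hg,
      abs_of_pos (rpow_pos_of_pos hq0 α)]
    simp only [smul_add, smul_smul]
  simp only [e]
  rw [integral_const_mul]
  have hβ2 : q ^ β ≤ 2 ^ β := rpow_le_rpow hq0.le hq2 S.hβ.le
  have hβ1 : (1 / 2) ^ β ≤ q ^ β := rpow_le_rpow (by norm_num) hq1 S.hβ.le
  have hα2 : q ^ α ≤ 2 ^ α := rpow_le_rpow hq0.le hq2 hα.le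
  have hR : 0 ≤ R := (norm_nonneg y).trans hy
  have hbd := integral_unitBall_affine_le hgc (fun x => by rw [hg]; positivity)
    (z := q ^ β • y) (R := 2 ^ β * (R + 1)) (mul_pos hqβ hr0) (by
      rw [norm_smul, Real.norm_eq_abs, abs_of_pos hqβ, ← mul_add]
      exact mul_le_mul hβ2 (by linarith [hr.2]) (by positivity) (by positivity))
  have hdθ : ∫ x in Metric.closedBall 0 (2 ^ β * (R + 1)), g x ≤ C * (2 ^ δ * θ ^ δ) := by
    rw [hg]
    refine (hd (θ * q) ⟨hσ0, by linarith⟩).trans (mul_le_mul_of_nonneg_left ?_ hC)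
    rw [← mul_rpow (by norm_num) hθ0.le]
    exact rpow_le_rpow hσ0.le (by linarith) hδ.le
  have hinv : ((q ^ β * r) ^ n)⁻¹ ≤ (((1 / 2) ^ β * r) ^ n)⁻¹ := by
    have : 0 < (1 / 2 : ℝ) ^ β := by positivity
    gcongr
  have hfin := mul_le_mul hα2 (hbd.trans (mul_le_mul hinv hdθ
    (integral_nonneg fun x => by rw [hg]; positivity) (by positivity)))
    (integral_nonneg fun x => by rw [hg]; positivity) (by positivity)
  refine hfin.trans (le_trans (le_of_eq ?_) hMκ.le)
  rw [hM]
  ring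

end BlowupAverages

section Closeness

theorem dir_translate {X : Type*} [NormedAddCommGroup X] [NormedSpace ℝ X] (g : X → ℝ) (a v : X) :
    dir v (fun q => g (a + q)) = fun q => dir v g (a + q) := by
  funext q
  simp only [dir, fderiv_comp_add_left]

variable {n : ℕ} {m β α T : ℝ} {h h1 h2 lo up : ℝ → ℝ} {u : EuclideanSpace ℝ (Fin n) → ℝ → ℝ}
  {u0 : EuclideanSpace ℝ (Fin n) → ℝ}

theorem mem_cyl_iff {r δ : ℝ} {p : SpaceTime n} : p ∈ cyl n r δ ↔ ‖p.1‖ ≤ r ∧ |p.2| ≤ δ := by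
  rw [cyl, mem_prod, mem_closedBall_zero_iff, mem_closedBall_zero_iff, Real.norm_eq_abs]

theorem add_mem_cyl {r δ r' δ' : ℝ} {p q : SpaceTime n} (hp : p ∈ cyl n r δ) (hq : q ∈ cyl n r' δ') :
    p + q ∈ cyl n (r + r') (δ + δ') := by
  rw [mem_cyl_iff] at *
  exact ⟨(norm_add_le _ _).trans (add_le_add hp.1 hq.1),
    (abs_add_le _ _).trans (add_le_add hp.2 hq.2)⟩

theorem Sandwich.localSol (S : Sandwich n m β α T h h1 h2 lo up u)
    (hAB : ∀ x, ∀ t ∈ Ioo 0 T, deriv (u x) t ≤ u x t / ((1 - m) * t)) {θ : ℝ}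
    (hθ : θ ∈ Ioc 0 (T / 4)) {W : SpaceTime n → ℝ} (hW : ContDiff ℝ (⊤ : ℕ∞) W)
    (hpos : ∀ p, 0 < W p) (heq : ∀ p, |p.2| ≤ 1 / 2 → W p = blowup β α T u θ p) {R c0 c1 ρ : ℝ}
    (hbd : ∀ p ∈ cyl n (R + 1) (1 / 2), c0 ≤ blowup β α T u θ p ∧ blowup β α T u θ p ≤ c1)
    (hρ : ρ ≤ 1 / 8) {p : SpaceTime n} (hp : p ∈ cyl n R (1 / 4)) :
    LocalSol n m c0 c1 (1 / (1 - m)) ρ fun q => W (p + q) := by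
  have hq : ∀ q ∈ cyl n ρ ρ, p + q ∈ cyl n (R + 1) (1 / 2) ∧ |(p + q).2| < 1 / 2 := fun q hq => by
    have := add_mem_cyl hp hq
    refine ⟨cyl_mono (by linarith) (by linarith) this, lt_of_le_of_lt (mem_cyl_iff.1 this).2 ?_⟩
    linarith
  have hb : ∀ q ∈ cyl n ρ ρ, c0 ≤ W (p + q) ∧ W (p + q) ≤ c1 := fun q hqq => by
    rw [heq _ (hq q hqq).2.le]
    exact hbd _ (hq q hqq).1
  refine ⟨hW.comp (contDiff_const.add contDiff_id), fun q => hpos _, fun q h => (hb q h).1,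
    fun q h => (hb q h).2, fun q h => ?_, fun q h => ?_⟩
  · have e : ∀ v : SpaceTime n, dir v (fun q => W (p + q) ^ m) =
        fun q => dir v (fun q => W q ^ m) (p + q) := fun v => dir_translate (fun q => W q ^ m) p v
    simp only [dir_translate W, e]
    rw [S.blowup_pde hθ hW hpos heq (hq q h).2]
    refine Finset.sum_congr rfl fun i _ => ?_
    rw [dir_translate (dir (ex i) fun q => W q ^ m)]
  · rw [dir_translate W]
    exact S.blowup_growth hAB hθ hW heq (hq q h).2

theorem SandwichInit.blowup_close (S : SandwichInit n m β α T h h1 h2 lo up u u0)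
    (hC1 : CondC1 n m β)
    (hcontr : ∀ t ∈ Ioo 0 T, (∫ x, |defect n β α T h u t x|) ≤
      ∫ x, |u0 x - Uself n β α T h x 0|)
    (hAB : ∀ x, ∀ t ∈ Ioo 0 T, deriv (u x) t ≤ u x t / ((1 - m) * t)) (R : ℝ) {η : ℝ}
    (hη : 0 < η) :
    ∃ θ0 ∈ Ioc 0 (T / 4), ∀ θ ∈ Ioc 0 θ0, ∀ p ∈ cyl n R (1 / 4),
      |blowup β α T u θ p - model n β α h p| ≤ η := by
  obtain ⟨c0, c1, hc0, hc01, hbd⟩ := S.blowup_bounds (R + 1)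
  have hm : 0 < 1 - m := sub_pos.2 S.lt_one
  obtain ⟨κ, hκ, hclose⟩ := exists_pointwise_close n S.hm0 S.lt_one hc0 hc01
    (one_div_nonneg.2 hm.le) hη
  obtain ⟨V, hV⟩ : ∃ V, V = (volume : Measure (EuclideanSpace ℝ (Fin n))).real
    (Metric.closedBall 0 1) := ⟨_, rfl⟩
  have hV0 : 0 ≤ V := hV ▸ measureReal_nonneg
  obtain ⟨κ', hκ'⟩ : ∃ κ', κ' = κ / (2 * (V + 1)) := ⟨_, rfl⟩
  have hκ'0 : 0 < κ' := by rw [hκ']; positivity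
  have hκV : V * κ' ≤ κ / 2 := by
    rw [hκ', mul_div_assoc', div_le_div_iff₀ (by positivity) two_pos]
    have := mul_nonneg hκ.le hV0
    linarith
  have hsub : cyl n (R + 1) (1 / 2) ⊆ {p | p.2 < 1} := fun p hp => by
    have := (abs_le.1 (mem_cyl_iff.1 hp).2).2
    simp only [mem_ofPred_eq]
    linarith
  obtain ⟨ε, hε, huc⟩ := Metric.uniformContinuousOn_iff.1
    ((isCompact_cyl (R + 1) (1 / 2)).uniformContinuousOn_of_continuous
      (S.prof.continuousOn_model.mono hsub)) κ' hκ'0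
  obtain ⟨ρ, hρ⟩ : ∃ ρ, ρ = min (1 / 8) (ε / 2) := ⟨_, rfl⟩
  have hρ0 : 0 < ρ := by rw [hρ]; positivity
  have hρ8 : ρ ≤ 1 / 8 := by rw [hρ]; exact min_le_left _ _
  have hρε : ρ < ε := by rw [hρ]; exact (min_le_right _ _).trans_lt (by linarith)
  obtain ⟨r, hr, δ, hδ, hpt⟩ := hclose ρ hρ0
  have hr1 : r ≤ 1 := hr.2.trans (by linarith)
  obtain ⟨θ0, hθ0, havg⟩ := S.blowup_average hC1 hcontr R ⟨hr.1, hr1⟩ (half_pos hκ)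
  refine ⟨θ0, hθ0, fun θ hθ p hp => ?_⟩
  have hθT : θ ∈ Ioc 0 (T / 4) := ⟨hθ.1, hθ.2.trans hθ0.2⟩
  obtain ⟨W, hW, hpos, heq⟩ := S.exists_smooth_blowup hθT
  have hpbig : p ∈ cyl n (R + 1) (1 / 2) := cyl_mono (by linarith) (by norm_num) hp
  obtain ⟨hp1, hp2⟩ := mem_cyl_iff.1 hp
  have hsol := S.localSol hAB hθT hW hpos heq (R := R) (c0 := c0) (c1 := c1)
    (fun q hq => (hbd q (cyl_mono (by linarith) le_rfl hq)).2 θ hθT) hρ8 hp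
  have hF := (hbd p (cyl_mono (by linarith) le_rfl hpbig)).1
  have := hpt _ (model n β α h p) hsol hF.1 hF.2 fun s hs => ?_
  · simp only [add_zero] at this
    rwa [heq p (hp2.trans (by norm_num))] at this
  rw [mem_closedBall_zero_iff, Real.norm_eq_abs] at hs
  have hs' : |p.2 + s| ≤ 1 / 2 := (abs_add_le _ _).trans (by linarith [hδ.2])
  have hs1 : p.2 + s < 1 := by linarith [(abs_le.1 hs').2]
  have hcm : Continuous fun ξ : EuclideanSpace ℝ (Fin n) => model n β α h (p.1 + r • ξ, p.2 + s) := by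
    have := S.prof.continuous
    simp only [model]
    fun_prop
  have hcb : Continuous fun ξ : EuclideanSpace ℝ (Fin n) => W (p.1 + r • ξ, p.2 + s) := by
    have := hW.continuous
    fun_prop
  have hca : Continuous fun ξ : EuclideanSpace ℝ (Fin n) =>
      |W (p.1 + r • ξ, p.2 + s) - model n β α h (p.1 + r • ξ, p.2 + s)| := (hcb.sub hcm).abs
  have havg' := havg θ hθ p.1 (p.2 + s) hp1 hs'
  have hInt : ∀ g : EuclideanSpace ℝ (Fin n) → ℝ, Continuous g →
      IntegrableOn g (Metric.closedBall 0 1) := fun g hg =>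
    hg.continuousOn.integrableOn_compact (isCompact_closedBall _ _)
  have e : ∀ ξ : EuclideanSpace ℝ (Fin n), p + (r • ξ, s) = (p.1 + r • ξ, p.2 + s) := fun ξ => rfl
  simp only [← heq (_, p.2 + s) hs'] at havg'
  simp only [e]
  calc ∫ ξ in Metric.closedBall 0 1, |W (p.1 + r • ξ, p.2 + s) - model n β α h p|
      ≤ ∫ ξ in Metric.closedBall 0 1,
        (|W (p.1 + r • ξ, p.2 + s) - model n β α h (p.1 + r • ξ, p.2 + s)| + κ') := by
        refine setIntegral_mono_on (hInt _ (hcb.sub continuous_const).abs)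
          (hInt _ (hca.add continuous_const))
          Metric.isClosed_closedBall.measurableSet fun ξ hξ => ?_
        rw [mem_closedBall_zero_iff] at hξ
        have hmem : ((r • ξ, s) : SpaceTime n) ∈ cyl n ρ ρ := by
          rw [mem_cyl_iff]
          refine ⟨?_, hs.trans hδ.2⟩
          rw [norm_smul, Real.norm_eq_abs, abs_of_pos hr.1]
          have := mul_le_mul_of_nonneg_left hξ hr.1.le
          linarith [hr.2]
        have hq := cyl_mono (r' := R + 1) (δ' := 1 / 2) (by linarith) (by linarith)
          (add_mem_cyl hp hmem)
        have hdist : dist (p + (r • ξ, s)) p < ε := by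
          rw [dist_eq_norm, add_sub_cancel_left]
          refine lt_of_le_of_lt ?_ hρε
          rw [Prod.norm_def]
          exact max_le (mem_cyl_iff.1 hmem).1 (mem_cyl_iff.1 hmem).2
        have := huc _ hq _ hpbig hdist
        rw [e, Real.dist_eq] at this
        have := abs_sub_le (W (p.1 + r • ξ, p.2 + s)) (model n β α h (p.1 + r • ξ, p.2 + s))
          (model n β α h p)
        linarith
    _ = (∫ ξ in Metric.closedBall 0 1,
        |W (p.1 + r • ξ, p.2 + s) - model n β α h (p.1 + r • ξ, p.2 + s)|) + V * κ' := by
        rw [integral_add (hInt _ hca) (hInt _ continuous_const), setIntegral_const,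
          smul_eq_mul, hV]
    _ ≤ κ := by linarith

end Closeness

section PressureBounds

variable {n : ℕ} {m β α T : ℝ} {h h1 h2 lo up : ℝ → ℝ} {u : EuclideanSpace ℝ (Fin n) → ℝ → ℝ}
  {u0 : EuclideanSpace ℝ (Fin n) → ℝ}

theorem slice_dir {g : SpaceTime n → ℝ} (hg : ContDiff ℝ (⊤ : ℕ∞) g) (i : Fin n) (s : ℝ) :
    (fun y => dir (ex i) g (y, s)) = dir (EuclideanSpace.single i (1 : ℝ)) fun y => g (y, s) :=
  funext fun y => dir_ex_slice i y s (hg.differentiable_infty _)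

/-- The pressure of the rescaled solution at the scale `θ`. -/
noncomputable def pressure (m β α T : ℝ) (u : EuclideanSpace ℝ (Fin n) → ℝ → ℝ) (θ : ℝ)
    (y : EuclideanSpace ℝ (Fin n)) : ℝ := m * blowup β α T u θ (y, 0) ^ (m - 1)

theorem Sandwich.contDiff_blowup_slice (S : Sandwich n m β α T h h1 h2 lo up u) {θ : ℝ}
    (hθ : θ ∈ Ioc 0 (T / 4)) : ContDiff ℝ (⊤ : ℕ∞) fun y => blowup β α T u θ (y, 0) :=
  contDiff_iff_contDiffAt.2 fun y =>
    (S.contDiffAt_blowup hθ (p := (y, 0)) (by simp)).comp y (f := fun y => (y, (0 : ℝ)))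
      (contDiffAt_id.prodMk contDiffAt_const)

theorem Sandwich.contDiff_pressure (S : Sandwich n m β α T h h1 h2 lo up u) {θ : ℝ}
    (hθ : θ ∈ Ioc 0 (T / 4)) : ContDiff ℝ (⊤ : ℕ∞) (pressure m β α T u θ) :=
  contDiff_const.mul ((S.contDiff_blowup_slice hθ).rpow_const_of_ne fun y =>
    (S.blowup_pos hθ (p := (y, 0)) (by simp)).ne')

theorem SandwichInit.pressure_bounds (S : SandwichInit n m β α T h h1 h2 lo up u u0)
    (hC1 : CondC1 n m β)
    (hcontr : ∀ t ∈ Ioo 0 T, (∫ x, |defect n β α T h u t x|) ≤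
      ∫ x, |u0 x - Uself n β α T h x 0|)
    (hAB : ∀ x, ∀ t ∈ Ioo 0 T, deriv (u x) t ≤ u x t / ((1 - m) * t))
    (y0 : EuclideanSpace ℝ (Fin n)) :
    ∃ r, 0 < r ∧ ∃ C, 0 ≤ C ∧ ∃ θ0 ∈ Ioc 0 (T / 4), ∀ θ ∈ Ioc 0 θ0, ∀ y ∈ Metric.closedBall y0 r,
      (∀ i j, |dir (EuclideanSpace.single i (1 : ℝ)) (dir (EuclideanSpace.single j (1 : ℝ))
        (pressure m β α T u θ)) y| ≤ C) ∧
      ∀ i j k, |dir (EuclideanSpace.single i (1 : ℝ)) (dir (EuclideanSpace.single j (1 : ℝ))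
        (dir (EuclideanSpace.single k (1 : ℝ)) (pressure m β α T u θ))) y| ≤ C := by
  obtain ⟨c0, c1, hc0, hc01, hbd⟩ := S.blowup_bounds (‖y0‖ + 1)
  have hm0 := S.hm0
  have hm1 := S.lt_one
  have hc1 : 0 < c1 := hc0.trans_le hc01
  obtain ⟨μ, hμ, hder⟩ := exists_derivative_bounds n (1 / (m - 1)) (m * c0 ^ (m - 1))
    (mul_pos hm0 (rpow_pos_of_pos hc1 (m - 1)))
  have hy0 : (y0, (0 : ℝ)) ∈ cyl n (‖y0‖ + 1) (1 / 2) := mem_cyl_iff.2 ⟨by simp, by simp⟩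
  have hcont : ContinuousOn (fun x : ℝ => m * x ^ (m - 1)) (Icc c0 c1) :=
    continuousOn_const.mul (continuousOn_id.rpow_const fun x hx => Or.inl (hc0.trans_le hx.1).ne')
  obtain ⟨η, hη, huc⟩ := Metric.uniformContinuousOn_iff.1
    (isCompact_Icc.uniformContinuousOn_of_continuous hcont) μ hμ
  have hmod : ContinuousAt (model n β α h) (y0, 0) :=
    S.prof.continuousOn_model.continuousAt
      ((isOpen_Iio.preimage continuous_snd).mem_nhds (by simp))
  obtain ⟨ε, hε, hmod⟩ := Metric.continuousAt_iff.1 hmod (η / 2) (half_pos hη)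
  obtain ⟨ρ, hρ⟩ : ∃ ρ, ρ = min (1 / 8) (ε / 2) := ⟨_, rfl⟩
  have hρ0 : 0 < ρ := by rw [hρ]; positivity
  have hρ8 : ρ ≤ 1 / 8 := by rw [hρ]; exact min_le_left _ _
  have hρε : ρ < ε := by rw [hρ]; exact (min_le_right _ _).trans_lt (by linarith)
  obtain ⟨C, hC, hder⟩ := hder ρ hρ0
  obtain ⟨θ0, hθ0, hclose⟩ := S.blowup_close hC1 hcontr hAB (‖y0‖ + 1) (η := η / 3) (by positivity)
  refine ⟨ρ / 8, by positivity, C, hC, θ0, hθ0, fun θ hθ y hy => ?_⟩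
  have hθT : θ ∈ Ioc 0 (T / 4) := ⟨hθ.1, hθ.2.trans hθ0.2⟩
  obtain ⟨W, hW, hpos, heq⟩ := S.exists_smooth_blowup hθT
  obtain ⟨w, hw⟩ : ∃ w : SpaceTime n → ℝ, w = fun q => W ((y0, 0) + q) := ⟨_, rfl⟩
  have hws : ContDiff ℝ (⊤ : ℕ∞) w := by
    rw [hw]
    exact hW.comp (contDiff_const.add contDiff_id)
  have hwpos : ∀ q, 0 < w q := fun q => by rw [hw]; exact hpos _
  have hO : IsOpen {q : SpaceTime n | |q.2| < 1 / 2} := isOpen_Iio.preimage continuous_snd.abs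
  have hmem : ∀ q ∈ backCyl n ρ, ‖q.1‖ ≤ ρ ∧ |q.2| ≤ ρ := fun q hq =>
    ⟨mem_closedBall_zero_iff.1 hq.1, abs_le.2 ⟨hq.2.1, hq.2.2.trans hρ0.le⟩⟩
  have hpow : ContDiff ℝ (⊤ : ℕ∞) fun q => m * w q ^ (m - 1) :=
    contDiff_const.mul (hws.rpow_const_of_ne fun p => (hwpos p).ne')
  have hwq : ∀ q ∈ backCyl n ρ, (c0 ≤ w q ∧ w q ≤ c1) ∧ |w q - model n β α h (y0, 0)| < η := by
    intro q hq
    obtain ⟨q1, q2⟩ := hmem q hq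
    have hqc : (y0, (0 : ℝ)) + q ∈ cyl n (‖y0‖ + 1) (1 / 4) := mem_cyl_iff.2
      ⟨(norm_add_le _ _).trans (by simp only; linarith), by
        simp only [Prod.snd_add, zero_add]; linarith⟩
    have e : w q = blowup β α T u θ ((y0, 0) + q) := by
      rw [hw]
      exact heq _ ((mem_cyl_iff.1 hqc).2.trans (by norm_num))
    have h1 := (hbd _ (cyl_mono le_rfl (by norm_num) hqc)).2 θ hθT
    have h2 := hclose θ hθ _ hqc
    have hd : dist ((y0, (0 : ℝ)) + q) (y0, 0) < ε := by
      rw [dist_eq_norm, add_sub_cancel_left, Prod.norm_def]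
      exact lt_of_le_of_lt (max_le q1 q2) hρε
    have h3 := hmod hd
    rw [Real.dist_eq] at h3
    rw [e]
    refine ⟨h1, ?_⟩
    have := abs_sub_le (blowup β α T u θ ((y0, 0) + q)) (model n β α h ((y0, 0) + q))
      (model n β α h (y0, 0))
    linarith
  have key := hder (fun q => m * w q ^ (m - 1)) (m * model n β α h (y0, 0) ^ (m - 1)) _ hpow hO
    (fun q hq => lt_of_le_of_lt (hmem q hq).2 (by linarith)) (fun q hq => by
      refine heatOp_pressure hm1.ne hws hwpos ?_
      have e : ∀ v : SpaceTime n, dir v (fun q => W ((y0, 0) + q) ^ m) =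
        fun q => dir v (fun q => W q ^ m) ((y0, 0) + q) :=
          fun v => dir_translate (fun q => W q ^ m) _ v
      rw [hw]
      simp only [dir_translate W, e]
      rw [S.blowup_pde hθT hW hpos heq (by simpa using hq)]
      refine Finset.sum_congr rfl fun i _ => ?_
      rw [dir_translate (dir (ex i) fun q => W q ^ m)]) (fun q hq => by
      obtain ⟨⟨a, b⟩, -⟩ := hwq q hq
      exact ⟨mul_le_mul_of_nonneg_left (rpow_le_rpow_of_nonpos (hwpos q) b (by linarith)) hm0.le,
        mul_le_mul_of_nonneg_left (rpow_le_rpow_of_nonpos hc0 a (by linarith)) hm0.le⟩)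
    (fun q hq => by
      obtain ⟨a, b⟩ := hwq q hq
      exact (huc _ a _ (hbd _ hy0).1 b).le)
  have hyq : (y - y0, (0 : ℝ)) ∈ backCyl n (ρ / 8) :=
    ⟨mem_closedBall_zero_iff.2 (mem_closedBall_iff_norm.1 hy), ⟨by linarith, le_rfl⟩⟩
  obtain ⟨-, k2, k3⟩ := key _ hyq
  have hpW : ContDiff ℝ (⊤ : ℕ∞) fun q => m * W q ^ (m - 1) :=
    contDiff_const.mul (hW.rpow_const_of_ne fun p => (hpos p).ne')
  obtain ⟨B, hB⟩ : ∃ B : SpaceTime n → ℝ, B = fun q => m * W q ^ (m - 1) := ⟨_, rfl⟩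
  have hB' : (fun q => m * w q ^ (m - 1)) = fun q => B ((y0, 0) + q) := by rw [hw, hB]
  have hBp : pressure m β α T u θ = fun y => B (y, 0) := by
    funext y
    rw [hB, pressure, ← heq (y, 0) (by simp)]
  rw [← hB] at hpW
  have hsum : (y0, (0 : ℝ)) + (y - y0, 0) = (y, 0) := by simp
  simp only [hB', dir_translate B] at k2 k3
  rw [hBp]
  simp only [← slice_dir hpW, ← slice_dir (hpW.dir_infty _),
    ← slice_dir ((hpW.dir_infty _).dir_infty _)]
  refine ⟨fun i j => ?_, fun i j k => ?_⟩
  · have := k2 i j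
    rw [dir_translate (dir (ex j) B)] at this
    simp only [hsum] at this
    exact this
  · have := k3 i j k
    rw [dir_translate (dir (ex k) B), dir_translate (dir (ex j) (dir (ex k) B))] at this
    simp only [hsum] at this
    exact this

end PressureBounds

section Interpolation

/-- Pointwise-local uniform convergence of a family together with a local bound on second
directional derivatives gives convergence of first directional derivatives. -/
theorem tendsto_dir_of_bound {X ι : Type*} [NormedAddCommGroup X] [NormedSpace ℝ X] {l : Filter ι}
    {φ : ι → X → ℝ} {ψ : X → ℝ} (v x : X) (hφ : ∀ᶠ t in l, ContDiff ℝ (⊤ : ℕ∞) (φ t))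
    (hψ : DifferentiableAt ℝ ψ x)
    (hlim : ∀ x, Tendsto (fun p : ι × X => φ p.1 p.2) (l ×ˢ 𝓝 x) (𝓝 (ψ x)))
    (hC : ∃ C, ∀ᶠ p : ι × X in l ×ˢ 𝓝 x, |dir v (dir v (φ p.1)) p.2| ≤ C) :
    Tendsto (fun p : ι × X => dir v (φ p.1) p.2) (l ×ˢ 𝓝 x) (𝓝 (dir v ψ x)) := by
  obtain ⟨C, hC⟩ := hC
  obtain ⟨A, hA, B, hB, hAB⟩ := eventually_prod_iff.1 hC
  obtain ⟨r, hr, hBr⟩ := Metric.eventually_nhds_iff.1 hB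
  rw [Metric.tendsto_nhds]
  intro ε hε
  have hline : HasDerivAt (fun s : ℝ => ψ (x + s • v)) (dir v ψ x) 0 := by
    have h1 : HasDerivAt (fun s : ℝ => x + s • v) v 0 := by
      simpa using ((hasDerivAt_id (0 : ℝ)).smul_const v).const_add x
    have h2 : HasFDerivAt ψ (fderiv ℝ ψ x) (x + (0 : ℝ) • v) := by simpa using hψ.hasFDerivAt
    exact h2.comp_hasDerivAt 0 h1
  have hslope := (Metric.tendsto_nhds.1 (hasDerivAt_iff_tendsto_slope_zero.1 hline) (ε / 3)
    (by positivity)).filter_mono (nhdsWithin_mono 0 (fun s (hs : 0 < s) => hs.ne') :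
      𝓝[>] (0 : ℝ) ≤ 𝓝[≠] 0)
  have hsm : ∀ c : ℝ, ∀ b > 0, ∀ᶠ s in 𝓝[>] (0 : ℝ), s * c < b := fun c b hb => by
    have : Tendsto (fun s : ℝ => s * c) (𝓝[>] 0) (𝓝 (0 * c)) :=
      ((continuous_mul_const c).tendsto 0).mono_left nhdsWithin_le_nhds
    rw [zero_mul] at this
    exact this.eventually_lt_const hb
  obtain ⟨s, hs0, hs1, hs2, hs3⟩ := ((hslope.and ((hsm (|C|) (ε / 3) (by positivity)).and
    ((hsm ‖v‖ (r / 2) (by positivity)).and self_mem_nhdsWithin))).exists)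
  have hs : 0 < s := hs3
  simp only [zero_add, zero_smul, add_zero, smul_eq_mul] at hs0
  have hshift : Tendsto (fun p : ι × X => φ p.1 (p.2 + s • v)) (l ×ˢ 𝓝 x) (𝓝 (ψ (x + s • v))) := by
    refine (hlim (x + s • v)).comp (f := fun p : ι × X => (p.1, p.2 + s • v)) ?_
    exact tendsto_fst.prodMk ((continuous_add_const (s • v)).continuousAt.tendsto.comp tendsto_snd)
  have hq := Metric.tendsto_nhds.1 ((hshift.sub (hlim x)).const_mul s⁻¹) (ε / 3) (by positivity)
  have hmem : ∀ᶠ p : ι × X in l ×ˢ 𝓝 x, (A p.1 ∧ ContDiff ℝ (⊤ : ℕ∞) (φ p.1)) ∧ dist p.2 x < r / 2 :=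
    (hA.and hφ).prod_mk (Metric.ball_mem_nhds x (half_pos hr))
  filter_upwards [hq, hmem] with p hp hp'
  obtain ⟨⟨hAp, hsm⟩, hpx⟩ := hp'
  obtain ⟨t, y⟩ := p
  simp only at hp hAp hsm hpx ⊢
  have hd1 : ∀ a, HasDerivAt (fun a : ℝ => φ t (y + a • v)) (dir v (φ t) (y + a • v)) a :=
    hasDerivAt_line hsm y v
  have hd2 : ∀ a, HasDerivAt (fun a : ℝ => dir v (φ t) (y + a • v))
      (dir v (dir v (φ t)) (y + a • v)) a := hasDerivAt_line (hsm.dir_infty v) y v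
  obtain ⟨c, hc, hc'⟩ := exists_hasDerivAt_eq_slope _ _ hs
    (fun a _ => (hd1 a).continuousAt.continuousWithinAt) fun a _ => hd1 a
  obtain ⟨c', hcc, hcc'⟩ := exists_hasDerivAt_eq_slope _ _ hc.1
    (fun a _ => (hd2 a).continuousAt.continuousWithinAt) fun a _ => hd2 a
  simp only [zero_smul, add_zero, sub_zero] at hc' hcc'
  have hbound : |dir v (dir v (φ t)) (y + c' • v)| ≤ |C| := by
    refine (hAB hAp (hBr ?_)).trans (le_abs_self C)
    have h1 : dist (y + c' • v) y ≤ s * ‖v‖ := by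
      rw [dist_eq_norm, add_sub_cancel_left, norm_smul, Real.norm_eq_abs, abs_of_pos hcc.1]
      exact mul_le_mul_of_nonneg_right (hcc.2.le.trans hc.2.le) (norm_nonneg v)
    linarith [dist_triangle (y + c' • v) y x]
  rw [eq_div_iff hc.1.ne'] at hcc'
  have h1 : |dir v (φ t) (y + c • v) - dir v (φ t) y| ≤ s * |C| := by
    rw [← hcc', abs_mul, abs_of_pos hc.1, mul_comm]
    exact mul_le_mul hc.2.le hbound (abs_nonneg _) hs.le
  rw [hc', div_eq_inv_mul] at h1
  rw [Real.dist_eq] at hs0 hp ⊢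
  obtain ⟨a1, a2⟩ := abs_lt.1 hs0
  obtain ⟨b1, b2⟩ := abs_lt.1 hp
  obtain ⟨d1, d2⟩ := abs_le.1 h1
  exact abs_lt.2 ⟨by linarith, by linarith⟩

end Interpolation

section LocallyUniform

theorem tendstoUniformlyOn_of_tendsto_prod {X Y ι : Type*} [TopologicalSpace X] [UniformSpace Y]
    {l : Filter ι} {F : ι → X → Y} {f : X → Y} (hf : Continuous f)
    (h : ∀ x, Tendsto (fun p : ι × X => F p.1 p.2) (l ×ˢ 𝓝 x) (𝓝 (f x))) {K : Set X}
    (hK : IsCompact K) : TendstoUniformlyOn F f l K := by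
  rw [← tendstoLocallyUniformlyOn_iff_tendstoUniformlyOn_of_compact hK]
  refine TendstoLocallyUniformly.tendstoLocallyUniformlyOn ?_
  rw [tendstoLocallyUniformly_iff_filter]
  intro x
  rw [tendstoUniformlyOnFilter_iff_tendsto]
  exact (((hf.tendsto x).comp tendsto_snd).prodMk_nhds (h x)).mono_right (nhds_le_uniformity _)

/-- In finite dimensions multilinear forms converge as soon as all their coefficients do. -/
theorem tendsto_multilinear {n k : ℕ} {J : Type*} {l : Filter J}
    {F : J → EuclideanSpace ℝ (Fin n) [×k]→L[ℝ] ℝ} {M : EuclideanSpace ℝ (Fin n) [×k]→L[ℝ] ℝ}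
    (h : ∀ v : Fin k → Fin n, Tendsto (fun j => F j fun a => EuclideanSpace.single (v a) (1 : ℝ)) l
      (𝓝 (M fun a => EuclideanSpace.single (v a) (1 : ℝ)))) : Tendsto F l (𝓝 M) := by
  have hfin : FiniteDimensional ℝ (EuclideanSpace ℝ (Fin n) [×k]→L[ℝ] ℝ) :=
    Module.Finite.of_injective (ContinuousMultilinearMap.toMultilinearMapLinear (R' := ℝ))
      ContinuousMultilinearMap.toMultilinearMap_injective
  obtain ⟨Φ, hΦ⟩ : ∃ Φ : (EuclideanSpace ℝ (Fin n) [×k]→L[ℝ] ℝ) →ₗ[ℝ] ((Fin k → Fin n) → ℝ),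
      ∀ M v, Φ M v = M fun a => EuclideanSpace.single (v a) (1 : ℝ) :=
    ⟨{ toFun := fun M v => M fun a => EuclideanSpace.single (v a) (1 : ℝ)
       map_add' := fun _ _ => rfl
       map_smul' := fun _ _ => rfl }, fun _ _ => rfl⟩
  have hinj : Function.Injective Φ := by
    intro M N hMN
    refine ContinuousMultilinearMap.toMultilinearMap_injective ?_
    refine Module.Basis.ext_multilinear
      (fun _ => (EuclideanSpace.basisFun (Fin n) ℝ).toBasis) fun v => ?_
    have := congrFun hMN v
    rw [hΦ, hΦ] at this
    simpa using this
  have hemb := LinearMap.isClosedEmbedding_of_injective (f := Φ) (LinearMap.ker_eq_bot.2 hinj)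
  rw [hemb.isEmbedding.tendsto_nhds_iff, tendsto_pi_nhds]
  intro v
  simp only [Function.comp_apply, hΦ]
  exact h v

end LocallyUniform

section Convergence

variable {X ι : Type*} [NormedAddCommGroup X] [NormedSpace ℝ X] {l : Filter ι}

theorem dir_const_mul_rpow {b : X → ℝ} (hb : Differentiable ℝ b) (hpos : ∀ p, 0 < b p) (c k : ℝ)
    (v : X) :
    dir v (fun q => c * b q ^ k) = fun p => c * (k * b p ^ (k - 1)) * dir v b p := by
  funext p
  exact dir_comp_apply (G := fun x => c * x ^ k)
    ((hasDerivAt_rpow_const (Or.inl (hpos p).ne')).const_mul c) (hb p) v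

theorem dir_dir_const_mul_rpow {b : X → ℝ} (hb : ContDiff ℝ 2 b) (hpos : ∀ p, 0 < b p) (c k : ℝ)
    (v w p : X) :
    dir v (dir w fun q => c * b q ^ k) p =
      c * (k * b p ^ (k - 1)) * dir v (dir w b) p +
        dir w b p * (c * k * ((k - 1) * b p ^ (k - 1 - 1)) * dir v b p) := by
  have hd : Differentiable ℝ b := hb.differentiable (by norm_num)
  have hdw : Differentiable ℝ (dir w b) :=
    (ContDiff.dir (k := 1) (by norm_num; exact hb) w).differentiable (by norm_num)
  have hr : Differentiable ℝ fun q => c * k * b q ^ (k - 1) :=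
    (hd.rpow_const fun q => Or.inl (hpos q).ne').const_mul _
  have e := dir_const_mul_rpow hd hpos (c * k) (k - 1) v
  rw [dir_const_mul_rpow hd hpos]
  simp only [← mul_assoc] at e ⊢
  rw [dir_mul_apply (hr p) (hdw p), e]
  ring

/-- Passing from convergence of derivatives of `φ` to those of a multiple of a power of `φ`. -/
theorem tendsto_dir_const_mul_rpow {J : Type*} {L : Filter J} {b : J → X → ℝ} {y : J → X}
    {ψ : X → ℝ} {x v : X} (c k : ℝ) (hb : ∀ᶠ j in L, ContDiff ℝ 2 (b j) ∧ ∀ p, 0 < b j p)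
    (hψ : ContDiff ℝ 2 ψ) (hpos : ∀ p, 0 < ψ p)
    (h0 : Tendsto (fun j => b j (y j)) L (𝓝 (ψ x)))
    (h1 : Tendsto (fun j => dir v (b j) (y j)) L (𝓝 (dir v ψ x))) :
    Tendsto (fun j => dir v (fun q => c * b j q ^ k) (y j)) L
      (𝓝 (dir v (fun q => c * ψ q ^ k) x)) := by
  rw [dir_const_mul_rpow (hψ.differentiable (by norm_num)) hpos]
  refine (((((h0.rpow_const (Or.inl (hpos x).ne')).const_mul k).const_mul c).mul h1)).congr' ?_
  filter_upwards [hb] with j hj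
  rw [dir_const_mul_rpow (hj.1.differentiable (by norm_num)) hj.2]

theorem tendsto_dir_dir_const_mul_rpow {J : Type*} {L : Filter J} {b : J → X → ℝ} {y : J → X}
    {ψ : X → ℝ} {x v w : X} (c k : ℝ) (hb : ∀ᶠ j in L, ContDiff ℝ 2 (b j) ∧ ∀ p, 0 < b j p)
    (hψ : ContDiff ℝ 2 ψ) (hpos : ∀ p, 0 < ψ p)
    (h0 : Tendsto (fun j => b j (y j)) L (𝓝 (ψ x)))
    (hv : Tendsto (fun j => dir v (b j) (y j)) L (𝓝 (dir v ψ x)))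
    (hw : Tendsto (fun j => dir w (b j) (y j)) L (𝓝 (dir w ψ x)))
    (hvw : Tendsto (fun j => dir v (dir w (b j)) (y j)) L (𝓝 (dir v (dir w ψ) x))) :
    Tendsto (fun j => dir v (dir w fun q => c * b j q ^ k) (y j)) L
      (𝓝 (dir v (dir w fun q => c * ψ q ^ k) x)) := by
  rw [dir_dir_const_mul_rpow hψ hpos]
  have hp : ∀ s : ℝ, Tendsto (fun j => b j (y j) ^ s) L (𝓝 (ψ x ^ s)) := fun s =>
    h0.rpow_const (Or.inl (hpos x).ne')
  refine (((((hp _).const_mul k).const_mul c).mul hvw).add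
    (hw.mul ((((hp _).const_mul (k - 1)).const_mul (c * k)).mul hv))).congr' ?_
  filter_upwards [hb] with j hj
  rw [dir_dir_const_mul_rpow hj.1 hj.2]

theorem dir_dir_eq_iteratedFDeriv {f : X → ℝ} (hf : ContDiff ℝ 2 f) (x : X) (v : Fin 2 → X) :
    iteratedFDeriv ℝ 2 f x v = dir (v 0) (dir (v 1) f) x := by
  have hd : DifferentiableAt ℝ (fderiv ℝ f) x :=
    (hf.fderiv_right (m := 1) (by norm_num)).differentiable (by norm_num) x
  rw [iteratedFDeriv_two_apply]
  change _ = fderiv ℝ (fun y => fderiv ℝ f y (v 1)) x (v 0)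
  rw [fderiv_clm_apply hd (differentiableAt_const _)]
  simp

end Convergence

section BlowupConvergence

variable {n : ℕ} {m β α T : ℝ} {h h1 h2 lo up : ℝ → ℝ} {u : EuclideanSpace ℝ (Fin n) → ℝ → ℝ}
  {u0 : EuclideanSpace ℝ (Fin n) → ℝ}

theorem SandwichInit.tendsto_blowup (S : SandwichInit n m β α T h h1 h2 lo up u u0)
    (hC1 : CondC1 n m β)
    (hcontr : ∀ t ∈ Ioo 0 T, (∫ x, |defect n β α T h u t x|) ≤
      ∫ x, |u0 x - Uself n β α T h x 0|)
    (hAB : ∀ x, ∀ t ∈ Ioo 0 T, deriv (u x) t ≤ u x t / ((1 - m) * t))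
    (x : EuclideanSpace ℝ (Fin n)) :
    Tendsto (fun p : ℝ × EuclideanSpace ℝ (Fin n) => blowup β α T u p.1 (p.2, 0))
      (𝓝[>] 0 ×ˢ 𝓝 x) (𝓝 (h ‖x‖)) := by
  have hF : Tendsto (fun p : ℝ × EuclideanSpace ℝ (Fin n) => h ‖p.2‖)
      (𝓝[>] 0 ×ˢ 𝓝 x) (𝓝 (h ‖x‖)) := (S.prof.contDiff_norm.continuous.tendsto x).comp tendsto_snd
  have hd : Tendsto (fun p : ℝ × EuclideanSpace ℝ (Fin n) =>
      blowup β α T u p.1 (p.2, 0) - h ‖p.2‖) (𝓝[>] 0 ×ˢ 𝓝 x) (𝓝 0) := by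
    rw [Metric.tendsto_nhds]
    intro ε hε
    obtain ⟨θ0, hθ0, hcl⟩ := S.blowup_close hC1 hcontr hAB (‖x‖ + 1) (half_pos hε)
    filter_upwards [prod_mem_prod (Ioc_mem_nhdsGT hθ0.1) (Metric.ball_mem_nhds x one_pos)] with p hp
    have h1 : ‖p.2‖ ≤ ‖x‖ + 1 := by
      have := norm_le_norm_add_norm_sub' p.2 x
      have h2 := mem_ball_iff_norm.1 hp.2
      linarith
    have := hcl p.1 hp.1 (p.2, 0) (mem_cyl_iff.2 ⟨h1, by simp⟩)
    rw [dist_zero_right, Real.norm_eq_abs]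
    simp only [model, sub_zero, one_rpow, one_mul] at this
    linarith
  simpa using hd.add hF

theorem SandwichInit.tendsto_pressure (S : SandwichInit n m β α T h h1 h2 lo up u u0)
    (hC1 : CondC1 n m β)
    (hcontr : ∀ t ∈ Ioo 0 T, (∫ x, |defect n β α T h u t x|) ≤
      ∫ x, |u0 x - Uself n β α T h x 0|)
    (hAB : ∀ x, ∀ t ∈ Ioo 0 T, deriv (u x) t ≤ u x t / ((1 - m) * t)) :
    (∀ x, Tendsto (fun p : ℝ × EuclideanSpace ℝ (Fin n) => pressure m β α T u p.1 p.2)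
      (𝓝[>] 0 ×ˢ 𝓝 x) (𝓝 (m * h ‖x‖ ^ (m - 1)))) ∧
    (∀ i x, Tendsto (fun p : ℝ × EuclideanSpace ℝ (Fin n) =>
      dir (EuclideanSpace.single i (1 : ℝ)) (pressure m β α T u p.1) p.2)
      (𝓝[>] 0 ×ˢ 𝓝 x) (𝓝 (dir (EuclideanSpace.single i (1 : ℝ))
        (fun y => m * h ‖y‖ ^ (m - 1)) x))) ∧
    ∀ i j x, Tendsto (fun p : ℝ × EuclideanSpace ℝ (Fin n) =>
      dir (EuclideanSpace.single i (1 : ℝ)) (dir (EuclideanSpace.single j (1 : ℝ))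
        (pressure m β α T u p.1)) p.2)
      (𝓝[>] 0 ×ˢ 𝓝 x) (𝓝 (dir (EuclideanSpace.single i (1 : ℝ))
        (dir (EuclideanSpace.single j (1 : ℝ)) fun y => m * h ‖y‖ ^ (m - 1)) x)) := by
  have hψ : ContDiff ℝ 2 fun y : EuclideanSpace ℝ (Fin n) => m * h ‖y‖ ^ (m - 1) :=
    contDiff_const.mul (S.prof.contDiff_norm.rpow_const_of_ne fun y => (S.prof.pos _).ne')
  have hb : ∀ x : EuclideanSpace ℝ (Fin n), ∃ C,
      ∀ᶠ p : ℝ × EuclideanSpace ℝ (Fin n) in 𝓝[>] 0 ×ˢ 𝓝 x,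
      (∀ i j, |dir (EuclideanSpace.single i (1 : ℝ)) (dir (EuclideanSpace.single j (1 : ℝ))
        (pressure m β α T u p.1)) p.2| ≤ C) ∧
      ∀ i j k, |dir (EuclideanSpace.single i (1 : ℝ)) (dir (EuclideanSpace.single j (1 : ℝ))
        (dir (EuclideanSpace.single k (1 : ℝ)) (pressure m β α T u p.1))) p.2| ≤ C := by
    intro x
    obtain ⟨r, hr, C, -, θ0, hθ0, hbd⟩ := S.pressure_bounds hC1 hcontr hAB x
    refine ⟨C, ?_⟩
    filter_upwards [prod_mem_prod (Ioc_mem_nhdsGT hθ0.1) (Metric.closedBall_mem_nhds x hr)] with p hp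
    exact hbd p.1 hp.1 p.2 hp.2
  have hsm : ∀ᶠ θ in 𝓝[>] (0 : ℝ), ContDiff ℝ (⊤ : ℕ∞) (pressure m β α T u θ) := by
    filter_upwards [Ioc_mem_nhdsGT (show 0 < T / 4 by linarith [S.hT])] with θ hθ
    exact S.contDiff_pressure hθ
  have h0 : ∀ x, Tendsto (fun p : ℝ × EuclideanSpace ℝ (Fin n) => pressure m β α T u p.1 p.2)
      (𝓝[>] 0 ×ˢ 𝓝 x) (𝓝 (m * h ‖x‖ ^ (m - 1))) := fun x =>
    ((S.tendsto_blowup hC1 hcontr hAB x).rpow_const (Or.inl (S.prof.pos _).ne')).const_mul m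
  have hd1 : ∀ i x, Tendsto (fun p : ℝ × EuclideanSpace ℝ (Fin n) =>
      dir (EuclideanSpace.single i (1 : ℝ)) (pressure m β α T u p.1) p.2)
      (𝓝[>] 0 ×ˢ 𝓝 x) (𝓝 (dir (EuclideanSpace.single i (1 : ℝ))
        (fun y => m * h ‖y‖ ^ (m - 1)) x)) := fun i x =>
    tendsto_dir_of_bound _ x hsm (hψ.differentiable (by norm_num) x) h0
      ((hb x).imp fun C hC => hC.mono fun p hp => hp.1 i i)
  refine ⟨h0, hd1, fun i j x => ?_⟩
  exact tendsto_dir_of_bound (φ := fun θ => dir (EuclideanSpace.single j (1 : ℝ))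
    (pressure m β α T u θ)) _ x (hsm.mono fun θ hθ => hθ.dir_infty _)
    ((ContDiff.dir (k := 1) (by norm_num; exact hψ) _).differentiable (by norm_num) x) (hd1 j)
    ((hb x).imp fun C hC => hC.mono fun p hp => hp.2 i i j)

theorem rpow_pressure {m w : ℝ} (hm0 : 0 < m) (hm1 : m < 1) (hw : 0 < w) :
    m ^ (-(1 / (m - 1))) * (m * w ^ (m - 1)) ^ (1 / (m - 1)) = w := by
  rw [mul_rpow hm0.le (rpow_nonneg hw.le _), ← mul_assoc, ← rpow_add hm0, neg_add_cancel, rpow_zero,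
    one_mul, ← rpow_mul hw.le, mul_one_div_cancel (by linarith), rpow_one]

theorem SandwichInit.tendsto_iteratedFDeriv_blowup
    (S : SandwichInit n m β α T h h1 h2 lo up u u0) (hC1 : CondC1 n m β)
    (hcontr : ∀ t ∈ Ioo 0 T, (∫ x, |defect n β α T h u t x|) ≤
      ∫ x, |u0 x - Uself n β α T h x 0|)
    (hAB : ∀ x, ∀ t ∈ Ioo 0 T, deriv (u x) t ≤ u x t / ((1 - m) * t)) {k : ℕ} (hk : k ≤ 2)
    (x : EuclideanSpace ℝ (Fin n)) :
    Tendsto (fun p : ℝ × EuclideanSpace ℝ (Fin n) =>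
      iteratedFDeriv ℝ k (fun z => blowup β α T u p.1 (z, 0)) p.2) (𝓝[>] 0 ×ˢ 𝓝 x)
      (𝓝 (iteratedFDeriv ℝ k (fun z => h ‖z‖) x)) := by
  obtain ⟨hp0, hp1, hp2⟩ := S.tendsto_pressure hC1 hcontr hAB
  have hm1 := S.lt_one
  have hψ : ContDiff ℝ 2 fun y : EuclideanSpace ℝ (Fin n) => m * h ‖y‖ ^ (m - 1) :=
    contDiff_const.mul (S.prof.contDiff_norm.rpow_const_of_ne fun y => (S.prof.pos _).ne')
  have hpos : ∀ y : EuclideanSpace ℝ (Fin n), 0 < m * h ‖y‖ ^ (m - 1) := fun y =>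
    mul_pos S.hm0 (rpow_pos_of_pos (S.prof.pos _) _)
  have hev : ∀ᶠ p : ℝ × EuclideanSpace ℝ (Fin n) in 𝓝[>] 0 ×ˢ 𝓝 x, p.1 ∈ Ioc 0 (T / 4) :=
    tendsto_fst.eventually (Ioc_mem_nhdsGT (show 0 < T / 4 by linarith [S.hT]))
  have hb : ∀ᶠ p : ℝ × EuclideanSpace ℝ (Fin n) in 𝓝[>] 0 ×ˢ 𝓝 x,
      ContDiff ℝ 2 (pressure m β α T u p.1) ∧ ∀ y, 0 < pressure m β α T u p.1 y := by
    filter_upwards [hev] with p hp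
    exact ⟨(S.contDiff_pressure hp).of_le (by norm_cast), fun y =>
      mul_pos S.hm0 (rpow_pos_of_pos (S.blowup_pos hp (by simp)) _)⟩
  have eh : (fun y : EuclideanSpace ℝ (Fin n) => h ‖y‖) = fun y =>
      m ^ (-(1 / (m - 1))) * (m * h ‖y‖ ^ (m - 1)) ^ (1 / (m - 1)) :=
    funext fun y => (rpow_pressure S.hm0 hm1 (S.prof.pos _)).symm
  have eb : ∀ θ ∈ Ioc 0 (T / 4), (fun y => blowup β α T u θ (y, 0)) = fun y =>
      m ^ (-(1 / (m - 1))) * pressure m β α T u θ y ^ (1 / (m - 1)) := fun θ hθ =>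
    funext fun y => (rpow_pressure S.hm0 hm1 (S.blowup_pos hθ (by simp))).symm
  refine tendsto_multilinear fun v => ?_
  interval_cases k
  · simp only [iteratedFDeriv_zero_apply]
    exact S.tendsto_blowup hC1 hcontr hAB x
  · simp only [iteratedFDeriv_one_apply]
    have := tendsto_dir_const_mul_rpow (m ^ (-(1 / (m - 1)))) (1 / (m - 1)) hb hψ hpos
      (hp0 x) (hp1 (v 0) x)
    rw [← eh] at this
    refine this.congr' ?_
    filter_upwards [hev] with p hp
    rw [← eb p.1 hp]
    rfl
  · rw [dir_dir_eq_iteratedFDeriv S.prof.contDiff_norm]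
    have := tendsto_dir_dir_const_mul_rpow (m ^ (-(1 / (m - 1)))) (1 / (m - 1)) hb hψ hpos
      (hp0 x) (hp1 (v 0) x) (hp1 (v 1) x) (hp2 (v 0) (v 1) x)
    rw [← eh] at this
    refine this.congr' ?_
    filter_upwards [hev] with p hp
    rw [← eb p.1 hp, dir_dir_eq_iteratedFDeriv
      ((S.contDiff_blowup_slice hp).of_le (by norm_cast))]

theorem resc_eq_blowup (n : ℕ) (β α T : ℝ) (u : EuclideanSpace ℝ (Fin n) → ℝ → ℝ)
    (y : EuclideanSpace ℝ (Fin n)) (τ : ℝ) :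
    resc n β α T u y τ = blowup β α T u (T * exp (-τ)) (y, 0) := by
  simp only [resc, blowup, sub_zero, mul_one, mul_sub]

theorem SandwichInit.tendstoUniformlyOn_resc (S : SandwichInit n m β α T h h1 h2 lo up u u0)
    (hC1 : CondC1 n m β)
    (hcontr : ∀ t ∈ Ioo 0 T, (∫ x, |defect n β α T h u t x|) ≤
      ∫ x, |u0 x - Uself n β α T h x 0|)
    (hAB : ∀ x, ∀ t ∈ Ioo 0 T, deriv (u x) t ≤ u x t / ((1 - m) * t))
    {K : Set (EuclideanSpace ℝ (Fin n))} (hK : IsCompact K) {k : ℕ} (hk : k ≤ 2) :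
    TendstoUniformlyOn (fun τ y => iteratedFDeriv ℝ k (fun z => resc n β α T u z τ) y)
      (iteratedFDeriv ℝ k (fun z => h ‖z‖)) atTop K := by
  have hexp : Tendsto (fun τ => T * exp (-τ)) atTop (𝓝[>] 0) := by
    refine tendsto_nhdsWithin_iff.2 ⟨?_, Eventually.of_forall fun τ => mul_pos S.hT (exp_pos _)⟩
    simpa using (tendsto_exp_atBot.comp tendsto_neg_atTop_atBot).const_mul T
  refine tendstoUniformlyOn_of_tendsto_prod
    (S.prof.contDiff_norm.continuous_iteratedFDeriv (by exact_mod_cast hk)) (fun x => ?_) hK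
  simp only [resc_eq_blowup]
  exact (S.tendsto_iteratedFDeriv_blowup hC1 hcontr hAB hk x).comp
    ((hexp.comp tendsto_fst).prodMk tendsto_snd)

/-- The integrated distance to the profile in rescaled variables. -/
theorem SandwichInit.integral_resc_le (S : SandwichInit n m β α T h h1 h2 lo up u u0)
    (hcontr : ∀ t ∈ Ioo 0 T, (∫ x, |defect n β α T h u t x|) ≤
      ∫ x, |u0 x - Uself n β α T h x 0|) {τ : ℝ} (hτ : 0 < τ) :
    (∫ y, |resc n β α T u y τ - h ‖y‖|) ≤ T ^ ((n : ℝ) * β - α) * exp (-((n : ℝ) * β - α) * τ) *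
      ∫ x, |u0 x - Uself n β α T h x 0| := by
  have hT := S.hT
  obtain ⟨s, hs⟩ : ∃ s, s = T * exp (-τ) := ⟨_, rfl⟩
  have hs0 : 0 < s := by rw [hs]; exact mul_pos hT (exp_pos _)
  have hsT : s < T := by
    rw [hs]
    exact mul_lt_of_lt_one_right hT (exp_lt_one_iff.2 (neg_neg_of_pos hτ))
  have hsβ : 0 < s ^ (-β) := rpow_pos_of_pos hs0 _
  have hy : ∀ y, |resc n β α T u y τ - h ‖y‖| =
      s ^ (-α) * |defect n β α T h u (T - s) (s ^ (-β) • y)| := fun y => by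
    have e1 : s ^ β * (s ^ (-β) * ‖y‖) = ‖y‖ := by
      rw [← mul_assoc, ← rpow_add hs0, add_neg_cancel, rpow_zero, one_mul]
    have e2 : s ^ (-α) * (s ^ α * h ‖y‖) = h ‖y‖ := by
      rw [← mul_assoc, ← rpow_add hs0, neg_add_cancel, rpow_zero, one_mul]
    have e3 : ∀ z, s ^ (-α) * |z| = |s ^ (-α) * z| := fun z => by
      rw [abs_mul, abs_of_pos (rpow_pos_of_pos hs0 (-α))]
    rw [resc_eq_blowup, ← hs, e3]
    simp only [blowup, defect, Uself, sub_zero, mul_one, norm_smul, Real.norm_eq_abs, abs_of_pos hsβ,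
      sub_sub_cancel, mul_sub, e1, e2]
  have hpow : T ^ ((n : ℝ) * β - α) * exp (-((n : ℝ) * β - α) * τ) = s ^ (-α) * ((s ^ (-β)) ^ n)⁻¹ := by
    rw [← rpow_natCast, ← rpow_mul hs0.le, ← rpow_neg hs0.le, ← rpow_add hs0, hs,
      mul_rpow hT.le (exp_pos _).le, ← exp_mul]
    congr 2 <;> ring
  have hcv := Measure.integral_comp_smul_of_nonneg (μ := (volume : Measure (EuclideanSpace ℝ (Fin n))))
    (fun x => |defect n β α T h u (T - s) x|) (s ^ (-β)) (hR := hsβ.le)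
  rw [finrank_euclideanSpace, Fintype.card_fin, smul_eq_mul] at hcv
  simp only [hy]
  rw [integral_const_mul, hcv, ← mul_assoc, hpow]
  exact mul_le_mul_of_nonneg_left (hcontr (T - s) ⟨by linarith, by linarith⟩) (by positivity)

end BlowupConvergence

/-- Convergence of the rescaled solution to the self-similar profile `f_{λ₀}` in the monotone
case (C1), uniformly with derivatives up to second order on compact sets, together with the
exponential `L¹`-decay when `β > β₁(m)`. -/
theorem convergence_to_profile_C1 (n : ℕ) (m β α T : ℝ) (hn : 3 ≤ n) (hm0 : 0 < m)
    (hm1 : m < ((n : ℝ) - 2) / n) (hα : α = (2 * β + 1) / (1 - m)) (hC1 : CondC1 n m β)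
    (hT : 0 < T) (f : ℝ → ℝ → ℝ) (hf : ∀ lam, 0 < lam → IsProfile n m β α lam (f lam))
    (hscale : ∀ lam, 0 < lam → ∀ r, 0 ≤ r → f lam r = lam ^ (2 / (1 - m)) * f 1 (lam * r))
    (lam1 lam0 lam2 : ℝ) (hlam1 : 0 < lam1) (h10 : lam1 ≤ lam0) (h02 : lam0 ≤ lam2)
    (u0 : EuclideanSpace ℝ (Fin n) → ℝ)
    (hu0lower : ∀ x, Uself n β α T (f lam1) x 0 ≤ u0 x)
    (hu0upper : ∀ x, u0 x ≤ Uself n β α T (f lam2) x 0)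
    (hu0L1 : Integrable (fun x => u0 x - Uself n β α T (f lam0) x 0))
    (u : EuclideanSpace ℝ (Fin n) → ℝ → ℝ)
    (hu : IsCauchySolution n m T u0 u)
    (hAB : ∀ x, ∀ t ∈ Set.Ioo 0 T, deriv (u x) t ≤ u x t / ((1 - m) * t))
    (hsand : ∀ x, ∀ t ∈ Set.Ioo 0 T,
      Uself n β α T (f lam1) x t ≤ u x t ∧ u x t ≤ Uself n β α T (f lam2) x t)
    (hcontr : ∀ t ∈ Set.Ioo 0 T,
      (∫ x, |u x t - Uself n β α T (f lam0) x t|) ≤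
        ∫ x, |u0 x - Uself n β α T (f lam0) x 0|) :
    (∀ K : Set (EuclideanSpace ℝ (Fin n)), IsCompact K → ∀ k : ℕ, k ≤ 2 →
      TendstoUniformlyOn
        (fun τ y => iteratedFDeriv ℝ k (fun z => resc n β α T u z τ) y)
        (iteratedFDeriv ℝ k (fun z => f lam0 ‖z‖)) atTop K) ∧
    (beta1 n m < β →
      ((n : ℝ) * β - α = 1 / (1 - m) * (β / beta1 n m - 1) ∧ 0 < (n : ℝ) * β - α ∧
      ∀ τ : ℝ, 0 < τ →
        (∫ y, |resc n β α T u y τ - f lam0 ‖y‖|) ≤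
          T ^ ((n : ℝ) * β - α) * Real.exp (-(((n : ℝ) * β - α)) * τ) *
            ∫ x, |u0 x - Uself n β α T (f lam0) x 0|)) := by
  have hn0 : (0 : ℝ) < n := by
    have : (3 : ℝ) ≤ n := by exact_mod_cast hn
    linarith
  have hm1' : m < 1 := lt_one_of_exponent hn hm1
  have hD : 0 < (n : ℝ) - 2 - n * m := by
    have := (lt_div_iff₀ hn0).1 hm1
    linarith
  have hβ : 0 < β := by
    rcases hC1 with h | ⟨-, -, -, h, -⟩
    · exact (one_div_pos.2 hD).trans h
    · exact (div_pos hm0 hD).trans ((le_max_right _ _).trans_lt h)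
  have hαm : α * (1 - m) = 2 * β + 1 := by rw [hα, div_mul_cancel₀ _ (by linarith)]
  have heven : ∀ lam, 0 < lam → ∃ h1 h2, EvenProfile n m β α (fun r => f lam |r|) h1 h2 :=
    fun lam hlam => (hf lam hlam).exists_even (by linarith) hm0
  have hU : ∀ lam x, ∀ t ≤ T, Uself n β α T (fun r => f lam |r|) x t = Uself n β α T (f lam) x t :=
    fun lam x t ht => by
      simp only [Uself, abs_of_nonneg (mul_nonneg (rpow_nonneg (sub_nonneg.2 ht) β) (norm_nonneg x))]
  have hlam0 : 0 < lam0 := hlam1.trans_le h10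
  obtain ⟨h1, h2, hprof⟩ := heven lam0 hlam0
  have S : SandwichInit n m β α T (fun r => f lam0 |r|) h1 h2 (fun r => f lam1 |r|)
      (fun r => f lam2 |r|) u u0 :=
    { hn := hn
      hm0 := hm0
      hm1 := hm1
      hβ := hβ
      hα := hαm
      hT := hT
      prof := hprof
      profLo := heven lam1 hlam1
      profUp := heven lam2 (hlam0.trans_le h02)
      pos := hu.pos
      smooth := hu.smooth
      pde := hu.pde
      sand := fun x t ht => by
        rw [hU _ _ _ ht.2.le, hU _ _ _ ht.2.le]
        exact hsand x t ht
      lower := fun x => by rw [hU _ _ _ hT.le]; exact hu0lower x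
      upper := fun x => by rw [hU _ _ _ hT.le]; exact hu0upper x
      integrable := by
        simp only [hU _ _ _ hT.le]
        exact hu0L1
      init := hu.init }
  have hcontr' : ∀ t ∈ Ioo 0 T, (∫ x, |defect n β α T (fun r => f lam0 |r|) u t x|) ≤
      ∫ x, |u0 x - Uself n β α T (fun r => f lam0 |r|) x 0| := fun t ht => by
    simp only [defect, hU _ _ _ hT.le, hU _ _ _ ht.2.le]
    exact hcontr t ht
  refine ⟨fun K hK k hk => ?_, fun hβ1 => ?_⟩
  · simpa only [abs_norm] using S.tendstoUniformlyOn_resc hC1 hcontr' hAB hK hk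
  · have hid : (n : ℝ) * β - α = 1 / (1 - m) * (β / beta1 n m - 1) := by
      have h0 : 1 - m ≠ 0 := by linarith
      rw [hα, beta1]
      field_simp
      ring
    refine ⟨hid, ?_, fun τ hτ => ?_⟩
    · rw [hid]
      have hb : 0 < beta1 n m := one_div_pos.2 hD
      have : 1 < β / beta1 n m := (one_lt_div hb).2 hβ1
      exact mul_pos (one_div_pos.2 (by linarith)) (by linarith)
    · simpa only [abs_norm, hU _ _ _ hT.le] using S.integral_resc_le hcontr' hτ
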